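/- There exists at least one forward solution to the initial–Neumann boundary value problem u_t = (σ(u_x))_x + b u_x + c u + f in Ω_T, u(·,0) = u0, u_x = 0 on ∂Ω×(0,T). -/

import Mathlib

open MeasureTheory Set
open scoped NNReal

noncomputable section

/-- The open space-time domain `Ω_T = (0,1) × (0,T)`. -/
def OmegaT (T : ℝ) : Set (ℝ × ℝ) := Ioo (0:ℝ) 1 ×ˢ Ioo (0:ℝ) T

/-- The closed space-time domain `cl Ω_T = [0,1] × [0,T]`. -/
def ClOmegaT (T : ℝ) : Set (ℝ × ℝ) := Icc (0:ℝ) 1 ×ˢ Icc (0:ℝ) T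

/-- Parabolic α-Hölder continuity on `cl Ω_T`. -/
def ParabolicHolder (α T : ℝ) (g : ℝ → ℝ → ℝ) : Prop :=
  ∃ C : ℝ, ∀ x ∈ Icc (0:ℝ) 1, ∀ y ∈ Icc (0:ℝ) 1, ∀ t ∈ Icc (0:ℝ) T, ∀ s ∈ Icc (0:ℝ) T,
    |g x t - g y s| ≤ C * (|x - y| ^ α + |t - s| ^ (α / 2))

/-- Hypotheses on the forward-backward diffusion flux `σ`, with derivative function `σ'`
(one-sided derivative on `(-∞,s1]` and `[s2,∞)`). -/
structure FluxHyp (α s1 s2 lam Lam : ℝ) (sigma sigma' : ℝ → ℝ) : Prop where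
  alpha_pos : 0 < α
  alpha_lt_one : α < 1
  s1_pos : 0 < s1
  s1_lt_s2 : s1 < s2
  lam_pos : 0 < lam
  lam_le_Lam : lam ≤ Lam
  deriv_left : ∀ s ∈ Iic s1, HasDerivWithinAt sigma (sigma' s) (Iic s1) s
  deriv_right : ∀ s ∈ Ici s2, HasDerivWithinAt sigma (sigma' s) (Ici s2) s
  holder_left : ∃ C : ℝ, ∀ s ∈ Iic s1, ∀ t ∈ Iic s1, |sigma' s - sigma' t| ≤ C * |s - t| ^ α
  holder_right : ∃ C : ℝ, ∀ s ∈ Ici s2, ∀ t ∈ Ici s2, |sigma' s - sigma' t| ≤ C * |s - t| ^ α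
  deriv_pos : ∀ s : ℝ, s < s1 ∨ s2 < s → 0 < sigma' s
  deriv_lb : ∀ s : ℝ, s < s1 / 2 ∨ 2 * s2 < s → lam ≤ sigma' s
  deriv_ub : ∀ s : ℝ, s < s1 / 2 ∨ 2 * s2 < s → sigma' s ≤ Lam
  sigma_zero : sigma 0 = 0
  sigma_s2_lt_s1 : sigma s2 < sigma s1
  sigma_s2_nonneg : 0 ≤ sigma s2

/-- Hypotheses on the convection coefficient `b` (with spatial derivative `bx`),
reaction coefficient `c`, source `f` and the function `d` with `c = b_x + d(t)`. -/
structure CoeffHyp (α T : ℝ) (b bx c f : ℝ → ℝ → ℝ) (d : ℝ → ℝ) : Prop where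
  b_cont : ContinuousOn (fun p : ℝ × ℝ => b p.1 p.2) (ClOmegaT T)
  b_holder : ParabolicHolder α T b
  b_deriv : ∀ p ∈ ClOmegaT T, HasDerivWithinAt (fun y => b y p.2) (bx p.1 p.2) (Icc (0:ℝ) 1) p.1
  bx_cont : ContinuousOn (fun p : ℝ × ℝ => bx p.1 p.2) (ClOmegaT T)
  c_cont : ContinuousOn (fun p : ℝ × ℝ => c p.1 p.2) (ClOmegaT T)
  c_holder : ParabolicHolder α T c
  f_cont : ContinuousOn (fun p : ℝ × ℝ => f p.1 p.2) (ClOmegaT T)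
  f_holder : ParabolicHolder α T f
  d_cont : ContinuousOn d (Icc (0:ℝ) T)
  c_eq : ∀ p ∈ ClOmegaT T, c p.1 p.2 = bx p.1 p.2 + d p.2

/-- Hypotheses on the initial datum `u0 ∈ C^{2+α}([0,1])` with `u0'(0) = u0'(1) = 0`. -/
structure InitHyp (α : ℝ) (u0 u0' u0'' : ℝ → ℝ) : Prop where
  deriv1 : ∀ x ∈ Icc (0:ℝ) 1, HasDerivWithinAt u0 (u0' x) (Icc (0:ℝ) 1) x
  deriv2 : ∀ x ∈ Icc (0:ℝ) 1, HasDerivWithinAt u0' (u0'' x) (Icc (0:ℝ) 1) x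
  holder : ∃ C : ℝ, ∀ x ∈ Icc (0:ℝ) 1, ∀ y ∈ Icc (0:ℝ) 1, |u0'' x - u0'' y| ≤ C * |x - y| ^ α
  compat0 : u0' 0 = 0
  compat1 : u0' 1 = 0

/-- `u` (with a.e. spatial derivative `ux`) is a Lipschitz (weak) solution of the
initial–Neumann problem for `u_t = (σ(u_x))_x + b u_x + c u + f` on `Ω_T`. -/
def IsLipschitzSolution (T : ℝ) (sigma : ℝ → ℝ) (b c f : ℝ → ℝ → ℝ) (u0 : ℝ → ℝ)
    (u ux : ℝ → ℝ → ℝ) : Prop :=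
  (∃ K : ℝ≥0, LipschitzOnWith K (fun p : ℝ × ℝ => u p.1 p.2) (ClOmegaT T)) ∧
  (∀ᵐ p ∂(volume.restrict (OmegaT T)), HasDerivAt (fun y => u y p.2) (ux p.1 p.2) p.1) ∧
  (∀ ζ : ℝ → ℝ → ℝ, ContDiff ℝ (⊤ : ℕ∞) (fun p : ℝ × ℝ => ζ p.1 p.2) →
    ∀ s ∈ Icc (0:ℝ) T,
      (∫ t in Ioo (0:ℝ) s, ∫ x in Ioo (0:ℝ) 1,
        (u x t * deriv (fun τ => ζ x τ) t - sigma (ux x t) * deriv (fun y => ζ y t) x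
          + (b x t * ux x t + c x t * u x t + f x t) * ζ x t))
      = ∫ x in Ioo (0:ℝ) 1, (u x s * ζ x s - u0 x * ζ x 0))

/-- The forward-phase constraint: `u_x ∈ (-∞,s1) ∪ (s2,∞)` a.e. in `Ω_T`. -/
def ForwardRange (T s1 s2 : ℝ) (ux : ℝ → ℝ → ℝ) : Prop :=
  ∀ᵐ p ∂(volume.restrict (OmegaT T)), ux p.1 p.2 < s1 ∨ s2 < ux p.1 p.2

namespace FwdSol

/-- radial retraction -/
noncomputable def rad {E : Type*} [NormedAddCommGroup E] [NormedSpace ℝ E] (R : ℝ) (x : E) : E :=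
  (R / max R ‖x‖) • x

lemma rad_eq {E : Type*} [NormedAddCommGroup E] [NormedSpace ℝ E] {R : ℝ} (hR : 0 < R) {x : E}
    (hx : ‖x‖ ≤ R) : rad R x = x := by
  rw [rad, max_eq_left hx, div_self hR.ne', one_smul]

lemma rad_norm {E : Type*} [NormedAddCommGroup E] [NormedSpace ℝ E] {R : ℝ} (hR : 0 < R) (x : E) :
    ‖rad R x‖ ≤ ‖x‖ ∧ ‖rad R x‖ ≤ R := by
  have h1 : 0 < max R ‖x‖ := lt_max_of_lt_left hR
  rw [rad, norm_smul, Real.norm_of_nonneg (by positivity)]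
  constructor
  · have : R / max R ‖x‖ ≤ 1 := (div_le_one h1).2 (le_max_left _ _)
    nlinarith [norm_nonneg x]
  · rw [div_mul_eq_mul_div, div_le_iff₀ h1]
    exact mul_le_mul_of_nonneg_left (le_max_right _ _) hR.le

lemma rad_lip {E : Type*} [NormedAddCommGroup E] [NormedSpace ℝ E] {R : ℝ} (hR : 0 < R) (x y : E) :
    ‖rad R x - rad R y‖ ≤ 2 * ‖x - y‖ := by
  have hx : 0 < max R ‖x‖ := lt_max_of_lt_left hR
  have hy : 0 < max R ‖y‖ := lt_max_of_lt_left hR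
  have e : rad R x - rad R y = (R / max R ‖x‖) • (x - y)
      + (R / max R ‖x‖ - R / max R ‖y‖) • y := by
    simp only [rad, smul_sub, sub_smul]; abel
  rw [e]
  refine (norm_add_le _ _).trans ?_
  rw [norm_smul, norm_smul, Real.norm_of_nonneg (by positivity), Real.norm_eq_abs]
  have h1 : R / max R ‖x‖ ≤ 1 := (div_le_one hx).2 (le_max_left _ _)
  have h2 : |R / max R ‖x‖ - R / max R ‖y‖| * ‖y‖ ≤ ‖x - y‖ := by
    have e2 : R / max R ‖x‖ - R / max R ‖y‖
        = (R / max R ‖x‖) * ((max R ‖y‖ - max R ‖x‖) / max R ‖y‖) := by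
      field_simp
    rw [e2, abs_mul, abs_of_nonneg (by positivity : 0 ≤ R / max R ‖x‖), abs_div, abs_of_pos hy]
    have h3 : |max R ‖y‖ - max R ‖x‖| ≤ ‖x - y‖ := by
      have := abs_max_sub_max_le_abs ‖y‖ ‖x‖ R
      rw [max_comm R, max_comm R]
      refine this.trans ?_
      rw [norm_sub_rev]; exact abs_norm_sub_norm_le y x
    have h4 : ‖y‖ / max R ‖y‖ ≤ 1 := (div_le_one hy).2 (le_max_right _ _)
    calc R / max R ‖x‖ * (|max R ‖y‖ - max R ‖x‖| / max R ‖y‖) * ‖y‖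
        = R / max R ‖x‖ * (|max R ‖y‖ - max R ‖x‖| * (‖y‖ / max R ‖y‖)) := by ring
      _ ≤ 1 * (‖x - y‖ * 1) := by gcongr
      _ = _ := by ring
  nlinarith [norm_nonneg (x - y)]

/-- Global existence for globally Lipschitz fields. -/
lemma ode_global {E : Type*} [NormedAddCommGroup E] [NormedSpace ℝ E] [CompleteSpace E]
    (v : ℝ → E → E) (K : ℝ) (hK : 0 ≤ K) (hL : ∀ t x y, ‖v t x - v t y‖ ≤ K * ‖x - y‖)
    (hc : ∀ x, Continuous fun t => v t x) (x0 : E) (a b : ℝ) (hab : a ≤ b) :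
    ∃ y : ℝ → E, y a = x0 ∧ ∀ t ∈ Icc a b, HasDerivAt y (v t (y t)) t := by
  -- bound on v t 0
  obtain ⟨C0, hC0⟩ : ∃ C0, ∀ t ∈ Icc (a - 1) (b + 1), ‖v t 0‖ ≤ C0 :=
    isCompact_Icc.exists_bound_of_continuousOn (hc 0).continuousOn
  have hC0' : 0 ≤ C0 := (norm_nonneg _).trans (hC0 a ⟨by linarith, by linarith⟩)
  have hvb : ∀ t ∈ Icc (a - 1) (b + 1), ∀ x, ‖v t x‖ ≤ K * ‖x‖ + C0 := by
    intro t ht x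
    have h1 := hL t x 0
    have h2 := hC0 t ht
    have h3 : ‖v t x‖ ≤ ‖v t x - v t 0‖ + ‖v t 0‖ := by
      simpa using norm_add_le (v t x - v t 0) (v t 0)
    rw [sub_zero] at h1; linarith
  set Rf : ℝ → ℝ := fun s => gronwallBound ‖x0‖ K C0 s with hRf
  obtain ⟨R0, hR0⟩ : ∃ R0, ∀ s ∈ Icc (0:ℝ) (b - a + 1), ‖Rf s‖ ≤ R0 :=
    isCompact_Icc.exists_bound_of_continuousOn
      (fun s _ => ((hasDerivAt_gronwallBound ‖x0‖ K C0 s).continuousAt).continuousWithinAt)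
  set R := max R0 1 with hR
  have hRpos : 0 < R := lt_of_lt_of_le one_pos (le_max_right _ _)
  set w : ℝ → E → E := fun t x => v t (rad R x) with hw
  have hwL : ∀ t x y, ‖w t x - w t y‖ ≤ (K * 2) * ‖x - y‖ := by
    intro t x y
    refine (hL t _ _).trans ?_
    rw [mul_assoc]; exact mul_le_mul_of_nonneg_left (rad_lip hRpos x y) hK
  set Lb : ℝ := K * R + C0 with hLb
  have hLb0 : 0 ≤ Lb := by positivity
  have hwb : ∀ t ∈ Icc (a - 1) (b + 1), ∀ x, ‖w t x‖ ≤ Lb := by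
    intro t ht x
    refine (hvb t ht _).trans ?_
    have := (rad_norm hRpos x).2
    have := mul_le_mul_of_nonneg_left this hK
    linarith
  have haI : a ∈ Icc (a - 1) (b + 1) := ⟨by linarith, by linarith⟩
  have hPL : IsPicardLindelof w (⟨a, haI⟩ : Icc (a - 1) (b + 1)) x0
      ⟨Lb * (b - a + 1), by have := sub_nonneg.2 hab; positivity⟩ 0 ⟨Lb, hLb0⟩
      ⟨K * 2, by positivity⟩ := by
    refine ⟨?_, ?_, ?_, ?_⟩
    · intro t _
      exact (LipschitzWith.of_dist_le_mul (fun x y => by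
        rw [dist_eq_norm, dist_eq_norm]; exact hwL t x y)).lipschitzOnWith
    · intro x _; exact (hc _).continuousOn
    · intro t ht x _; exact hwb t ht x
    · change Lb * max (b + 1 - a) (a - (a - 1)) ≤ Lb * (b - a + 1) - ((0:ℝ≥0):ℝ)
      rw [max_eq_left (by linarith)]
      simp only [NNReal.coe_zero, sub_zero]
      apply le_of_eq; ring
  obtain ⟨y, hy0, hy⟩ := hPL.exists_eq_forall_mem_Icc_hasDerivWithinAt₀
  have hyD : ∀ t ∈ Icc a b, HasDerivAt y (w t (y t)) t := by
    intro t ht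
    exact (hy t ⟨by linarith [ht.1], by linarith [ht.2]⟩).hasDerivAt
      (Icc_mem_nhds (by linarith [ht.1]) (by linarith [ht.2]))
  have hyR : ∀ t ∈ Icc a b, ‖y t‖ ≤ R := by
    intro t ht
    have h1 := norm_le_gronwallBound_of_norm_deriv_right_le (f := y) (f' := fun t => w t (y t))
      (δ := ‖x0‖) (K := K) (ε := C0) (a := a) (b := b)
      (fun s hs => (hyD s hs).continuousAt.continuousWithinAt)
      (fun s hs => (hyD s ⟨hs.1, hs.2.le⟩).hasDerivWithinAt) (by rw [← hy0])
      (fun s hs => by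
        refine (hvb s ⟨by linarith [hs.1], by linarith [hs.2]⟩ _).trans ?_
        have := mul_le_mul_of_nonneg_left (rad_norm hRpos (y s)).1 hK
        linarith) t ht
    have h2 := hR0 (t - a) ⟨by linarith [ht.1], by linarith [ht.2]⟩
    exact h1.trans ((le_abs_self _).trans (h2.trans (le_max_left _ _)))
  refine ⟨y, hy0, fun t ht => ?_⟩
  have := hyD t ht
  simp only [hw] at this
  rwa [rad_eq hRpos (hyR t ht)] at this

end FwdSol

namespace FwdSol

section hilb
variable {H : Type*} [NormedAddCommGroup H] [InnerProductSpace ℝ H]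

lemma norm_growth (z z' : ℝ → H) (a b S : ℝ)
    (hz : ∀ t ∈ Icc a b, HasDerivAt z (z' t) t)
    (hS : ∀ t ∈ Icc a b, inner ℝ (z t) (z' t) ≤ S * ‖z t‖) (hS0 : 0 ≤ S) :
    ∀ t ∈ Icc a b, ‖z t‖ ≤ ‖z a‖ + S * (t - a) := by
  intro t ht
  have hab : a ≤ b := ht.1.trans ht.2
  refine le_of_forall_pos_le_add fun ε hε => ?_
  set φ : ℝ → ℝ := fun t => Real.sqrt (‖z t‖ ^ 2 + ε ^ 2) - S * t with hφ
  have hpos : ∀ t, 0 < ‖z t‖ ^ 2 + ε ^ 2 := fun t => by positivity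
  have hd : ∀ s ∈ Icc a b, HasDerivAt φ
      ((2 * inner ℝ (z s) (z' s)) / (2 * Real.sqrt (‖z s‖ ^ 2 + ε ^ 2)) - S * 1) s := by
    intro s hs
    have h1 : HasDerivAt (fun t => ‖z t‖ ^ 2 + ε ^ 2) (2 * inner ℝ (z s) (z' s)) s :=
      (hz s hs).norm_sq.add_const _
    exact (h1.sqrt (hpos s).ne').sub ((hasDerivAt_id s).const_mul S)
  have hanti : AntitoneOn φ (Icc a b) := by
    apply antitoneOn_of_deriv_nonpos (convex_Icc a b)
      (fun s hs => (hd s hs).continuousAt.continuousWithinAt)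
    · intro s hs; rw [interior_Icc] at hs
      exact (hd s ⟨hs.1.le, hs.2.le⟩).differentiableAt.differentiableWithinAt
    · intro s hs; rw [interior_Icc] at hs
      have hs' : s ∈ Icc a b := ⟨hs.1.le, hs.2.le⟩
      rw [(hd s hs').deriv]
      have h1 := hS s hs'
      have h2 : ‖z s‖ ≤ Real.sqrt (‖z s‖ ^ 2 + ε ^ 2) :=
        Real.le_sqrt_of_sq_le (by nlinarith [sq_nonneg ε])
      have h3 : 0 < Real.sqrt (‖z s‖ ^ 2 + ε ^ 2) := Real.sqrt_pos.2 (hpos s)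
      rw [sub_nonpos, mul_one, div_le_iff₀ (by positivity)]
      nlinarith [mul_le_mul_of_nonneg_left h2 hS0]
  have h := hanti ⟨le_rfl, hab⟩ ht ht.1
  simp only [hφ] at h
  have h1 : ‖z t‖ ≤ Real.sqrt (‖z t‖ ^ 2 + ε ^ 2) :=
    Real.le_sqrt_of_sq_le (by nlinarith [sq_nonneg ε])
  have h2 : Real.sqrt (‖z a‖ ^ 2 + ε ^ 2) ≤ ‖z a‖ + ε := by
    apply Real.sqrt_le_iff.2
    constructor
    · positivity
    · nlinarith [norm_nonneg (z a)]
  linarith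

/-- abstract convex gradient structure: `F = - ∇E`. -/
structure GradF (F : H → H) (E : H → ℝ) (K : ℝ) : Prop where
  lip : ∀ x y, ‖F x - F y‖ ≤ K * ‖x - y‖
  K0 : 0 ≤ K
  conv : ∀ x y, E x - inner ℝ (F x) (y - x) ≤ E y

variable {F : H → H} {E : H → ℝ} {K : ℝ}

lemma GradF.mono (hF : GradF F E K) (x y : H) : inner ℝ (x - y) (F x - F y) ≤ 0 := by
  have h1 := hF.conv x y
  have h2 := hF.conv y x
  have e : inner ℝ (x - y) (F x - F y) = -(inner ℝ (F x) (y - x)) - inner ℝ (F y) (x - y) := by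
    rw [real_inner_comm]
    have : y - x = -(x - y) := by abel
    rw [this, inner_neg_right, inner_sub_left]; ring
  rw [e]; linarith

lemma GradF.hasFDerivAt (hF : GradF F E K) (x : H) :
    HasFDerivAt E (-(innerSL ℝ (F x))) x := by
  rw [hasFDerivAt_iff_isLittleO]
  refine Asymptotics.IsBigO.trans_isLittleO (g := fun y => ‖y - x‖ ^ 2) ?_ ?_
  · refine Asymptotics.IsBigO.of_bound K (Filter.Eventually.of_forall fun y => ?_)
    have h1 := hF.conv x y
    have h2 := hF.conv y x
    have e : (-(innerSL ℝ (F x))) (y - x) = - inner ℝ (F x) (y - x) := rfl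
    have e2 : inner ℝ (F y) (x - y) = - inner ℝ (F x) (y - x)
        - inner ℝ (F y - F x) (y - x) := by
      have : x - y = -(y - x) := by abel
      rw [this, inner_neg_right, inner_sub_left]; ring
    have h3 : |inner ℝ (F y - F x) (y - x)| ≤ K * ‖y - x‖ * ‖y - x‖ :=
      (abs_real_inner_le_norm _ _).trans
        (mul_le_mul_of_nonneg_right (hF.lip y x) (norm_nonneg _))
    rw [e, Real.norm_eq_abs, norm_pow, norm_norm, abs_le]
    have h4 := abs_le.1 h3
    have h5 : 0 ≤ K * ‖y - x‖ * ‖y - x‖ := (abs_nonneg _).trans h3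
    constructor <;> nlinarith
  · have := Asymptotics.isLittleO_pow_sub_sub x (m := 2) (by norm_num)
    exact this

variable {G : H} {h : ℝ → H} {a b : ℝ}

lemma GradF.deriv_anti (hF : GradF F E K)
    (hh : ∀ t ∈ Icc a b, HasDerivAt h (F (h t) + G) t) {s t : ℝ} (has : a ≤ s) (hst : s ≤ t)
    (htb : t < b) : ‖F (h t) + G‖ ≤ ‖F (h s) + G‖ := by
  have key : ∀ ε, 0 < ε → ε ≤ b - t → ‖h (t + ε) - h t‖ ≤ ‖h (s + ε) - h s‖ := by
    intro ε hε hεb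
    have := norm_growth (fun r => h (r + ε) - h r)
      (fun r => (F (h (r + ε)) + G) - (F (h r) + G)) s t 0
      (fun r hr => by
        have h1 : HasDerivAt (fun r => h (r + ε)) (F (h (r + ε)) + G) r :=
          HasDerivAt.comp_add_const r ε (hh (r + ε) ⟨by linarith [hr.1], by linarith [hr.2]⟩)
        exact h1.sub (hh r ⟨by linarith [hr.1], by linarith [hr.2]⟩))
      (fun r hr => by
        have := hF.mono (h (r + ε)) (h r)
        simpa using this) le_rfl t ⟨hst, le_rfl⟩
    simpa using this
  have lim : ∀ r ∈ Icc a b, Filter.Tendsto (fun ε : ℝ => ‖ε⁻¹ • (h (r + ε) - h r)‖)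
      (nhdsWithin 0 (Ioi 0)) (nhds ‖F (h r) + G‖) := by
    intro r hr
    exact ((hh r hr).tendsto_slope_zero_right).norm
  refine le_of_tendsto_of_tendsto (lim t ⟨has.trans hst, htb.le⟩)
    (lim s ⟨has, hst.trans htb.le⟩) ?_
  have : Ioo (0:ℝ) (b - t) ∈ nhdsWithin (0:ℝ) (Ioi 0) := Ioo_mem_nhdsGT (by linarith)
  filter_upwards [this] with ε hε
  rw [norm_smul, norm_smul]
  exact mul_le_mul_of_nonneg_left (key ε hε.1 hε.2.le) (norm_nonneg _)

lemma GradF.lip_forward (hF : GradF F E K)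
    (hh : ∀ t ∈ Icc a b, HasDerivAt h (F (h t) + G) t) {s t : ℝ} (has : a ≤ s) (hst : s ≤ t)
    (htb : t ≤ b) : ‖h t - h s‖ ≤ (t - s) * ‖F (h s) + G‖ := by
  have := norm_image_sub_le_of_norm_deriv_right_le_segment (f := h)
    (f' := fun r => F (h r) + G) (C := ‖F (h s) + G‖) (a := s) (b := t)
    (fun r hr => (hh r ⟨by linarith [hr.1], by linarith [hr.2]⟩).continuousAt.continuousWithinAt)
    (fun r hr => (hh r ⟨by linarith [hr.1], by linarith [hr.2]⟩).hasDerivWithinAt)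
    (fun r hr => hF.deriv_anti hh has hr.1 (by linarith [hr.2])) t ⟨hst, le_rfl⟩
  rwa [mul_comm] at this

lemma GradF.smoothing (hF : GradF F E K)
    (hh : ∀ t ∈ Icc a b, HasDerivAt h (F (h t) + G) t) {t : ℝ} (hat : a ≤ t)
    (htb : t < b) : (t - a) * ‖F (h t) + G‖ ≤ ‖h t - h a‖ := by
  set m := ‖F (h t) + G‖ with hm
  have hm0 : 0 ≤ m := norm_nonneg _
  -- energy decay
  set e : ℝ → ℝ := fun s => E (h s) - inner ℝ G (h s) with he
  have hed : ∀ s ∈ Icc a b, HasDerivAt e (-‖F (h s) + G‖ ^ 2) s := by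
    intro s hs
    have h1 : HasDerivAt (fun s => E (h s)) ((-(innerSL ℝ (F (h s)))) (F (h s) + G)) s :=
      (hF.hasFDerivAt (h s)).comp_hasDerivAt s (hh s hs)
    have h2 : HasDerivAt (fun s => inner ℝ G (h s)) (inner ℝ G (F (h s) + G)) s := by
      have := (hasDerivAt_const s G).inner ℝ (hh s hs)
      simpa using this
    refine (h1.sub h2).congr_deriv ?_
    have : (-(innerSL ℝ (F (h s)))) (F (h s) + G) = - inner ℝ (F (h s)) (F (h s) + G) := rfl
    rw [this, ← real_inner_self_eq_norm_sq, inner_add_left]; ring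
  have hdec : ∀ s ∈ Icc a t, e t - e s ≤ -(t - s) * m ^ 2 := by
    intro s hs
    have := Convex.image_sub_le_mul_sub_of_deriv_le (convex_Icc s t) (f := e) (C := -m ^ 2)
      (fun r hr => (hed r ⟨by linarith [hr.1, hs.1], by linarith [hr.2]⟩).continuousAt.continuousWithinAt)
      (fun r hr => by
        rw [interior_Icc] at hr
        exact (hed r ⟨by linarith [hr.1, hs.1], by linarith [hr.2]⟩).differentiableAt.differentiableWithinAt)
      (fun r hr => by
        rw [interior_Icc] at hr
        rw [(hed r ⟨by linarith [hr.1, hs.1], by linarith [hr.2]⟩).deriv]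
        have := hF.deriv_anti hh (s := r) (t := t) (by linarith [hr.1, hs.1]) hr.2.le htb
        nlinarith [norm_nonneg (F (h t) + G)])
      s ⟨le_rfl, hs.2⟩ t ⟨hs.2, le_rfl⟩ hs.2
    linarith
  set ψ : ℝ → ℝ := fun s => ‖h s - h t‖ ^ 2 - (t - s) ^ 2 * m ^ 2 with hψ
  have hψd : ∀ s ∈ Icc a t, HasDerivAt ψ
      (2 * inner ℝ (h s - h t) (F (h s) + G) + 2 * (t - s) * m ^ 2) s := by
    intro s hs
    have h1 := ((hh s ⟨hs.1, hs.2.trans htb.le⟩).sub_const (h t)).norm_sq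
    have h2 : HasDerivAt (fun s : ℝ => (t - s) ^ 2 * m ^ 2) (-(2 * (t - s)) * m ^ 2) s := by
      have := (((hasDerivAt_id s).const_sub t).pow 2).mul_const (m ^ 2)
      refine this.congr_deriv ?_
      simp
    refine (h1.sub h2).congr_deriv ?_; ring
  have hanti : AntitoneOn ψ (Icc a t) := by
    apply antitoneOn_of_deriv_nonpos (convex_Icc a t)
      (fun s hs => (hψd s hs).continuousAt.continuousWithinAt)
    · intro s hs; rw [interior_Icc] at hs
      exact (hψd s ⟨hs.1.le, hs.2.le⟩).differentiableAt.differentiableWithinAt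
    · intro s hs; rw [interior_Icc] at hs
      have hs' : s ∈ Icc a t := ⟨hs.1.le, hs.2.le⟩
      rw [(hψd s hs').deriv]
      have h1 := hdec s hs'
      have h2 := hF.conv (h s) (h t)
      have h3 : inner ℝ (h s - h t) (F (h s) + G) ≤ e t - e s := by
        simp only [he]
        have e1 : inner ℝ (h s - h t) (F (h s) + G)
            = - inner ℝ (F (h s)) (h t - h s) - (inner ℝ G (h t) - inner ℝ G (h s)) := by
          rw [real_inner_comm, inner_add_left, inner_sub_right, inner_sub_right, inner_sub_right]
          ring
        rw [e1]; linarith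
      nlinarith
  have h1 := hanti ⟨le_rfl, hat⟩ ⟨hat, le_rfl⟩ hat
  simp only [hψ, sub_self, norm_zero] at h1
  have h2 : ((t - a) * m) ^ 2 ≤ ‖h a - h t‖ ^ 2 := by nlinarith
  rw [norm_sub_rev (h t)]
  exact (abs_le_of_sq_le_sq' h2 (norm_nonneg _)).2


lemma GradF.exists_flow [CompleteSpace H] (hF : GradF F E K) (G x0 : H) (a b : ℝ) (hab : a ≤ b) :
    ∃ h : ℝ → H, h a = x0 ∧ ∀ t ∈ Icc a b, HasDerivAt h (F (h t) + G) t :=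
  ode_global (fun _ x => F x + G) K hF.K0
    (fun _ x y => by simpa using hF.lip x y) (fun x => continuous_const) x0 a b hab

lemma GradF.compare (hF : GradF F E K) {u g : ℝ → H} {h : ℝ → H} {G : H} {a b S : ℝ}
    (hu : ∀ t ∈ Icc a b, HasDerivAt u (F (u t) + g t) t)
    (hh : ∀ t ∈ Icc a b, HasDerivAt h (F (h t) + G) t) (h0 : h a = u a)
    (hS : ∀ t ∈ Icc a b, ‖g t - G‖ ≤ S) (hS0 : 0 ≤ S) :
    ∀ t ∈ Icc a b, ‖u t - h t‖ ≤ S * (t - a) := by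
  intro t ht
  have := norm_growth (fun t => u t - h t) (fun t => (F (u t) + g t) - (F (h t) + G)) a b S
    (fun t ht => (hu t ht).sub (hh t ht))
    (fun t ht => by
      have e : (F (u t) + g t) - (F (h t) + G) = (F (u t) - F (h t)) + (g t - G) := by abel
      rw [e, inner_add_right]
      have h1 := hF.mono (u t) (h t)
      have h2 := real_inner_le_norm (u t - h t) (g t - G)
      have h3 := mul_le_mul_of_nonneg_left (hS t ht) (norm_nonneg (u t - h t))
      linarith) hS0 t ht
  simpa [h0] using this

lemma GradF.step [CompleteSpace H] (hF : GradF F E K) {u g : ℝ → H} {T κ θ τ D : ℝ}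
    (hu : ∀ t ∈ Icc 0 T, HasDerivAt u (F (u t) + g t) t)
    (hκ : 0 ≤ κ) (hθ : 0 < θ) (hθ1 : θ ≤ 1)
    (hg : ∀ r ∈ Icc 0 T, ∀ s ∈ Icc 0 T, ‖g r - g s‖ ≤ κ * |r - s| ^ θ)
    (hτ : 0 < τ) (hD0 : ‖F (u 0) + g 0‖ ≤ D)
    (hD : ∀ t, 0 ≤ t → t + τ ≤ T → ‖u (t + τ) - u t‖ ≤ D * τ) :
    ∀ t, 0 ≤ t → t + τ / 2 ≤ T → ‖u (t + τ / 2) - u t‖ ≤ (D + 12 * κ * τ ^ θ) * (τ / 2) := by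
  intro t ht htT
  have hτθ : 0 < τ ^ θ := Real.rpow_pos_of_pos hτ _
  rcases le_or_gt τ t with htτ | htτ
  · obtain ⟨h, h0, hh⟩ := hF.exists_flow (g t) (u (t - τ)) (t - τ) (t + τ / 2) (by linarith)
    have hS : ∀ r ∈ Icc (t - τ) (t + τ / 2), ‖g r - g t‖ ≤ κ * τ ^ θ := by
      intro r hr
      refine (hg r ⟨by linarith [hr.1], by linarith [hr.2]⟩ t ⟨ht, by linarith⟩).trans ?_
      refine mul_le_mul_of_nonneg_left ?_ hκ
      refine Real.rpow_le_rpow (abs_nonneg _) ?_ hθ.le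
      rw [abs_le]; constructor <;> linarith [hr.1, hr.2]
    have hcmp := hF.compare (u := u) (g := g) (h := h) (S := κ * τ ^ θ)
      (fun r hr => hu r ⟨by linarith [hr.1], by linarith [hr.2]⟩) hh h0 hS (by positivity)
    have c1 := hcmp (t + τ / 2) ⟨by linarith, le_rfl⟩
    have c2 := hcmp t ⟨by linarith, by linarith⟩
    have l := hF.lip_forward hh (s := t) (t := t + τ / 2) (by linarith) (by linarith) le_rfl
    have sm := hF.smoothing hh (t := t) (by linarith) (by linarith)
    have d := hD (t - τ) (by linarith) (by linarith)
    rw [sub_add_cancel] at d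
    rw [h0] at sm
    have t1 : ‖u (t + τ / 2) - u t‖ ≤ ‖u (t + τ / 2) - h (t + τ / 2)‖ + ‖h (t + τ / 2) - h t‖
        + ‖u t - h t‖ := by
      have : u (t + τ / 2) - u t = (u (t + τ / 2) - h (t + τ / 2)) + (h (t + τ / 2) - h t)
        - (u t - h t) := by abel
      rw [this]
      exact (norm_sub_le _ _).trans (add_le_add_left (norm_add_le _ _) _)
    have t2 : ‖h t - u (t - τ)‖ ≤ ‖u t - u (t - τ)‖ + ‖u t - h t‖ := by
      have : h t - u (t - τ) = (u t - u (t - τ)) - (u t - h t) := by abel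
      rw [this]; exact norm_sub_le _ _
    ring_nf at *
    nlinarith [mul_pos hτ hτθ, mul_nonneg hκ (mul_pos hτ hτθ).le]
  · obtain ⟨h, h0, hh⟩ := hF.exists_flow (g 0) (u 0) 0 (t + τ / 2) (by linarith)
    have hS : ∀ r ∈ Icc (0:ℝ) (t + τ / 2), ‖g r - g 0‖ ≤ κ * (2 * τ ^ θ) := by
      intro r hr
      refine (hg r ⟨by linarith [hr.1], by linarith [hr.2]⟩ 0 ⟨le_rfl, by linarith⟩).trans ?_
      refine mul_le_mul_of_nonneg_left ?_ hκ
      calc |r - 0| ^ θ ≤ (2 * τ) ^ θ := by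
            refine Real.rpow_le_rpow (abs_nonneg _) ?_ hθ.le
            rw [abs_le]; constructor <;> linarith [hr.1, hr.2]
        _ = 2 ^ θ * τ ^ θ := Real.mul_rpow (by norm_num) hτ.le
        _ ≤ 2 * τ ^ θ := by
            refine mul_le_mul_of_nonneg_right ?_ hτθ.le
            calc (2:ℝ) ^ θ ≤ 2 ^ (1:ℝ) := Real.rpow_le_rpow_of_exponent_le (by norm_num) hθ1
              _ = 2 := by simp
    have hcmp := hF.compare (u := u) (g := g) (h := h) (S := κ * (2 * τ ^ θ))
      (fun r hr => hu r ⟨by linarith [hr.1], by linarith [hr.2]⟩) hh h0 hS (by positivity)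
    have c1 := hcmp (t + τ / 2) ⟨by linarith, le_rfl⟩
    have c2 := hcmp t ⟨by linarith, by linarith⟩
    have l := hF.lip_forward hh (s := t) (t := t + τ / 2) (by linarith) (by linarith) le_rfl
    have an := hF.deriv_anti hh (s := 0) (t := t) le_rfl ht (by linarith)
    rw [h0] at an
    have t1 : ‖u (t + τ / 2) - u t‖ ≤ ‖u (t + τ / 2) - h (t + τ / 2)‖ + ‖h (t + τ / 2) - h t‖
        + ‖u t - h t‖ := by
      have : u (t + τ / 2) - u t = (u (t + τ / 2) - h (t + τ / 2)) + (h (t + τ / 2) - h t)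
        - (u t - h t) := by abel
      rw [this]
      exact (norm_sub_le _ _).trans (add_le_add_left (norm_add_le _ _) _)
    have e1 : (t + τ / 2 - t) * ‖F (h t) + g 0‖ ≤ τ / 2 * D := by
      have : t + τ / 2 - t = τ / 2 := by ring
      rw [this]; exact mul_le_mul_of_nonneg_left (an.trans hD0) (by linarith)
    have e2 : κ * (2 * τ ^ θ) * (t + τ / 2 - 0) ≤ κ * (2 * τ ^ θ) * (3 / 2 * τ) :=
      mul_le_mul_of_nonneg_left (by linarith) (by positivity)
    have e3 : κ * (2 * τ ^ θ) * (t - 0) ≤ κ * (2 * τ ^ θ) * (3 / 2 * τ) :=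
      mul_le_mul_of_nonneg_left (by linarith) (by positivity)
    nlinarith

lemma GradF.main [CompleteSpace H] (hF : GradF F E K) {u g : ℝ → H} {T κ θ τ D : ℝ}
    (hu : ∀ t ∈ Icc 0 T, HasDerivAt u (F (u t) + g t) t)
    (hκ : 0 ≤ κ) (hθ : 0 < θ) (hθ1 : θ ≤ 1)
    (hg : ∀ r ∈ Icc 0 T, ∀ s ∈ Icc 0 T, ‖g r - g s‖ ≤ κ * |r - s| ^ θ)
    (hτ : 0 < τ) (hD0 : ‖F (u 0) + g 0‖ ≤ D)
    (hD : ∀ t, 0 ≤ t → t + τ ≤ T → ‖u (t + τ) - u t‖ ≤ D * τ) :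
    ∀ t, 0 ≤ t → t < T →
      ‖F (u t) + g t‖ ≤ D + 12 * κ * τ ^ θ / (1 - (1 / 2) ^ θ) := by
  set q : ℝ := (1 / 2 : ℝ) ^ θ with hq
  have hq0 : 0 < q := Real.rpow_pos_of_pos (by norm_num) _
  have hq1 : q < 1 := Real.rpow_lt_one (by norm_num) (by norm_num) hθ
  have hτθ : 0 < τ ^ θ := Real.rpow_pos_of_pos hτ _
  have hgeo : ∀ k : ℕ, ∑ j ∈ Finset.range k, q ^ j ≤ 1 / (1 - q) := by
    intro k
    rw [geom_sum_eq hq1.ne, ← neg_div_neg_eq, neg_sub, neg_sub]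
    exact div_le_div_of_nonneg_right (by have := pow_pos hq0 k; linarith) (by linarith)
  have hk : ∀ k : ℕ, ∀ t, 0 ≤ t → t + τ / 2 ^ k ≤ T →
      ‖u (t + τ / 2 ^ k) - u t‖
        ≤ (D + 12 * κ * τ ^ θ * ∑ j ∈ Finset.range k, q ^ j) * (τ / 2 ^ k) := by
    intro k
    induction k with
    | zero => simpa using hD
    | succ k ih =>
      have hsum : 0 ≤ ∑ j ∈ Finset.range k, q ^ j := Finset.sum_nonneg fun j _ => by positivity
      have := hF.step hu hκ hθ hθ1 hg (τ := τ / 2 ^ k) (by positivity)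
        (hD0.trans (by
          have : 0 ≤ 12 * κ * τ ^ θ * ∑ j ∈ Finset.range k, q ^ j := by positivity
          linarith)) ih
      intro t ht htT
      have e : τ / 2 ^ (k + 1) = τ / 2 ^ k / 2 := by rw [pow_succ]; field_simp
      rw [e] at htT ⊢
      refine (this t ht htT).trans (le_of_eq ?_)
      rw [Finset.sum_range_succ]
      have e2 : (τ / 2 ^ k) ^ θ = τ ^ θ * q ^ k := by
        rw [div_eq_mul_inv, Real.mul_rpow hτ.le (by positivity)]
        congr 1
        have e3 : ((2:ℝ) ^ k)⁻¹ = (1 / 2) ^ k := by simp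
        rw [e3, hq, ← Real.rpow_natCast, ← Real.rpow_natCast, ← Real.rpow_mul (by norm_num),
          ← Real.rpow_mul (by norm_num), mul_comm]
      rw [e2]; ring
  intro t ht htT
  have h0 : Filter.Tendsto (fun k : ℕ => τ / 2 ^ k) Filter.atTop (nhdsWithin 0 (Ioi 0)) := by
    rw [tendsto_nhdsWithin_iff]
    constructor
    · have := (tendsto_pow_atTop_nhds_zero_of_lt_one (r := (1/2:ℝ)) (by norm_num)
        (by norm_num)).const_mul τ
      simpa [div_eq_mul_inv] using this
    · exact Filter.Eventually.of_forall fun k => by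
        change 0 < τ / 2 ^ k
        positivity
  have h1 := (((hu t ⟨ht, htT.le⟩).tendsto_slope_zero_right).norm).comp h0
  refine le_of_tendsto h1 ?_
  have h2 : ∀ᶠ k : ℕ in Filter.atTop, τ / 2 ^ k < T - t := by
    have := (h0.mono_right nhdsWithin_le_nhds).eventually (gt_mem_nhds (sub_pos.2 htT))
    exact this
  filter_upwards [h2] with k hk2
  simp only [Function.comp]
  have hp : 0 < τ / 2 ^ k := by positivity
  rw [norm_smul, norm_inv, Real.norm_of_nonneg hp.le, inv_mul_le_iff₀ hp]
  refine (hk k t ht (by linarith)).trans ?_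
  rw [mul_comm]
  refine mul_le_mul_of_nonneg_left ?_ hp.le
  have := mul_le_mul_of_nonneg_left (hgeo k) (by positivity : 0 ≤ 12 * κ * τ ^ θ)
  rw [mul_one_div] at this
  linarith

end hilb
end FwdSol

namespace FwdSol

/-- Finite family maximum principle. -/
lemma max_principle {ι : Type*} (S : Finset ι) (z z' : ι → ℝ → ℝ) (T : ℝ)
    (hz : ∀ k ∈ S, ∀ t ∈ Icc 0 T, HasDerivAt (z k) (z' k t) t)
    (h0 : ∀ k ∈ S, z k 0 ≤ 0)
    (hm : ∀ k ∈ S, ∀ t ∈ Icc 0 T, 0 < z k t → (∀ l ∈ S, z l t ≤ z k t) → z' k t < 0) :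
    ∀ k ∈ S, ∀ t ∈ Icc 0 T, z k t ≤ 0 := by
  intro k hk t1 ht1
  by_contra hcon
  push Not at hcon
  -- maximise each in time on [0,t1]
  have hT : ∀ l ∈ S, ∃ s ∈ Icc 0 t1, ∀ r ∈ Icc 0 t1, z l r ≤ z l s := by
    intro l hl
    obtain ⟨s, hs, hs2⟩ := isCompact_Icc.exists_isMaxOn (nonempty_Icc.2 ht1.1)
      (f := z l) (s := Icc 0 t1)
      (fun r hr => (hz l hl r ⟨hr.1, hr.2.trans ht1.2⟩).continuousAt.continuousWithinAt)
    exact ⟨s, hs, fun r hr => hs2 hr⟩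
  choose! s hs hsm using hT
  obtain ⟨l, hl, hlm⟩ := S.exists_max_image (fun l => z l (s l)) ⟨k, hk⟩
  have hpos : 0 < z l (s l) :=
    hcon.trans_le ((hsm k hk t1 ⟨ht1.1, le_rfl⟩).trans (hlm k hk))
  have hsl := hs l hl
  have hslT : s l ∈ Icc 0 T := ⟨hsl.1, hsl.2.trans ht1.2⟩
  have hd := hm l hl (s l) hslT hpos (fun l' hl' => (hsm l' hl' _ hsl).trans (hlm l' hl'))
  have hs0 : 0 < s l := by
    rcases hsl.1.eq_or_lt with h | h
    · rw [← h] at hpos; exact absurd (h0 l hl) (not_le.2 hpos)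
    · exact h
  -- left slopes are nonneg
  have hlim := ((hz l hl (s l) hslT).tendsto_slope_zero_left)
  have : 0 ≤ z' l (s l) := by
    refine ge_of_tendsto hlim ?_
    have : Ioo (-(s l)) 0 ∈ nhdsWithin (0:ℝ) (Iio 0) := Ioo_mem_nhdsLT (by linarith)
    filter_upwards [this] with ε hε
    have h1 := hsm l hl (s l + ε) ⟨by linarith [hε.1], by linarith [hε.2, hsl.2]⟩
    rw [smul_eq_mul]
    exact mul_nonneg_of_nonpos_of_nonpos (inv_nonpos.2 hε.2.le) (by linarith)
  linarith

/-- a discrete diffusion system on nodes `0..m`. -/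
structure DSys (m : ℕ) (al be : ℕ → ℝ) (Y : ℕ → ℝ → ℝ) (T : ℝ) : Prop where
  al0 : ∀ i, 0 ≤ al i
  be0 : ∀ i, 0 ≤ be i
  alm : al m = 0
  bez : be 0 = 0
  ode : ∀ i ≤ m, ∀ t ∈ Icc 0 T,
    HasDerivAt (Y i) (al i * (Y (i + 1) t - Y i t) - be i * (Y i t - Y (i - 1) t)) t

lemma DSys.neg {m : ℕ} {al be : ℕ → ℝ} {Y : ℕ → ℝ → ℝ} {T : ℝ} (h : DSys m al be Y T) :
    DSys m al be (fun i t => - Y i t) T where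
  al0 := h.al0
  be0 := h.be0
  alm := h.alm
  bez := h.bez
  ode i hi t ht := (h.ode i hi t ht).neg.congr_deriv (by ring)

lemma DSys.le {m : ℕ} {al be : ℕ → ℝ} {Y : ℕ → ℝ → ℝ} {T B : ℝ} (h : DSys m al be Y T)
    (hB : ∀ i ≤ m, Y i 0 ≤ B) : ∀ i ≤ m, ∀ t ∈ Icc 0 T, Y i t ≤ B := by
  intro i hi t ht
  refine le_of_forall_pos_le_add fun ε hε => ?_
  have hT1 : 0 < 1 + T := by linarith [ht.1, ht.2]
  set δ := ε / (1 + T) with hδ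
  have hδ0 : 0 < δ := by positivity
  have := max_principle (Finset.range (m + 1)) (fun i t => Y i t - B - δ * t)
    (fun i t => al i * (Y (i + 1) t - Y i t) - be i * (Y i t - Y (i - 1) t) - δ) T
    (fun i hi t ht => by
      have h1 := (h.ode i (by simpa [Nat.lt_succ_iff] using hi) t ht)
      exact ((h1.sub_const B).sub ((hasDerivAt_id t).const_mul δ)).congr_deriv (by simp))
    (fun i hi => by
      have := hB i (by simpa [Nat.lt_succ_iff] using hi)
      simpa using this)
    (fun i hi t ht _ hmax => by
      have hi' : i ≤ m := by simpa [Nat.lt_succ_iff] using hi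
      have h1 : al i * (Y (i + 1) t - Y i t) ≤ 0 := by
        rcases hi'.eq_or_lt with h2 | h2
        · rw [h2, h.alm]; simp
        · have := hmax (i + 1) (by simpa using h2)
          exact mul_nonpos_of_nonneg_of_nonpos (h.al0 i) (by linarith)
      have h2 : 0 ≤ be i * (Y i t - Y (i - 1) t) := by
        have := hmax (i - 1) (by simp; omega)
        exact mul_nonneg (h.be0 i) (by linarith)
      linarith) i (by simpa [Nat.lt_succ_iff] using hi) t ht
  have h3 : δ * t ≤ ε := by
    have : δ * t ≤ δ * (1 + T) := mul_le_mul_of_nonneg_left (by linarith [ht.2]) hδ0.le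
    have e : δ * (1 + T) = ε := by rw [hδ]; field_simp
    linarith
  linarith

noncomputable def bar (M R r : ℝ) : ℝ := M * (R ^ 2 - (max (R - r) 0) ^ 2)

lemma bar_up {M R r D : ℝ} (hM : 0 ≤ M) (hr : r ≤ R) (hD : 0 ≤ D) :
    bar M R (r + D) - bar M R r ≤ M * (2 * (R - r) * D) := by
  rw [bar, bar, max_eq_left (sub_nonneg.2 hr), ← mul_sub]
  refine mul_le_mul_of_nonneg_left ?_ hM
  rcases le_total (R - (r + D)) 0 with h | h
  · rw [max_eq_right h]; nlinarith
  · rw [max_eq_left h]; nlinarith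

lemma bar_down {M R r D : ℝ} (hr : r ≤ R) (hD : 0 ≤ D) :
    bar M R r - bar M R (r - D) = M * (2 * (R - r) * D + D ^ 2) := by
  rw [bar, bar, max_eq_left (sub_nonneg.2 hr), max_eq_left (by linarith)]; ring

lemma DSys.kl_aux {m : ℕ} {al be : ℕ → ℝ} {Y : ℕ → ℝ → ℝ} {T : ℝ} (h : DSys m al be Y T)
    {X : ℕ → ℝ} {B c : ℝ} (hX : ∀ i, X i < X (i + 1)) (hT : 0 < T) (hB : 0 < B) (hc : 0 < c)
    (hr : ∀ i, 1 ≤ i → i ≤ m → al i * (X (i + 1) - X i) ≤ be i * (X i - X (i - 1)))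
    (hl : ∀ j < m, be j * (X j - X (j - 1)) ≤ al j * (X (j + 1) - X j))
    (hcc : ∀ j i, j < i → i ≤ m →
      c ≤ be i * (X i - X (i - 1)) ^ 2 + al j * (X (j + 1) - X j) ^ 2 ∨
        ∀ t ∈ Icc 0 T, Y i t ≤ Y j t)
    (hY : ∀ i ≤ m, |Y i 0| ≤ B) :
    ∀ i < m, Y (i + 1) T - Y i T ≤ 5 * B / Real.sqrt (c * T) * (X (i + 1) - X i) := by
  have hXm : StrictMono X := strictMono_nat_of_lt_succ hX
  have hup := h.le (B := B) (fun i hi => (abs_le.1 (hY i hi)).2)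
  have hlo : ∀ i ≤ m, ∀ t ∈ Icc 0 T, -B ≤ Y i t := fun i hi t ht => by
    have := h.neg.le (B := B) (fun i hi => by linarith [(abs_le.1 (hY i hi)).1]) i hi t ht
    linarith
  set M := 3 * B / (c * T) with hM
  have hM0 : 0 < M := by positivity
  set R := Real.sqrt (2 * B / M) with hR
  have hR0 : 0 < R := Real.sqrt_pos.2 (by positivity)
  have hR2 : M * R ^ 2 = 2 * B := by
    rw [hR, Real.sq_sqrt (by positivity)]; field_simp
  have hbig : ∀ r, R ≤ r → bar M R r = 2 * B := by
    intro r hr; rw [bar, max_eq_right (by linarith)]; linarith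
  have hbar0 : bar M R 0 = 0 := by rw [bar, sub_zero, max_eq_left hR0.le]; ring
  have hbarnn : ∀ r, 0 ≤ r → 0 ≤ bar M R r := by
    intro r hr
    rcases le_total R r with h1 | h1
    · rw [hbig r h1]; positivity
    · rw [bar, max_eq_left (by linarith)]
      exact mul_nonneg hM0.le (by nlinarith)
  have key := max_principle
    ((Finset.range (m + 1) ×ˢ Finset.range (m + 1)).filter (fun p => p.2 ≤ p.1))
    (fun p t => Y p.1 t - Y p.2 t - (2 * B * (1 - t / T) + bar M R (X p.1 - X p.2)))
    (fun p t => (al p.1 * (Y (p.1 + 1) t - Y p.1 t) - be p.1 * (Y p.1 t - Y (p.1 - 1) t))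
      - (al p.2 * (Y (p.2 + 1) t - Y p.2 t) - be p.2 * (Y p.2 t - Y (p.2 - 1) t)) + 2 * B / T) T
    (fun p hp t ht => by
      simp only [Finset.mem_filter, Finset.mem_product, Finset.mem_range, Nat.lt_succ_iff] at hp
      have h1 := (h.ode p.1 hp.1.1 t ht).sub (h.ode p.2 hp.1.2 t ht)
      have h2 : HasDerivAt (fun t => 2 * B * (1 - t / T) + bar M R (X p.1 - X p.2))
        (2 * B * (-(1 / T))) t :=
        ((((hasDerivAt_id t).div_const T).const_sub 1).const_mul (2 * B)).add_const _
      exact (h1.sub h2).congr_deriv (by ring))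
    (fun p hp => by
      simp only [Finset.mem_filter, Finset.mem_product, Finset.mem_range, Nat.lt_succ_iff] at hp
      have h1 := hup p.1 hp.1.1 0 ⟨le_rfl, hT.le⟩
      have h2 := hlo p.2 hp.1.2 0 ⟨le_rfl, hT.le⟩
      have h3 := hbarnn (X p.1 - X p.2) (sub_nonneg.2 (hXm.monotone hp.2))
      simp only [zero_div, sub_zero, mul_one]; linarith)
    (by
      rintro ⟨i, j⟩ hp t ht hpos hmax
      simp only [Finset.mem_filter, Finset.mem_product, Finset.mem_range, Nat.lt_succ_iff] at hp
      obtain ⟨⟨him, hjm⟩, hji⟩ := hp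
      simp only at hpos hmax ⊢
      have ht1 : 0 ≤ 2 * B * (1 - t / T) := by
        have : t / T ≤ 1 := (div_le_one hT).2 ht.2
        have : 0 ≤ 1 - t / T := by linarith
        positivity
      have hne : j < i := by
        rcases hji.eq_or_lt with h1 | h1
        · exfalso; rw [h1, sub_self, sub_self, hbar0] at hpos; linarith
        · exact h1
      set r := X i - X j with hrdef
      have hr0 : 0 < r := sub_pos.2 (hXm hne)
      have hrR : r < R := by
        by_contra h1
        push Not at h1
        rw [hbig r h1] at hpos
        linarith [hup i him t ht, hlo j hjm t ht]
      have hD : ∀ k, 0 < X (k + 1) - X k := fun k => sub_pos.2 (hX k)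
      have hmem : ∀ i' j', i' ≤ m → j' ≤ i' → (i', j') ∈
          ((Finset.range (m + 1) ×ˢ Finset.range (m + 1)).filter (fun p => p.2 ≤ p.1)) := by
        intro i' j' h1 h2
        simp only [Finset.mem_filter, Finset.mem_product, Finset.mem_range, Nat.lt_succ_iff]
        exact ⟨⟨h1, h2.trans h1⟩, h2⟩
      have hi1 : 1 ≤ i := by omega
      have ei : i - 1 + 1 = i := by omega
      have hDi : 0 < X i - X (i - 1) := by have := hD (i - 1); rwa [ei] at this
      -- four terms
      have q1 : al i * (Y (i + 1) t - Y i t) ≤ al i * (M * (2 * (R - r) * (X (i + 1) - X i))) := by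
        rcases him.eq_or_lt with h1 | h1
        · rw [h1, h.alm]; simp
        · refine mul_le_mul_of_nonneg_left ?_ (h.al0 i)
          have h2 := hmax (i + 1, j) (hmem _ _ h1 (by omega))
          simp only at h2
          have h3 := bar_up (M := M) (R := R) (r := r) (D := X (i + 1) - X i) hM0.le hrR.le (hD i).le
          have e : r + (X (i + 1) - X i) = X (i + 1) - X j := by rw [hrdef]; ring
          rw [e] at h3
          linarith
      have q2 : be i * (M * (2 * (R - r) * (X i - X (i - 1)) + (X i - X (i - 1)) ^ 2))
          ≤ be i * (Y i t - Y (i - 1) t) := by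
        refine mul_le_mul_of_nonneg_left ?_ (h.be0 i)
        have h2 := hmax (i - 1, j) (hmem _ _ (by omega) (by omega))
        simp only at h2
        have h3 := bar_down (M := M) (R := R) (r := r) (D := X i - X (i - 1)) hrR.le hDi.le
        have e : r - (X i - X (i - 1)) = X (i - 1) - X j := by rw [hrdef]; ring
        rw [e] at h3
        linarith
      have q3 : al j * (M * (2 * (R - r) * (X (j + 1) - X j) + (X (j + 1) - X j) ^ 2))
          ≤ al j * (Y (j + 1) t - Y j t) := by
        refine mul_le_mul_of_nonneg_left ?_ (h.al0 j)
        have h2 := hmax (i, j + 1) (hmem _ _ him (by omega))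
        simp only at h2
        have h3 := bar_down (M := M) (R := R) (r := r) (D := X (j + 1) - X j) hrR.le (hD j).le
        have e : r - (X (j + 1) - X j) = X i - X (j + 1) := by rw [hrdef]; ring
        rw [e] at h3
        linarith
      have q4 : be j * (Y j t - Y (j - 1) t) ≤ be j * (M * (2 * (R - r) * (X j - X (j - 1)))) := by
        rcases Nat.eq_zero_or_pos j with h1 | h1
        · rw [h1, h.bez]; simp
        · refine mul_le_mul_of_nonneg_left ?_ (h.be0 j)
          have h2 := hmax (i, j - 1) (hmem _ _ him (by omega))
          simp only at h2
          have h5 := hD (j - 1)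
          rw [Nat.sub_add_cancel h1] at h5
          have h3 := bar_up (M := M) (R := R) (r := r) (D := X j - X (j - 1)) hM0.le hrR.le h5.le
          have e : r + (X j - X (j - 1)) = X i - X (j - 1) := by rw [hrdef]; ring
          rw [e] at h3
          linarith
      have hcij : c ≤ be i * (X i - X (i - 1)) ^ 2 + al j * (X (j + 1) - X j) ^ 2 := by
        rcases hcc j i hne him with h1 | h1
        · exact h1
        · exfalso
          have := h1 t ht
          have := hbarnn r hr0.le
          linarith
      have b1 := hr i hi1 him
      have b2 := hl j (by omega)
      have hMR : 0 ≤ M * (2 * (R - r)) := by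
        have : 0 < R - r := by linarith
        positivity
      have b1' := mul_le_mul_of_nonneg_left b1 hMR
      have b2' := mul_le_mul_of_nonneg_left b2 hMR
      have b3 := mul_le_mul_of_nonneg_left hcij hM0.le
      have hMc : M * c = 3 * B / T := by rw [hM]; field_simp
      have hBT : 0 < B / T := by positivity
      have e1 : 3 * B / T = 3 * (B / T) := by ring
      have e2 : 2 * B / T = 2 * (B / T) := by ring
      rw [hMc, e1] at b3
      rw [e2]
      nlinarith)
  intro i hi
  have h1 := key (i + 1, i) (by simp; omega) T ⟨hT.le, le_rfl⟩
  simp only [div_self hT.ne', sub_self, mul_zero, zero_add] at h1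
  have h2 := bar_up (M := M) (R := R) (r := 0) (D := X (i + 1) - X i) hM0.le hR0.le
    (sub_nonneg.2 (hX i).le)
  rw [zero_add, hbar0] at h2
  have h3 : M * (2 * R) ≤ 5 * B / Real.sqrt (c * T) := by
    have hs : 0 < Real.sqrt (c * T) := Real.sqrt_pos.2 (by positivity)
    rw [le_div_iff₀ hs]
    have hsq : Real.sqrt (c * T) ^ 2 = c * T := Real.sq_sqrt (by positivity)
    have : (M * (2 * R) * Real.sqrt (c * T)) ^ 2 ≤ (5 * B) ^ 2 := by
      have e : (M * (2 * R) * Real.sqrt (c * T)) ^ 2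
          = 4 * (M * (c * T)) * (M * R ^ 2) := by
        rw [mul_pow, mul_pow, hsq]; ring
      have e' : M * (c * T) = 3 * B := by rw [hM]; field_simp
      rw [e, hR2, e']; nlinarith
    exact (abs_le_of_sq_le_sq' this (by positivity)).2
  have h4 := mul_le_mul_of_nonneg_right h3 (sub_nonneg.2 (hX i).le)
  nlinarith

lemma DSys.kl {m : ℕ} {al be : ℕ → ℝ} {Y : ℕ → ℝ → ℝ} {T : ℝ} (h : DSys m al be Y T)
    {X : ℕ → ℝ} {B c : ℝ} (hX : ∀ i, X i < X (i + 1)) (hT : 0 < T) (hB : 0 < B) (hc : 0 < c)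
    (hr : ∀ i, 1 ≤ i → i ≤ m → al i * (X (i + 1) - X i) ≤ be i * (X i - X (i - 1)))
    (hl : ∀ j < m, be j * (X j - X (j - 1)) ≤ al j * (X (j + 1) - X j))
    (hcc : ∀ j i, j < i → i ≤ m →
      c ≤ be i * (X i - X (i - 1)) ^ 2 + al j * (X (j + 1) - X j) ^ 2 ∨
        ∀ t ∈ Icc 0 T, Y i t = Y j t)
    (hY : ∀ i ≤ m, |Y i 0| ≤ B) :
    ∀ i < m, |Y (i + 1) T - Y i T| ≤ 5 * B / Real.sqrt (c * T) * (X (i + 1) - X i) := by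
  intro i hi
  have h1 := h.kl_aux hX hT hB hc hr hl
    (fun j i hji him => (hcc j i hji him).imp_right fun h t ht => (h t ht).le) hY i hi
  have h2 := h.neg.kl_aux hX hT hB hc hr hl
    (fun j i hji him => (hcc j i hji him).imp_right fun h t ht => (neg_le_neg (h t ht).ge))
    (fun i hi => by rw [abs_neg]; exact hY i hi) i hi
  rw [abs_le]; constructor <;> linarith

end FwdSol

namespace FwdSol

/-- discrete gradient on edges `0..n+1`, with zero boundary edges -/
noncomputable def edge (n : ℕ) (y : ℕ → ℝ) (i : ℕ) : ℝ :=
  if i = 0 ∨ n < i then 0 else ((n:ℝ) + 1) * (y i - y (i - 1))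

lemma edge_zero (n : ℕ) (y : ℕ → ℝ) : edge n y 0 = 0 := by simp [edge]
lemma edge_last (n : ℕ) (y : ℕ → ℝ) : edge n y (n + 1) = 0 := by simp [edge]
lemma edge_succ {n : ℕ} (y : ℕ → ℝ) {i : ℕ} (hi : i < n) :
    edge n y (i + 1) = ((n:ℝ) + 1) * (y (i + 1) - y i) := by
  rw [edge, if_neg (by omega)]; simp

structure LinSys (n : ℕ) (a : ℕ → ℝ) (y : ℕ → ℝ → ℝ) (T : ℝ) : Prop where
  ode : ∀ i ≤ n, ∀ t ∈ Icc 0 T, HasDerivAt (y i)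
    (a i * (((n:ℝ) + 1) * (edge n (fun k => y k t) (i + 1) - edge n (fun k => y k t) i))) t

variable {n : ℕ} {a : ℕ → ℝ} {y : ℕ → ℝ → ℝ} {T lam Lam B : ℝ}

lemma LinSys.dsys (h : LinSys n a y T) (ha : ∀ i, 0 < a i) :
    DSys n (fun i => if i < n then a i * ((n:ℝ) + 1) ^ 2 else 0)
      (fun i => if i = 0 then 0 else a i * ((n:ℝ) + 1) ^ 2) y T where
  al0 i := by
    have := ha i
    split_ifs <;> positivity
  be0 i := by
    have := ha i
    split_ifs <;> positivity
  alm := by simp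
  bez := by simp
  ode i hi t ht := by
    refine (h.ode i hi t ht).congr_deriv ?_
    have e1 : edge n (fun k => y k t) (i + 1)
        = if i < n then ((n:ℝ) + 1) * (y (i + 1) t - y i t) else 0 := by
      split_ifs with h1
      · exact edge_succ _ h1
      · have : i = n := by omega
        rw [this, edge_last]
    have e2 : edge n (fun k => y k t) i
        = if i = 0 then 0 else ((n:ℝ) + 1) * (y i t - y (i - 1) t) := by
      split_ifs with h1
      · rw [h1, edge_zero]
      · rw [edge, if_neg (by omega)]
    rw [e1, e2]
    split_ifs <;> ring

lemma LinSys.bound (h : LinSys n a y T) (ha : ∀ i, 0 < a i) (hB : ∀ i ≤ n, |y i 0| ≤ B) :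
    ∀ i ≤ n, ∀ t ∈ Icc 0 T, |y i t| ≤ B := by
  intro i hi t ht
  have h1 := (h.dsys ha).le (B := B) (fun i hi => (abs_le.1 (hB i hi)).2) i hi t ht
  have h2 := (h.dsys ha).neg.le (B := B) (fun i hi => by linarith [(abs_le.1 (hB i hi)).1]) i hi t ht
  rw [abs_le]; constructor <;> linarith

lemma LinSys.grad (h : LinSys n a y T) (hl : 0 < lam) (ha : ∀ i, lam ≤ a i)
    (hT : 0 < T) (hB0 : 0 < B) (hB : ∀ i ≤ n, |y i 0| ≤ B) :
    ∀ i ≤ n + 1, |edge n (fun k => y k T) i| ≤ 5 * B / Real.sqrt (lam * T) := by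
  have hN : (0:ℝ) < (n:ℝ) + 1 := by positivity
  have ha' : ∀ i, 0 < a i := fun i => hl.trans_le (ha i)
  have key := (h.dsys ha').kl (X := fun i => (i:ℝ) / ((n:ℝ) + 1)) (B := B) (c := lam)
    (fun i => by
      have : ((i + 1 : ℕ):ℝ) = i + 1 := by push_cast; ring
      rw [this]; gcongr; linarith) hT hB0 hl
    (fun i h1 h2 => by
      obtain ⟨k, rfl⟩ : ∃ k, i = k + 1 := ⟨i - 1, by omega⟩
      simp only [Nat.add_sub_cancel, Nat.succ_ne_zero, if_false]
      have e1 : ((k + 1 + 1 : ℕ):ℝ) / ((n:ℝ) + 1) - ((k + 1 : ℕ):ℝ) / ((n:ℝ) + 1)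
        = 1 / ((n:ℝ) + 1) := by push_cast; ring
      have e2 : ((k + 1 : ℕ):ℝ) / ((n:ℝ) + 1) - ((k : ℕ):ℝ) / ((n:ℝ) + 1)
        = 1 / ((n:ℝ) + 1) := by push_cast; ring
      rw [e1, e2]
      have := ha' (k + 1)
      split_ifs
      · exact le_rfl
      · rw [zero_mul]; positivity)
    (fun j hj => by
      rw [if_pos hj]
      have := ha' j
      split_ifs with h1
      · rw [zero_mul]
        have e1 : ((j + 1 : ℕ):ℝ) / ((n:ℝ) + 1) - (j:ℝ) / ((n:ℝ) + 1)
          = 1 / ((n:ℝ) + 1) := by push_cast; ring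
        rw [e1]; positivity
      · obtain ⟨k, rfl⟩ : ∃ k, j = k + 1 := ⟨j - 1, by omega⟩
        simp only [Nat.add_sub_cancel]
        apply le_of_eq
        push_cast; ring)
    (fun j i hji hin => Or.inl (by
      rw [if_neg (by omega), if_pos (by omega)]
      obtain ⟨k, rfl⟩ : ∃ k, i = k + 1 := ⟨i - 1, by omega⟩
      simp only [Nat.add_sub_cancel]
      have e1 : ((k + 1 : ℕ):ℝ) / ((n:ℝ) + 1) - ((k : ℕ):ℝ) / ((n:ℝ) + 1)
        = 1 / ((n:ℝ) + 1) := by push_cast; ring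
      rw [e1]
      have e2 : a (k + 1) * ((n:ℝ) + 1) ^ 2 * (1 / ((n:ℝ) + 1)) ^ 2 = a (k + 1) := by field_simp
      rw [e2]
      have h1 := ha (k + 1)
      have h2 := ha' j
      have : 0 ≤ a j * ((n:ℝ) + 1) ^ 2 * (((j + 1 : ℕ):ℝ) / ((n:ℝ) + 1) - (j:ℝ) / ((n:ℝ) + 1)) ^ 2 := by
        positivity
      linarith)) hB
  intro i hi
  rcases Nat.eq_zero_or_pos i with h0 | h0
  · rw [h0, edge_zero, abs_zero]; positivity
  · obtain ⟨k, rfl⟩ : ∃ k, i = k + 1 := ⟨i - 1, by omega⟩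
    rcases (show k ≤ n by omega).eq_or_lt with h1 | h1
    · rw [h1, edge_last, abs_zero]; positivity
    · rw [edge_succ _ h1, abs_mul, abs_of_pos hN]
      have := key k h1
      have e1 : ((k + 1 : ℕ):ℝ) / ((n:ℝ) + 1) - ((k : ℕ):ℝ) / ((n:ℝ) + 1)
        = 1 / ((n:ℝ) + 1) := by push_cast; ring
      rw [e1] at this
      calc ((n:ℝ) + 1) * |y (k + 1) T - y k T| ≤ ((n:ℝ) + 1) * (5 * B / Real.sqrt (lam * T) * (1 / ((n:ℝ) + 1))) := by
            gcongr
        _ = _ := by field_simp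

lemma LinSys.edgeSys (h : LinSys n a y T) (ha : ∀ i, 0 < a i) :
    DSys (n + 1) (fun i => if i = 0 ∨ n < i then 0 else a i * ((n:ℝ) + 1) ^ 2)
      (fun i => if i = 0 ∨ n < i then 0 else a (i - 1) * ((n:ℝ) + 1) ^ 2)
      (fun i t => edge n (fun k => y k t) i) T where
  al0 i := by
    have := ha i
    split_ifs <;> positivity
  be0 i := by
    have := ha (i - 1)
    split_ifs <;> positivity
  alm := by simp
  bez := by simp
  ode i hi t ht := by
    rcases Nat.eq_zero_or_pos i with h0 | h0
    · subst h0
      simp only [true_or, if_true, zero_mul, sub_zero, edge_zero]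
      exact hasDerivAt_const _ _
    · obtain ⟨k, rfl⟩ : ∃ k, i = k + 1 := ⟨i - 1, by omega⟩
      rcases (show k ≤ n by omega).eq_or_lt with h1 | h1
      · subst h1
        simp only [Nat.lt_succ_self, or_true, if_true, zero_mul, sub_zero, edge_last]
        exact hasDerivAt_const _ _
      · rw [if_neg (by omega), if_neg (by omega)]
        have e : (fun t => edge n (fun k => y k t) (k + 1))
            = fun t => ((n:ℝ) + 1) * (y (k + 1) t - y k t) := by
          ext t; exact edge_succ _ h1
        rw [e]
        refine (((h.ode (k + 1) (by omega) t ht).sub (h.ode k (by omega) t ht)).const_mul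
          ((n:ℝ) + 1)).congr_deriv ?_
        simp only [Nat.add_sub_cancel]
        ring

lemma LinSys.shift (h : LinSys n a y T) {s : ℝ} (hs : 0 ≤ s) :
    LinSys n a (fun i t => y i (t + s)) (T - s) where
  ode i hi t ht := (h.ode i hi (t + s) ⟨by linarith [ht.1], by linarith [ht.2]⟩).comp_add_const t s

lemma LinSys.short (h : LinSys n a y T) {s : ℝ} (hs : s ≤ T) :
    LinSys n a y s where
  ode i hi t ht := (h.ode i hi t ⟨by linarith [ht.1], by linarith [ht.2]⟩)

lemma LinSys.smooth (h : LinSys n a y T) (hl : 0 < lam) (ha : ∀ i, lam ≤ a i) (hLam : ∀ i, a i ≤ Lam)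
    (hT : 0 < T) (hB0 : 0 < B) (hB : ∀ i ≤ n, |y i 0| ≤ B) :
    ∀ i ≤ n, |a i * (((n:ℝ) + 1) * (edge n (fun k => y k T) (i + 1) - edge n (fun k => y k T) i))|
      ≤ 50 * Real.sqrt (Lam / lam) * B / T := by
  have hN : (0:ℝ) < (n:ℝ) + 1 := by positivity
  have ha' : ∀ i, 0 < a i := fun i => hl.trans_le (ha i)
  have hL : 0 < Lam := (ha' 0).trans_le (hLam 0)
  set B2 := 5 * B / Real.sqrt (lam * (T / 2)) with hB2
  have hB20 : 0 < B2 := by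
    have : 0 < Real.sqrt (lam * (T / 2)) := Real.sqrt_pos.2 (by positivity)
    positivity
  have h1 := (h.short (s := T / 2) (by linarith)).grad hl ha (by linarith) hB0 hB
  have h2 := (h.shift (s := T / 2) (by linarith)).edgeSys ha'
  have eT : T - T / 2 = T / 2 := by ring
  rw [eT] at h2
  have hX : ∀ i, (∑ k ∈ Finset.range (i + 1), 1 / (((n:ℝ) + 1) * a k))
      - (∑ k ∈ Finset.range i, 1 / (((n:ℝ) + 1) * a k)) = 1 / (((n:ℝ) + 1) * a i) := fun i => by
    rw [Finset.sum_range_succ]; ring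
  have hXp : ∀ i, 0 < 1 / (((n:ℝ) + 1) * a i) := fun i => by
    have := ha' i
    positivity
  have key := h2.kl (X := fun i => ∑ k ∈ Finset.range i, 1 / (((n:ℝ) + 1) * a k)) (B := B2)
    (c := 1 / Lam) (fun i => by have := hX i; have := hXp i; linarith) (by linarith) hB20
    (by positivity)
    (fun i h1 h2 => by
      obtain ⟨k, rfl⟩ : ∃ k, i = k + 1 := ⟨i - 1, by omega⟩
      rw [Nat.add_sub_cancel, hX, hX]
      have := ha' k
      have := ha' (k + 1)
      by_cases hk : k + 1 = 0 ∨ n < k + 1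
      · rw [if_pos hk, if_pos hk]; simp
      · rw [if_neg hk, if_neg hk]; apply le_of_eq; field_simp)
    (fun i h1 => by
      rcases Nat.eq_zero_or_pos i with h0 | h0
      · subst h0; simp
      obtain ⟨k, rfl⟩ : ∃ k, i = k + 1 := ⟨i - 1, by omega⟩
      rw [Nat.add_sub_cancel, hX, hX]
      have := ha' k
      have := ha' (k + 1)
      by_cases hk : k + 1 = 0 ∨ n < k + 1
      · rw [if_pos hk, if_pos hk]; simp
      · rw [if_neg hk, if_neg hk]; apply le_of_eq; field_simp)
    (fun j i hji hin => by
      obtain ⟨k, rfl⟩ : ∃ k, i = k + 1 := ⟨i - 1, by omega⟩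
      simp only [Nat.add_sub_cancel]
      rw [hX, hX]
      have A1 : ∀ i, a i * ((n:ℝ) + 1) ^ 2 * (1 / (((n:ℝ) + 1) * a i)) ^ 2 = 1 / a i := fun i => by
        have := ha' i
        field_simp
      have A2 : ∀ i, 1 / Lam ≤ 1 / a i := fun i =>
        one_div_le_one_div_of_le (ha' i) (hLam i)
      have A3 : ∀ i, 0 < 1 / a i := fun i => by have := ha' i; positivity
      by_cases hkn : k < n
      · left
        rw [if_neg (by omega : ¬ (k + 1 = 0 ∨ n < k + 1)), A1]
        split_ifs
        · have := A2 k; simpa using this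
        · rw [A1]; linarith [A2 k, A3 j]
      · have hk : k = n := by omega
        subst hk
        rcases Nat.eq_zero_or_pos j with h0 | h0
        · right
          intro t _
          rw [h0, edge_last, edge_zero]
        · left
          rw [if_neg (by omega : ¬ (j = 0 ∨ k < j)), A1]
          simp only [Nat.lt_succ_self, or_true, if_true, zero_mul, zero_add]
          exact A2 j)
    (fun i hi => by
      have := h1 i hi
      simpa using this)
  intro i hi
  have k1 := key i (by omega)
  simp only [add_halves] at k1
  rw [hX] at k1
  have hai := ha' i
  rw [abs_mul, abs_mul, abs_of_pos hai, abs_of_pos hN]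
  calc a i * (((n:ℝ) + 1) * |edge n (fun k => y k T) (i + 1) - edge n (fun k => y k T) i|)
      ≤ a i * (((n:ℝ) + 1) * (5 * B2 / Real.sqrt (1 / Lam * (T / 2)) * (1 / (((n:ℝ) + 1) * a i)))) := by
        gcongr
    _ = 5 * B2 / Real.sqrt (1 / Lam * (T / 2)) := by field_simp
    _ = 25 * B / (Real.sqrt (lam * (T / 2)) * Real.sqrt (1 / Lam * (T / 2))) := by
        rw [hB2]; field_simp; norm_num
    _ = 50 * Real.sqrt (Lam / lam) * B / T := by
        rw [← Real.sqrt_mul (by positivity)]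
        have e : lam * (T / 2) * (1 / Lam * (T / 2)) = (T / 2) ^ 2 / (Lam / lam) := by field_simp
        have hs : 0 < Real.sqrt (Lam / lam) := Real.sqrt_pos.2 (by positivity)
        rw [e, Real.sqrt_div (by positivity), Real.sqrt_sq (by positivity)]
        field_simp
        norm_num

end FwdSol

namespace FwdSol

abbrev HN (n : ℕ) := EuclideanSpace ℝ (Fin (n + 1))

noncomputable def vec (n : ℕ) (f : ℕ → ℝ) : HN n := WithLp.toLp 2 (fun i : Fin (n + 1) => f i)
noncomputable def ex {n : ℕ} (V : HN n) (i : ℕ) : ℝ := if h : i < n + 1 then V ⟨i, h⟩ else 0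

variable {n : ℕ}

lemma vec_apply (f : ℕ → ℝ) (i : Fin (n + 1)) : vec n f i = f i := rfl

lemma vec_ex (V : HN n) : vec n (ex V) = V := by
  ext i
  rw [vec_apply, ex, dif_pos i.2]

lemma ex_vec (f : ℕ → ℝ) {i : ℕ} (hi : i ≤ n) : ex (vec n f) i = f i := by
  rw [ex, dif_pos (by omega), vec_apply]

lemma vec_sub (f g : ℕ → ℝ) : vec n f - vec n g = vec n (fun i => f i - g i) := rfl
lemma vec_add (f g : ℕ → ℝ) : vec n f + vec n g = vec n (fun i => f i + g i) := rfl

lemma ex_sub (V W : HN n) (i : ℕ) : ex (V - W) i = ex V i - ex W i := by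
  simp only [ex]; split_ifs <;> simp

lemma vec_congr {f g : ℕ → ℝ} (h : ∀ i ≤ n, f i = g i) : vec n f = vec n g := by
  ext i; rw [vec_apply, vec_apply]; exact h i (by omega)

lemma inner_vec (f g : ℕ → ℝ) : inner ℝ (vec n f) (vec n g) = ∑ i ∈ Finset.range (n + 1), f i * g i := by
  rw [PiLp.inner_apply, Finset.sum_range]
  refine Finset.sum_congr rfl fun i _ => ?_
  rw [vec_apply, vec_apply]
  simp [mul_comm]

lemma norm_vec_sq (f : ℕ → ℝ) : ‖vec n f‖ ^ 2 = ∑ i ∈ Finset.range (n + 1), f i ^ 2 := by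
  rw [← real_inner_self_eq_norm_sq, inner_vec]
  exact Finset.sum_congr rfl fun i _ => by ring

lemma norm_vec_le {f g : ℕ → ℝ} {c : ℝ} (hc : 0 ≤ c) (h : ∀ i ≤ n, |f i| ≤ c * |g i|) :
    ‖vec n f‖ ≤ c * ‖vec n g‖ := by
  have : ‖vec n f‖ ^ 2 ≤ (c * ‖vec n g‖) ^ 2 := by
    rw [mul_pow, norm_vec_sq, norm_vec_sq, Finset.mul_sum]
    refine Finset.sum_le_sum fun i hi => ?_
    have h1 := h i (by simpa [Nat.lt_succ_iff] using hi)
    rw [← sq_abs (f i), ← sq_abs (g i), ← mul_pow]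
    exact pow_le_pow_left₀ (abs_nonneg _) h1 2
  exact (abs_le_of_sq_le_sq' this (by positivity)).2

lemma norm_vec_one : ‖vec n (fun _ => 1)‖ = Real.sqrt ((n:ℝ) + 1) := by
  rw [← Real.sqrt_sq (norm_nonneg _), norm_vec_sq]; simp

lemma norm_vec_const {f : ℕ → ℝ} {c : ℝ} (hc : 0 ≤ c) (h : ∀ i ≤ n, |f i| ≤ c) :
    ‖vec n f‖ ≤ c * Real.sqrt ((n:ℝ) + 1) := by
  rw [← norm_vec_one]
  exact norm_vec_le hc (by simpa using h)

lemma abs_le_norm_vec (f : ℕ → ℝ) {i : ℕ} (hi : i ≤ n) : |f i| ≤ ‖vec n f‖ := by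
  have : |f i| ^ 2 ≤ ‖vec n f‖ ^ 2 := by
    rw [norm_vec_sq, sq_abs]
    exact Finset.single_le_sum (f := fun i => f i ^ 2) (fun j _ => sq_nonneg (f j)) (by simp; omega)
  exact (abs_le_of_sq_le_sq' this (norm_nonneg _)).2

/-- mean of absolute values bounded by L2 norm -/
lemma sum_abs_le (f : ℕ → ℝ) {k : ℕ} (hk : k ≤ n + 1) :
    ∑ i ∈ Finset.range k, |f i| ≤ Real.sqrt ((n:ℝ) + 1) * ‖vec n f‖ := by
  calc ∑ i ∈ Finset.range k, |f i| ≤ ∑ i ∈ Finset.range (n + 1), |f i| :=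
        Finset.sum_le_sum_of_subset_of_nonneg (Finset.range_mono hk) fun _ _ _ => abs_nonneg _
    _ = inner ℝ (vec n (fun _ => 1)) (vec n (fun i => |f i|)) := by rw [inner_vec]; simp
    _ ≤ ‖vec n (fun _ => 1)‖ * ‖vec n (fun i => |f i|)‖ := real_inner_le_norm _ _
    _ ≤ Real.sqrt ((n:ℝ) + 1) * (1 * ‖vec n f‖) := by
        rw [norm_vec_one]; gcongr; exact norm_vec_le one_pos.le (by simp)
    _ = _ := by rw [one_mul]

lemma edge_congr {f g : ℕ → ℝ} (h : ∀ i ≤ n, f i = g i) (i : ℕ) : edge n f i = edge n g i := by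
  rw [edge, edge]
  split_ifs with h1
  · rfl
  · rw [h i (by omega), h (i - 1) (by omega)]

lemma edge_sub (f g : ℕ → ℝ) (i : ℕ) :
    edge n (fun k => f k - g k) i = edge n f i - edge n g i := by
  rw [edge, edge, edge]; split_ifs <;> ring

lemma abel_edge (A v : ℕ → ℝ) (h0 : A 0 = 0) (h1 : A (n + 1) = 0) :
    ∑ i ∈ Finset.range (n + 1), (((n:ℝ) + 1) * (A (i + 1) - A i)) * v i
      = - ∑ i ∈ Finset.range (n + 1), A i * edge n v i := by
  have key : ∀ m ≤ n, ∑ i ∈ Finset.range (m + 1), (((n:ℝ) + 1) * (A (i + 1) - A i)) * v i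
      = ((n:ℝ) + 1) * A (m + 1) * v m - ∑ i ∈ Finset.range (m + 1), A i * edge n v i := by
    intro m
    induction m with
    | zero => intro _; simp [h0]
    | succ m ih =>
      intro hm
      rw [Finset.sum_range_succ, ih (by omega), Finset.sum_range_succ _ (m + 1),
        edge_succ v (show m < n by omega)]
      ring
  rw [key n le_rfl, h1]; ring

/-- second difference -/
noncomputable def dd (n : ℕ) (A : ℕ → ℝ) (i : ℕ) : ℝ := ((n:ℝ) + 1) * (A (i + 1) - A i)

lemma inner_dd (A v : ℕ → ℝ) (h0 : A 0 = 0) (h1 : A (n + 1) = 0) :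
    inner ℝ (vec n (dd n A)) (vec n v) = - inner ℝ (vec n A) (vec n (edge n v)) := by
  rw [inner_vec, inner_vec, ← abel_edge A v h0 h1]; rfl

lemma norm_edge_sq (v : ℕ → ℝ) :
    ‖vec n (edge n v)‖ ^ 2 ≤ ‖vec n v‖ * ‖vec n (dd n (edge n v))‖ := by
  have h := inner_dd (n := n) (edge n v) v (edge_zero n v) (edge_last n v)
  rw [← real_inner_self_eq_norm_sq]
  have h2 := abs_real_inner_le_norm (vec n (dd n (edge n v))) (vec n v)
  have h3 := neg_abs_le (inner ℝ (vec n (dd n (edge n v))) (vec n v))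
  rw [mul_comm]; linarith

lemma abs_edge_le (v : ℕ → ℝ) (i : ℕ) :
    |edge n v i| ≤ 2 * ((n:ℝ) + 1) * ‖vec n v‖ := by
  rw [edge]
  split_ifs with h
  · simp; positivity
  · rw [abs_mul, abs_of_pos (by positivity)]
    have h1 := abs_le_norm_vec v (show i ≤ n by omega)
    have h2 := abs_le_norm_vec v (show i - 1 ≤ n by omega)
    have h3 := abs_sub (v i) (v (i - 1))
    have : |v i - v (i - 1)| ≤ 2 * ‖vec n v‖ := by linarith
    calc ((n:ℝ) + 1) * |v i - v (i - 1)| ≤ ((n:ℝ) + 1) * (2 * ‖vec n v‖) := by gcongr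
      _ = _ := by ring

/-- if the `0`-th entry of `A` vanishes then A is bounded by its differences. -/
lemma abs_le_of_dd {A : ℕ → ℝ} (h0 : A 0 = 0) {i : ℕ} (hi : i ≤ n + 1) :
    ((n:ℝ) + 1) * |A i| ≤ Real.sqrt ((n:ℝ) + 1) * ‖vec n (dd n A)‖ := by
  refine le_trans ?_ (sum_abs_le (dd n A) hi)
  have e : ∑ k ∈ Finset.range i, (A (k + 1) - A k) = A i := by
    rw [Finset.sum_range_sub, h0, sub_zero]
  conv_lhs => rw [← e]
  have : ∀ k, |dd n A k| = ((n:ℝ) + 1) * |A (k + 1) - A k| := fun k => by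
    rw [dd, abs_mul, abs_of_pos (by positivity)]
  simp_rw [this, ← Finset.mul_sum]
  gcongr
  exact Finset.abs_sum_le_sum_abs _ _

lemma sq_le_of_dd (v : ℕ → ℝ) {i : ℕ} (hi : i ≤ n + 1) :
    ((n:ℝ) + 1) * edge n v i ^ 2 ≤ 2 * ‖vec n (dd n (edge n v))‖ * ‖vec n (edge n v)‖ := by
  have hN : (0:ℝ) < (n:ℝ) + 1 := by positivity
  have e : ∑ k ∈ Finset.range i, (edge n v (k + 1) ^ 2 - edge n v k ^ 2) = edge n v i ^ 2 := by
    rw [Finset.sum_range_sub (fun k => edge n v k ^ 2), edge_zero]; ring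
  have h1 : ((n:ℝ) + 1) * edge n v i ^ 2
      ≤ ∑ k ∈ Finset.range (n + 1), |dd n (edge n v) k| * (|edge n v (k + 1)| + |edge n v k|) := by
    rw [← e, Finset.mul_sum]
    refine le_trans (Finset.sum_le_sum fun k _ => ?_)
      (Finset.sum_le_sum_of_subset_of_nonneg (Finset.range_mono hi) fun _ _ _ => by positivity)
    have e2 : ((n:ℝ) + 1) * (edge n v (k + 1) ^ 2 - edge n v k ^ 2)
        = dd n (edge n v) k * (edge n v (k + 1) + edge n v k) := by rw [dd]; ring
    rw [e2]
    refine (le_abs_self _).trans ?_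
    rw [abs_mul]
    gcongr
    exact abs_add_le _ _
  have h2 : ‖vec n (fun k => edge n v (k + 1))‖ = ‖vec n (edge n v)‖ := by
    have : ‖vec n (fun k => edge n v (k + 1))‖ ^ 2 = ‖vec n (edge n v)‖ ^ 2 := by
      rw [norm_vec_sq, norm_vec_sq, Finset.sum_range_succ, Finset.sum_range_succ' (fun i => edge n v i ^ 2),
        edge_last, edge_zero]
    exact (pow_left_inj₀ (norm_nonneg _) (norm_nonneg _) two_ne_zero).1 this
  refine h1.trans ?_
  have h3 : ∑ k ∈ Finset.range (n + 1), |dd n (edge n v) k| * (|edge n v (k + 1)| + |edge n v k|)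
      = inner ℝ (vec n (fun k => |dd n (edge n v) k|))
        (vec n (fun k => |edge n v (k + 1)|) + vec n (fun k => |edge n v k|)) := by
    rw [vec_add, inner_vec]
  rw [h3]
  refine (real_inner_le_norm _ _).trans ?_
  have b1 : ‖vec n (fun k => |dd n (edge n v) k|)‖ ≤ ‖vec n (dd n (edge n v))‖ := by
    have := norm_vec_le (n := n) (f := fun k => |dd n (edge n v) k|) (g := dd n (edge n v)) one_pos.le (by simp)
    simpa using this
  have b2 : ‖vec n (fun k => |edge n v (k + 1)|)‖ ≤ ‖vec n (edge n v)‖ := by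
    have := norm_vec_le (n := n) (f := fun k => |edge n v (k + 1)|) (g := fun k => edge n v (k + 1)) one_pos.le (by simp)
    rw [← h2]; simpa using this
  have b3 : ‖vec n (fun k => |edge n v k|)‖ ≤ ‖vec n (edge n v)‖ := by
    have := norm_vec_le (n := n) (f := fun k => |edge n v k|) (g := edge n v) one_pos.le (by simp)
    simpa using this
  calc _ ≤ ‖vec n (dd n (edge n v))‖ * (‖vec n (edge n v)‖ + ‖vec n (edge n v)‖) := by
        gcongr
        exact (norm_add_le _ _).trans (add_le_add b2 b3)
    _ = _ := by ring

/-! ### The nonlinear flux -/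

structure SReg (α lam Lam Ck : ℝ) (sig k : ℝ → ℝ) : Prop where
  a0 : 0 < α
  a1 : α < 1
  lam0 : 0 < lam
  der : ∀ s, HasDerivAt sig (k s) s
  lb : ∀ s, lam ≤ k s
  ub : ∀ s, k s ≤ Lam
  hol : ∀ s t, |k s - k t| ≤ Ck * |s - t| ^ α
  zero : sig 0 = 0

variable {α lam Lam Ck : ℝ} {sig k : ℝ → ℝ}

lemma SReg.Lam0 (h : SReg α lam Lam Ck sig k) : 0 < Lam := h.lam0.trans_le ((h.lb 0).trans (h.ub 0))

lemma SReg.mv (h : SReg α lam Lam Ck sig k) (p q : ℝ) :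
    ∃ a, lam ≤ a ∧ a ≤ Lam ∧ sig q - sig p = a * (q - p) := by
  rcases lt_trichotomy p q with hpq | hpq | hpq
  · obtain ⟨c, _, hc⟩ := exists_hasDerivAt_eq_slope sig k hpq
      (fun x _ => (h.der x).continuousAt.continuousWithinAt) (fun x _ => h.der x)
    refine ⟨k c, h.lb c, h.ub c, ?_⟩
    rw [hc]; have : q - p ≠ 0 := by linarith
    field_simp
  · exact ⟨lam, le_rfl, (h.lb 0).trans (h.ub 0), by rw [hpq]; ring⟩
  · obtain ⟨c, _, hc⟩ := exists_hasDerivAt_eq_slope sig k hpq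
      (fun x _ => (h.der x).continuousAt.continuousWithinAt) (fun x _ => h.der x)
    refine ⟨k c, h.lb c, h.ub c, ?_⟩
    rw [hc]; have : p - q ≠ 0 := by linarith
    field_simp; ring

lemma SReg.lipsig (h : SReg α lam Lam Ck sig k) (p q : ℝ) : |sig q - sig p| ≤ Lam * |q - p| := by
  obtain ⟨a, h1, h2, h3⟩ := h.mv p q
  rw [h3, abs_mul, abs_of_pos (h.lam0.trans_le h1)]; gcongr

lemma SReg.lower (h : SReg α lam Lam Ck sig k) (p q : ℝ) : |q - p| ≤ 1 / lam * |sig q - sig p| := by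
  obtain ⟨a, h1, h2, h3⟩ := h.mv p q
  have := h.lam0
  rw [h3, abs_mul, abs_of_pos (h.lam0.trans_le h1)]
  have h4 : 1 ≤ 1 / lam * a := by rw [one_div, inv_mul_eq_div]; exact (one_le_div h.lam0).2 h1
  nlinarith [abs_nonneg (q - p)]

lemma SReg.cont (h : SReg α lam Lam Ck sig k) : Continuous sig :=
  continuous_iff_continuousAt.2 fun x => (h.der x).continuousAt

/-- potential -/
noncomputable def pot (sig : ℝ → ℝ) (s : ℝ) : ℝ := ∫ r in (0:ℝ)..s, sig r

lemma SReg.pot_convex (h : SReg α lam Lam Ck sig k) (p q : ℝ) :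
    pot sig p + sig p * (q - p) ≤ pot sig q := by
  have hd : ∀ s, HasDerivAt (fun s => pot sig s - sig p * s) (sig s - sig p) s := fun s =>
    ((intervalIntegral.integral_hasDerivAt_right (h.cont.intervalIntegrable _ _)
      (h.cont.stronglyMeasurableAtFilter _ _) h.cont.continuousAt).sub
      ((hasDerivAt_id s).const_mul (sig p))).congr_deriv (by simp)
  have hmono : ∀ s t, s ≤ t → sig s ≤ sig t := fun s t hst => by
    obtain ⟨a, h1, h2, h3⟩ := h.mv s t
    have : 0 ≤ a * (t - s) := mul_nonneg (h.lam0.le.trans h1) (by linarith)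
    linarith
  rcases le_total p q with hpq | hpq
  · have : MonotoneOn (fun s => pot sig s - sig p * s) (Icc p q) := by
      apply monotoneOn_of_deriv_nonneg (convex_Icc _ _)
        (fun s _ => (hd s).continuousAt.continuousWithinAt)
        (fun s _ => (hd s).differentiableAt.differentiableWithinAt)
      intro s hs; rw [interior_Icc] at hs; rw [(hd s).deriv]
      linarith [hmono p s hs.1.le]
    have := this ⟨le_rfl, hpq⟩ ⟨hpq, le_rfl⟩ hpq
    simp only at this; linarith
  · have : AntitoneOn (fun s => pot sig s - sig p * s) (Icc q p) := by
      apply antitoneOn_of_deriv_nonpos (convex_Icc _ _)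
        (fun s _ => (hd s).continuousAt.continuousWithinAt)
        (fun s _ => (hd s).differentiableAt.differentiableWithinAt)
      intro s hs; rw [interior_Icc] at hs; rw [(hd s).deriv]
      linarith [hmono s p hs.2.le]
    have := this ⟨le_rfl, hpq⟩ ⟨hpq, le_rfl⟩ hpq
    simp only at this; linarith

/-- nonlinear discrete diffusion -/
noncomputable def Fop (sig : ℝ → ℝ) (n : ℕ) (v : ℕ → ℝ) : ℕ → ℝ := dd n (fun i => sig (edge n v i))

lemma SReg.gradF (h : SReg α lam Lam Ck sig k) (n : ℕ) :
    GradF (fun V : HN n => vec n (Fop sig n (ex V)))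
      (fun V => ∑ i ∈ Finset.range (n + 1), pot sig (edge n (ex V) i))
      (4 * Lam * ((n:ℝ) + 1) ^ 2 * Real.sqrt ((n:ℝ) + 1)) where
  K0 := by have := h.Lam0; positivity
  lip x y := by
    have hL := h.Lam0
    rw [vec_sub]
    have hb : ∀ i ≤ n, |Fop sig n (ex x) i - Fop sig n (ex y) i|
        ≤ 4 * Lam * ((n:ℝ) + 1) ^ 2 * ‖x - y‖ := by
      intro i hi
      have key : ∀ j ≤ n + 1, |sig (edge n (ex x) j) - sig (edge n (ex y) j)|
          ≤ Lam * (2 * ((n:ℝ) + 1) * ‖x - y‖) := by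
        intro j hj
        refine (h.lipsig _ _).trans ?_
        gcongr
        rw [← edge_sub]
        have := abs_edge_le (n := n) (ex (x - y)) j
        rw [vec_ex] at this
        have e : (fun k => ex x k - ex y k) = ex (x - y) := by ext k; rw [ex_sub]
        rw [e]; exact this
      have e : Fop sig n (ex x) i - Fop sig n (ex y) i = ((n:ℝ) + 1) *
        ((sig (edge n (ex x) (i + 1)) - sig (edge n (ex y) (i + 1)))
          - (sig (edge n (ex x) i) - sig (edge n (ex y) i))) := by
        simp only [Fop, dd]; ring
      rw [e, abs_mul, abs_of_pos (by positivity)]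
      have h1 := key (i + 1) (by omega)
      have h2 := key i (by omega)
      calc _ ≤ ((n:ℝ) + 1) * (Lam * (2 * ((n:ℝ) + 1) * ‖x - y‖) + Lam * (2 * ((n:ℝ) + 1) * ‖x - y‖)) := by
            gcongr
            exact (abs_sub _ _).trans (add_le_add h1 h2)
        _ = _ := by ring
    refine (norm_vec_const (by positivity) hb).trans (le_of_eq (by ring))
  conv x y := by
    have e1 : inner ℝ (vec n (Fop sig n (ex x))) (y - x)
        = - ∑ i ∈ Finset.range (n + 1), sig (edge n (ex x) i) * (edge n (ex y) i - edge n (ex x) i) := by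
      rw [← vec_ex (y - x), Fop, inner_dd _ _ (by rw [edge_zero, h.zero]) (by rw [edge_last, h.zero]),
        inner_vec]
      congr 1
      refine Finset.sum_congr rfl fun i _ => ?_
      rw [← edge_sub]
      congr 2
      ext k; rw [ex_sub]
    rw [e1, sub_neg_eq_add, ← Finset.sum_add_distrib]
    exact Finset.sum_le_sum fun i _ => h.pot_convex _ _

end FwdSol

namespace FwdSol

/-- globally defined coefficients -/
structure Coef (Cb θ : ℝ) (b c f : ℝ → ℝ → ℝ) : Prop where
  t0 : 0 < θ
  t1 : θ ≤ 1 / 2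
  C0 : 0 ≤ Cb
  bb : ∀ x t, |b x t| ≤ Cb
  cb : ∀ x t, |c x t| ≤ Cb
  fb : ∀ x t, |f x t| ≤ Cb
  bh : ∀ x t s, |b x t - b x s| ≤ Cb * |t - s| ^ θ
  ch : ∀ x t s, |c x t - c x s| ≤ Cb * |t - s| ^ θ
  fh : ∀ x t s, |f x t - f x s| ≤ Cb * |t - s| ^ θ

lemma cont_of_holder {g : ℝ → ℝ} {C θ : ℝ} (hθ : 0 < θ)
    (h : ∀ t s, |g t - g s| ≤ C * |t - s| ^ θ) : Continuous g := by
  rw [continuous_iff_continuousAt]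
  intro s
  rw [ContinuousAt, tendsto_iff_dist_tendsto_zero]
  have h1 : Filter.Tendsto (fun t => C * |t - s| ^ θ) (nhds s) (nhds 0) := by
    have : Continuous fun t : ℝ => C * |t - s| ^ θ :=
      continuous_const.mul ((continuous_id.sub continuous_const).abs.rpow_const fun _ => Or.inr hθ.le)
    have h2 := this.tendsto s
    simpa [Real.zero_rpow hθ.ne'] using h2
  exact squeeze_zero (fun _ => dist_nonneg) (fun t => by rw [Real.dist_eq]; exact h t s) h1

/-- lower-order terms -/
noncomputable def gg (n : ℕ) (b c f : ℝ → ℝ → ℝ) (t : ℝ) (v : ℕ → ℝ) (i : ℕ) : ℝ :=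
  b ((i:ℝ) / ((n:ℝ) + 1)) t * edge n v i + c ((i:ℝ) / ((n:ℝ) + 1)) t * v i + f ((i:ℝ) / ((n:ℝ) + 1)) t

variable {α lam Lam Ck : ℝ} {sig k : ℝ → ℝ} {Cb θ : ℝ} {b c f : ℝ → ℝ → ℝ} {n : ℕ}

/-- the solution of the discrete system in `HN n` -/
def IsSys (n : ℕ) (sig : ℝ → ℝ) (b c f : ℝ → ℝ → ℝ) (T : ℝ) (U : ℝ → HN n) : Prop :=
  ∀ t ∈ Icc 0 T, HasDerivAt U (vec n (Fop sig n (ex (U t))) + vec n (gg n b c f t (ex (U t)))) t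

lemma exists_sys (h : SReg α lam Lam Ck sig k) (hc : Coef Cb θ b c f) (n : ℕ) (v0 : ℕ → ℝ) {T : ℝ}
    (hT : 0 ≤ T) : ∃ U : ℝ → HN n, U 0 = vec n v0 ∧ IsSys n sig b c f T U := by
  have hC := hc.C0
  refine ode_global (fun t V => vec n (Fop sig n (ex V)) + vec n (gg n b c f t (ex V)))
    (4 * Lam * ((n:ℝ) + 1) ^ 2 * Real.sqrt ((n:ℝ) + 1) +
      (Cb * (2 * ((n:ℝ) + 1)) + Cb) * Real.sqrt ((n:ℝ) + 1))
    (by have := h.Lam0; positivity) ?_ ?_ (vec n v0) 0 T hT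
  · intro t x y
    have h1 := (h.gradF n).lip x y
    have h2 : ‖vec n (gg n b c f t (ex x)) - vec n (gg n b c f t (ex y))‖
        ≤ ((Cb * (2 * ((n:ℝ) + 1)) + Cb) * ‖x - y‖) * Real.sqrt ((n:ℝ) + 1) := by
      rw [vec_sub]
      refine norm_vec_const (by positivity) fun i hi => ?_
      have e1 := abs_edge_le (n := n) (ex (x - y)) i
      have e2 := abs_le_norm_vec (n := n) (ex (x - y)) hi
      rw [vec_ex] at e1 e2
      have e3 : (ex (x - y)) = (fun k => ex x k - ex y k) := by ext k; rw [ex_sub]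
      rw [e3, edge_sub] at e1
      rw [ex_sub] at e2
      have e4 : gg n b c f t (ex x) i - gg n b c f t (ex y) i
        = b ((i:ℝ) / ((n:ℝ) + 1)) t * (edge n (ex x) i - edge n (ex y) i)
          + c ((i:ℝ) / ((n:ℝ) + 1)) t * (ex x i - ex y i) := by simp only [gg]; ring
      rw [e4]
      refine (abs_add_le _ _).trans ?_
      rw [abs_mul, abs_mul]
      calc _ ≤ Cb * (2 * ((n:ℝ) + 1) * ‖x - y‖) + Cb * ‖x - y‖ := by
            gcongr
            · exact hc.bb _ _
            · exact hc.cb _ _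
        _ = _ := by ring
    have e : vec n (Fop sig n (ex x)) + vec n (gg n b c f t (ex x)) -
        (vec n (Fop sig n (ex y)) + vec n (gg n b c f t (ex y)))
        = (vec n (Fop sig n (ex x)) - vec n (Fop sig n (ex y)))
          + (vec n (gg n b c f t (ex x)) - vec n (gg n b c f t (ex y))) := by abel
    rw [e]
    refine (norm_add_le _ _).trans ?_
    linarith
  · intro V
    refine continuous_const.add ?_
    refine (PiLp.continuous_toLp 2 _).comp (continuous_pi fun i => ?_)
    have h1 := cont_of_holder hc.t0 (hc.bh (((i:ℕ):ℝ) / ((n:ℝ) + 1)))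
    have h2 := cont_of_holder hc.t0 (hc.ch (((i:ℕ):ℝ) / ((n:ℝ) + 1)))
    have h3 := cont_of_holder hc.t0 (hc.fh (((i:ℕ):ℝ) / ((n:ℝ) + 1)))
    simp only [gg]
    fun_prop

lemma norm_gg (hc : Coef Cb θ b c f) (t : ℝ) (v : ℕ → ℝ) :
    ‖vec n (gg n b c f t v)‖ ≤ Cb * ‖vec n (edge n v)‖ + Cb * ‖vec n v‖ + Cb * Real.sqrt ((n:ℝ) + 1) := by
  have e : vec n (gg n b c f t v) = vec n (fun i => b ((i:ℝ) / ((n:ℝ) + 1)) t * edge n v i)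
      + vec n (fun i => c ((i:ℝ) / ((n:ℝ) + 1)) t * v i) + vec n (fun i => f ((i:ℝ) / ((n:ℝ) + 1)) t) := rfl
  rw [e]
  refine (norm_add₃_le).trans ?_
  gcongr
  · exact norm_vec_le hc.C0 fun i _ => by rw [abs_mul]; gcongr; exact hc.bb _ _
  · exact norm_vec_le hc.C0 fun i _ => by rw [abs_mul]; gcongr; exact hc.cb _ _
  · exact norm_vec_const hc.C0 fun i _ => hc.fb _ _

lemma norm_gg_sub (hc : Coef Cb θ b c f) (r s : ℝ) (v w : ℕ → ℝ) :
    ‖vec n (gg n b c f r v) - vec n (gg n b c f s w)‖ ≤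
      Cb * ‖vec n (edge n (fun k => v k - w k))‖ + Cb * ‖vec n (fun k => v k - w k)‖
      + Cb * |r - s| ^ θ * (‖vec n (edge n v)‖ + ‖vec n v‖ + Real.sqrt ((n:ℝ) + 1)) := by
  have hC := hc.C0
  have e : vec n (gg n b c f r v) - vec n (gg n b c f s w)
     = (vec n (fun i => b ((i:ℝ) / ((n:ℝ) + 1)) s * edge n (fun k => v k - w k) i)
      + vec n (fun i => c ((i:ℝ) / ((n:ℝ) + 1)) s * (v i - w i)))
      + (vec n (fun i => (b ((i:ℝ) / ((n:ℝ) + 1)) r - b ((i:ℝ) / ((n:ℝ) + 1)) s) * edge n v i)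
      + vec n (fun i => (c ((i:ℝ) / ((n:ℝ) + 1)) r - c ((i:ℝ) / ((n:ℝ) + 1)) s) * v i)
      + vec n (fun i => f ((i:ℝ) / ((n:ℝ) + 1)) r - f ((i:ℝ) / ((n:ℝ) + 1)) s)) := by
    simp only [vec_add, vec_sub, gg, edge_sub]
    refine vec_congr fun i _ => ?_
    ring
  rw [e]
  refine (norm_add_le _ _).trans ?_
  refine add_le_add ((norm_add_le _ _).trans ?_) ((norm_add₃_le).trans ?_)
  · gcongr
    · exact norm_vec_le hC fun i _ => by rw [abs_mul]; gcongr; exact hc.bb _ _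
    · exact norm_vec_le hC fun i _ => by rw [abs_mul]; gcongr; exact hc.cb _ _
  · rw [mul_add, mul_add]
    gcongr
    · exact norm_vec_le (by positivity) fun i _ => by rw [abs_mul]; gcongr; exact hc.bh _ _ _
    · exact norm_vec_le (by positivity) fun i _ => by rw [abs_mul]; gcongr; exact hc.ch _ _ _
    · exact norm_vec_const (by positivity) fun i _ => hc.fh _ _ _

lemma exsub_fun (x y : HN n) : (fun k => ex x k - ex y k) = ex (x - y) := by ext k; rw [ex_sub]

/-- L2 bound -/
lemma l2_bound (h : SReg α lam Lam Ck sig k) (hc : Coef Cb θ b c f) {C0 T : ℝ} (hC0 : 0 ≤ C0)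
    {U : ℝ → HN n} (hU : IsSys n sig b c f T U) (h0 : ‖U 0‖ ≤ C0 * Real.sqrt ((n:ℝ) + 1)) :
    ∀ t ∈ Icc 0 T, ‖U t‖ ≤ Real.exp ((Cb ^ 2 / (4 * lam) + Cb) * T) * (C0 + Cb * T) * Real.sqrt ((n:ℝ) + 1) := by
  intro t ht
  have hT : 0 ≤ T := ht.1.trans ht.2
  have hC := hc.C0
  have hl := h.lam0
  set S := Real.sqrt ((n:ℝ) + 1) with hS
  have hS0 : 0 ≤ S := Real.sqrt_nonneg _
  set C1 := Cb ^ 2 / (4 * lam) + Cb with hC1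
  have hC10 : 0 ≤ C1 := by positivity
  have key : ∀ t ∈ Icc 0 T, inner ℝ (U t) (vec n (Fop sig n (ex (U t))) + vec n (gg n b c f t (ex (U t))))
      ≤ C1 * ‖U t‖ ^ 2 + Cb * S * ‖U t‖ := by
    intro t _
    rw [inner_add_right]
    have e1 : inner ℝ (U t) (vec n (Fop sig n (ex (U t)))) ≤ - (lam * ‖vec n (edge n (ex (U t)))‖ ^ 2) := by
      rw [real_inner_comm]
      have e0 := inner_dd (n := n) (fun i => sig (edge n (ex (U t)) i)) (ex (U t))
        (by rw [edge_zero, h.zero]) (by rw [edge_last, h.zero])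
      rw [vec_ex] at e0
      rw [Fop, e0, inner_vec,
        norm_vec_sq, Finset.mul_sum]
      refine neg_le_neg (Finset.sum_le_sum fun i _ => ?_)
      obtain ⟨a, a1, a2, a3⟩ := h.mv 0 (edge n (ex (U t)) i)
      rw [h.zero, sub_zero, sub_zero] at a3
      rw [a3]; nlinarith [sq_nonneg (edge n (ex (U t)) i)]
    have e2 : inner ℝ (U t) (vec n (gg n b c f t (ex (U t)))) ≤ ‖U t‖ *
        (Cb * ‖vec n (edge n (ex (U t)))‖ + Cb * ‖U t‖ + Cb * S) := by
      refine (real_inner_le_norm _ _).trans ?_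
      gcongr
      have := norm_gg (n := n) hc t (ex (U t))
      rwa [vec_ex] at this
    set P := ‖vec n (edge n (ex (U t)))‖
    have e3 : Cb * P * ‖U t‖ ≤ lam * P ^ 2 + Cb ^ 2 / (4 * lam) * ‖U t‖ ^ 2 := by
      have : lam * P ^ 2 + Cb ^ 2 / (4 * lam) * ‖U t‖ ^ 2 - Cb * P * ‖U t‖
        = (2 * lam * P - Cb * ‖U t‖) ^ 2 / (4 * lam) := by field_simp; ring
      have h2 : 0 ≤ (2 * lam * P - Cb * ‖U t‖) ^ 2 / (4 * lam) := by positivity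
      linarith
    rw [hC1]
    nlinarith
  have hz := norm_growth (fun t => Real.exp (-C1 * t) • U t)
    (fun t => Real.exp (-C1 * t) • (vec n (Fop sig n (ex (U t))) + vec n (gg n b c f t (ex (U t))))
      + (Real.exp (-C1 * t) * (-C1)) • U t) 0 T (Cb * S)
    (fun t ht => by
      have h1 : HasDerivAt (fun t => Real.exp (-C1 * t)) (Real.exp (-C1 * t) * (-C1)) t := by
        have := ((hasDerivAt_id t).const_mul (-C1)).exp
        simpa using this
      exact h1.smul (hU t ht))
    (fun t ht => by
      have hk := key t ht
      have h1 : Real.exp (-C1 * t) ≤ 1 := by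
        rw [Real.exp_le_one_iff]; nlinarith [ht.1]
      have h2 := Real.exp_pos (-C1 * t)
      rw [inner_add_right, inner_smul_left, inner_smul_left, inner_smul_right, inner_smul_right,
        real_inner_self_eq_norm_sq, norm_smul, Real.norm_eq_abs, abs_of_pos h2]
      simp only [conj_trivial]
      set E := Real.exp (-C1 * t)
      calc _ = E * E * (inner ℝ (U t) (vec n (Fop sig n (ex (U t))) + vec n (gg n b c f t (ex (U t))))
              - C1 * ‖U t‖ ^ 2) := by ring
        _ ≤ E * E * (Cb * S * ‖U t‖) := by gcongr; linarith
        _ ≤ 1 * E * (Cb * S * ‖U t‖) := by gcongr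
        _ = _ := by ring) (by positivity) t ht
  simp only [mul_zero, Real.exp_zero, one_smul, sub_zero] at hz
  rw [norm_smul, Real.norm_eq_abs, abs_of_pos (Real.exp_pos _)] at hz
  have h3 : ‖U t‖ = Real.exp (C1 * t) * (Real.exp (-C1 * t) * ‖U t‖) := by
    rw [← mul_assoc, ← Real.exp_add]; simp
  rw [h3]
  calc _ ≤ Real.exp (C1 * T) * (C0 * S + Cb * S * T) := by
        have : ‖U 0‖ + Cb * S * t ≤ C0 * S + Cb * S * T := by
          have := mul_le_mul_of_nonneg_left ht.2 (mul_nonneg hC hS0)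
          linarith
        gcongr
        · exact ht.2
        · linarith
    _ = _ := by ring

/-- consequence of a bound on `U'` at time `t`. -/
lemma dd_bound (h : SReg α lam Lam Ck sig k) (hc : Coef Cb θ b c f) {C2 m t : ℝ} (hC2 : 0 ≤ C2)
    {V : HN n} (hV : ‖V‖ ≤ C2 * Real.sqrt ((n:ℝ) + 1))
    (hm : ‖vec n (Fop sig n (ex V)) + vec n (gg n b c f t (ex V))‖ ≤ m * Real.sqrt ((n:ℝ) + 1)) :
    ‖vec n (dd n (edge n (ex V)))‖ ≤
      2 / lam * (m + (Cb * C2 + Cb + Cb ^ 2 * C2 / (2 * lam))) * Real.sqrt ((n:ℝ) + 1) := by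
  have hC := hc.C0
  have hl := h.lam0
  set S := Real.sqrt ((n:ℝ) + 1) with hS
  have hS0 : 0 ≤ S := Real.sqrt_nonneg _
  set D := ‖vec n (dd n (edge n (ex V)))‖ with hD
  set P := ‖vec n (edge n (ex V))‖ with hP
  have h1 : D ≤ 1 / lam * ‖vec n (Fop sig n (ex V))‖ := by
    refine norm_vec_le (by positivity) fun i _ => ?_
    rw [dd, Fop, dd, abs_mul, abs_mul, abs_of_pos (by positivity)]
    have := h.lower (edge n (ex V) i) (edge n (ex V) (i + 1))
    calc _ ≤ ((n:ℝ) + 1) * (1 / lam * |sig (edge n (ex V) (i + 1)) - sig (edge n (ex V) i)|) := by gcongr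
      _ = _ := by ring
  have h2 : ‖vec n (Fop sig n (ex V))‖ ≤ m * S + ‖vec n (gg n b c f t (ex V))‖ := by
    have := norm_sub_le (vec n (Fop sig n (ex V)) + vec n (gg n b c f t (ex V))) (vec n (gg n b c f t (ex V)))
    rw [add_sub_cancel_right] at this
    linarith
  have h3 := norm_gg (n := n) hc t (ex V)
  rw [vec_ex] at h3
  have h4 : P ^ 2 ≤ C2 * S * D := by
    have := norm_edge_sq (n := n) (ex V)
    rw [vec_ex] at this
    refine this.trans ?_
    gcongr
  have h5 : Cb * P ≤ lam / 2 * D + Cb ^ 2 * C2 / (2 * lam) * S := by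
    have : (Cb * P) ^ 2 ≤ (lam / 2 * D + Cb ^ 2 * C2 / (2 * lam) * S) ^ 2 := by
      have e1 : (lam / 2 * D + Cb ^ 2 * C2 / (2 * lam) * S) ^ 2 = (lam / 2 * D - Cb ^ 2 * C2 / (2 * lam) * S) ^ 2
        + Cb ^ 2 * (C2 * S * D) := by field_simp; ring
      rw [e1, mul_pow]
      have := mul_le_mul_of_nonneg_left h4 (sq_nonneg Cb)
      nlinarith [sq_nonneg (lam / 2 * D - Cb ^ 2 * C2 / (2 * lam) * S)]
    exact (abs_le_of_sq_le_sq' this (by positivity)).2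
  have h6 : lam * D ≤ ‖vec n (Fop sig n (ex V))‖ := by
    rw [one_div, inv_mul_eq_div, le_div_iff₀ hl] at h1; linarith
  have h7 : Cb * ‖V‖ ≤ Cb * (C2 * S) := by gcongr
  have h8 : lam * D / 2 ≤ (m + (Cb * C2 + Cb + Cb ^ 2 * C2 / (2 * lam))) * S := by nlinarith
  have e : 2 / lam * (m + (Cb * C2 + Cb + Cb ^ 2 * C2 / (2 * lam))) * S
    = 2 / lam * ((m + (Cb * C2 + Cb + Cb ^ 2 * C2 / (2 * lam))) * S) := by ring
  rw [e]
  calc D = 2 / lam * (lam * D / 2) := by field_simp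
    _ ≤ _ := by gcongr

lemma rpow_le_of_le {x a θ T : ℝ} (hx : 0 ≤ x) (hxT : x ≤ T) (ha : θ ≤ a) (ha1 : a ≤ 1) (ht : 0 < θ) :
    x ^ a ≤ (T + 1) * x ^ θ := by
  have hT : 0 ≤ T := hx.trans hxT
  rcases hx.eq_or_lt with rfl | hx
  · rw [Real.zero_rpow (by linarith), Real.zero_rpow (by linarith)]; simp
  · have e : a = (a - θ) + θ := by ring
    rw [e, Real.rpow_add hx]
    gcongr
    rcases le_total x 1 with h | h
    · calc x ^ (a - θ) ≤ 1 := Real.rpow_le_one hx.le h (by linarith)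
        _ ≤ _ := by linarith
    · calc x ^ (a - θ) ≤ x ^ (1:ℝ) := Real.rpow_le_rpow_of_exponent_le h (by linarith)
        _ ≤ _ := by rw [Real.rpow_one]; linarith

/-- consequences of a uniform bound on `U'`. -/
lemma diff_bound (h : SReg α lam Lam Ck sig k) (hc : Coef Cb θ b c f) {C2 C3 m T : ℝ} (hC2 : 0 ≤ C2)
    (hC3 : 0 ≤ C3) (hm0 : 0 ≤ m)
    {U : ℝ → HN n} (hU : IsSys n sig b c f T U) (hV : ∀ t ∈ Icc 0 T, ‖U t‖ ≤ C2 * Real.sqrt ((n:ℝ) + 1))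
    (hm : ∀ t ∈ Icc 0 T, ‖vec n (Fop sig n (ex (U t))) + vec n (gg n b c f t (ex (U t)))‖ ≤ m * Real.sqrt ((n:ℝ) + 1))
    (hd : ∀ t ∈ Icc 0 T, ‖vec n (dd n (edge n (ex (U t))))‖ ≤ C3 * (1 + m) * Real.sqrt ((n:ℝ) + 1)) :
    ∀ r ∈ Icc 0 T, ∀ s ∈ Icc 0 T, ‖U r - U s‖ ≤ m * Real.sqrt ((n:ℝ) + 1) * |r - s| ∧
      ‖vec n (dd n (edge n (ex (U r - U s))))‖ ≤ 2 * C3 * (1 + m) * Real.sqrt ((n:ℝ) + 1) ∧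
      ‖vec n (edge n (ex (U r - U s)))‖ ≤ (1 + 2 * C3) * (1 + m) * Real.sqrt ((n:ℝ) + 1) * |r - s| ^ (1 / 2 : ℝ) := by
  intro r hr s hs
  set S := Real.sqrt ((n:ℝ) + 1) with hS
  have hS0 : 0 ≤ S := Real.sqrt_nonneg _
  have h1 : ‖U r - U s‖ ≤ m * S * |r - s| := by
    have := Convex.norm_image_sub_le_of_norm_hasDerivWithin_le (s := Icc 0 T) (C := m * S)
      (fun t ht => (hU t ht).hasDerivWithinAt) hm (convex_Icc _ _) hs hr
    simpa [Real.norm_eq_abs] using this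
  have h2 : ‖vec n (dd n (edge n (ex (U r - U s))))‖ ≤ 2 * C3 * (1 + m) * S := by
    have e : vec n (dd n (edge n (ex (U r - U s)))) = vec n (dd n (edge n (ex (U r)))) -
        vec n (dd n (edge n (ex (U s)))) := by
      rw [vec_sub]
      refine vec_congr fun i _ => ?_
      simp only [dd, ← exsub_fun, edge_sub]; ring
    rw [e]
    refine (norm_sub_le _ _).trans ?_
    linarith [hd r hr, hd s hs]
  refine ⟨h1, h2, ?_⟩
  have h3 := norm_edge_sq (n := n) (ex (U r - U s))
  rw [vec_ex] at h3
  have h4 : ‖vec n (edge n (ex (U r - U s)))‖ ^ 2 ≤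
      ((1 + 2 * C3) * (1 + m) * S * |r - s| ^ (1 / 2 : ℝ)) ^ 2 := by
    rw [mul_pow, ← Real.rpow_natCast (|r - s| ^ (1 / 2 : ℝ)), ← Real.rpow_mul (abs_nonneg _)]
    norm_num
    calc _ ≤ (m * S * |r - s|) * (2 * C3 * (1 + m) * S) := h3.trans (by gcongr)
      _ = (m * (2 * C3) * (1 + m)) * (S ^ 2 * |r - s|) := by ring
      _ ≤ ((1 + m) * (1 + 2 * C3) ^ 2 * (1 + m)) * (S ^ 2 * |r - s|) := by
          gcongr
          · linarith
          · nlinarith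
      _ = _ := by ring
  exact (abs_le_of_sq_le_sq' h4 (by positivity)).2

lemma exists_tau {θ C : ℝ} (hθ : 0 < θ) : ∃ τ : ℝ, 0 < τ ∧ C * τ ^ θ ≤ 1 / 2 := by
  have h1 : Filter.Tendsto (fun τ : ℝ => C * τ ^ θ) (nhdsWithin 0 (Ioi 0)) (nhds 0) := by
    have : Continuous fun τ : ℝ => C * τ ^ θ :=
      continuous_const.mul (continuous_id.rpow_const fun _ => Or.inr hθ.le)
    have h2 := this.tendsto 0
    simp only [Real.zero_rpow hθ.ne', mul_zero] at h2
    exact h2.mono_left nhdsWithin_le_nhds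
  have h2 := h1.eventually (ge_mem_nhds (show (0:ℝ) < 1 / 2 by norm_num))
  obtain ⟨τ, h3, h4⟩ := (h2.and self_mem_nhdsWithin).exists
  exact ⟨τ, h4, h3⟩

set_option maxHeartbeats 1000000 in
/-- `L²` bound of the time derivative -/
lemma l2_deriv (h : SReg α lam Lam Ck sig k) (hc : Coef Cb θ b c f) {C2 m0 T : ℝ} (hC2 : 0 ≤ C2)
    (hm0 : 0 ≤ m0) (hT : 0 < T) :
    ∃ M : ℝ, 0 ≤ M ∧ ∀ (n : ℕ) (U : ℝ → HN n), IsSys n sig b c f T U →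
      (∀ t ∈ Icc 0 T, ‖U t‖ ≤ C2 * Real.sqrt ((n:ℝ) + 1)) →
      ‖vec n (Fop sig n (ex (U 0))) + vec n (gg n b c f 0 (ex (U 0)))‖ ≤ m0 * Real.sqrt ((n:ℝ) + 1) →
      ∀ t ∈ Icc 0 T, ‖vec n (Fop sig n (ex (U t))) + vec n (gg n b c f t (ex (U t)))‖ ≤ M * Real.sqrt ((n:ℝ) + 1) := by
  have hC := hc.C0
  have hl := h.lam0
  have hθ := hc.t0
  have hθ1 := hc.t1
  set K := Cb * C2 + Cb + Cb ^ 2 * C2 / (2 * lam) with hK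
  have hK0 : 0 ≤ K := by positivity
  set C3 := 2 / lam * (1 + K) with hC3
  have hC30 : 0 ≤ C3 := by positivity
  set C6 := Cb * ((1 + 2 * C3) * (T + 1)) + Cb * (T + 1) + Cb * ((1 + C2 * C3) + C2 + 1) with hC6
  have hC60 : 0 ≤ C6 := by positivity
  set q := (1 / 2 : ℝ) ^ θ with hq
  have hq1 : q < 1 := Real.rpow_lt_one (by norm_num) (by norm_num) hθ
  obtain ⟨τ, hτ, hτ2⟩ := exists_tau (C := 12 * C6 / (1 - q)) hθ
  refine ⟨2 * (max (2 * C2 / τ) m0) + 1, by positivity, ?_⟩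
  intro n U hU hV h0
  set S := Real.sqrt ((n:ℝ) + 1) with hS
  have hS0 : 0 < S := Real.sqrt_pos.2 (by positivity)
  have hUc : ContinuousOn U (Icc 0 T) := fun t ht => (hU t ht).continuousAt.continuousWithinAt
  set g : ℝ → HN n := fun t => vec n (gg n b c f t (ex (U t))) with hg
  -- the compactness argument
  have hF : ContinuousOn (fun t => vec n (Fop sig n (ex (U t)))) (Icc 0 T) := by
    have hL := (h.gradF n).lip
    have : LipschitzWith (Real.toNNReal (4 * Lam * ((n:ℝ) + 1) ^ 2 * Real.sqrt ((n:ℝ) + 1)))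
        (fun V : HN n => vec n (Fop sig n (ex V))) :=
      LipschitzWith.of_dist_le_mul fun x y => by
        rw [dist_eq_norm, dist_eq_norm, Real.coe_toNNReal _ (h.gradF n).K0]; exact hL x y
    exact this.continuous.comp_continuousOn hUc
  have hexc : ∀ i ≤ n, ContinuousOn (fun t => ex (U t) i) (Icc 0 T) := by
    intro i hi
    have : (fun t => ex (U t) i) = fun t => (U t) ⟨i, by omega⟩ := by
      ext t; rw [ex, dif_pos (by omega)]
    rw [this]
    exact (PiLp.continuous_apply 2 _ _).comp_continuousOn hUc
  have hgc : ContinuousOn g (Icc 0 T) := by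
    refine (PiLp.continuous_toLp 2 _).comp_continuousOn (continuousOn_pi.2 fun i => ?_)
    have h1 := (cont_of_holder hc.t0 (hc.bh (((i:ℕ):ℝ) / ((n:ℝ) + 1)))).continuousOn (s := Icc 0 T)
    have h2 := (cont_of_holder hc.t0 (hc.ch (((i:ℕ):ℝ) / ((n:ℝ) + 1)))).continuousOn (s := Icc 0 T)
    have h3 := (cont_of_holder hc.t0 (hc.fh (((i:ℕ):ℝ) / ((n:ℝ) + 1)))).continuousOn (s := Icc 0 T)
    have h4 : ContinuousOn (fun t => edge n (ex (U t)) i) (Icc 0 T) := by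
      simp only [edge]
      split_ifs with hi
      · exact continuousOn_const
      · exact continuousOn_const.mul ((hexc _ (by omega)).sub (hexc _ (by omega)))
    exact ((h1.mul h4).add (h2.mul (hexc i (by omega)))).add h3
  have hsum : ContinuousOn (fun t => ‖vec n (Fop sig n (ex (U t))) + g t‖) (Icc 0 T) := (hF.add hgc).norm
  obtain ⟨t0, ht0, hmax⟩ := isCompact_Icc.exists_isMaxOn (nonempty_Icc.2 hT.le) hsum
  set m := ‖vec n (Fop sig n (ex (U t0))) + g t0‖ / S with hm
  have hm0' : 0 ≤ m := by positivity
  have hmS : m * S = ‖vec n (Fop sig n (ex (U t0))) + g t0‖ := by rw [hm]; field_simp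
  have hmb : ∀ t ∈ Icc 0 T, ‖vec n (Fop sig n (ex (U t))) + g t‖ ≤ m * S := fun t ht => by
    rw [hmS]; exact hmax ht
  have hd : ∀ t ∈ Icc 0 T, ‖vec n (dd n (edge n (ex (U t))))‖ ≤ C3 * (1 + m) * S := fun t ht => by
    refine (dd_bound h hc hC2 (hV t ht) (hmb t ht)).trans ?_
    rw [hC3, mul_assoc (2 / lam) (1 + K)]
    gcongr
    nlinarith
  have hdiff := diff_bound h hc hC2 hC30 hm0' hU hV hmb hd
  have hP : ∀ t ∈ Icc 0 T, ‖vec n (edge n (ex (U t)))‖ ≤ (1 + C2 * C3) * (1 + m) * S := fun t ht => by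
    have h1 := norm_edge_sq (n := n) (ex (U t))
    rw [vec_ex] at h1
    have h2 : ‖vec n (edge n (ex (U t)))‖ ^ 2 ≤ ((1 + C2 * C3) * (1 + m) * S) ^ 2 := by
      calc _ ≤ (C2 * S) * (C3 * (1 + m) * S) := h1.trans (by gcongr; exacts [hV t ht, hd t ht])
        _ = (C2 * C3) * (1 + m) * S ^ 2 := by ring
        _ ≤ ((1 + C2 * C3) ^ 2) * ((1 + m) ^ 2) * S ^ 2 := by
            have : 0 ≤ C2 * C3 := by positivity
            gcongr
            · nlinarith
            · nlinarith
        _ = _ := by ring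
    exact (abs_le_of_sq_le_sq' h2 (by positivity)).2
  have hgh : ∀ r ∈ Icc 0 T, ∀ s ∈ Icc 0 T, ‖g r - g s‖ ≤ (S * (C6 * (1 + m))) * |r - s| ^ θ := by
    intro r hr s hs
    obtain ⟨d1, _, d3⟩ := hdiff r hr s hs
    have hrs : |r - s| ≤ T := abs_le.2 ⟨by linarith [hr.1, hs.2], by linarith [hr.2, hs.1]⟩
    have p1 := rpow_le_of_le (abs_nonneg (r - s)) hrs hθ1 (by norm_num) hθ
    have p2 := rpow_le_of_le (abs_nonneg (r - s)) hrs (show θ ≤ 1 by linarith) le_rfl hθ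
    rw [Real.rpow_one] at p2
    have := norm_gg_sub (n := n) hc r s (ex (U r)) (ex (U s))
    rw [exsub_fun, vec_ex, vec_ex] at this
    refine this.trans ?_
    have hx : 0 ≤ |r - s| ^ θ := by positivity
    set X := |r - s| ^ θ
    calc _ ≤ Cb * ((1 + 2 * C3) * (1 + m) * S * ((T + 1) * X)) + Cb * (m * S * ((T + 1) * X))
          + Cb * X * ((1 + C2 * C3) * (1 + m) * S + C2 * S + S) := by
          gcongr
          · exact d3.trans (by gcongr)
          · exact d1.trans (by gcongr)
          · exact hP r hr
          · exact hV r hr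
      _ ≤ Cb * ((1 + 2 * C3) * (1 + m) * S * ((T + 1) * X)) + Cb * ((1 + m) * S * ((T + 1) * X))
          + Cb * X * ((1 + C2 * C3) * (1 + m) * S + C2 * ((1 + m) * S) + (1 + m) * S) := by
          gcongr
          · linarith
          · nlinarith
          · nlinarith
      _ = _ := by rw [hC6]; ring
  have hmain := (h.gradF n).main (u := U) (g := g) (T := T) (κ := S * (C6 * (1 + m))) (θ := θ) (τ := τ)
    (D := max (2 * C2 / τ) m0 * S) hU (by positivity) hθ (by linarith) hgh hτ
    (h0.trans (by gcongr; exact le_max_right _ _))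
    (fun t ht htT => by
      have a1 := hV (t + τ) ⟨by linarith, htT⟩
      have a2 := hV t ⟨ht, by linarith⟩
      calc ‖U (t + τ) - U t‖ ≤ 2 * C2 / τ * S * τ := by
            have : 2 * C2 / τ * S * τ = C2 * S + C2 * S := by field_simp; ring
            rw [this]; exact (norm_sub_le _ _).trans (add_le_add a1 a2)
        _ ≤ _ := by gcongr; exact le_max_left _ _)
  have hb : ∀ t, 0 ≤ t → t < T → ‖vec n (Fop sig n (ex (U t))) + g t‖ ≤
      (max (2 * C2 / τ) m0 + (1 + m) / 2) * S := by
    intro t h1 h2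
    refine (hmain t h1 h2).trans ?_
    have e : 12 * (S * (C6 * (1 + m))) * τ ^ θ / (1 - (1 / 2) ^ θ) = (12 * C6 / (1 - q) * τ ^ θ) * ((1 + m) * S) := by
      rw [← hq]; field_simp
    rw [e]
    have : (12 * C6 / (1 - q) * τ ^ θ) * ((1 + m) * S) ≤ 1 / 2 * ((1 + m) * S) := by gcongr
    nlinarith
  have hb' : ∀ t ∈ Icc 0 T, ‖vec n (Fop sig n (ex (U t))) + g t‖ ≤
      (max (2 * C2 / τ) m0 + (1 + m) / 2) * S := by
    intro t ht
    have hcl : t ∈ closure (Ico 0 T) := by rw [closure_Ico hT.ne]; exact ht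
    exact ContinuousWithinAt.closure_le hcl ((hsum t ht).mono Ico_subset_Icc_self) continuousWithinAt_const
      (fun s hs => hb s hs.1 hs.2)
  have hfin : m * S ≤ (max (2 * C2 / τ) m0 + (1 + m) / 2) * S := by rw [hmS]; exact hb' t0 ht0
  have hfin2 : m ≤ max (2 * C2 / τ) m0 + (1 + m) / 2 := le_of_mul_le_mul_right hfin hS0
  intro t ht
  refine (hmb t ht).trans ?_
  gcongr
  linarith

end FwdSol

namespace FwdSol

variable {α lam Lam Ck : ℝ} {sig k : ℝ → ℝ} {Cb θ : ℝ} {b c f : ℝ → ℝ → ℝ} {n : ℕ}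

/-- discrete solutions with some first bounds -/
structure Disc (n : ℕ) (sig : ℝ → ℝ) (b c f : ℝ → ℝ → ℝ) (T C : ℝ) (u : ℕ → ℝ → ℝ) : Prop where
  ode : ∀ i ≤ n, ∀ t ∈ Icc 0 T, HasDerivAt (u i)
    (Fop sig n (fun k => u k t) i + gg n b c f t (fun k => u k t) i) t
  bu : ∀ i ≤ n, ∀ t ∈ Icc 0 T, |u i t| ≤ C
  bp : ∀ i ≤ n + 1, ∀ t ∈ Icc 0 T, |edge n (fun k => u k t) i| ≤ C
  hp : ∀ i ≤ n + 1, ∀ t ∈ Icc 0 T, ∀ s ∈ Icc 0 T,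
    |edge n (fun k => u k t) i - edge n (fun k => u k s) i| ≤ C * |t - s| ^ (1 / 4 : ℝ)

/-- regular initial data -/
structure IniD (n : ℕ) (C0 : ℝ) (v0 : ℕ → ℝ) : Prop where
  b0 : ∀ i ≤ n, |v0 i| ≤ C0
  b1 : ∀ i ≤ n + 1, |edge n v0 i| ≤ C0
  b2 : ∀ i ≤ n, |dd n (edge n v0) i| ≤ C0

lemma abs_le_of_edge {C2 C3 : ℝ} (hC3 : 0 ≤ C3) (v : ℕ → ℝ)
    (h2 : ‖vec n v‖ ≤ C2 * Real.sqrt ((n:ℝ) + 1)) (hP : ∀ i ≤ n + 1, |edge n v i| ≤ C3) :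
    ∀ i ≤ n, |v i| ≤ C2 + 2 * C3 := by
  have hN : (0:ℝ) < (n:ℝ) + 1 := by positivity
  have h1 : ∀ i ≤ n, |v i - v 0| ≤ C3 := by
    intro i hi
    have : ∀ i ≤ n, |v i - v 0| ≤ i / ((n:ℝ) + 1) * C3 := by
      intro i
      induction i with
      | zero => simp
      | succ i ih =>
        intro hi
        have a1 := ih (by omega)
        have a2 := hP (i + 1) (by omega)
        rw [edge_succ v (by omega), abs_mul, abs_of_pos hN] at a2
        have a3 : |v (i + 1) - v i| ≤ C3 / ((n:ℝ) + 1) := by rw [le_div_iff₀ hN]; linarith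
        have a4 := abs_sub_le (v (i + 1)) (v i) (v 0)
        have : ((i + 1 : ℕ) : ℝ) / ((n:ℝ) + 1) * C3 = C3 / ((n:ℝ) + 1) + i / ((n:ℝ) + 1) * C3 := by
          push_cast; ring
        linarith
    refine (this i hi).trans ?_
    have : (i:ℝ) / ((n:ℝ) + 1) ≤ 1 := by
      rw [div_le_one hN]; have : (i:ℝ) ≤ n := by exact_mod_cast hi
      linarith
    nlinarith
  have h3 : ∃ j ≤ n, |v j| ≤ C2 := by
    by_contra hcon
    push Not at hcon
    have hC2 : 0 ≤ C2 := by
      have := (norm_nonneg _).trans h2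
      by_contra hneg
      push Not at hneg
      have := mul_neg_of_neg_of_pos hneg (Real.sqrt_pos.2 hN)
      linarith
    have e1 : ‖vec n v‖ ^ 2 ≤ C2 ^ 2 * ((n:ℝ) + 1) := by
      have := pow_le_pow_left₀ (norm_nonneg _) h2 2
      rwa [mul_pow, Real.sq_sqrt hN.le] at this
    rw [norm_vec_sq] at e1
    have e2 : ∑ i ∈ Finset.range (n + 1), C2 ^ 2 < ∑ i ∈ Finset.range (n + 1), v i ^ 2 := by
      refine Finset.sum_lt_sum_of_nonempty (by simp) fun i hi => ?_
      rw [← sq_abs (v i)]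
      exact pow_lt_pow_left₀ (hcon i (by simp at hi; omega)) hC2 two_ne_zero
    simp at e2
    linarith
  obtain ⟨j, hj, hj2⟩ := h3
  intro i hi
  have a1 := h1 i hi
  have a2 := h1 j hj
  have : v i = v j + (v i - v 0) - (v j - v 0) := by ring
  rw [this]
  calc _ ≤ |v j + (v i - v 0)| + |v j - v 0| := abs_sub _ _
    _ ≤ |v j| + |v i - v 0| + |v j - v 0| := by gcongr; exact abs_add_le _ _
    _ ≤ _ := by linarith

lemma sq_quarter {p B X : ℝ} (hB : 0 ≤ B) (hX : 0 ≤ X) (h : p ^ 2 ≤ B * X ^ (1 / 2 : ℝ)) :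
    |p| ≤ (1 + B) * X ^ (1 / 4 : ℝ) := by
  have h4 : p ^ 2 ≤ ((1 + B) * X ^ (1 / 4 : ℝ)) ^ 2 := by
    rw [mul_pow, ← Real.rpow_natCast (X ^ (1 / 4 : ℝ)), ← Real.rpow_mul hX]
    have : (1 / 4 : ℝ) * (2:ℕ) = 1 / 2 := by norm_num
    rw [this]
    refine h.trans ?_
    have h1 : B ≤ (1 + B) ^ 2 := by nlinarith
    exact mul_le_mul_of_nonneg_right h1 (by positivity)
  exact abs_le_of_sq_le_sq h4 (by positivity)

set_option maxHeartbeats 1000000 in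
lemma exists_disc (h : SReg α lam Lam Ck sig k) (hc : Coef Cb θ b c f) {C0 T : ℝ} (hC0 : 0 ≤ C0)
    (hT : 0 < T) : ∃ C : ℝ, 0 ≤ C ∧ ∀ n v0, IniD n C0 v0 → ∃ u : ℕ → ℝ → ℝ,
      (∀ i ≤ n, u i 0 = v0 i) ∧ Disc n sig b c f T C u := by
  have hC := hc.C0
  have hl := h.lam0
  have hL := h.Lam0
  set C2 := Real.exp ((Cb ^ 2 / (4 * lam) + Cb) * T) * (C0 + Cb * T) with hC2
  have hC20 : 0 ≤ C2 := by positivity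
  set m0 := Lam * C0 + (Cb * C0 + Cb * C0 + Cb)
  have hm0 : 0 ≤ m0 := by positivity
  obtain ⟨M, hM, hMain⟩ := l2_deriv h hc hC20 hm0 hT
  set K := Cb * C2 + Cb + Cb ^ 2 * C2 / (2 * lam) with hK
  have hK0 : 0 ≤ K := by positivity
  set C3 := 2 / lam * (1 + K) with hC3
  have hC30 : 0 ≤ C3 := by positivity
  set C4 := C3 * (1 + M) with hC4
  have hC40 : 0 ≤ C4 := by positivity
  set C5 := (1 + 2 * C3) * (1 + M) with hC5
  have hC50 : 0 ≤ C5 := by positivity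
  refine ⟨(C2 + 2 * C4) + C4 + (1 + 4 * C4 * C5), by positivity, ?_⟩
  intro n v0 hv0
  obtain ⟨U, hU0, hU⟩ := exists_sys h hc n v0 hT.le
  set S := Real.sqrt ((n:ℝ) + 1) with hS
  have hS0 : 0 < S := Real.sqrt_pos.2 (by positivity)
  have hSS : S * S = (n:ℝ) + 1 := Real.mul_self_sqrt (by positivity)
  have hV := l2_bound h hc hC0 hU (by rw [hU0]; exact norm_vec_const hC0 hv0.b0)
  have hex0 : ∀ i ≤ n, ex (U 0) i = v0 i := fun i hi => by rw [hU0, ex_vec _ hi]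
  have hm := hMain n U hU hV (by
    rw [vec_add]
    refine norm_vec_const hm0 fun i hi => ?_
    refine (abs_add_le _ _).trans (add_le_add ?_ ?_)
    · rw [Fop, dd, edge_congr hex0, edge_congr hex0, abs_mul, abs_of_pos (by positivity)]
      have := hv0.b2 i hi
      rw [dd, abs_mul, abs_of_pos (by positivity)] at this
      calc _ ≤ ((n:ℝ) + 1) * (Lam * |edge n v0 (i + 1) - edge n v0 i|) := by
            gcongr; exact h.lipsig _ _
        _ = Lam * (((n:ℝ) + 1) * |edge n v0 (i + 1) - edge n v0 i|) := by ring
        _ ≤ _ := by gcongr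
    · rw [gg, edge_congr hex0, hex0 i hi]
      refine (abs_add_three _ _ _).trans ?_
      rw [abs_mul, abs_mul]
      gcongr
      · exact hc.bb _ _
      · exact hv0.b1 i (by omega)
      · exact hc.cb _ _
      · exact hv0.b0 i hi
      · exact hc.fb _ _)
  have hd : ∀ t ∈ Icc 0 T, ‖vec n (dd n (edge n (ex (U t))))‖ ≤ C4 * S := fun t ht => by
    refine (dd_bound h hc hC20 (hV t ht) (hm t ht)).trans ?_
    rw [hC4, hC3, mul_assoc (2 / lam) (1 + K)]
    gcongr
    nlinarith
  have hdiff := diff_bound h hc hC20 hC30 hM hU hV hm hd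
  have hbp : ∀ i ≤ n + 1, ∀ t ∈ Icc 0 T, |edge n (ex (U t)) i| ≤ C4 := by
    intro i hi t ht
    have h1 := abs_le_of_dd (n := n) (edge_zero n (ex (U t))) hi
    have h2 : ((n:ℝ) + 1) * |edge n (ex (U t)) i| ≤ ((n:ℝ) + 1) * C4 := by
      calc _ ≤ S * (C4 * S) := h1.trans (by gcongr; exact hd t ht)
        _ = _ := by rw [← hSS]; ring
    exact le_of_mul_le_mul_left h2 (by positivity)
  refine ⟨fun i t => ex (U t) i, hex0, ⟨?_, ?_, ?_, ?_⟩⟩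
  · intro i hi t ht
    have h1 := hU t ht
    rw [vec_add] at h1
    have h2 := (PiLp.proj 2 (𝕜 := ℝ) (fun _ : Fin (n + 1) => ℝ) (⟨i, by omega⟩ : Fin (n + 1))).hasFDerivAt.comp_hasDerivAt t h1
    have e : (fun t => ex (U t) i) = (PiLp.proj 2 (𝕜 := ℝ) (fun _ : Fin (n + 1) => ℝ) (⟨i, by omega⟩ : Fin (n + 1))) ∘ U := by
      ext t; rw [ex, dif_pos (by omega)]; rfl
    rw [e]
    exact h2
  · intro i hi t ht
    have := abs_le_of_edge hC40 (ex (U t)) (by rw [vec_ex]; exact hV t ht) (fun j hj => hbp j hj t ht) i hi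
    refine this.trans ?_
    have : 0 ≤ C4 * C5 := by positivity
    linarith
  · intro i hi t ht
    refine (hbp i hi t ht).trans ?_
    have : 0 ≤ C4 * C5 := by positivity
    linarith
  · intro i hi t ht s hs
    obtain ⟨_, d2, d3⟩ := hdiff t ht s hs
    have h1 := sq_le_of_dd (n := n) (ex (U t - U s)) hi
    have e : edge n (ex (U t)) i - edge n (ex (U s)) i = edge n (ex (U t - U s)) i := by
      rw [← edge_sub, exsub_fun]
    change |edge n (ex (U t)) i - edge n (ex (U s)) i| ≤ _
    rw [e]
    set X := |t - s| with hX
    have hX0 : 0 ≤ X := abs_nonneg _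
    have h2 : ((n:ℝ) + 1) * edge n (ex (U t - U s)) i ^ 2 ≤ ((n:ℝ) + 1) * (4 * C4 * C5 * X ^ (1 / 2 : ℝ)) := by
      calc _ ≤ 2 * (2 * C3 * (1 + M) * S) * ((1 + 2 * C3) * (1 + M) * S * X ^ (1 / 2 : ℝ)) :=
            h1.trans (by gcongr)
        _ = (S * S) * (4 * C4 * C5 * X ^ (1 / 2 : ℝ)) := by rw [hC4, hC5]; ring
        _ = _ := by rw [hSS]
    have h3 := le_of_mul_le_mul_left h2 (by positivity)
    have h5 := sq_quarter (show 0 ≤ 4 * C4 * C5 by positivity) hX0 h3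
    refine h5.trans ?_
    have : C2 + 2 * C4 + C4 + (1 + 4 * C4 * C5) = (1 + 4 * C4 * C5) + (C2 + 2 * C4 + C4) := by ring
    rw [this, add_mul]
    have h6 : 0 ≤ (C2 + 2 * C4 + C4) * X ^ (1 / 4 : ℝ) := by positivity
    linarith

/-! ### Duhamel estimate -/

lemma duhamel {E : Type*} [NormedAddCommGroup E] [NormedSpace ℝ E] [CompleteSpace E] (A : E →L[ℝ] E)
    {K a t ε β : ℝ} (hK : 0 ≤ K) (hat : a < t) (hε : 0 ≤ ε) (hβ : 0 < β)
    (hA : ∀ s > 0, ∀ v : E, ‖A (NormedSpace.exp (s • A) v)‖ ≤ K * ‖v‖ / s)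
    {u e : ℝ → E} (hu : ∀ r ∈ Icc a t, HasDerivAt u (A (u r) + e r) r)
    (he : ∀ r ∈ Icc a t, ‖e r - e t‖ ≤ ε * (t - r) ^ β) :
    ‖A (u t) + e t‖ ≤ ‖NormedSpace.exp ((t - a) • A) (A (u a) + e t)‖ + K * ε / β * (t - a) ^ β := by
  set Ĝ : ℝ → E := fun r => NormedSpace.exp ((t - r) • A) (A (u r) + e t) with hĜ
  have hexp : ∀ r, HasDerivAt (fun r => NormedSpace.exp ((t - r) • A)) (-(NormedSpace.exp ((t - r) • A) * A)) r := by
    intro r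
    have h1 := hasDerivAt_exp_smul_const A (t - r)
    have h2 : HasDerivAt (fun r : ℝ => t - r) (-1) r := by simpa using (hasDerivAt_id r).const_sub t
    have := h1.scomp r h2
    simp only [neg_smul, one_smul] at this
    exact this
  have hder : ∀ r ∈ Icc a t, HasDerivAt Ĝ (NormedSpace.exp ((t - r) • A) (A (e r - e t))) r := by
    intro r hr
    have h1 := (hexp r).clm_apply ((A.hasFDerivAt.comp_hasDerivAt r (hu r hr)).add_const (e t))
    refine h1.congr_deriv ?_
    simp only [neg_apply, mul_apply_eq_comp, map_add, map_sub, Function.comp_apply]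
    abel
  have hcomm : ∀ (s : ℝ) (v : E), NormedSpace.exp (s • A) (A v) = A (NormedSpace.exp (s • A) v) := by
    intro s v
    have : Commute (NormedSpace.exp (s • A)) A :=
      ((Commute.refl A).smul_left s).exp_left
    have := congrArg (fun L : E →L[ℝ] E => L v) this.eq
    simpa using this
  have hbound : ∀ r ∈ Ico a t, ‖NormedSpace.exp ((t - r) • A) (A (e r - e t))‖ ≤ K * ε * (t - r) ^ (β - 1) := by
    intro r hr
    have htr : 0 < t - r := by linarith [hr.2]
    rw [hcomm]
    refine (hA (t - r) htr _).trans ?_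
    rw [Real.rpow_sub_one htr.ne', ← mul_div_assoc]
    refine div_le_div_of_nonneg_right ?_ htr.le
    rw [mul_assoc]
    exact mul_le_mul_of_nonneg_left (he r ⟨hr.1, hr.2.le⟩) hK
  have hBd : ∀ r ∈ Ico a t, HasDerivAt (fun r => ‖Ĝ a‖ + K * ε / β * ((t - a) ^ β - (t - r) ^ β))
      (K * ε * (t - r) ^ (β - 1)) r := by
    intro r hr
    have htr : 0 < t - r := by linarith [hr.2]
    have h2 : HasDerivAt (fun r : ℝ => t - r) (-1) r := by simpa using (hasDerivAt_id r).const_sub t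
    have h3 := h2.rpow_const (p := β) (Or.inl htr.ne')
    have h4 := ((h3.const_sub ((t - a) ^ β)).const_mul (K * ε / β)).const_add (‖Ĝ a‖)
    refine h4.congr_deriv ?_
    field_simp
  have hfin := image_norm_le_of_norm_deriv_right_le_deriv_boundary' (f := Ĝ) (a := a) (b := t)
    (f' := fun r => NormedSpace.exp ((t - r) • A) (A (e r - e t)))
    (fun r hr => (hder r hr).continuousAt.continuousWithinAt)
    (fun r hr => (hder r ⟨hr.1, hr.2.le⟩).hasDerivWithinAt)
    (B := fun r => ‖Ĝ a‖ + K * ε / β * ((t - a) ^ β - (t - r) ^ β))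
    (B' := fun r => K * ε * (t - r) ^ (β - 1))
    (by simp)
    (by
      refine Continuous.continuousOn ?_
      have : Continuous fun r : ℝ => (t - r) ^ β :=
        (continuous_const.sub continuous_id).rpow_const fun _ => Or.inr hβ.le
      fun_prop)
    (fun r hr => (hBd r hr).hasDerivWithinAt)
    hbound (right_mem_Icc.2 hat.le)
  simp only [hĜ, sub_self, zero_smul, NormedSpace.exp_zero, one_apply_eq_self,
    Real.zero_rpow hβ.ne', sub_zero] at hfin
  exact hfin

end FwdSol

namespace FwdSol

variable {α lam Lam Ck : ℝ} {sig k : ℝ → ℝ} {Cb θ : ℝ} {b c f : ℝ → ℝ → ℝ} {n : ℕ}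

/-- averaged derivative -/
noncomputable def avg (k : ℝ → ℝ) (p q : ℝ) : ℝ := ∫ r in (0:ℝ)..1, k (p + r * (q - p))

lemma SReg.kcont (h : SReg α lam Lam Ck sig k) : Continuous k := cont_of_holder h.a0 h.hol

lemma SReg.avg_int (h : SReg α lam Lam Ck sig k) (p q : ℝ) :
    IntervalIntegrable (fun r => k (p + r * (q - p))) volume 0 1 := by
  have := h.kcont
  exact (by fun_prop : Continuous fun r => k (p + r * (q - p))).intervalIntegrable _ _

lemma SReg.avg_mul (h : SReg α lam Lam Ck sig k) (p q : ℝ) : sig q - sig p = avg k p q * (q - p) := by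
  have hd : ∀ r ∈ uIcc (0:ℝ) 1, HasDerivAt (fun r => sig (p + r * (q - p))) (k (p + r * (q - p)) * (q - p)) r := by
    intro r _
    have h2 : HasDerivAt (fun r : ℝ => p + r * (q - p)) (q - p) r := by
      simpa using ((hasDerivAt_id r).mul_const (q - p)).const_add p
    exact (h.der _).comp r h2
  have := intervalIntegral.integral_eq_sub_of_hasDerivAt hd ((h.avg_int p q).mul_const _)
  rw [intervalIntegral.integral_mul_const] at this
  rw [avg, this]; simp

lemma SReg.avg_lb (h : SReg α lam Lam Ck sig k) (p q : ℝ) : lam ≤ avg k p q := by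
  have := intervalIntegral.integral_mono_on zero_le_one (μ := volume) (f := fun _ => lam)
    (by simp) (h.avg_int p q) (fun r _ => h.lb _)
  simpa [avg] using this

lemma SReg.avg_ub (h : SReg α lam Lam Ck sig k) (p q : ℝ) : avg k p q ≤ Lam := by
  have := intervalIntegral.integral_mono_on zero_le_one (μ := volume) (g := fun _ => Lam)
    (h.avg_int p q) (by simp) (fun r _ => h.ub _)
  simpa [avg] using this

lemma SReg.Ck0 (h : SReg α lam Lam Ck sig k) : 0 ≤ Ck := by
  have := (abs_nonneg _).trans (h.hol 0 1)
  simpa using this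

lemma SReg.avg_hol (h : SReg α lam Lam Ck sig k) {p q p' q' B : ℝ} (hp : |p - p'| ≤ B) (hq : |q - q'| ≤ B) :
    |avg k p q - avg k p' q'| ≤ Ck * B ^ α := by
  have hB : 0 ≤ B := (abs_nonneg _).trans hp
  have h0 := h.Ck0
  rw [avg, avg, ← intervalIntegral.integral_sub (h.avg_int _ _) (h.avg_int _ _)]
  have := intervalIntegral.norm_integral_le_of_norm_le_const (a := 0) (b := 1) (C := Ck * B ^ α)
    (f := fun r => k (p + r * (q - p)) - k (p' + r * (q' - p'))) (fun r hr => by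
      rw [uIoc_of_le zero_le_one] at hr
      refine (h.hol _ _).trans ?_
      have ha := h.a0.le
      gcongr
      have e : p + r * (q - p) - (p' + r * (q' - p')) = (1 - r) * (p - p') + r * (q - q') := by ring
      rw [e]
      refine (abs_add_le _ _).trans ?_
      rw [abs_mul, abs_mul, abs_of_nonneg (by linarith [hr.2] : 0 ≤ 1 - r), abs_of_pos hr.1]
      nlinarith [hr.1, hr.2])
  simpa using this

noncomputable def px {n : ℕ} (v : Fin (n + 1) → ℝ) (i : ℕ) : ℝ := if h : i < n + 1 then v ⟨i, h⟩ else 0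

lemma px_of (v : ℕ → ℝ) {i : ℕ} (hi : i ≤ n) : px (fun j : Fin (n + 1) => v j) i = v i := by
  rw [px, dif_pos (by omega)]

lemma px_val (v : Fin (n + 1) → ℝ) (j : Fin (n + 1)) : px v j = v j := by
  rw [px, dif_pos j.2]

lemma px_add (v w : Fin (n + 1) → ℝ) (i : ℕ) : px (v + w) i = px v i + px w i := by
  simp only [px]; split_ifs <;> simp

lemma px_smul (r : ℝ) (v : Fin (n + 1) → ℝ) (i : ℕ) : px (r • v) i = r * px v i := by
  simp only [px]; split_ifs <;> simp

lemma edge_px_add (v w : Fin (n + 1) → ℝ) (i : ℕ) :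
    edge n (px (v + w)) i = edge n (px v) i + edge n (px w) i := by
  simp only [edge, px_add]; split_ifs <;> ring

lemma edge_px_smul (r : ℝ) (v : Fin (n + 1) → ℝ) (i : ℕ) :
    edge n (px (r • v)) i = r * edge n (px v) i := by
  simp only [edge, px_smul]; split_ifs <;> ring

noncomputable def Aop (n : ℕ) (a : ℕ → ℝ) : (Fin (n + 1) → ℝ) →L[ℝ] (Fin (n + 1) → ℝ) :=
  LinearMap.toContinuousLinearMap
    { toFun := fun v i => a i * dd n (edge n (px v)) i
      map_add' := fun v w => by ext i; simp only [dd, edge_px_add, Pi.add_apply]; ring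
      map_smul' := fun r v => by
        ext i; simp only [dd, edge_px_smul, Pi.smul_apply, smul_eq_mul, RingHom.id_apply]; ring }

lemma Aop_apply (a : ℕ → ℝ) (v : Fin (n + 1) → ℝ) (i : Fin (n + 1)) :
    Aop n a v i = a i * dd n (edge n (px v)) i := rfl

lemma Aop_linsys (a : ℕ → ℝ) (v : Fin (n + 1) → ℝ) (T : ℝ) :
    LinSys n a (fun i s => px (NormedSpace.exp (s • Aop n a) v) i) T where
  ode i hi t _ := by
    have h1 := (hasDerivAt_exp_smul_const' (Aop n a) t).clm_apply (hasDerivAt_const t v)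
    have h2 := (hasDerivAt_pi.1 h1) ⟨i, by omega⟩
    have e : (fun s : ℝ => px (NormedSpace.exp (s • Aop n a) v) i)
        = fun s : ℝ => (NormedSpace.exp (s • Aop n a) v) ⟨i, by omega⟩ := by
      ext s; rw [px, dif_pos (by omega)]
    rw [e]
    refine h2.congr_deriv ?_
    simp only [map_zero, add_zero, mul_apply_eq_comp]
    rw [Aop_apply]; rfl

lemma exp_bound {a : ℕ → ℝ} (ha : ∀ i, 0 < a i) (v : Fin (n + 1) → ℝ) {s : ℝ} (hs : 0 ≤ s) :
    ‖NormedSpace.exp (s • Aop n a) v‖ ≤ ‖v‖ := by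
  rw [pi_norm_le_iff_of_nonneg (norm_nonneg _)]
  intro i
  have := (Aop_linsys a v s).bound ha (B := ‖v‖) (fun j hj => by
    simp only [zero_smul, NormedSpace.exp_zero, one_apply_eq_self]
    rw [px, dif_pos (by omega)]; exact norm_le_pi_norm v _) i (by omega) s (right_mem_Icc.2 hs)
  rw [px_val] at this
  exact this

lemma Aexp_bound {a : ℕ → ℝ} (hl : 0 < lam) (ha : ∀ i, lam ≤ a i) (hLam : ∀ i, a i ≤ Lam)
    (v : Fin (n + 1) → ℝ) {s : ℝ} (hs : 0 < s) :
    ‖Aop n a (NormedSpace.exp (s • Aop n a) v)‖ ≤ 50 * Real.sqrt (Lam / lam) * ‖v‖ / s := by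
  rcases eq_or_ne v 0 with rfl | hv
  · simp
  have hv0 : 0 < ‖v‖ := norm_pos_iff.2 hv
  rw [pi_norm_le_iff_of_nonneg (by positivity)]
  intro i
  have := (Aop_linsys a v s).smooth hl ha hLam hs hv0 (fun j hj => by
    simp only [zero_smul, NormedSpace.exp_zero, one_apply_eq_self]
    rw [px, dif_pos (by omega)]; exact norm_le_pi_norm v _) i (by omega)
  exact this

lemma abs_gg_sub (hc : Coef Cb θ b c f) {C D E X : ℝ} (r s : ℝ) (v w : ℕ → ℝ) (i : ℕ) (hC : 0 ≤ C)
    (h1 : |edge n v i - edge n w i| ≤ D) (h2 : |v i - w i| ≤ E) (h3 : |edge n v i| ≤ C) (h4 : |v i| ≤ C)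
    (hX : |r - s| ^ θ ≤ X) :
    |gg n b c f r v i - gg n b c f s w i| ≤ Cb * D + Cb * E + Cb * X * (2 * C + 1) := by
  have hCb := hc.C0
  have hX0 : 0 ≤ X := le_trans (by positivity) hX
  have hD : 0 ≤ D := (abs_nonneg _).trans h1
  have hE : 0 ≤ E := (abs_nonneg _).trans h2
  set x := (i:ℝ) / ((n:ℝ) + 1) with hx
  have e : gg n b c f r v i - gg n b c f s w i = b x s * (edge n v i - edge n w i) + c x s * (v i - w i)
      + ((b x r - b x s) * edge n v i + (c x r - c x s) * v i + (f x r - f x s)) := by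
    simp only [gg, ← hx]; ring
  rw [e]
  refine (abs_add_three _ _ _).trans ?_
  refine add_le_add (add_le_add ?_ ?_) ((abs_add_three _ _ _).trans ?_)
  · rw [abs_mul]; exact mul_le_mul (hc.bb _ _) h1 (abs_nonneg _) hCb
  · rw [abs_mul]; exact mul_le_mul (hc.cb _ _) h2 (abs_nonneg _) hCb
  · have k1 : |b x r - b x s| ≤ Cb * X := (hc.bh _ _ _).trans (by gcongr)
    have k2 : |c x r - c x s| ≤ Cb * X := (hc.ch _ _ _).trans (by gcongr)
    have k3 : |f x r - f x s| ≤ Cb * X := (hc.fh _ _ _).trans (by gcongr)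
    rw [abs_mul, abs_mul]
    have p1 := mul_le_mul k1 h3 (abs_nonneg _) (by positivity)
    have p2 := mul_le_mul k2 h4 (abs_nonneg _) (by positivity)
    nlinarith

lemma abs_gg (hc : Coef Cb θ b c f) {C : ℝ} (t : ℝ) (v : ℕ → ℝ) (i : ℕ)
    (h3 : |edge n v i| ≤ C) (h4 : |v i| ≤ C) : |gg n b c f t v i| ≤ Cb * (2 * C + 1) := by
  have hCb := hc.C0
  rw [gg]
  refine (abs_add_three _ _ _).trans ?_
  rw [abs_mul, abs_mul]
  have p1 := mul_le_mul (hc.bb ((i:ℝ) / ((n:ℝ) + 1)) t) h3 (abs_nonneg _) hCb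
  have p2 := mul_le_mul (hc.cb ((i:ℝ) / ((n:ℝ) + 1)) t) h4 (abs_nonneg _) hCb
  have p3 := hc.fb ((i:ℝ) / ((n:ℝ) + 1)) t
  linarith

lemma Disc.contP {T C : ℝ} {u : ℕ → ℝ → ℝ} (hD : Disc n sig b c f T C u) (i : ℕ) :
    ContinuousOn (fun t => edge n (fun k => u k t) i) (Icc 0 T) := by
  have hu : ∀ i ≤ n, ContinuousOn (u i) (Icc 0 T) := fun i hi t ht =>
    (hD.ode i hi t ht).continuousAt.continuousWithinAt
  simp only [edge]
  split_ifs with hi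
  · exact continuousOn_const
  · exact continuousOn_const.mul ((hu _ (by omega)).sub (hu _ (by omega)))

lemma Disc.contR {T C : ℝ} {u : ℕ → ℝ → ℝ} (h : SReg α lam Lam Ck sig k) (hc : Coef Cb θ b c f)
    (hD : Disc n sig b c f T C u) (i : ℕ) (hi : i ≤ n) :
    ContinuousOn (fun t => Fop sig n (fun k => u k t) i + gg n b c f t (fun k => u k t) i) (Icc 0 T) := by
  have hu : ∀ i ≤ n, ContinuousOn (u i) (Icc 0 T) := fun i hi t ht =>
    (hD.ode i hi t ht).continuousAt.continuousWithinAt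
  have hP := hD.contP
  have h1 := (cont_of_holder hc.t0 (hc.bh (((i:ℕ):ℝ) / ((n:ℝ) + 1)))).continuousOn (s := Icc 0 T)
  have h2 := (cont_of_holder hc.t0 (hc.ch (((i:ℕ):ℝ) / ((n:ℝ) + 1)))).continuousOn (s := Icc 0 T)
  have h3 := (cont_of_holder hc.t0 (hc.fh (((i:ℕ):ℝ) / ((n:ℝ) + 1)))).continuousOn (s := Icc 0 T)
  simp only [Fop, dd, gg]
  exact (continuousOn_const.mul ((h.cont.comp_continuousOn (hP (i + 1))).sub (h.cont.comp_continuousOn (hP i)))).add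
    (((h1.mul (hP i)).add (h2.mul (hu i hi))).add h3)

/-- right-hand side -/
noncomputable def RR (n : ℕ) (sig : ℝ → ℝ) (b c f : ℝ → ℝ → ℝ) (u : ℕ → ℝ → ℝ) (i : ℕ) (t : ℝ) : ℝ :=
  Fop sig n (fun k => u k t) i + gg n b c f t (fun k => u k t) i

lemma SReg.Fop_eq (h : SReg α lam Lam Ck sig k) (v : ℕ → ℝ) (i : ℕ) :
    Fop sig n v i = avg k (edge n v i) (edge n v (i + 1)) * dd n (edge n v) i := by
  rw [Fop, dd, h.avg_mul, dd]; ring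

lemma disc_dd {T C m : ℝ} (h : SReg α lam Lam Ck sig k) (hc : Coef Cb θ b c f)
    {u : ℕ → ℝ → ℝ} (hD : Disc n sig b c f T C u)
    (hm : ∀ i ≤ n, ∀ r ∈ Icc 0 T, |RR n sig b c f u i r| ≤ m) :
    ∀ i ≤ n, ∀ r ∈ Icc 0 T, |dd n (edge n (fun k => u k r)) i| ≤ (m + Cb * (2 * C + 1)) / lam := by
  intro i hi r hr
  have hl := h.lam0
  have h1 := hm i hi r hr
  rw [RR, h.Fop_eq] at h1
  have h2 := abs_gg hc r (fun k => u k r) i (hD.bp i (by omega) r hr) (hD.bu i hi r hr)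
  set g := gg n b c f r (fun k => u k r) i
  set d := dd n (edge n fun k => u k r) i
  set A := avg k (edge n (fun k => u k r) i) (edge n (fun k => u k r) (i + 1)) with hA
  have h3 : lam ≤ A := h.avg_lb _ _
  rw [le_div_iff₀ hl]
  have h4 : |A * d| ≤ m + Cb * (2 * C + 1) := by
    have : A * d = (A * d + g) - g := by ring
    rw [this]
    exact (abs_sub _ _).trans (add_le_add h1 h2)
  rw [abs_mul, abs_of_pos (hl.trans_le h3)] at h4
  nlinarith [abs_nonneg d]

set_option maxHeartbeats 1000000 in
lemma disc_step {T C m a t : ℝ} (h : SReg α lam Lam Ck sig k) (hc : Coef Cb θ b c f) (hθ : α / 4 ≤ θ)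
    (hC : 0 ≤ C) (hm0 : 0 ≤ m)
    {u : ℕ → ℝ → ℝ} (hD : Disc n sig b c f T C u)
    (hm : ∀ i ≤ n, ∀ r ∈ Icc 0 T, |RR n sig b c f u i r| ≤ m) (ha : 0 ≤ a) (hat : a < t) (ht : t ≤ T) {Y C7 : ℝ}
    (hC7 : C7 = Ck * C ^ α * ((1 + Cb * (2 * C + 1)) / lam) + Cb * C * (T + 1) + Cb * (T + 1) + Cb * (T + 1) * (2 * C + 1))
    (hY : Y = 50 * Real.sqrt (Lam / lam) * (C7 * (1 + m)) / (α / 4) * (t - a) ^ (α / 4)) :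
    (∀ i ≤ n, |RR n sig b c f u i t| ≤ 50 * Real.sqrt (Lam / lam) * C / (t - a) + Cb * (2 * C + 1) + Y) ∧
    (∀ C0, 0 ≤ C0 → (∀ i ≤ n, |dd n (edge n (fun k => u k a)) i| ≤ C0) →
      ∀ i ≤ n, |RR n sig b c f u i t| ≤ Lam * C0 + Cb * (2 * C + 1) + Y) := by
  have hl := h.lam0
  have hL := h.Lam0
  have hCb := hc.C0
  have hCk := h.Ck0
  have hα := h.a0
  have hT : 0 < T := by linarith
  have htT : t ∈ Icc 0 T := ⟨by linarith, ht⟩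
  set P : ℕ → ℝ → ℝ := fun i r => edge n (fun k => u k r) i with hP
  set av : ℕ → ℝ := fun i => avg k (P i t) (P (i + 1) t) with hav
  have hav1 : ∀ i, lam ≤ av i := fun i => h.avg_lb _ _
  have hav2 : ∀ i, av i ≤ Lam := fun i => h.avg_ub _ _
  set A := Aop n av with hA
  set ub : ℝ → (Fin (n + 1) → ℝ) := fun r j => u j r with hub
  set e : ℝ → (Fin (n + 1) → ℝ) := fun r j => RR n sig b c f u j r - av j * dd n (fun i => P i r) j with he
  have hAu : ∀ r (j : Fin (n + 1)), A (ub r) j = av j * dd n (fun i => P i r) j := by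
    intro r j
    rw [hA, Aop_apply]
    congr 2
    ext i
    exact edge_congr (fun i hi => px_of (fun k => u k r) hi) i
  have hC70 : 0 ≤ C7 := by rw [hC7]; positivity
  have hder : ∀ r ∈ Icc a t, HasDerivAt ub (A (ub r) + e r) r := by
    intro r hr
    rw [hasDerivAt_pi]
    intro j
    refine (hD.ode j (by omega) r ⟨by linarith [hr.1], by linarith [hr.2]⟩).congr_deriv ?_
    rw [Pi.add_apply, hAu]; simp only [he]
    rw [RR]; ring
  have hek : ∀ r (j : Fin (n + 1)), e r j = (avg k (P j r) (P (j + 1) r) - av j) * dd n (fun i => P i r) j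
      + gg n b c f r (fun k => u k r) j := by
    intro r j
    simp only [he]
    rw [RR, h.Fop_eq]; ring
  have het : ∀ j : Fin (n + 1), e t j = gg n b c f t (fun k => u k t) j := by
    intro j; rw [hek]; simp [hav]
  have hdd := disc_dd h hc hD hm
  have hlip : ∀ i ≤ n, ∀ r ∈ Icc 0 T, |u i r - u i t| ≤ m * |r - t| := by
    intro i hi r hr
    have := Convex.norm_image_sub_le_of_norm_hasDerivWithin_le (s := Icc 0 T) (C := m)
      (fun t ht => (hD.ode i hi t ht).hasDerivWithinAt) (fun t ht => hm i hi t ht) (convex_Icc _ _) htT hr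
    simpa [Real.norm_eq_abs] using this
  have heb : ∀ r ∈ Icc a t, ‖e r - e t‖ ≤ C7 * (1 + m) * (t - r) ^ (α / 4) := by
    intro r hr
    have hrT : r ∈ Icc 0 T := ⟨by linarith [hr.1], by linarith [hr.2]⟩
    have hx0 : 0 ≤ t - r := by linarith [hr.2]
    have hxT : t - r ≤ T := by linarith [hr.1]
    have habs : |r - t| = t - r := by rw [abs_sub_comm, abs_of_nonneg hx0]
    rw [pi_norm_le_iff_of_nonneg (by positivity)]
    intro j
    have hjn : (j:ℕ) ≤ n := by omega
    have e1 : (e r - e t) j = (avg k (P j r) (P (j + 1) r) - av j) * dd n (fun i => P i r) j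
      + (gg n b c f r (fun k => u k r) j - gg n b c f t (fun k => u k t) j) := by
      rw [Pi.sub_apply, hek, het]; ring
    rw [e1, Real.norm_eq_abs]
    have q1 := rpow_le_of_le hx0 hxT (show α / 4 ≤ 1 / 4 by linarith [h.a1]) (by norm_num) (by positivity)
    have q2 := rpow_le_of_le hx0 hxT (show α / 4 ≤ 1 by linarith [h.a1]) le_rfl (by positivity)
    have q3 := rpow_le_of_le hx0 hxT hθ (by linarith [hc.t1]) (by positivity)
    rw [Real.rpow_one] at q2
    have hp1 : ∀ i ≤ n + 1, |P i r - P i t| ≤ C * (t - r) ^ (1 / 4 : ℝ) := fun i hi => by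
      have := hD.hp i hi r hrT t htT
      rwa [habs] at this
    have hq : (C * (t - r) ^ (1 / 4 : ℝ)) ^ α = C ^ α * (t - r) ^ (α / 4) := by
      rw [Real.mul_rpow hC (by positivity), ← Real.rpow_mul hx0]; congr 2; ring
    have b1 : |avg k (P j r) (P (j + 1) r) - av j| ≤ Ck * (C ^ α * (t - r) ^ (α / 4)) := by
      rw [← hq]; exact h.avg_hol (hp1 _ (by omega)) (hp1 _ (by omega))
    set X := (t - r) ^ (α / 4) with hX
    have hX0 : 0 ≤ X := by positivity
    have b2 := abs_gg_sub hc (D := C * ((T + 1) * X)) (E := m * ((T + 1) * X)) (X := (T + 1) * X) r t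
      (fun k => u k r) (fun k => u k t) j hC
      ((hp1 j (by omega)).trans (mul_le_mul_of_nonneg_left q1 hC))
      ((hlip j hjn r hrT).trans (by rw [habs]; exact mul_le_mul_of_nonneg_left q2 hm0))
      (hD.bp j (by omega) r hrT) (hD.bu j hjn r hrT) (by rw [habs]; exact q3)
    have b3 := hdd j hjn r hrT
    refine (abs_add_le _ _).trans ?_
    have b4 : |(avg k (P j r) (P (j + 1) r) - av j) * dd n (fun i => P i r) j| ≤
        Ck * (C ^ α * X) * ((m + Cb * (2 * C + 1)) / lam) := by
      rw [abs_mul]; exact mul_le_mul b1 b3 (abs_nonneg _) (by positivity)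
    have b5 : (m + Cb * (2 * C + 1)) / lam ≤ (1 + Cb * (2 * C + 1)) / lam * (1 + m) := by
      rw [div_mul_eq_mul_div]
      refine div_le_div_of_nonneg_right ?_ hl.le
      have : 0 ≤ Cb * (2 * C + 1) * m := by positivity
      linarith
    have b6 : Ck * (C ^ α * X) * ((m + Cb * (2 * C + 1)) / lam) ≤
       Ck * (C ^ α * X) * ((1 + Cb * (2 * C + 1)) / lam * (1 + m)) :=
      mul_le_mul_of_nonneg_left b5 (by positivity)
    have c1 : 0 ≤ m * (Cb * C * (T + 1) * X) := by positivity
    have c2 : 0 ≤ Cb * (T + 1) * X := by positivity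
    have c3 : 0 ≤ m * (Cb * (T + 1) * (2 * C + 1) * X) := by positivity
    rw [hC7]
    linarith
  have hdu := duhamel A (K := 50 * Real.sqrt (Lam / lam)) (by positivity) hat (by positivity)
    (show 0 < α / 4 by positivity) (fun s hs v => Aexp_bound hl hav1 hav2 v hs) hder heb
  rw [← hY] at hdu
  have hnorm : ∀ i ≤ n, |RR n sig b c f u i t| ≤ ‖A (ub t) + e t‖ := by
    intro i hi
    have h1 := norm_le_pi_norm (A (ub t) + e t) ⟨i, by omega⟩
    rw [Pi.add_apply, hAu] at h1
    simp only [he] at h1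
    simpa using h1
  have hetn : ‖e t‖ ≤ Cb * (2 * C + 1) := by
    rw [pi_norm_le_iff_of_nonneg (by positivity)]
    intro j
    rw [het]
    exact abs_gg hc t _ j (hD.bp j (by omega) t htT) (hD.bu j (by omega) t htT)
  have haT : a ∈ Icc 0 T := ⟨ha, by linarith⟩
  have hpos : ∀ i, 0 < av i := fun i => hl.trans_le (hav1 i)
  constructor
  · intro i hi
    refine (hnorm i hi).trans (hdu.trans ?_)
    gcongr
    rw [map_add]
    refine (norm_add_le _ _).trans (add_le_add ?_ ((exp_bound hpos _ (by linarith)).trans hetn))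
    have hcomm : NormedSpace.exp ((t - a) • A) (A (ub a)) = A (NormedSpace.exp ((t - a) • A) (ub a)) := by
      have : Commute (NormedSpace.exp ((t - a) • A)) A := ((Commute.refl A).smul_left (t - a)).exp_left
      have := congrArg (fun L : (Fin (n + 1) → ℝ) →L[ℝ] (Fin (n + 1) → ℝ) => L (ub a)) this.eq
      simpa using this
    rw [hcomm]
    refine (Aexp_bound hl hav1 hav2 (ub a) (by linarith)).trans ?_
    have hta : 0 < t - a := by linarith
    gcongr
    rw [pi_norm_le_iff_of_nonneg hC]
    intro j
    exact hD.bu j (by omega) a haT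
  · intro C0 hC0 hd0 i hi
    refine (hnorm i hi).trans (hdu.trans ?_)
    gcongr
    refine (exp_bound hpos _ (by linarith)).trans ((norm_add_le _ _).trans (add_le_add ?_ hetn))
    rw [pi_norm_le_iff_of_nonneg (by positivity)]
    intro j
    rw [hAu, norm_mul, Real.norm_eq_abs, Real.norm_eq_abs, abs_of_pos (hpos _)]
    exact mul_le_mul (hav2 _) (hd0 j (by omega)) (abs_nonneg _) hL.le

lemma disc_deriv {T C C0 : ℝ} (h : SReg α lam Lam Ck sig k) (hc : Coef Cb θ b c f) (hθ : α / 4 ≤ θ)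
    (hC : 0 ≤ C) (hC0 : 0 ≤ C0) (hT : 0 < T) :
    ∃ M : ℝ, 0 ≤ M ∧ ∀ n v0 u, IniD n C0 v0 → (∀ i ≤ n, u i 0 = v0 i) → Disc n sig b c f T C u →
      ∀ i ≤ n, ∀ t ∈ Icc 0 T, |RR n sig b c f u i t| ≤ M := by
  have hl := h.lam0
  have hL := h.Lam0
  have hCb := hc.C0
  have hCk := h.Ck0
  have hα := h.a0
  obtain ⟨C7, hC7⟩ : ∃ C7, C7 = Ck * C ^ α * ((1 + Cb * (2 * C + 1)) / lam) + Cb * C * (T + 1) + Cb * (T + 1) + Cb * (T + 1) * (2 * C + 1) := ⟨_, rfl⟩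
  have hC70 : 0 ≤ C7 := by rw [hC7]; positivity
  obtain ⟨τ, hτ, hτ2⟩ := exists_tau (C := 50 * Real.sqrt (Lam / lam) * C7 / (α / 4)) (show 0 < α / 4 by positivity)
  set K1 := 50 * Real.sqrt (Lam / lam) * C / τ with hK1
  have hK10 : 0 ≤ K1 := by positivity
  refine ⟨2 * (K1 + Lam * C0 + Cb * (2 * C + 1)) + 1, by positivity, ?_⟩
  intro n v0 u hv0 hu0 hD
  -- max
  obtain ⟨m, hm0, hm, hmx⟩ : ∃ m, 0 ≤ m ∧ (∀ i ≤ n, ∀ r ∈ Icc 0 T, |RR n sig b c f u i r| ≤ m) ∧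
      ∃ i ≤ n, ∃ r ∈ Icc 0 T, |RR n sig b c f u i r| = m := by
    have hmax : ∀ i, ∃ t0 ∈ Icc 0 T, i ≤ n → ∀ r ∈ Icc 0 T, |RR n sig b c f u i r| ≤ |RR n sig b c f u i t0| := by
      intro i
      by_cases hi : i ≤ n
      · obtain ⟨t0, h1, h2⟩ := isCompact_Icc.exists_isMaxOn (nonempty_Icc.2 hT.le) (hD.contR h hc i hi).abs
        exact ⟨t0, h1, fun _ r hr => h2 hr⟩
      · exact ⟨0, ⟨le_rfl, hT.le⟩, fun h => absurd h hi⟩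
    choose t0 ht0 hmx using hmax
    obtain ⟨i0, hi0, hi0m⟩ := Finset.exists_max_image (Finset.range (n + 1))
      (fun i => |RR n sig b c f u i (t0 i)|) (by simp)
    refine ⟨_, abs_nonneg _, fun i hi r hr => ?_, i0, by simp at hi0; omega, t0 i0, ht0 i0, rfl⟩
    exact (hmx i hi r hr).trans (hi0m i (by simp; omega))
  have hd0 : ∀ i ≤ n, |dd n (edge n (fun k => u k 0)) i| ≤ C0 := by
    intro i hi
    have := hv0.b2 i hi
    rw [dd] at this ⊢
    rwa [edge_congr hu0, edge_congr hu0]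
  have hkey : ∀ i ≤ n, ∀ t ∈ Icc 0 T, |RR n sig b c f u i t| ≤ K1 + Lam * C0 + Cb * (2 * C + 1) + (1 + m) / 2 := by
    intro i hi t ht
    have hLC : 0 ≤ Lam * C0 := by positivity
    have hYb : ∀ a, 0 ≤ t - a → t - a ≤ τ →
        50 * Real.sqrt (Lam / lam) * (C7 * (1 + m)) / (α / 4) * (t - a) ^ (α / 4) ≤ (1 + m) / 2 := by
      intro a h1 h2
      calc _ ≤ 50 * Real.sqrt (Lam / lam) * (C7 * (1 + m)) / (α / 4) * τ ^ (α / 4) := by gcongr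
        _ = (50 * Real.sqrt (Lam / lam) * C7 / (α / 4) * τ ^ (α / 4)) * (1 + m) := by ring
        _ ≤ 1 / 2 * (1 + m) := by gcongr
        _ = _ := by ring
    rcases ht.1.eq_or_lt with h0 | h0
    · subst h0
      rw [RR, h.Fop_eq]
      have h2 := abs_gg hc 0 (fun k => u k 0) i (hD.bp i (by omega) 0 ht) (hD.bu i hi 0 ht)
      refine (abs_add_le _ _).trans ?_
      rw [abs_mul, abs_of_pos (hl.trans_le (h.avg_lb _ _))]
      have := mul_le_mul (h.avg_ub (edge n (fun k => u k 0) i) (edge n (fun k => u k 0) (i + 1))) (hd0 i hi) (abs_nonneg _) hL.le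
      linarith
    rcases le_or_gt τ t with h1 | h1
    · have := (disc_step h hc hθ hC hm0 hD hm (a := t - τ) (by linarith) (by linarith) ht.2 hC7 rfl).1 i hi
      have h2 := hYb (t - τ) (by linarith) (by linarith)
      have e : t - (t - τ) = τ := by ring
      rw [e] at this h2
      linarith
    · have := (disc_step h hc hθ hC hm0 hD hm (a := 0) le_rfl h0 ht.2 hC7 rfl).2 C0 hC0 hd0 i hi
      have h2 := hYb 0 (by linarith) (by linarith)
      linarith
  obtain ⟨i, hi, r, hr, hir⟩ := hmx
  have := hkey i hi r hr
  rw [hir] at this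
  intro i hi t ht
  exact (hm i hi t ht).trans (by linarith)

end FwdSol

namespace FwdSol

/-! ### Ultrafilter limits -/

noncomputable def hyp : Filter ℕ := ((Filter.hyperfilter ℕ : Ultrafilter ℕ) : Filter ℕ)

instance hyp_neBot : hyp.NeBot := by unfold hyp; infer_instance

lemma hyp_le : hyp ≤ Filter.atTop := by
  rw [← Nat.cofinite_eq_atTop]; exact Filter.hyperfilter_le_cofinite

noncomputable def ulim (s : ℕ → ℝ) : ℝ := hyp.limUnder s

lemma tendsto_ulim {s : ℕ → ℝ} {C : ℝ} (h : ∀ n, |s n| ≤ C) : Filter.Tendsto s hyp (nhds (ulim s)) := by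
  have hmem : ((Filter.hyperfilter ℕ : Ultrafilter ℕ).map s : Filter ℝ) ≤ Filter.principal (Icc (-C) C) := by
    rw [Filter.le_principal_iff, Ultrafilter.coe_map, Filter.mem_map]
    exact Filter.univ_mem' fun n => abs_le.1 (h n)
  obtain ⟨x, _, hx⟩ := isCompact_Icc.ultrafilter_le_nhds _ hmem
  exact tendsto_nhds_limUnder ⟨x, hx⟩

/-- grid index -/
noncomputable def gi (n : ℕ) (x : ℝ) : ℕ := ⌊((n:ℝ) + 1) * x⌋₊

lemma gi_le {n : ℕ} {x : ℝ} (hx : x ∈ Icc (0:ℝ) 1) : gi n x ≤ n + 1 := by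
  unfold gi
  refine Nat.floor_le_of_le ?_
  push_cast
  nlinarith [hx.2, (by positivity : (0:ℝ) ≤ (n:ℝ) + 1)]

lemma gi_zero (n : ℕ) : gi n 0 = 0 := by simp [gi]

lemma gi_one (n : ℕ) : gi n 1 = n + 1 := by
  unfold gi
  have : ((n:ℝ) + 1) * 1 = ((n + 1 : ℕ) : ℝ) := by push_cast; ring
  rw [this, Nat.floor_natCast]

lemma tendsto_inv_hyp : Filter.Tendsto (fun n : ℕ => 1 / ((n:ℝ) + 1)) hyp (nhds 0) :=
  tendsto_one_div_add_atTop_nhds_zero_nat.mono_left hyp_le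

lemma tendsto_gi {x : ℝ} (hx : 0 ≤ x) :
    Filter.Tendsto (fun n : ℕ => (gi n x : ℝ) / ((n:ℝ) + 1)) hyp (nhds x) := by
  have h1 : Filter.Tendsto (fun n : ℕ => x - 1 / ((n:ℝ) + 1)) hyp (nhds x) := by
    simpa using tendsto_inv_hyp.const_sub x
  refine tendsto_of_tendsto_of_tendsto_of_le_of_le h1 tendsto_const_nhds (fun n => ?_) (fun n => ?_)
  · have hN : (0:ℝ) < (n:ℝ) + 1 := by positivity
    have := Nat.lt_floor_add_one (((n:ℝ) + 1) * x)
    simp only [gi]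
    rw [le_div_iff₀ hN, sub_mul, div_mul_cancel₀ _ hN.ne']
    linarith
  · have hN : (0:ℝ) < (n:ℝ) + 1 := by positivity
    have := Nat.floor_le (show 0 ≤ ((n:ℝ) + 1) * x by positivity)
    simp only [gi]
    rw [div_le_iff₀ hN]; linarith

/-- limit of a grid function -/
noncomputable def glim (Y : ℕ → ℕ → ℝ → ℝ) (x t : ℝ) : ℝ := ulim (fun n => Y n (gi n x) t)

def GB (T C : ℝ) (Y : ℕ → ℕ → ℝ → ℝ) : Prop := ∀ n, ∀ i ≤ n + 1, ∀ t ∈ Icc 0 T, |Y n i t| ≤ C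

lemma tendsto_glim {T C : ℝ} {Y : ℕ → ℕ → ℝ → ℝ} (h : GB T C Y) {x t : ℝ} (hx : x ∈ Icc (0:ℝ) 1)
    (ht : t ∈ Icc 0 T) : Filter.Tendsto (fun n => Y n (gi n x) t) hyp (nhds (glim Y x t)) :=
  tendsto_ulim (C := C) fun n => h n _ (gi_le hx) t ht

/-- space time modulus of continuity -/
def GH (T C γ δ : ℝ) (Y : ℕ → ℕ → ℝ → ℝ) : Prop := ∀ n, ∀ i ≤ n + 1, ∀ j ≤ n + 1, ∀ t ∈ Icc 0 T, ∀ s ∈ Icc 0 T,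
  |Y n i t - Y n j s| ≤ C * |(i:ℝ) / ((n:ℝ) + 1) - (j:ℝ) / ((n:ℝ) + 1)| ^ γ + C * |t - s| ^ δ

lemma tendsto_pow_gi {x y γ : ℝ} (hγ : 0 < γ) (hx : x ∈ Icc (0:ℝ) 1) (hy : y ∈ Icc (0:ℝ) 1) :
    Filter.Tendsto (fun n : ℕ => |(gi n x:ℝ) / ((n:ℝ) + 1) - (gi n y:ℝ) / ((n:ℝ) + 1)| ^ γ) hyp (nhds (|x - y| ^ γ)) :=
  ((tendsto_gi hx.1).sub (tendsto_gi hy.1)).abs.rpow_const (Or.inr hγ.le)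

lemma glim_holder {T C C' γ δ : ℝ} {Y : ℕ → ℕ → ℝ → ℝ} (hB : GB T C' Y) (h : GH T C γ δ Y) (hγ : 0 < γ)
    {x y t s : ℝ} (hx : x ∈ Icc (0:ℝ) 1) (hy : y ∈ Icc (0:ℝ) 1)
    (ht : t ∈ Icc 0 T) (hs : s ∈ Icc 0 T) :
    |glim Y x t - glim Y y s| ≤ C * |x - y| ^ γ + C * |t - s| ^ δ := by
  refine le_of_tendsto_of_tendsto ((tendsto_glim hB hx ht).sub (tendsto_glim hB hy hs)).abs
    (((tendsto_pow_gi hγ hx hy).const_mul C).add_const _) (Filter.Eventually.of_forall fun n => ?_)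
  exact h n _ (gi_le hx) _ (gi_le hy) t ht s hs

/-- space derivative at the discrete level -/
lemma disc_space {n : ℕ} {C γ : ℝ} {Y Z : ℕ → ℝ} (hC : 0 ≤ C) (hγ : 0 < γ)
    (h1 : ∀ i ≤ n, |Y (i + 1) - Y i - Z i / ((n:ℝ) + 1)| ≤ C / ((n:ℝ) + 1) / ((n:ℝ) + 1))
    (h2 : ∀ i ≤ n + 1, ∀ j ≤ n + 1, |Z i - Z j| ≤ C * |(i:ℝ) / ((n:ℝ) + 1) - (j:ℝ) / ((n:ℝ) + 1)| ^ γ)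
    (i j : ℕ) (hi : i ≤ n + 1) (hj : j ≤ n + 1) :
    |Y j - Y i - ((j:ℝ) / ((n:ℝ) + 1) - (i:ℝ) / ((n:ℝ) + 1)) * Z i| ≤
      C * (1 / ((n:ℝ) + 1)) + 2 * C * (|(j:ℝ) / ((n:ℝ) + 1) - (i:ℝ) / ((n:ℝ) + 1)| ^ γ *
        |(j:ℝ) / ((n:ℝ) + 1) - (i:ℝ) / ((n:ℝ) + 1)|) := by
  set N := (n:ℝ) + 1 with hN
  have hN0 : 0 < N := by positivity
  have key : ∀ i l, i + l ≤ n + 1 → ∀ z, (∀ r ≤ l, |Z (i + r) - z| ≤ C * ((l:ℝ) / N) ^ γ) →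
      ∀ r ≤ l, |Y (i + r) - Y i - (r:ℝ) / N * z| ≤ (r:ℝ) / N * (C / N + C * ((l:ℝ) / N) ^ γ) := by
    intro i l hil z hz r
    induction r with
    | zero => intro _; simp
    | succ r ih =>
      intro hr
      have a1 := ih (by omega)
      have a2 := h1 (i + r) (by omega)
      have a3 := hz r (by omega)
      have e : Y (i + (r + 1)) - Y i - ((r + 1 : ℕ):ℝ) / N * z = (Y (i + r) - Y i - (r:ℝ) / N * z)
        + (Y (i + r + 1) - Y (i + r) - Z (i + r) / N) + (Z (i + r) - z) / N := by
        push_cast; rw [← add_assoc]; ring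
      rw [e]
      refine (abs_add_three _ _ _).trans ?_
      have a4 : |(Z (i + r) - z) / N| ≤ (C * ((l:ℝ) / N) ^ γ) / N := by
        rw [abs_div, abs_of_pos hN0]; gcongr
      have : ((r + 1 : ℕ):ℝ) / N * (C / N + C * ((l:ℝ) / N) ^ γ) = (r:ℝ) / N * (C / N + C * ((l:ℝ) / N) ^ γ)
        + C / N / N + (C * ((l:ℝ) / N) ^ γ) / N := by push_cast; ring
      linarith
  have hdist : ∀ i j : ℕ, i ≤ j → |(j:ℝ) / N - (i:ℝ) / N| = ((j - i : ℕ):ℝ) / N := by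
    intro i j hij
    rw [Nat.cast_sub hij, ← sub_div, abs_of_nonneg]
    have : (i:ℝ) ≤ j := by exact_mod_cast hij
    exact div_nonneg (by linarith) hN0.le
  have hlow : ∀ i j : ℕ, i ≤ j → j ≤ n + 1 → ∀ z ∈ ({Z i, Z j} : Set ℝ),
      |Y j - Y i - ((j:ℝ) / N - (i:ℝ) / N) * z| ≤ C * (1 / N) + 2 * C * (|(j:ℝ) / N - (i:ℝ) / N| ^ γ * |(j:ℝ) / N - (i:ℝ) / N|) := by
    intro i j hij hj z hz
    obtain ⟨l, rfl⟩ := Nat.exists_eq_add_of_le hij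
    have hd := hdist i (i + l) hij
    rw [Nat.add_sub_cancel_left] at hd
    have hzz : ∀ r ≤ l, |Z (i + r) - z| ≤ C * ((l:ℝ) / N) ^ γ := by
      intro r hr
      have mono : ∀ q : ℕ, q ≤ l → C * ((q:ℝ) / N) ^ γ ≤ C * ((l:ℝ) / N) ^ γ := by
        intro q hq
        have : (q:ℝ) ≤ l := by exact_mod_cast hq
        gcongr
      rcases hz with rfl | hz
      · refine (h2 _ (by omega) _ (by omega)).trans ?_
        rw [hdist i (i + r) (by omega), Nat.add_sub_cancel_left]
        exact mono r hr
      · rw [mem_singleton_iff] at hz; subst hz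
        refine (h2 _ (by omega) _ (by omega)).trans ?_
        rw [abs_sub_comm, hdist (i + r) (i + l) (by omega)]
        exact mono _ (by omega)
    have := key i l hj z hzz l le_rfl
    rw [hd]
    have e : (((i + l : ℕ):ℝ) / N - (i:ℝ) / N) = (l:ℝ) / N := by push_cast; ring
    rw [e]
    refine this.trans ?_
    have hl1 : (l:ℝ) / N ≤ 1 := by
      rw [div_le_one hN0, hN]; have : l ≤ n + 1 := by omega
      exact_mod_cast this
    have hl0 : 0 ≤ (l:ℝ) / N := by positivity
    have p1 : (l:ℝ) / N * (C / N) ≤ C * (1 / N) := by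
      rw [mul_one_div]; exact mul_le_of_le_one_left (by positivity) hl1
    have p2 : 0 ≤ C * (((l:ℝ) / N) ^ γ * ((l:ℝ) / N)) := by positivity
    calc _ = (l:ℝ) / N * (C / N) + C * (((l:ℝ) / N) ^ γ * ((l:ℝ) / N)) := by ring
      _ ≤ _ := by linarith
  rcases le_total i j with hij | hij
  · exact hlow i j hij hj _ (by simp)
  · have := hlow j i hij hi (Z i) (by simp)
    have e : Y j - Y i - ((j:ℝ) / N - (i:ℝ) / N) * Z i = -(Y i - Y j - ((i:ℝ) / N - (j:ℝ) / N) * Z i) := by ring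
    rw [e, abs_neg, abs_sub_comm ((j:ℝ) / N)]
    exact this

lemma hasDerivWithinAt_of_bound {F : ℝ → ℝ} {G x C γ : ℝ} {s : Set ℝ} (hγ : 0 < γ)
    (h : ∀ y ∈ s, |F y - F x - (y - x) * G| ≤ C * (|y - x| ^ γ * |y - x|)) : HasDerivWithinAt F G s x := by
  rw [hasDerivWithinAt_iff_isLittleO]
  have h1 : (fun y => |y - x| ^ γ * |y - x|) =o[nhdsWithin x s] fun y => y - x := by
    have hc : Continuous fun y : ℝ => |y - x| ^ γ :=
      (continuous_id.sub continuous_const).abs.rpow_const fun _ => Or.inr hγ.le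
    have h2 : Filter.Tendsto (fun y : ℝ => |y - x| ^ γ) (nhdsWithin x s) (nhds 0) := by
      have := hc.tendsto x
      simp only [sub_self, abs_zero, Real.zero_rpow hγ.ne'] at this
      exact this.mono_left nhdsWithin_le_nhds
    have h3 := (Asymptotics.isLittleO_one_iff ℝ).2 h2
    have h4 := h3.mul_isBigO (Asymptotics.isBigO_refl (fun y => |y - x|) (nhdsWithin x s))
    simp only [one_mul] at h4
    exact h4.trans_isBigO (Asymptotics.isBigO_of_le _ fun y => by simp)
  refine Asymptotics.IsBigO.trans_isLittleO ?_ h1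
  refine Asymptotics.IsBigO.of_bound C ?_
  filter_upwards [self_mem_nhdsWithin] with y hy
  have := h y hy
  rw [Real.norm_eq_abs, Real.norm_eq_abs, abs_of_nonneg (by positivity : 0 ≤ |y - x| ^ γ * |y - x|)]
  simpa using this

lemma glim_space {T C C1 γ : ℝ} {Y Z : ℕ → ℕ → ℝ → ℝ} (hY : GB T C1 Y) (hZ : GB T C1 Z)
    (hC : 0 ≤ C) (hγ : 0 < γ) {t : ℝ} (ht : t ∈ Icc 0 T)
    (h1 : ∀ n, ∀ i ≤ n, |Y n (i + 1) t - Y n i t - Z n i t / ((n:ℝ) + 1)| ≤ C / ((n:ℝ) + 1) / ((n:ℝ) + 1))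
    (h2 : ∀ n, ∀ i ≤ n + 1, ∀ j ≤ n + 1, |Z n i t - Z n j t| ≤ C * |(i:ℝ) / ((n:ℝ) + 1) - (j:ℝ) / ((n:ℝ) + 1)| ^ γ)
    {x : ℝ} (hx : x ∈ Icc (0:ℝ) 1) :
    HasDerivWithinAt (fun y => glim Y y t) (glim Z x t) (Icc 0 1) x := by
  refine hasDerivWithinAt_of_bound (C := 2 * C) hγ fun y hy => ?_
  have t1 := (((tendsto_glim hY hy ht).sub (tendsto_glim hY hx ht)).sub
    (((tendsto_gi hy.1).sub (tendsto_gi hx.1)).mul (tendsto_glim hZ hx ht))).abs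
  have t2 := ((tendsto_inv_hyp.const_mul C).add
    (((tendsto_pow_gi hγ hy hx).mul ((tendsto_gi hy.1).sub (tendsto_gi hx.1)).abs).const_mul (2 * C)))
  rw [mul_zero, zero_add] at t2
  refine le_of_tendsto_of_tendsto t1 t2 (Filter.Eventually.of_forall fun n => ?_)
  exact disc_space (Y := fun i => Y n i t) (Z := fun i => Z n i t) hC hγ (h1 n) (h2 n) _ _ (gi_le hx) (gi_le hy)

lemma glim_time {T C C1 δ : ℝ} {Y Z : ℕ → ℕ → ℝ → ℝ} (hY : GB T C1 Y) (hZ : GB T C1 Z)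
    (hC : 0 ≤ C) (hδ : 0 < δ)
    (h1 : ∀ n, ∀ i ≤ n + 1, ∀ t ∈ Icc 0 T, HasDerivAt (Y n i) (Z n i t) t)
    (h2 : ∀ n, ∀ i ≤ n + 1, ∀ t ∈ Icc 0 T, ∀ s ∈ Icc 0 T, |Z n i t - Z n i s| ≤ C * |t - s| ^ δ)
    {x : ℝ} (hx : x ∈ Icc (0:ℝ) 1) {t : ℝ} (ht : t ∈ Icc 0 T) :
    HasDerivWithinAt (fun s => glim Y x s) (glim Z x t) (Icc 0 T) t := by
  refine hasDerivWithinAt_of_bound (C := C) hδ fun s hs => ?_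
  have t1 := (((tendsto_glim hY hx hs).sub (tendsto_glim hY hx ht)).sub
    ((tendsto_glim hZ hx ht).const_mul (s - t))).abs
  refine le_of_tendsto t1 (Filter.Eventually.of_forall fun n => ?_)
  set i := gi n x
  have hi : i ≤ n + 1 := gi_le hx
  have hsub : uIcc t s ⊆ Icc 0 T := uIcc_subset_Icc ht hs
  have := Convex.norm_image_sub_le_of_norm_hasDerivWithin_le (s := uIcc t s) (C := C * |s - t| ^ δ)
    (f := fun r => Y n i r - r * Z n i t) (f' := fun r => Z n i r - Z n i t)
    (fun r hr => by
      have := (h1 n i hi r (hsub hr)).sub ((hasDerivAt_id r).mul_const (Z n i t))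
      simp only [one_mul, id] at this
      exact this.hasDerivWithinAt)
    (fun r hr => by
      refine (h2 n i hi r (hsub hr) t ht).trans ?_
      have : |r - t| ≤ |s - t| := abs_sub_left_of_mem_uIcc hr
      gcongr)
    (convex_uIcc _ _) left_mem_uIcc right_mem_uIcc
  rw [Real.norm_eq_abs, Real.norm_eq_abs] at this
  have e : Y n i s - Y n i t - (s - t) * Z n i t = (Y n i s - s * Z n i t) - (Y n i t - t * Z n i t) := by ring
  rw [e, ← mul_assoc]
  exact this

end FwdSol

namespace FwdSol

def GHE (T γ δ : ℝ) (Y : ℕ → ℕ → ℝ → ℝ) : Prop := ∃ C, 0 ≤ C ∧ GB T C Y ∧ GH T C γ δ Y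

variable {T γ δ : ℝ} {Y Z : ℕ → ℕ → ℝ → ℝ}

lemma GB.mono {C C' : ℝ} (h : GB T C Y) (hC : C ≤ C') : GB T C' Y := fun n i hi t ht => (h n i hi t ht).trans hC

lemma GH.mono {C C' : ℝ} (h : GH T C γ δ Y) (hC : C ≤ C') : GH T C' γ δ Y := fun n i hi j hj t ht s hs =>
  (h n i hi j hj t ht s hs).trans (by gcongr)

lemma GHE.add (hY : GHE T γ δ Y) (hZ : GHE T γ δ Z) : GHE T γ δ (fun n i t => Y n i t + Z n i t) := by
  obtain ⟨C, hC, a1, a2⟩ := hY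
  obtain ⟨D, hD, b1, b2⟩ := hZ
  refine ⟨C + D, by positivity, fun n i hi t ht => ?_, fun n i hi j hj t ht s hs => ?_⟩
  · exact (abs_add_le _ _).trans (add_le_add (a1 n i hi t ht) (b1 n i hi t ht))
  · have h1 := a2 n i hi j hj t ht s hs
    have h2 := b2 n i hi j hj t ht s hs
    rw [add_sub_add_comm]
    refine (abs_add_le _ _).trans ((add_le_add h1 h2).trans (le_of_eq (by ring)))

lemma GHE.mul (hY : GHE T γ δ Y) (hZ : GHE T γ δ Z) : GHE T γ δ (fun n i t => Y n i t * Z n i t) := by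
  obtain ⟨C, hC, a1, a2⟩ := hY
  obtain ⟨D, hD, b1, b2⟩ := hZ
  refine ⟨2 * C * D, by positivity, fun n i hi t ht => ?_, fun n i hi j hj t ht s hs => ?_⟩
  · rw [abs_mul]
    refine (mul_le_mul (a1 n i hi t ht) (b1 n i hi t ht) (abs_nonneg _) hC).trans ?_
    nlinarith [mul_nonneg hC hD]
  · have h1 := a2 n i hi j hj t ht s hs
    have h2 := b2 n i hi j hj t ht s hs
    have h3 := a1 n j hj s hs
    have h4 := b1 n i hi t ht
    have e : Y n i t * Z n i t - Y n j s * Z n j s = (Y n i t - Y n j s) * Z n i t + Y n j s * (Z n i t - Z n j s) := by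
      ring
    rw [e]
    refine (abs_add_le _ _).trans ?_
    rw [abs_mul, abs_mul]
    refine (add_le_add (mul_le_mul h1 h4 (abs_nonneg _) (by positivity))
      (mul_le_mul h3 h2 (abs_nonneg _) hC)).trans (le_of_eq (by ring))

lemma GHE.lip {g : ℝ → ℝ} {L : ℝ} (hL : 0 ≤ L) (h0 : g 0 = 0) (hg : ∀ p q, |g q - g p| ≤ L * |q - p|)
    (hY : GHE T γ δ Y) : GHE T γ δ (fun n i t => g (Y n i t)) := by
  obtain ⟨C, hC, a1, a2⟩ := hY
  refine ⟨L * C, by positivity, fun n i hi t ht => ?_, fun n i hi j hj t ht s hs => ?_⟩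
  · have := hg 0 (Y n i t)
    rw [h0, sub_zero, sub_zero] at this
    exact this.trans (mul_le_mul_of_nonneg_left (a1 n i hi t ht) hL)
  · refine (hg _ _).trans ((mul_le_mul_of_nonneg_left (a2 n i hi j hj t ht s hs) hL).trans (le_of_eq (by ring)))

noncomputable def cs (Y : ℕ → ℕ → ℝ → ℝ) (n k : ℕ) (t : ℝ) : ℝ := (∑ i ∈ Finset.range k, Y n i t) / ((n:ℝ) + 1)

lemma cs_succ (Y : ℕ → ℕ → ℝ → ℝ) (n k : ℕ) (t : ℝ) : cs Y n (k + 1) t = cs Y n k t + Y n k t / ((n:ℝ) + 1) := by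
  simp only [cs]; rw [Finset.sum_range_succ]; ring

lemma cs_zero (Y : ℕ → ℕ → ℝ → ℝ) (n : ℕ) (t : ℝ) : cs Y n 0 t = 0 := by simp [cs]

lemma dist_le_one {n i j : ℕ} (hi : i ≤ n + 1) (hj : j ≤ n + 1) :
    |(i:ℝ) / ((n:ℝ) + 1) - (j:ℝ) / ((n:ℝ) + 1)| ≤ 1 := by
  have hN : (0:ℝ) < (n:ℝ) + 1 := by positivity
  have h1 : (i:ℝ) / ((n:ℝ) + 1) ≤ 1 := by rw [div_le_one hN]; exact_mod_cast hi
  have h2 : (j:ℝ) / ((n:ℝ) + 1) ≤ 1 := by rw [div_le_one hN]; exact_mod_cast hj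
  have h3 : 0 ≤ (i:ℝ) / ((n:ℝ) + 1) := by positivity
  have h4 : 0 ≤ (j:ℝ) / ((n:ℝ) + 1) := by positivity
  rw [abs_le]; constructor <;> linarith

/-- from a step bound in space and Hölder bound in time -/
lemma GH.of_step {C a : ℝ}
    (h1 : ∀ n, ∀ i ≤ n, ∀ t ∈ Icc 0 T, |Y n (i + 1) t - Y n i t| ≤ C / ((n:ℝ) + 1))
    (h2 : ∀ n, ∀ i ≤ n + 1, ∀ t ∈ Icc 0 T, ∀ s ∈ Icc 0 T, |Y n i t - Y n i s| ≤ C * |t - s| ^ a) :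
    GH T C 1 a Y := by
  have key : ∀ n i l, i + l ≤ n + 1 → ∀ t ∈ Icc 0 T,
      |Y n (i + l) t - Y n i t| ≤ C * |((i + l : ℕ):ℝ) / ((n:ℝ) + 1) - (i:ℝ) / ((n:ℝ) + 1)| := by
    intro n i l
    have e : |((i + l : ℕ):ℝ) / ((n:ℝ) + 1) - (i:ℝ) / ((n:ℝ) + 1)| = (l:ℝ) / ((n:ℝ) + 1) := by
      push_cast
      rw [add_div, add_sub_cancel_left, abs_of_nonneg (by positivity)]
    rw [e]; clear e
    induction l with
    | zero => intro _ t _; simp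
    | succ l ih =>
      intro hl t ht
      have := ih (by omega) t ht
      have h3 := h1 n (i + l) (by omega) t ht
      rw [← add_assoc]
      have e : Y n (i + l + 1) t - Y n i t = (Y n (i + l + 1) t - Y n (i + l) t) + (Y n (i + l) t - Y n i t) := by ring
      rw [e]
      refine (abs_add_le _ _).trans ((add_le_add h3 this).trans (le_of_eq ?_))
      push_cast; ring
  have key2 : ∀ n, ∀ i ≤ n + 1, ∀ j ≤ n + 1, ∀ t ∈ Icc 0 T,
      |Y n i t - Y n j t| ≤ C * |(i:ℝ) / ((n:ℝ) + 1) - (j:ℝ) / ((n:ℝ) + 1)| := by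
    intro n i hi j hj t ht
    rcases le_total j i with hij | hij
    · obtain ⟨l, rfl⟩ := Nat.exists_eq_add_of_le hij
      exact key n j l hi t ht
    · obtain ⟨l, rfl⟩ := Nat.exists_eq_add_of_le hij
      rw [abs_sub_comm, abs_sub_comm ((i:ℝ) / _)]
      exact key n i l hj t ht
  intro n i hi j hj t ht s hs
  rw [Real.rpow_one]
  have e : Y n i t - Y n j s = (Y n i t - Y n j t) + (Y n j t - Y n j s) := by ring
  rw [e]
  exact (abs_add_le _ _).trans (add_le_add (key2 n i hi j hj t ht) (h2 n j hj t ht s hs))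

lemma GH.toGHE {C C' a : ℝ} (hT : 0 < T) (hC : 0 ≤ C) (hC' : 0 ≤ C') (hB : GB T C' Y) (h : GH T C 1 a Y) (hγ : γ ≤ 1)
    (hδ : 0 < δ) (hδa : δ ≤ a) (ha : a ≤ 1) : GHE T γ δ Y := by
  refine ⟨C' + C * (T + 1), by positivity, hB.mono (by nlinarith [mul_nonneg hC hT.le]), fun n i hi j hj t ht s hs => ?_⟩
  have h1 := h n i hi j hj t ht s hs
  have hts : |t - s| ≤ T := by rw [abs_le]; constructor <;> linarith [ht.1, ht.2, hs.1, hs.2]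
  have h2 := rpow_le_of_le (abs_nonneg (t - s)) hts hδa ha hδ
  have h3 : |(i:ℝ) / ((n:ℝ) + 1) - (j:ℝ) / ((n:ℝ) + 1)| ^ (1:ℝ) ≤ |(i:ℝ) / ((n:ℝ) + 1) - (j:ℝ) / ((n:ℝ) + 1)| ^ γ := by
    rcases eq_or_lt_of_le (abs_nonneg ((i:ℝ) / ((n:ℝ) + 1) - (j:ℝ) / ((n:ℝ) + 1))) with h0 | h0
    · rw [← h0, Real.rpow_one]; exact Real.rpow_nonneg le_rfl _
    · exact Real.rpow_le_rpow_of_exponent_ge h0 (dist_le_one hi hj) hγ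
  set A := |(i:ℝ) / ((n:ℝ) + 1) - (j:ℝ) / ((n:ℝ) + 1)| ^ γ
  set B := |t - s| ^ δ
  have hA : 0 ≤ A := by positivity
  have hB : 0 ≤ B := by positivity
  have h4 : C * |t - s| ^ a ≤ C * (T + 1) * B := by
    rw [mul_assoc]; exact mul_le_mul_of_nonneg_left h2 hC
  have h5 := mul_le_mul_of_nonneg_left h3 hC
  have h6 : C * A ≤ C * (T + 1) * A := by nlinarith [mul_nonneg (mul_nonneg hC hT.le) hA]
  have h7 := mul_nonneg hC' hA
  have h8 := mul_nonneg hC' hB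
  linarith

lemma GHE.cs (hT : 0 < T) (hγ0 : 0 < γ) (hγ : γ ≤ 1) (hδ : 0 < δ) (hδ1 : δ ≤ 1) (hY : GHE T γ δ Y) : GHE T γ δ (cs Y) := by
  obtain ⟨C, hC, a1, a2⟩ := hY
  have key : ∀ n k : ℕ, k ≤ n + 1 → ∀ (g : ℕ → ℝ) (D : ℝ), 0 ≤ D → (∀ i ≤ n + 1, |g i| ≤ D) →
      |(∑ i ∈ Finset.range k, g i) / ((n:ℝ) + 1)| ≤ D := by
    intro n k hk g D hD hg
    have hN : (0:ℝ) < (n:ℝ) + 1 := by positivity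
    rw [abs_div, abs_of_pos hN, div_le_iff₀ hN]
    have hk' : (k:ℝ) ≤ (n:ℝ) + 1 := by exact_mod_cast hk
    calc _ ≤ ∑ i ∈ Finset.range k, |g i| := Finset.abs_sum_le_sum_abs _ _
      _ ≤ ∑ i ∈ Finset.range k, D := Finset.sum_le_sum fun i hi => hg i (by have := Finset.mem_range.1 hi; omega)
      _ = k * D := by simp
      _ ≤ _ := by nlinarith
  have hB : GB T C (FwdSol.cs Y) := fun n k hk t ht => key n k hk _ C hC fun i hi => a1 n i hi t ht
  refine GH.toGHE (a := δ) hT hC hC hB (GH.of_step ?_ ?_) hγ hδ le_rfl hδ1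
  · intro n i hi t ht
    rw [cs_succ, add_sub_cancel_left, abs_div, abs_of_pos (by positivity : (0:ℝ) < (n:ℝ) + 1)]
    have := a1 n i (by omega) t ht
    gcongr
  · intro n i hi t ht s hs
    simp only [FwdSol.cs]
    rw [← sub_div, ← Finset.sum_sub_distrib]
    refine key n i hi _ _ (by positivity) fun j hj => ?_
    have := a2 n j hj j hj t ht s hs
    rw [sub_self, abs_zero] at this
    rwa [Real.zero_rpow hγ0.ne', mul_zero, zero_add] at this

end FwdSol

namespace FwdSol

/-- clamp to `[0,T]` -/
noncomputable def cl (T x : ℝ) : ℝ := max 0 (min x T)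

lemma cl_mem {T : ℝ} (hT : 0 < T) (x : ℝ) : cl T x ∈ Icc 0 T :=
  ⟨le_max_left _ _, max_le hT.le (min_le_right _ _)⟩

lemma cl_eq {T x : ℝ} (hx : x ∈ Icc 0 T) : cl T x = x := by
  rw [cl, min_eq_left hx.2, max_eq_right hx.1]

lemma cl_cont (T : ℝ) : Continuous (cl T) := by unfold cl; fun_prop

lemma cl_lip (T x y : ℝ) : |cl T x - cl T y| ≤ |x - y| := by
  unfold cl
  refine (abs_max_sub_max_le_max _ _ _ _).trans ?_
  rw [sub_self, abs_zero]
  refine max_le (abs_nonneg _) ((abs_min_sub_min_le_max _ _ _ _).trans ?_)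
  rw [sub_self, abs_zero]
  exact max_le le_rfl (abs_nonneg _)

/-- A quintuple of potentials for the equation. -/
structure Pot (T : ℝ) (b c f : ℝ → ℝ → ℝ) (W u p w Q : ℝ → ℝ → ℝ) : Prop where
  cW : Continuous fun z : ℝ × ℝ => W z.1 z.2
  cu : Continuous fun z : ℝ × ℝ => u z.1 z.2
  cp : Continuous fun z : ℝ × ℝ => p z.1 z.2
  cw : Continuous fun z : ℝ × ℝ => w z.1 z.2
  cQ : Continuous fun z : ℝ × ℝ => Q z.1 z.2
  Wx : ∀ x ∈ Icc (0:ℝ) 1, ∀ t ∈ Icc 0 T, HasDerivWithinAt (fun y => W y t) (u x t) (Icc 0 1) x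
  ux : ∀ x ∈ Icc (0:ℝ) 1, ∀ t ∈ Icc 0 T, HasDerivWithinAt (fun y => u y t) (p x t) (Icc 0 1) x
  Qx : ∀ x ∈ Icc (0:ℝ) 1, ∀ t ∈ Icc 0 T, HasDerivWithinAt (fun y => Q y t)
    (b x t * p x t + c x t * u x t + f x t) (Icc 0 1) x
  Wt : ∀ x ∈ Icc (0:ℝ) 1, ∀ t ∈ Icc 0 T, HasDerivWithinAt (fun s => W x s) (w x t + Q x t) (Icc 0 T) t
  W0 : ∀ t ∈ Icc 0 T, W 0 t = 0
  Q0 : ∀ t ∈ Icc 0 T, Q 0 t = 0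
  w0 : ∀ t ∈ Icc 0 T, w 0 t = 0
  w1 : ∀ t ∈ Icc 0 T, w 1 t = 0

/-- clamped limit -/
noncomputable def gcl (T : ℝ) (Y : ℕ → ℕ → ℝ → ℝ) (x t : ℝ) : ℝ := glim Y (cl 1 x) (cl T t)

lemma gcl_eq {T x t : ℝ} (Y : ℕ → ℕ → ℝ → ℝ) (hx : x ∈ Icc (0:ℝ) 1) (ht : t ∈ Icc 0 T) : gcl T Y x t = glim Y x t := by
  rw [gcl, cl_eq hx, cl_eq ht]

lemma gcl_holder {T C C' γ δ : ℝ} {Y : ℕ → ℕ → ℝ → ℝ} (hT : 0 < T) (hC : 0 ≤ C) (hB : GB T C' Y) (h : GH T C γ δ Y) (hγ : 0 < γ)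
    (hδ : 0 < δ) (x y t s : ℝ) :
    |gcl T Y x t - gcl T Y y s| ≤ C * |x - y| ^ γ + C * |t - s| ^ δ := by
  refine (glim_holder hB h hγ (cl_mem one_pos x) (cl_mem one_pos y) (cl_mem hT t) (cl_mem hT s)).trans ?_
  have := cl_lip 1 x y
  have := cl_lip T t s
  gcongr

lemma GHE.gcl_cont {T γ δ : ℝ} {Y : ℕ → ℕ → ℝ → ℝ} (hT : 0 < T) (h : GHE T γ δ Y) (hγ : 0 < γ)
    (hδ : 0 < δ) : Continuous fun z : ℝ × ℝ => gcl T Y z.1 z.2 := by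
  obtain ⟨C, hC, h1, h2⟩ := h
  rw [continuous_iff_continuousAt]
  intro z
  rw [ContinuousAt, tendsto_iff_dist_tendsto_zero]
  have hc : Continuous fun y : ℝ × ℝ => C * |y.1 - z.1| ^ γ + C * |y.2 - z.2| ^ δ :=
    (((continuous_fst.sub continuous_const).abs.rpow_const fun _ => Or.inr hγ.le).const_mul C).add
      (((continuous_snd.sub continuous_const).abs.rpow_const fun _ => Or.inr hδ.le).const_mul C)
  have h3 := hc.tendsto z
  simp only [sub_self, abs_zero, Real.zero_rpow hγ.ne', Real.zero_rpow hδ.ne', mul_zero, add_zero] at h3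
  exact squeeze_zero (fun _ => dist_nonneg) (fun y => gcl_holder hT hC h1 h2 hγ hδ _ _ _ _) h3

variable {α lam Lam Ck : ℝ} {sig k : ℝ → ℝ} {Cb θ : ℝ} {b c f : ℝ → ℝ → ℝ}

lemma coef_GHE {T γ δ : ℝ} (hT : 0 < T) (hC : 0 ≤ Cb) (hδ : 0 < δ) (hδθ : δ ≤ θ) (hθ : θ ≤ 1) (h1 : ∀ x t, |b x t| ≤ Cb)
    (h2 : ∀ x t s, |b x t - b x s| ≤ Cb * |t - s| ^ θ) (h3 : ∀ x y t, |b x t - b y t| ≤ Cb * |x - y| ^ γ) :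
    GHE T γ δ (fun n i t => b ((i:ℝ) / ((n:ℝ) + 1)) t) := by
  refine ⟨Cb * (T + 1), by positivity, fun n i hi t ht => (h1 _ _).trans (by nlinarith [mul_nonneg hC hT.le]), ?_⟩
  intro n i hi j hj t ht s hs
  have hts : |t - s| ≤ T := by rw [abs_le]; constructor <;> linarith [ht.1, ht.2, hs.1, hs.2]
  have a1 := rpow_le_of_le (abs_nonneg (t - s)) hts hδθ hθ hδ
  have a2 := h3 ((i:ℝ) / ((n:ℝ) + 1)) ((j:ℝ) / ((n:ℝ) + 1)) t
  have a3 := h2 ((j:ℝ) / ((n:ℝ) + 1)) t s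
  have a4 := mul_le_mul_of_nonneg_left a1 hC
  refine (abs_sub_le _ (b ((j:ℝ) / ((n:ℝ) + 1)) t) _).trans ?_
  set A := |(i:ℝ) / ((n:ℝ) + 1) - (j:ℝ) / ((n:ℝ) + 1)| ^ γ
  have hA : 0 ≤ A := by positivity
  have : Cb * A ≤ Cb * (T + 1) * A := by nlinarith [mul_nonneg (mul_nonneg hC hT.le) hA]
  linarith

lemma hasDeriv_congr_gcl {T x t D : ℝ} {Y : ℕ → ℕ → ℝ → ℝ} (hx : x ∈ Icc (0:ℝ) 1) (ht : t ∈ Icc 0 T)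
    (h : HasDerivWithinAt (fun y => glim Y y t) D (Icc 0 1) x) :
    HasDerivWithinAt (fun y => gcl T Y y t) D (Icc 0 1) x :=
  h.congr (fun y hy => gcl_eq Y hy ht) (gcl_eq Y hx ht)

lemma hasDeriv_congr_gcl' {T x t D : ℝ} {Y : ℕ → ℕ → ℝ → ℝ} (hx : x ∈ Icc (0:ℝ) 1) (ht : t ∈ Icc 0 T)
    (h : HasDerivWithinAt (fun s => glim Y x s) D (Icc 0 T) t) :
    HasDerivWithinAt (fun s => gcl T Y x s) D (Icc 0 T) t :=
  h.congr (fun y hy => gcl_eq Y hx hy) (gcl_eq Y hx ht)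

lemma glim_eq_of_tendsto {T C : ℝ} {Y : ℕ → ℕ → ℝ → ℝ} (h : GB T C Y) {x t l : ℝ} (hx : x ∈ Icc (0:ℝ) 1)
    (ht : t ∈ Icc 0 T) (hl : Filter.Tendsto (fun n => Y n (gi n x) t) hyp (nhds l)) : glim Y x t = l :=
  tendsto_nhds_unique (tendsto_glim h hx ht) hl

lemma edge_ut {n : ℕ} (v : ℕ → ℝ) {i : ℕ} (hi : i ≤ n) :
    v (min (i + 1) n) - v (min i n) = edge n v (i + 1) / ((n:ℝ) + 1) := by
  have hN : (0:ℝ) < (n:ℝ) + 1 := by positivity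
  rcases Nat.lt_or_ge i n with h | h
  · rw [edge_succ v h, min_eq_left h, min_eq_left hi, mul_div_cancel_left₀ _ hN.ne']
  · have : i = n := le_antisymm hi h
    subst this
    rw [edge_last]; simp

set_option maxHeartbeats 1000000 in
theorem exists_pot {T C0 : ℝ} {u0 : ℝ → ℝ} (h : SReg α lam Lam Ck sig k) (hc : Coef Cb (α / 2) b c f)
    (hbx : ∀ x y t, |b x t - b y t| ≤ Cb * |x - y| ^ α)
    (hcx : ∀ x y t, |c x t - c y t| ≤ Cb * |x - y| ^ α)
    (hfx : ∀ x y t, |f x t - f y t| ≤ Cb * |x - y| ^ α)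
    (hT : 0 < T) (hC0 : 0 ≤ C0) (hini : ∀ n : ℕ, IniD n C0 (fun i => u0 ((i:ℝ) / ((n:ℝ) + 1))))
    (hu0 : ContinuousOn u0 (Icc 0 1)) :
    ∃ W u p Q : ℝ → ℝ → ℝ, Pot T b c f W u p (fun x t => sig (p x t)) Q ∧
      (∃ K, 0 ≤ K ∧ ∀ x y t s, |u x t - u y s| ≤ K * |x - y| + K * |t - s|) ∧ ∀ x ∈ Icc (0:ℝ) 1, u x 0 = u0 x := by
  obtain ⟨C, hC, hex⟩ := exists_disc h hc hC0 hT
  have ha0 := h.a0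
  have ha1 := h.a1
  obtain ⟨M, hM, hder⟩ := disc_deriv h hc (by linarith) hC hC0 hT
  have hex' := fun n => hex n _ (hini n)
  choose u hu hD using hex'
  have hR := fun n => hder n _ _ (hini n) (hu n) (hD n)
  have hdd := fun n => disc_dd h hc (hD n) (hR n)
  set D := (M + Cb * (2 * C + 1)) / lam with hDdef
  have hl := h.lam0
  have hCb := hc.C0
  have hD0 : 0 ≤ D := by positivity
  have hd4 : 0 < α / 4 := by positivity
  -- grid functions
  set U : ℕ → ℕ → ℝ → ℝ := fun n i t => u n (min i n) t with hUdef
  set P : ℕ → ℕ → ℝ → ℝ := fun n i t => edge n (fun k => u n k t) i with hPdef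
  have hUB : GB T C U := fun n i hi t ht => (hD n).bu _ (min_le_right _ _) t ht
  have hPB : GB T C P := fun n i hi t ht => (hD n).bp i hi t ht
  have hUs : ∀ n, ∀ i ≤ n, ∀ t, U n (i + 1) t - U n i t = P n (i + 1) t / ((n:ℝ) + 1) :=
    fun n i hi t => edge_ut (fun k => u n k t) hi
  have hPs : ∀ n, ∀ i ≤ n, ∀ t ∈ Icc 0 T, |P n (i + 1) t - P n i t| ≤ D / ((n:ℝ) + 1) := by
    intro n i hi t ht
    have := hdd n i hi t ht
    rw [dd, abs_mul, abs_of_pos (by positivity : (0:ℝ) < (n:ℝ) + 1)] at this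
    rw [le_div_iff₀ (by positivity)]; linarith
  have hUH : GH T (C + M) 1 1 U := by
    refine GH.of_step ?_ ?_
    · intro n i hi t ht
      rw [hUs n i hi, abs_div, abs_of_pos (by positivity : (0:ℝ) < (n:ℝ) + 1)]
      have := hPB n (i + 1) (by omega) t ht
      gcongr; linarith
    · intro n i hi t ht s hs
      have hi' : min i n ≤ n := min_le_right _ _
      have := Convex.norm_image_sub_le_of_norm_hasDerivWithin_le (s := Icc 0 T) (C := M)
        (f := u n (min i n)) (fun r hr => ((hD n).ode _ hi' r hr).hasDerivWithinAt)
        (fun r hr => hR n _ hi' r hr) (convex_Icc _ _) hs ht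
      rw [Real.norm_eq_abs, Real.norm_eq_abs] at this
      rw [Real.rpow_one]
      refine this.trans ?_
      gcongr; linarith
  have hPH : GH T (C + D) 1 (1 / 4) P := by
    refine GH.of_step (fun n i hi t ht => (hPs n i hi t ht).trans (by gcongr; linarith)) fun n i hi t ht s hs => ?_
    exact ((hD n).hp i hi t ht s hs).trans (by gcongr; linarith)
  have eU : GHE T α (α / 4) U := hUH.toGHE hT (by positivity) hC hUB ha1.le hd4 (by linarith) le_rfl
  have eP : GHE T α (α / 4) P := hPH.toGHE hT (by positivity) hC hPB ha1.le hd4 (by linarith) (by norm_num)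
  have eb := coef_GHE (T := T) (γ := α) (δ := α / 4) hT hCb hd4 (by linarith) (by linarith) hc.bb hc.bh hbx
  have ec := coef_GHE (T := T) (γ := α) (δ := α / 4) hT hCb hd4 (by linarith) (by linarith) hc.cb hc.ch hcx
  have ef := coef_GHE (T := T) (γ := α) (δ := α / 4) hT hCb hd4 (by linarith) (by linarith) hc.fb hc.fh hfx
  set G : ℕ → ℕ → ℝ → ℝ := fun n i t => b ((i:ℝ) / ((n:ℝ) + 1)) t * P n i t + c ((i:ℝ) / ((n:ℝ) + 1)) t * U n i t
    + f ((i:ℝ) / ((n:ℝ) + 1)) t with hGdef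
  have eG : GHE T α (α / 4) G := ((eb.mul eP).add (ec.mul eU)).add ef
  have eQ : GHE T α (α / 4) (cs G) := eG.cs hT ha0 ha1.le hd4 (by linarith)
  have eW : GHE T α (α / 4) (cs U) := eU.cs hT ha0 ha1.le hd4 (by linarith)
  have eS : GHE T α (α / 4) (fun n i t => sig (P n i t)) := eP.lip h.Lam0.le h.zero h.lipsig
  have eSQ := eS.add eQ
  have hWder : ∀ n, ∀ i ≤ n + 1, ∀ t ∈ Icc 0 T, HasDerivAt (cs U n i) (sig (P n i t) + cs G n i t) t := by
    intro n i hi t ht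
    induction i with
    | zero =>
      have e1 : cs U n 0 = fun _ => (0:ℝ) := by funext s; exact cs_zero _ _ _
      rw [e1, cs_zero]
      simp only [hPdef]
      rw [edge_zero, h.zero, add_zero]
      exact hasDerivAt_const _ _
    | succ i ih =>
      have hin : i ≤ n := by omega
      have e1 : cs U n (i + 1) = fun s => cs U n i s + U n i s / ((n:ℝ) + 1) := by funext s; exact cs_succ _ _ _ _
      rw [e1]
      have a1 := (hD n).ode i hin t ht
      have a2 := (ih (by omega)).add (a1.div_const ((n:ℝ) + 1))
      have e2 : U n i = u n i := by funext s; simp only [hUdef]; rw [min_eq_left hin]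
      rw [e2]
      refine a2.congr_deriv ?_
      have e3 : G n i t = gg n b c f t (fun k => u n k t) i := by
        simp only [hGdef, gg, hPdef, hUdef]; rw [min_eq_left hin]
      rw [cs_succ, e3, Fop, dd, add_div, mul_div_cancel_left₀ _ (by positivity : (n:ℝ) + 1 ≠ 0)]
      simp only [hPdef]
      ring
  have hpc := eP.gcl_cont hT ha0 hd4
  obtain ⟨C1, hC1, bU, hU1⟩ := eU
  obtain ⟨C2, hC2, bP, hP1⟩ := eP
  obtain ⟨C3, hC3, bG, hG1⟩ := eG
  obtain ⟨C4, hC4, bQ, hQ1⟩ := id eQ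
  obtain ⟨C5, hC5, bW, hW1⟩ := id eW
  obtain ⟨C6, hC6, bSQ, hSQ1⟩ := id eSQ
  have sp : ∀ {Y : ℕ → ℕ → ℝ → ℝ} {K : ℝ}, GH T K α (α / 4) Y → ∀ t ∈ Icc 0 T, ∀ n, ∀ i ≤ n + 1, ∀ j ≤ n + 1,
      |Y n i t - Y n j t| ≤ K * |(i:ℝ) / ((n:ℝ) + 1) - (j:ℝ) / ((n:ℝ) + 1)| ^ α := by
    intro Y K hY t ht n i hi j hj
    have := hY n i hi j hj t ht t ht
    rwa [sub_self, abs_zero, Real.zero_rpow hd4.ne', mul_zero, add_zero] at this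
  have tm : ∀ {Y : ℕ → ℕ → ℝ → ℝ} {K : ℝ}, GH T K α (α / 4) Y → ∀ n, ∀ i ≤ n + 1, ∀ t ∈ Icc 0 T, ∀ s ∈ Icc 0 T,
      |Y n i t - Y n i s| ≤ K * |t - s| ^ (α / 4) := by
    intro Y K hY n i hi t ht s hs
    have := hY n i hi i hi t ht s hs
    rwa [sub_self, abs_zero, Real.zero_rpow ha0.ne', mul_zero, zero_add] at this
  have hcx' : ∀ {g : ℝ → ℝ → ℝ}, (∀ x y t, |g x t - g y t| ≤ Cb * |x - y| ^ α) → ∀ x, 0 ≤ x → ∀ t,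
      Filter.Tendsto (fun n => g ((gi n x : ℝ) / ((n:ℝ) + 1)) t) hyp (nhds (g x t)) := by
    intro g hg x hx t
    have : Continuous fun x => g x t := cont_of_holder ha0 fun x y => hg x y t
    exact (this.tendsto x).comp (tendsto_gi hx)
  refine ⟨gcl T (cs U), gcl T U, gcl T P, gcl T (cs G), ⟨eW.gcl_cont hT ha0 hd4,
    GHE.gcl_cont hT ⟨C1, hC1, bU, hU1⟩ ha0 hd4, hpc, h.cont.comp hpc, eQ.gcl_cont hT ha0 hd4,
    ?_, ?_, ?_, ?_, ?_, ?_, ?_, ?_⟩, ⟨C + M, by positivity, ?_⟩, ?_⟩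
  · intro x hx t ht
    refine hasDeriv_congr_gcl hx ht ?_
    rw [gcl_eq U hx ht]
    refine glim_space (bW.mono (le_max_left C5 C1)) (bU.mono (le_max_right C5 C1)) hC1 ha0 ht ?_ (sp hU1 t ht) hx
    intro n i hi
    rw [cs_succ, add_sub_cancel_left, sub_self, abs_zero]; positivity
  · intro x hx t ht
    refine hasDeriv_congr_gcl hx ht ?_
    rw [gcl_eq P hx ht]
    refine glim_space (bU.mono (le_max_left C1 C2)) (bP.mono (le_max_right C1 C2)) (le_max_of_le_left hC2 : 0 ≤ max C2 D)
      ha0 ht ?_ ?_ hx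
    · intro n i hi
      rw [hUs n i hi, ← sub_div, abs_div, abs_of_pos (by positivity : (0:ℝ) < (n:ℝ) + 1)]
      have := hPs n i hi t ht
      have h2 : D / ((n:ℝ) + 1) ≤ max C2 D / ((n:ℝ) + 1) := by gcongr; exact le_max_right _ _
      have h3 := this.trans h2
      gcongr
    · intro n i hi j hj
      refine (sp hP1 t ht n i hi j hj).trans ?_
      gcongr; exact le_max_left _ _
  · intro x hx t ht
    refine hasDeriv_congr_gcl hx ht ?_
    rw [gcl_eq P hx ht, gcl_eq U hx ht]
    have e : glim G x t = b x t * glim P x t + c x t * glim U x t + f x t :=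
      glim_eq_of_tendsto bG hx ht ((((hcx' hbx x hx.1 t).mul (tendsto_glim bP hx ht)).add
        ((hcx' hcx x hx.1 t).mul (tendsto_glim bU hx ht))).add (hcx' hfx x hx.1 t))
    rw [← e]
    refine glim_space (bQ.mono (le_max_left C4 C3)) (bG.mono (le_max_right C4 C3)) hC3 ha0 ht ?_ (sp hG1 t ht) hx
    intro n i hi
    rw [cs_succ, add_sub_cancel_left, sub_self, abs_zero]; positivity
  · intro x hx t ht
    refine hasDeriv_congr_gcl' hx ht ?_
    rw [gcl_eq P hx ht, gcl_eq (cs G) hx ht]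
    have e : glim (fun n i t => sig (P n i t) + cs G n i t) x t = sig (glim P x t) + glim (cs G) x t :=
      glim_eq_of_tendsto bSQ hx ht (((h.cont.tendsto _).comp (tendsto_glim bP hx ht)).add (tendsto_glim bQ hx ht))
    rw [← e]
    exact glim_time (bW.mono (le_max_left C5 C6)) (bSQ.mono (le_max_right C5 C6)) hC6 hd4 hWder (tm hSQ1) hx ht
  · intro t ht
    rw [gcl_eq _ (by simp) ht]
    refine glim_eq_of_tendsto bW (by simp) ht ?_
    simp only [gi_zero, cs_zero]; exact tendsto_const_nhds
  · intro t ht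
    rw [gcl_eq _ (by simp) ht]
    refine glim_eq_of_tendsto bQ (by simp) ht ?_
    simp only [gi_zero, cs_zero]; exact tendsto_const_nhds
  · intro t ht
    have : gcl T P 0 t = 0 := by
      rw [gcl_eq _ (by simp) ht]
      refine glim_eq_of_tendsto bP (by simp) ht ?_
      simp only [gi_zero, hPdef, edge_zero]; exact tendsto_const_nhds
    simp only [this, h.zero]
  · intro t ht
    have : gcl T P 1 t = 0 := by
      rw [gcl_eq _ (by simp) ht]
      refine glim_eq_of_tendsto bP (by simp) ht ?_
      simp only [gi_one, hPdef, edge_last]; exact tendsto_const_nhds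
    simp only [this, h.zero]
  · intro x y t s
    have := gcl_holder hT (by positivity) hUB hUH one_pos one_pos x y t s
    simpa only [Real.rpow_one] using this
  · intro x hx
    have h0 : (0:ℝ) ∈ Icc 0 T := ⟨le_rfl, hT.le⟩
    rw [gcl_eq _ hx h0]
    refine glim_eq_of_tendsto bU hx h0 ?_
    have e : (fun n => U n (gi n x) 0) = fun n => u0 (((min (gi n x) n : ℕ) : ℝ) / ((n:ℝ) + 1)) := by
      funext n; exact hu n _ (min_le_right _ _)
    rw [e]
    have hmem : ∀ n : ℕ, ((min (gi n x) n : ℕ) : ℝ) / ((n:ℝ) + 1) ∈ Icc (0:ℝ) 1 := by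
      intro n
      refine ⟨by positivity, ?_⟩
      rw [div_le_one (by positivity)]
      have : min (gi n x) n ≤ n + 1 := (min_le_right _ _).trans (by omega)
      exact_mod_cast this
    refine (hu0 x hx).tendsto.comp (tendsto_nhdsWithin_iff.2 ⟨?_, Filter.Eventually.of_forall hmem⟩)
    have h1 : Filter.Tendsto (fun n : ℕ => (gi n x : ℝ) / ((n:ℝ) + 1) - 1 / ((n:ℝ) + 1)) hyp (nhds x) := by
      simpa using (tendsto_gi hx.1).sub tendsto_inv_hyp
    refine tendsto_of_tendsto_of_tendsto_of_le_of_le h1 (tendsto_gi hx.1) (fun n => ?_) (fun n => ?_)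
    · have : gi n x ≤ min (gi n x) n + 1 := by have := gi_le (n := n) hx; omega
      have h2 : (gi n x : ℝ) ≤ ((min (gi n x) n : ℕ):ℝ) + 1 := by exact_mod_cast this
      simp only
      rw [← sub_div]
      gcongr; linarith
    · have : min (gi n x) n ≤ gi n x := min_le_left _ _
      have h2 : ((min (gi n x) n : ℕ):ℝ) ≤ (gi n x : ℝ) := by exact_mod_cast this
      simp only
      gcongr

end FwdSol

namespace FwdSol

lemma lip_of_deriv {g g' : ℝ → ℝ} {K : ℝ} {s : Set ℝ} (hs : Convex ℝ s)
    (h : ∀ x ∈ s, HasDerivWithinAt g (g' x) s x) (hb : ∀ x ∈ s, |g' x| ≤ K) {x y : ℝ} (hx : x ∈ s) (hy : y ∈ s) :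
    |g x - g y| ≤ K * |x - y| := by
  have := Convex.norm_image_sub_le_of_norm_hasDerivWithin_le h hb hs hy hx
  simpa only [Real.norm_eq_abs] using this

lemma iniD_of {u0 u0' u0'' : ℝ → ℝ} {K : ℝ} (hK : 0 ≤ K)
    (h1 : ∀ x ∈ Icc (0:ℝ) 1, HasDerivWithinAt u0 (u0' x) (Icc (0:ℝ) 1) x)
    (h2 : ∀ x ∈ Icc (0:ℝ) 1, HasDerivWithinAt u0' (u0'' x) (Icc (0:ℝ) 1) x)
    (hb : ∀ x ∈ Icc (0:ℝ) 1, |u0'' x| ≤ K) (c0 : u0' 0 = 0) (c1 : u0' 1 = 0) (n : ℕ) :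
    IniD n (|u0 0| + 3 * K) (fun i => u0 ((i:ℝ) / ((n:ℝ) + 1))) := by
  set N := (n:ℝ) + 1 with hN
  have hN0 : 0 < N := by positivity
  have hN1 : 1 / N ≤ 1 := by rw [div_le_one hN0, hN]; linarith [(Nat.cast_nonneg n : (0:ℝ) ≤ n)]
  have z0 : (0:ℝ) ∈ Icc (0:ℝ) 1 := by simp
  have l2 : ∀ {x y : ℝ}, x ∈ Icc (0:ℝ) 1 → y ∈ Icc (0:ℝ) 1 → |u0' x - u0' y| ≤ K * |x - y| := fun hx hy =>
    lip_of_deriv (convex_Icc _ _) h2 hb hx hy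
  have b1 : ∀ x ∈ Icc (0:ℝ) 1, |u0' x| ≤ K := by
    intro x hx
    have := l2 hx z0
    rw [c0, sub_zero, sub_zero, abs_of_nonneg hx.1] at this
    nlinarith [hx.2]
  have l1 : ∀ {x y : ℝ}, x ∈ Icc (0:ℝ) 1 → y ∈ Icc (0:ℝ) 1 → |u0 x - u0 y| ≤ K * |x - y| := fun hx hy =>
    lip_of_deriv (convex_Icc _ _) h1 b1 hx hy
  have hm : ∀ i : ℕ, i ≤ n + 1 → (i:ℝ) / N ∈ Icc (0:ℝ) 1 := by
    intro i hi
    refine ⟨by positivity, ?_⟩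
    rw [div_le_one hN0, hN]; exact_mod_cast hi
  have hE : ∀ i ≤ n + 1, |edge n (fun i => u0 ((i:ℝ) / N)) i - u0' ((i:ℝ) / N)| ≤ K / N := by
    intro i hi
    rcases Nat.eq_zero_or_pos i with rfl | hpos
    · rw [edge_zero]; simp [c0]; positivity
    rcases Nat.lt_or_ge n i with hlt | hge
    · have : i = n + 1 := by omega
      subst this
      rw [edge_last]
      have e : ((n + 1 : ℕ):ℝ) / N = 1 := by push_cast; rw [← hN]; exact div_self hN0.ne'
      rw [e, c1]; simp; positivity
    · obtain ⟨j, rfl⟩ : ∃ j, i = j + 1 := ⟨i - 1, by omega⟩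
      rw [edge_succ _ (by omega), ← hN]
      have hx := hm (j + 1) hi
      have hy := hm j (by omega)
      set x := ((j + 1 : ℕ):ℝ) / N
      set y := (j:ℝ) / N with hyd
      have hxy : x - y = 1 / N := by simp only [x, y]; push_cast; ring
      have hsub : Icc y x ⊆ Icc (0:ℝ) 1 := Icc_subset_Icc hy.1 hx.2
      have hle : y ≤ x := by have : 0 < 1 / N := by positivity
                             linarith
      have key := lip_of_deriv (g := fun z => u0 z - z * u0' x) (g' := fun z => u0' z - 1 * u0' x) (K := K / N)
        (convex_Icc y x) (fun z hz => ((h1 z (hsub hz)).mono hsub).sub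
          ((hasDerivAt_id z).mul_const (u0' x)).hasDerivWithinAt)
        (fun z hz => by
          rw [one_mul]
          refine (l2 (hsub hz) hx).trans ?_
          rw [div_eq_mul_one_div, ← hxy, abs_sub_comm, abs_of_nonneg (by linarith [hz.2])]
          have := hz.1
          gcongr) (right_mem_Icc.2 hle) (left_mem_Icc.2 hle)
      rw [hxy, abs_of_pos (by positivity : 0 < 1 / N)] at key
      have e : N * (u0 x - u0 y) - u0' x = N * (u0 x - x * u0' x - (u0 y - y * u0' x)) := by
        have : N * (x - y) = 1 := by rw [hxy]; field_simp
        linear_combination (u0' x) * this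
      rw [e, abs_mul, abs_of_pos hN0]
      calc _ ≤ N * (K / N * (1 / N)) := by gcongr
        _ = K / N := by field_simp
  have hKN : K / N ≤ K := by rw [div_eq_mul_one_div]; exact mul_le_of_le_one_right hK hN1
  refine ⟨fun i hi => ?_, fun i hi => ?_, fun i hi => ?_⟩
  · have hx := hm i (by omega)
    have := l1 hx z0
    rw [sub_zero, abs_of_nonneg hx.1] at this
    have h3 : K * ((i:ℝ) / N) ≤ K := mul_le_of_le_one_right hK hx.2
    have h4 := abs_sub_abs_le_abs_sub (u0 ((i:ℝ) / N)) (u0 0)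
    linarith
  · have a1 := hE i hi
    have a2 := b1 _ (hm i hi)
    have h4 := abs_sub_abs_le_abs_sub (edge n (fun i => u0 ((i:ℝ) / N)) i) (u0' ((i:ℝ) / N))
    linarith [abs_nonneg (u0 0)]
  · have a1 := hE i (by omega)
    have a2 := hE (i + 1) (by omega)
    have a3 := l2 (hm (i + 1) (by omega)) (hm i (by omega))
    have e : |((i + 1 : ℕ):ℝ) / N - (i:ℝ) / N| = 1 / N := by
      push_cast; rw [add_div, add_sub_cancel_left, abs_of_pos (by positivity)]
    rw [e] at a3
    rw [dd, ← hN, abs_mul, abs_of_pos hN0]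
    have e2 : edge n (fun i => u0 ((i:ℝ) / N)) (i + 1) - edge n (fun i => u0 ((i:ℝ) / N)) i =
      (edge n (fun i => u0 ((i:ℝ) / N)) (i + 1) - u0' (((i + 1 : ℕ):ℝ) / N))
      + (u0' (((i + 1 : ℕ):ℝ) / N) - u0' ((i:ℝ) / N))
      + (u0' ((i:ℝ) / N) - edge n (fun i => u0 ((i:ℝ) / N)) i) := by ring
    have a4 : |edge n (fun i => u0 ((i:ℝ) / N)) (i + 1) - edge n (fun i => u0 ((i:ℝ) / N)) i| ≤ 3 * K * (1 / N) := by
      rw [e2]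
      refine (abs_add_three _ _ _).trans ?_
      rw [abs_sub_comm (u0' ((i:ℝ) / N))]
      have : K / N = K * (1 / N) := by ring
      linarith
    calc _ ≤ N * (3 * K * (1 / N)) := by gcongr
      _ = 3 * K := by field_simp
      _ ≤ _ := by linarith [abs_nonneg (u0 0)]

/-- clamped function -/
noncomputable def clf (T : ℝ) (g : ℝ → ℝ → ℝ) (x t : ℝ) : ℝ := g (cl 1 x) (cl T t)

lemma clf_eq {T x t : ℝ} (g : ℝ → ℝ → ℝ) (hx : x ∈ Icc (0:ℝ) 1) (ht : t ∈ Icc 0 T) : clf T g x t = g x t := by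
  rw [clf, cl_eq hx, cl_eq ht]

lemma clf_cont {T : ℝ} (hT : 0 < T) {g : ℝ → ℝ → ℝ}
    (hg : ContinuousOn (fun p : ℝ × ℝ => g p.1 p.2) (Icc (0:ℝ) 1 ×ˢ Icc 0 T)) :
    Continuous fun p : ℝ × ℝ => clf T g p.1 p.2 :=
  hg.comp_continuous (f := fun p : ℝ × ℝ => (cl 1 p.1, cl T p.2))
    (((cl_cont 1).comp continuous_fst).prodMk ((cl_cont T).comp continuous_snd))
    fun p => ⟨cl_mem one_pos _, cl_mem hT _⟩

lemma clf_coef {T α : ℝ} (hα : 0 < α) (hT : 0 < T) {g : ℝ → ℝ → ℝ}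
    (hg : ∃ C : ℝ, ∀ x ∈ Icc (0:ℝ) 1, ∀ y ∈ Icc (0:ℝ) 1, ∀ t ∈ Icc (0:ℝ) T, ∀ s ∈ Icc (0:ℝ) T,
    |g x t - g y s| ≤ C * (|x - y| ^ α + |t - s| ^ (α / 2))) :
    ∃ C, 0 ≤ C ∧ ∀ C' ≥ C, (∀ x t, |clf T g x t| ≤ C') ∧ (∀ x t s, |clf T g x t - clf T g x s| ≤ C' * |t - s| ^ (α / 2))
      ∧ (∀ x y t, |clf T g x t - clf T g y t| ≤ C' * |x - y| ^ α) := by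
  obtain ⟨C, hC⟩ := hg
  have z1 : (0:ℝ) ∈ Icc (0:ℝ) 1 := by simp
  have z2 : (0:ℝ) ∈ Icc (0:ℝ) T := ⟨le_rfl, hT.le⟩
  have ha2 : α / 2 ≠ 0 := by positivity
  refine ⟨|g 0 0| + |C| * (1 + T ^ (α / 2)), by positivity, fun C' hC' => ⟨fun x t => ?_, fun x t s => ?_, fun x y t => ?_⟩⟩
  · have hx := cl_mem one_pos x
    have ht := cl_mem hT t
    have := hC _ hx 0 z1 _ ht 0 z2
    rw [sub_zero, sub_zero, abs_of_nonneg hx.1, abs_of_nonneg ht.1] at this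
    have h1 : (cl 1 x) ^ α ≤ 1 := Real.rpow_le_one hx.1 hx.2 hα.le
    have h2 : (cl T t) ^ (α / 2) ≤ T ^ (α / 2) := Real.rpow_le_rpow ht.1 ht.2 (by positivity)
    have h3 : 0 ≤ (cl 1 x) ^ α := Real.rpow_nonneg hx.1 _
    have h4 : 0 ≤ (cl T t) ^ (α / 2) := Real.rpow_nonneg ht.1 _
    have h5 : C * ((cl 1 x) ^ α + (cl T t) ^ (α / 2)) ≤ |C| * (1 + T ^ (α / 2)) :=
      mul_le_mul (le_abs_self C) (by linarith) (by linarith) (abs_nonneg _)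
    have h6 := abs_sub_abs_le_abs_sub (g (cl 1 x) (cl T t)) (g 0 0)
    simp only [clf]
    linarith
  all_goals
    have hCC : |C| ≤ C' := by
      have : 0 ≤ |C| * T ^ (α / 2) := by positivity
      linarith [abs_nonneg (g 0 0)]
  · have := hC _ (cl_mem one_pos x) _ (cl_mem one_pos x) _ (cl_mem hT t) _ (cl_mem hT s)
    rw [sub_self, abs_zero, Real.zero_rpow hα.ne', zero_add] at this
    refine this.trans ?_
    have h1 := cl_lip T t s
    have h2 : |cl T t - cl T s| ^ (α / 2) ≤ |t - s| ^ (α / 2) := by gcongr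
    exact mul_le_mul ((le_abs_self C).trans hCC) h2 (by positivity) (by linarith [abs_nonneg C])
  · have := hC _ (cl_mem one_pos x) _ (cl_mem one_pos y) _ (cl_mem hT t) _ (cl_mem hT t)
    rw [sub_self, abs_zero, Real.zero_rpow ha2, add_zero] at this
    refine this.trans ?_
    have h1 := cl_lip 1 x y
    have h2 : |cl 1 x - cl 1 y| ^ α ≤ |x - y| ^ α := by gcongr
    exact mul_le_mul ((le_abs_self C).trans hCC) h2 (by positivity) (by linarith [abs_nonneg C])

end FwdSol

namespace FwdSol

lemma cmp {f g f' g' : ℝ → ℝ} {a b : ℝ} (hab : a ≤ b)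
    (hf : ∀ x ∈ Icc a b, HasDerivWithinAt f (f' x) (Icc a b) x)
    (hg : ∀ x ∈ Icc a b, HasDerivWithinAt g (g' x) (Icc a b) x)
    (h : ∀ x ∈ Icc a b, f' x ≤ g' x) : f b - f a ≤ g b - g a := by
  have hd : ∀ x ∈ Icc a b, HasDerivWithinAt (fun y => g y - f y) (g' x - f' x) (Icc a b) x :=
    fun x hx => (hg x hx).sub (hf x hx)
  have hm : MonotoneOn (fun y => g y - f y) (Icc a b) := by
    refine monotoneOn_of_hasDerivWithinAt_nonneg (f' := fun x => g' x - f' x) (convex_Icc a b)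
      (fun x hx => (hd x hx).continuousWithinAt) (fun x hx => ?_) (fun x hx => ?_)
    · exact (hd x (interior_subset hx)).mono interior_subset
    · exact sub_nonneg.2 (h x (interior_subset hx))
  have := hm (left_mem_Icc.2 hab) (right_mem_Icc.2 hab) hab
  simp only at this
  linarith

lemma cmp_eq {f g f' g' : ℝ → ℝ} {a b : ℝ} (hab : a ≤ b)
    (hf : ∀ x ∈ Icc a b, HasDerivWithinAt f (f' x) (Icc a b) x)
    (hg : ∀ x ∈ Icc a b, HasDerivWithinAt g (g' x) (Icc a b) x)
    (h : ∀ x ∈ Icc a b, f' x = g' x) : f b - f a = g b - g a :=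
  le_antisymm (cmp hab hf hg fun x hx => (h x hx).le) (cmp hab hg hf fun x hx => (h x hx).ge)

lemma inv_branch {S S' : ℝ → ℝ} {a b m : ℝ} (hab : a ≤ b) (hm : 0 < m)
    (hd : ∀ x ∈ Icc a b, HasDerivWithinAt S (S' x) (Icc a b) x) (hS : ∀ x ∈ Icc a b, m ≤ S' x) :
    ∃ L : ℝ → ℝ, Continuous L ∧ Monotone L ∧ (∀ w, L w ∈ Icc a b) ∧ (∀ w ∈ Icc (S a) (S b), S (L w) = w) ∧
      ∀ s ∈ Icc a b, L (S s) = s := by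
  have hex : ∀ x ∈ Icc a b, ∀ y ∈ Icc a b, x ≤ y → m * (y - x) ≤ S y - S x := by
    intro x hx y hy hxy
    have hsub : Icc x y ⊆ Icc a b := Icc_subset_Icc hx.1 hy.2
    have := cmp (f := fun z => m * z) (f' := fun _ => m) (g := S) (g' := S') hxy
      (fun z _ => by simpa using ((hasDerivAt_id z).const_mul m).hasDerivWithinAt)
      (fun z hz => (hd z (hsub hz)).mono hsub) (fun z hz => hS z (hsub hz))
    linarith
  have hcont : ContinuousOn S (Icc a b) := fun x hx => (hd x hx).continuousWithinAt
  have hle : S a ≤ S b := by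
    have := hex a (left_mem_Icc.2 hab) b (right_mem_Icc.2 hab) hab
    nlinarith
  set pr : ℝ → ℝ := fun w => max (S a) (min w (S b)) with hpr
  have prm : ∀ w, pr w ∈ Icc (S a) (S b) := fun w => ⟨le_max_left _ _, max_le hle (min_le_right _ _)⟩
  have pre : ∀ w ∈ Icc (S a) (S b), pr w = w := by
    intro w hw; simp only [hpr]; rw [min_eq_left hw.2, max_eq_right hw.1]
  have prmono : Monotone pr := fun v w h => max_le_max le_rfl (min_le_min h le_rfl)
  have prlip : ∀ v w, |pr v - pr w| ≤ |v - w| := by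
    intro v w
    refine (abs_max_sub_max_le_max _ _ _ _).trans ?_
    rw [sub_self, abs_zero]
    refine max_le (abs_nonneg _) ((abs_min_sub_min_le_max _ _ _ _).trans ?_)
    rw [sub_self, abs_zero]
    exact max_le le_rfl (abs_nonneg _)
  have hs : ∀ w, ∃ x ∈ Icc a b, S x = pr w := fun w => intermediate_value_Icc hab hcont (prm w)
  choose L hL1 hL2 using hs
  have hexa : ∀ x ∈ Icc a b, ∀ y ∈ Icc a b, m * |y - x| ≤ |S y - S x| := by
    intro x hx y hy
    rcases le_total x y with h | h
    · have := hex x hx y hy h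
      rw [abs_of_nonneg (by linarith)]
      exact this.trans (le_abs_self _)
    · have := hex y hy x hx h
      rw [abs_sub_comm, abs_of_nonneg (by linarith), abs_sub_comm (S y)]
      exact this.trans (le_abs_self _)
  refine ⟨L, ?_, ?_, hL1, fun w hw => by rw [hL2, pre w hw], ?_⟩
  · refine (LipschitzWith.of_dist_le_mul (K := Real.toNNReal (1 / m)) fun v w => ?_).continuous
    have h1 := hexa _ (hL1 w) _ (hL1 v)
    rw [hL2, hL2] at h1
    have h2 := h1.trans (prlip v w)
    rw [Real.dist_eq, Real.dist_eq, Real.coe_toNNReal _ (by positivity), one_div, ← div_eq_inv_mul, le_div_iff₀ hm]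
    linarith
  · intro v w hvw
    by_contra hcon
    push Not at hcon
    have h1 := hex _ (hL1 w) _ (hL1 v) hcon.le
    rw [hL2, hL2] at h1
    have := prmono hvw
    nlinarith
  · intro s hsm
    have hmem : S s ∈ Icc (S a) (S b) := by
      constructor
      · have := hex a (left_mem_Icc.2 hab) s hsm hsm.1; nlinarith [hsm.1]
      · have := hex s hsm b (right_mem_Icc.2 hab) hsm.2; nlinarith [hsm.2]
    have h1 := hexa _ (hL1 (S s)) s hsm
    rw [hL2, pre _ hmem, sub_self, abs_zero] at h1
    have : |s - L (S s)| ≤ 0 := by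
      by_contra hc; push Not at hc; nlinarith
    have := abs_nonpos_iff.1 this
    linarith

/-! bounded Hölder functions on the line -/
def BHol (α : ℝ) (g : ℝ → ℝ) : Prop := ∃ C, 0 ≤ C ∧ (∀ s, |g s| ≤ C) ∧ ∀ s t, |g s - g t| ≤ C * |s - t| ^ α

variable {α : ℝ} {g h : ℝ → ℝ}

lemma BHol.add (hg : BHol α g) (hh : BHol α h) : BHol α (fun s => g s + h s) := by
  obtain ⟨C, hC, a1, a2⟩ := hg
  obtain ⟨D, hD, b1, b2⟩ := hh
  refine ⟨C + D, by positivity, fun s => (abs_add_le _ _).trans (add_le_add (a1 s) (b1 s)), fun s t => ?_⟩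
  rw [add_sub_add_comm, add_mul]
  exact (abs_add_le _ _).trans (add_le_add (a2 s t) (b2 s t))

lemma BHol.mul (hg : BHol α g) (hh : BHol α h) : BHol α (fun s => g s * h s) := by
  obtain ⟨C, hC, a1, a2⟩ := hg
  obtain ⟨D, hD, b1, b2⟩ := hh
  refine ⟨2 * C * D, by positivity, fun s => ?_, fun s t => ?_⟩
  · rw [abs_mul]
    refine (mul_le_mul (a1 s) (b1 s) (abs_nonneg _) hC).trans ?_
    nlinarith [mul_nonneg hC hD]
  · have e : g s * h s - g t * h t = (g s - g t) * h s + g t * (h s - h t) := by ring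
    rw [e]
    refine (abs_add_le _ _).trans ?_
    rw [abs_mul, abs_mul]
    refine (add_le_add (mul_le_mul (a2 s t) (b1 s) (abs_nonneg _) (by positivity))
      (mul_le_mul (a1 t) (b2 s t) (abs_nonneg _) hC)).trans (le_of_eq (by ring))

lemma BHol.const (c : ℝ) : BHol α (fun _ => c) :=
  ⟨|c|, abs_nonneg _, fun _ => le_rfl, fun s t => by rw [sub_self, abs_zero]; positivity⟩

lemma BHol.of_lip (ha0 : 0 < α) (ha1 : α ≤ 1) {C K : ℝ} (hC : 0 ≤ C) (hK : 0 ≤ K) (h1 : ∀ s, |g s| ≤ C)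
    (h2 : ∀ s t, |g s - g t| ≤ K * |s - t|) : BHol α g := by
  refine ⟨2 * C + K, by positivity, fun s => (h1 s).trans (by linarith), fun s t => ?_⟩
  rcases le_total |s - t| 1 with h | h
  · have h3 : |s - t| ≤ |s - t| ^ α := by
      rcases eq_or_lt_of_le (abs_nonneg (s - t)) with h0 | h0
      · rw [← h0]; exact Real.rpow_nonneg le_rfl _
      · have := Real.rpow_le_rpow_of_exponent_ge h0 h ha1
        rwa [Real.rpow_one] at this
    calc _ ≤ K * |s - t| := h2 s t
      _ ≤ K * |s - t| ^ α := by gcongr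
      _ ≤ _ := by gcongr; linarith
  · have h3 : 1 ≤ |s - t| ^ α := Real.one_le_rpow h ha0.le
    have h4 : |g s - g t| ≤ 2 * C := (abs_sub _ _).trans (by linarith [h1 s, h1 t])
    nlinarith

end FwdSol

namespace FwdSol

lemma min_lip (a s t : ℝ) : |min s a - min t a| ≤ |s - t| := by
  refine (abs_min_sub_min_le_max _ _ _ _).trans ?_
  rw [sub_self, abs_zero]; exact max_le le_rfl (abs_nonneg _)

lemma max_lip (a s t : ℝ) : |max s a - max t a| ≤ |s - t| := by
  refine (abs_max_sub_max_le_max _ _ _ _).trans ?_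
  rw [sub_self, abs_zero]; exact max_le le_rfl (abs_nonneg _)

variable {α s1 s2 lam Lam : ℝ} {sigma sigma' : ℝ → ℝ}

lemma hol_left (hF : FluxHyp α s1 s2 lam Lam sigma sigma') {a : ℝ} (ha : a ≤ s1) :
    ∃ C, 0 ≤ C ∧ ∀ s t, |sigma' (min s a) - sigma' (min t a)| ≤ C * |s - t| ^ α := by
  obtain ⟨C, hC⟩ := hF.holder_left
  have h0 := hF.alpha_pos
  refine ⟨|C|, abs_nonneg _, fun s t => ?_⟩
  refine (hC _ (mem_Iic.2 ((min_le_right _ _).trans ha)) _ (mem_Iic.2 ((min_le_right _ _).trans ha))).trans ?_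
  have := min_lip a s t
  have h2 : |min s a - min t a| ^ α ≤ |s - t| ^ α := by gcongr
  exact mul_le_mul (le_abs_self C) h2 (by positivity) (abs_nonneg _)

lemma hol_right (hF : FluxHyp α s1 s2 lam Lam sigma sigma') {a : ℝ} (ha : s2 ≤ a) :
    ∃ C, 0 ≤ C ∧ ∀ s t, |sigma' (max s a) - sigma' (max t a)| ≤ C * |s - t| ^ α := by
  obtain ⟨C, hC⟩ := hF.holder_right
  have h0 := hF.alpha_pos
  refine ⟨|C|, abs_nonneg _, fun s t => ?_⟩
  refine (hC _ (mem_Ici.2 (ha.trans (le_max_right _ _))) _ (mem_Ici.2 (ha.trans (le_max_right _ _)))).trans ?_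
  have := max_lip a s t
  have h2 : |max s a - max t a| ^ α ≤ |s - t| ^ α := by gcongr
  exact mul_le_mul (le_abs_self C) h2 (by positivity) (abs_nonneg _)

lemma left_bounds (hF : FluxHyp α s1 s2 lam Lam sigma sigma') {a : ℝ} (ha : a < s1) :
    ∃ m M, 0 < m ∧ ∀ s ≤ a, m ≤ sigma' s ∧ sigma' s ≤ M := by
  obtain ⟨C, hC, hh⟩ := hol_left hF ha.le
  have h1 := hF.s1_pos
  have h2 := hF.lam_pos
  obtain ⟨C, hC, hh⟩ := hol_left hF le_rfl
  have hcont : Continuous fun s => sigma' (min s s1) := cont_of_holder hF.alpha_pos hh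
  have hne : (Icc (s1 / 2) (max a (s1 / 2))).Nonempty := nonempty_Icc.2 (le_max_right _ _)
  obtain ⟨x, hx, hxm⟩ := isCompact_Icc.exists_isMinOn hne hcont.continuousOn
  obtain ⟨y, hy, hym⟩ := isCompact_Icc.exists_isMaxOn hne hcont.continuousOn
  have hlt : ∀ z ∈ Icc (s1 / 2) (max a (s1 / 2)), z < s1 := fun z hz =>
    lt_of_le_of_lt hz.2 (max_lt ha (by linarith))
  have hx0 : 0 < sigma' (min x s1) := by
    rw [min_eq_left (hlt x hx).le]; exact hF.deriv_pos x (Or.inl (hlt x hx))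
  refine ⟨min lam (sigma' (min x s1)), max Lam (sigma' (min y s1)), lt_min h2 hx0, fun s hs => ?_⟩
  rcases lt_or_ge s (s1 / 2) with h | h
  · exact ⟨(min_le_left _ _).trans (hF.deriv_lb s (Or.inl h)), (hF.deriv_ub s (Or.inl h)).trans (le_max_left _ _)⟩
  · have hm : s ∈ Icc (s1 / 2) (max a (s1 / 2)) := ⟨h, hs.trans (le_max_left _ _)⟩
    have e1 := hxm hm
    have e2 := hym hm
    simp only [mem_ofPred_eq] at e1 e2
    rw [min_eq_left (hlt s hm).le] at e1 e2
    exact ⟨(min_le_right _ _).trans e1, e2.trans (le_max_right _ _)⟩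

lemma right_bounds (hF : FluxHyp α s1 s2 lam Lam sigma sigma') {a : ℝ} (ha : s2 < a) :
    ∃ m M, 0 < m ∧ ∀ s, a ≤ s → m ≤ sigma' s ∧ sigma' s ≤ M := by
  have h1 : 0 < s2 := hF.s1_pos.trans hF.s1_lt_s2
  have h2 := hF.lam_pos
  obtain ⟨C, hC, hh⟩ := hol_right hF le_rfl
  have hcont : Continuous fun s => sigma' (max s s2) := cont_of_holder hF.alpha_pos hh
  have hne : (Icc (min a (2 * s2)) (2 * s2)).Nonempty := nonempty_Icc.2 (min_le_right _ _)
  obtain ⟨x, hx, hxm⟩ := isCompact_Icc.exists_isMinOn hne hcont.continuousOn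
  obtain ⟨y, hy, hym⟩ := isCompact_Icc.exists_isMaxOn hne hcont.continuousOn
  have hlt : ∀ z ∈ Icc (min a (2 * s2)) (2 * s2), s2 < z := fun z hz =>
    lt_of_lt_of_le (lt_min ha (by linarith)) hz.1
  have hx0 : 0 < sigma' (max x s2) := by
    rw [max_eq_left (hlt x hx).le]; exact hF.deriv_pos x (Or.inr (hlt x hx))
  refine ⟨min lam (sigma' (max x s2)), max Lam (sigma' (max y s2)), lt_min h2 hx0, fun s hs => ?_⟩
  rcases lt_or_ge (2 * s2) s with h | h
  · exact ⟨(min_le_left _ _).trans (hF.deriv_lb s (Or.inr h)), (hF.deriv_ub s (Or.inr h)).trans (le_max_left _ _)⟩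
  · have hm : s ∈ Icc (min a (2 * s2)) (2 * s2) := ⟨(min_le_left _ _).trans hs, h⟩
    have e1 := hxm hm
    have e2 := hym hm
    simp only [mem_ofPred_eq] at e1 e2
    rw [max_eq_left (hlt s hm).le] at e1 e2
    exact ⟨(min_le_right _ _).trans e1, e2.trans (le_max_right _ _)⟩

lemma mono_left (hF : FluxHyp α s1 s2 lam Lam sigma sigma') : StrictMonoOn sigma (Iic s1) := by
  refine strictMonoOn_of_hasDerivWithinAt_pos (f' := sigma') (convex_Iic s1)
    (fun x hx => (hF.deriv_left x hx).continuousWithinAt) (fun x hx => ?_) (fun x hx => ?_)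
  · exact (hF.deriv_left x (interior_subset hx)).mono interior_subset
  · rw [interior_Iic] at hx; exact hF.deriv_pos x (Or.inl hx)

lemma mono_right (hF : FluxHyp α s1 s2 lam Lam sigma sigma') : StrictMonoOn sigma (Ici s2) := by
  refine strictMonoOn_of_hasDerivWithinAt_pos (f' := sigma') (convex_Ici s2)
    (fun x hx => (hF.deriv_right x hx).continuousWithinAt) (fun x hx => ?_) (fun x hx => ?_)
  · exact (hF.deriv_right x (interior_subset hx)).mono interior_subset
  · rw [interior_Ici] at hx; exact hF.deriv_pos x (Or.inr hx)

lemma inv_left (hF : FluxHyp α s1 s2 lam Lam sigma sigma') {w : ℝ} (h1 : sigma s2 < w) (h2 : w < sigma s1) :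
    ∃ s, 0 < s ∧ s < s1 ∧ sigma s = w := by
  have h0 := hF.sigma_s2_nonneg
  have hc : ContinuousOn sigma (Icc 0 s1) := fun x hx =>
    ((hF.deriv_left x hx.2).mono Icc_subset_Iic_self).continuousWithinAt
  obtain ⟨s, hs, he⟩ := intermediate_value_Icc hF.s1_pos.le hc (show w ∈ _ by
    rw [hF.sigma_zero]; exact ⟨by linarith, h2.le⟩)
  refine ⟨s, lt_of_le_of_ne hs.1 ?_, lt_of_le_of_ne hs.2 ?_, he⟩
  · rintro rfl; rw [hF.sigma_zero] at he; linarith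
  · rintro rfl; linarith

lemma inv_right (hF : FluxHyp α s1 s2 lam Lam sigma sigma') {w : ℝ} (h1 : sigma s2 < w) :
    ∃ s, s2 < s ∧ sigma s = w := by
  have hs2 : 0 < s2 := hF.s1_pos.trans hF.s1_lt_s2
  have hl := hF.lam_pos
  set X := 2 * s2 + 1 + |w - sigma (2 * s2 + 1)| / lam with hX
  have hX0 : 2 * s2 + 1 ≤ X := by rw [hX]; have : 0 ≤ |w - sigma (2 * s2 + 1)| / lam := by positivity
                                  linarith
  have hsub : Icc (2 * s2 + 1) X ⊆ Ici s2 := fun x hx => mem_Ici.2 (by linarith [hx.1])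
  have hw : w ≤ sigma X := by
    have := cmp (f := fun z => lam * z) (f' := fun _ => lam) (g := sigma) (g' := sigma') hX0
      (fun z _ => by simpa using ((hasDerivAt_id z).const_mul lam).hasDerivWithinAt)
      (fun z hz => (hF.deriv_right z (hsub hz)).mono hsub)
      (fun z hz => hF.deriv_lb z (Or.inr (by linarith [hz.1])))
    have e : lam * X - lam * (2 * s2 + 1) = |w - sigma (2 * s2 + 1)| := by rw [hX]; field_simp; ring
    have := le_abs_self (w - sigma (2 * s2 + 1))
    linarith
  have hc : ContinuousOn sigma (Icc s2 X) := fun x hx =>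
    ((hF.deriv_right x hx.1).mono Icc_subset_Ici_self).continuousWithinAt
  obtain ⟨s, hs, he⟩ := intermediate_value_Icc (by linarith) hc (show w ∈ _ from ⟨h1.le, hw⟩)
  refine ⟨s, lt_of_le_of_ne hs.1 ?_, he⟩
  rintro rfl; linarith

end FwdSol

namespace FwdSol

structure Rel (sigma : ℝ → ℝ) (s1 s2 : ℝ) (sig : ℝ → ℝ) (A B R1 R2 eps : ℝ) (L U : ℝ → ℝ) : Prop where
  e0 : 0 < eps
  Lc : Continuous L
  Uc : Continuous U
  A1 : A < s1
  B2 : s2 < B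
  AB : A < B
  lo : ∀ s ≤ A, sig s = sigma s
  hi : ∀ s, B ≤ s → sig s = sigma s
  r1 : ∀ s ∈ Icc A B, R1 + eps ≤ sig s
  r2 : ∀ s ∈ Icc A B, sig s ≤ R2 - eps
  rL : ∀ s ∈ Icc A B, L (sig s) ≤ s
  rU : ∀ s ∈ Icc A B, s ≤ U (sig s)
  Lp : ∀ w ∈ Icc R1 R2, sigma (L w) = w
  Up : ∀ w ∈ Icc R1 R2, sigma (U w) = w
  Ls : ∀ w, L w < s1
  Us : ∀ w, s2 < U w

lemma cl_zero {x : ℝ} (hx : x ≤ 0) : cl 1 x = 0 := by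
  rw [cl, max_eq_left]; exact (min_le_left _ _).trans hx

lemma cl_one {x : ℝ} (hx : 1 ≤ x) : cl 1 x = 1 := by
  rw [cl, min_eq_right hx, max_eq_right zero_le_one]

lemma hasDerivAt_prim {g : ℝ → ℝ} (hg : Continuous g) (x : ℝ) :
    HasDerivAt (fun s => ∫ r in (0:ℝ)..s, g r) (g x) x :=
  (hg.integral_hasStrictDerivAt 0 x).hasDerivAt

noncomputable def tent (s1 s2 s : ℝ) : ℝ := max 0 (min (s - s1) (s2 - s))

lemma tent_nonneg (s1 s2 s : ℝ) : 0 ≤ tent s1 s2 s := le_max_left _ _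

lemma tent_le {s1 s2 : ℝ} (h : s1 < s2) (s : ℝ) : tent s1 s2 s ≤ s2 - s1 := by
  refine max_le (by linarith) ?_
  rcases le_total s s2 with h1 | h1
  · exact (min_le_left _ _).trans (by linarith)
  · exact (min_le_right _ _).trans (by linarith)

lemma tent_left {s1 s2 s : ℝ} (h : s ≤ s1) : tent s1 s2 s = 0 :=
  max_eq_left ((min_le_left _ _).trans (by linarith))

lemma tent_right {s1 s2 s : ℝ} (h : s2 ≤ s) : tent s1 s2 s = 0 :=
  max_eq_left ((min_le_right _ _).trans (by linarith))

lemma tent_lip (s1 s2 s t : ℝ) : |tent s1 s2 s - tent s1 s2 t| ≤ 1 * |s - t| := by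
  rw [one_mul]
  refine (abs_max_sub_max_le_max _ _ _ _).trans ?_
  rw [sub_self, abs_zero]
  refine max_le (abs_nonneg _) ((abs_min_sub_min_le_max _ _ _ _).trans ?_)
  have e1 : s - s1 - (t - s1) = s - t := by ring
  have e2 : s2 - s - (s2 - t) = t - s := by ring
  rw [e1, e2, abs_sub_comm t s, max_self]

lemma cl_aff_lip (A l s t : ℝ) : |cl 1 ((s - A) / l) - cl 1 ((t - A) / l)| ≤ |1 / l| * |s - t| := by
  refine (cl_lip _ _ _).trans (le_of_eq ?_)
  rw [← abs_mul]; congr 1; ring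

variable {α s1 s2 lam Lam : ℝ} {sigma sigma' : ℝ → ℝ}

set_option maxHeartbeats 1000000 in
theorem exists_rel (hF : FluxHyp α s1 s2 lam Lam sigma sigma') :
    ∃ lam' Lam' Ck sig k A B R1 R2 eps L U, SReg α lam' Lam' Ck sig k ∧ Rel sigma s1 s2 sig A B R1 R2 eps L U := by
  have hα := hF.alpha_pos
  have hα1 := hF.alpha_lt_one
  have hs12 := hF.s1_lt_s2
  set D := sigma s1 - sigma s2 with hD
  have hD0 : 0 < D := by have := hF.sigma_s2_lt_s1; linarith
  have mL := mono_left hF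
  have mR := mono_right hF
  obtain ⟨a0, p0, q0, ea0⟩ := inv_left hF (w := sigma s2 + D * (1 / 10)) (by linarith) (by linarith)
  obtain ⟨A, pA, qA, eA⟩ := inv_left hF (w := sigma s2 + D * (2 / 10)) (by linarith) (by linarith)
  obtain ⟨A', pA', qA', eA'⟩ := inv_left hF (w := sigma s2 + D * (3 / 10)) (by linarith) (by linarith)
  obtain ⟨A2, pA2, qA2, eA2⟩ := inv_left hF (w := sigma s2 + D * (8 / 10)) (by linarith) (by linarith)
  obtain ⟨a3, p3, q3, ea3⟩ := inv_left hF (w := sigma s2 + D * (9 / 10)) (by linarith) (by linarith)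
  obtain ⟨c0, pc0, ec0⟩ := inv_right hF (w := sigma s2 + D * (1 / 10)) (by linarith)
  obtain ⟨B1, pB1, eB1⟩ := inv_right hF (w := sigma s2 + D * (2 / 10)) (by linarith)
  obtain ⟨B', pB', eB'⟩ := inv_right hF (w := sigma s2 + D * (7 / 10)) (by linarith)
  obtain ⟨B, pB, eB⟩ := inv_right hF (w := sigma s2 + D * (8 / 10)) (by linarith)
  obtain ⟨c3, pc3, ec3⟩ := inv_right hF (w := sigma s2 + D * (9 / 10)) (by linarith)
  have o1 : a0 < A := (mL.lt_iff_lt q0.le qA.le).1 (by linarith)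
  have o2 : A < A' := (mL.lt_iff_lt qA.le qA'.le).1 (by linarith)
  have o3 : A' < A2 := (mL.lt_iff_lt qA'.le qA2.le).1 (by linarith)
  have o4 : A2 < a3 := (mL.lt_iff_lt qA2.le q3.le).1 (by linarith)
  have o5 : c0 < B1 := (mR.lt_iff_lt pc0.le pB1.le).1 (by linarith)
  have o6 : B1 < B' := (mR.lt_iff_lt pB1.le pB'.le).1 (by linarith)
  have o7 : B' < B := (mR.lt_iff_lt pB'.le pB.le).1 (by linarith)
  have o8 : B < c3 := (mR.lt_iff_lt pB.le pc3.le).1 (by linarith)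
  obtain ⟨m1, M1, hm1, hb1⟩ := left_bounds hF q3
  obtain ⟨m2, M2, hm2, hb2⟩ := right_bounds hF pc0
  have dL : ∀ {x y : ℝ}, y ≤ s1 → ∀ z ∈ Icc x y, HasDerivWithinAt sigma (sigma' z) (Icc x y) z := fun hy z hz =>
    (hF.deriv_left z (mem_Iic.2 (hz.2.trans hy))).mono fun w hw => mem_Iic.2 (hw.2.trans hy)
  have dR : ∀ {x y : ℝ}, s2 ≤ x → ∀ z ∈ Icc x y, HasDerivWithinAt sigma (sigma' z) (Icc x y) z := fun hx z hz =>
    (hF.deriv_right z (mem_Ici.2 (hx.trans hz.1))).mono fun w hw => mem_Ici.2 (hx.trans hw.1)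
  obtain ⟨L, Lc, Lm, Lr, LS, SL⟩ := inv_branch (S := sigma) (S' := sigma') (a := a0) (b := a3) (by linarith) hm1
    (dL q3.le) (fun x hx => (hb1 x hx.2).1)
  obtain ⟨U, Uc, Um, Ur, US, SU⟩ := inv_branch (S := sigma) (S' := sigma') (a := c0) (b := c3) (by linarith) hm2
    (dR pc0.le) (fun x hx => (hb2 x hx.1).1)
  have hBA : 0 < B - A := by linarith
  obtain ⟨κ, hκ0, hκ1, hκ2, hκ3⟩ : ∃ κ : ℝ, 0 < κ ∧ κ ≤ m1 ∧ κ ≤ m2 ∧ κ * (B - A) ≤ D * (3 / 10) := by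
    refine ⟨min (min m1 m2) (D * (3 / 10) / (B - A)), lt_min (lt_min hm1 hm2) (by positivity),
      (min_le_left _ _).trans (min_le_left _ _), (min_le_left _ _).trans (min_le_right _ _), ?_⟩
    exact (le_div_iff₀ hBA).1 (min_le_right _ _)
  set e1 : ℝ → ℝ := fun s => cl 1 ((s - A') / (A - A')) with he1
  set e2 : ℝ → ℝ := fun s => cl 1 ((s - B') / (B - B')) with he2
  have e1r : ∀ s, e1 s ∈ Icc (0:ℝ) 1 := fun s => cl_mem one_pos _
  have e2r : ∀ s, e2 s ∈ Icc (0:ℝ) 1 := fun s => cl_mem one_pos _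
  have e1A : ∀ s ≤ A, e1 s = 1 := fun s hs => cl_one (by rw [le_div_iff_of_neg (by linarith)]; linarith)
  have e1A' : ∀ s, A' ≤ s → e1 s = 0 := fun s hs => cl_zero (div_nonpos_of_nonneg_of_nonpos (by linarith) (by linarith))
  have e2B : ∀ s, B ≤ s → e2 s = 1 := fun s hs => cl_one (by rw [le_div_iff₀ (by linarith)]; linarith)
  have e2B' : ∀ s ≤ B', e2 s = 0 := fun s hs => cl_zero (div_nonpos_of_nonpos_of_nonneg (by linarith) (by linarith))
  set k0 : ℝ → ℝ := fun s => e1 s * sigma' (min s A') + e2 s * sigma' (max s B') + κ * (1 + -1 * e1 s + -1 * e2 s) with hk0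
  have be1 : BHol α e1 := BHol.of_lip hα hα1.le zero_le_one (abs_nonneg _)
    (fun s => by rw [abs_of_nonneg (e1r s).1]; exact (e1r s).2) (cl_aff_lip _ _)
  have be2 : BHol α e2 := BHol.of_lip hα hα1.le zero_le_one (abs_nonneg _)
    (fun s => by rw [abs_of_nonneg (e2r s).1]; exact (e2r s).2) (cl_aff_lip _ _)
  have bl : BHol α (fun s => sigma' (min s A')) := by
    obtain ⟨C, hC, hh⟩ := hol_left hF qA'.le
    have hM : ∀ s, |sigma' (min s A')| ≤ M1 := by
      intro s
      have := hb1 (min s A') ((min_le_right _ _).trans (by linarith))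
      rw [abs_of_nonneg (by linarith)]; exact this.2
    exact ⟨M1 + C, by linarith [(abs_nonneg _).trans (hM 0)], fun s => (hM s).trans (by linarith),
      fun s t => (hh s t).trans (by gcongr; linarith [(abs_nonneg _).trans (hM 0)])⟩
  have br : BHol α (fun s => sigma' (max s B')) := by
    obtain ⟨C, hC, hh⟩ := hol_right hF pB'.le
    have hM : ∀ s, |sigma' (max s B')| ≤ M2 := by
      intro s
      have := hb2 (max s B') (le_trans (by linarith) (le_max_right _ _))
      rw [abs_of_nonneg (by linarith)]; exact this.2
    exact ⟨M2 + C, by linarith [(abs_nonneg _).trans (hM 0)], fun s => (hM s).trans (by linarith),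
      fun s t => (hh s t).trans (by gcongr; linarith [(abs_nonneg _).trans (hM 0)])⟩
  have bk0 : BHol α k0 := ((be1.mul bl).add (be2.mul br)).add
    ((BHol.const κ).mul (((BHol.const 1).add ((BHol.const (-1)).mul be1)).add ((BHol.const (-1)).mul be2)))
  have btent : BHol α (tent s1 s2) := BHol.of_lip (C := s2 - s1) (K := 1) hα hα1.le (by linarith) zero_le_one
    (fun s => by rw [abs_of_nonneg (tent_nonneg _ _ _)]; exact tent_le hs12 s) (tent_lip s1 s2)
  -- pointwise properties of k0
  have kL : ∀ s ≤ a3, κ ≤ k0 s ∧ k0 s ≤ sigma' s := by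
    intro s hs
    have h1 := hb1 s hs
    have h2 := e1r s
    simp only [hk0]
    rw [e2B' s (by linarith)]
    rcases le_total s A' with h | h
    · rw [min_eq_left h]
      constructor <;> nlinarith [h2.1, h2.2]
    · rw [e1A' s h]; constructor <;> linarith
  have kR : ∀ s, c0 ≤ s → κ ≤ k0 s ∧ k0 s ≤ sigma' s := by
    intro s hs
    have h1 := hb2 s hs
    have h2 := e2r s
    simp only [hk0]
    rw [e1A' s (by linarith)]
    rcases le_total B' s with h | h
    · rw [max_eq_left h]
      constructor <;> nlinarith [h2.1, h2.2]
    · rw [e2B' s h]; constructor <;> linarith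
  have kM : ∀ s, A' ≤ s → s ≤ B' → k0 s = κ := by
    intro s h1 h2
    simp only [hk0]; rw [e1A' s h1, e2B' s h2]; ring
  have kA : ∀ s ≤ A, k0 s = sigma' s := by
    intro s hs
    simp only [hk0]; rw [e1A s hs, e2B' s (by linarith), min_eq_left (by linarith)]; ring
  have kB : ∀ s, B ≤ s → k0 s = sigma' s := by
    intro s hs
    simp only [hk0]; rw [e2B s hs, e1A' s (by linarith), max_eq_left (by linarith)]; ring
  have kpos : ∀ s, κ ≤ k0 s := by
    intro s
    rcases le_total s a3 with h | h
    · exact (kL s h).1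
    rcases le_total c0 s with h' | h'
    · exact (kR s h').1
    · exact (kM s (by linarith) (by linarith)).ge
  have cont_of : ∀ {g : ℝ → ℝ}, BHol α g → Continuous g := by
    rintro g ⟨C, _, _, h⟩; exact cont_of_holder hα h
  have ck0 := cont_of bk0
  have ctent := cont_of btent
  set K0 : ℝ → ℝ := fun s => ∫ r in (0:ℝ)..s, k0 r with hK0
  set Th : ℝ → ℝ := fun s => ∫ r in (0:ℝ)..s, tent s1 s2 r with hTh
  have dK : ∀ x, HasDerivAt K0 (k0 x) x := hasDerivAt_prim ck0
  have dT : ∀ x, HasDerivAt Th (tent s1 s2 x) x := hasDerivAt_prim ctent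
  have T1 : ∀ x y, x ≤ y → y ≤ s1 → Th y - Th x = 0 := by
    intro x y hxy hy
    have := cmp_eq (f := Th) (g := fun _ => (0:ℝ)) (g' := fun _ => 0) hxy (fun z _ => (dT z).hasDerivWithinAt)
      (fun z _ => hasDerivWithinAt_const _ _ _) (fun z hz => tent_left (hz.2.trans hy))
    simpa using this
  have T2 : ∀ x y, x ≤ y → s2 ≤ x → Th y - Th x = 0 := by
    intro x y hxy hy
    have := cmp_eq (f := Th) (g := fun _ => (0:ℝ)) (g' := fun _ => 0) hxy (fun z _ => (dT z).hasDerivWithinAt)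
      (fun z _ => hasDerivWithinAt_const _ _ _) (fun z hz => tent_right (hy.trans hz.1))
    simpa using this
  have Tm : Th s1 < Th s2 := by
    have : StrictMonoOn Th (Icc s1 s2) := by
      refine strictMonoOn_of_hasDerivWithinAt_pos (f' := tent s1 s2) (convex_Icc _ _)
        (fun x _ => (dT x).continuousAt.continuousWithinAt) (fun x _ => (dT x).hasDerivWithinAt) (fun x hx => ?_)
      rw [interior_Icc] at hx
      exact lt_max_of_lt_right (lt_min (by linarith [hx.1]) (by linarith [hx.2]))
    exact this (left_mem_Icc.2 hs12.le) (right_mem_Icc.2 hs12.le) hs12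
  set τ := Th s2 - Th s1 with hτ
  have hτ0 : 0 < τ := by linarith
  have hKd : K0 B - K0 A ≤ D * (5 / 10) := by
    have i1 := cmp (f := K0) o2.le (fun z _ => (dK z).hasDerivWithinAt) (dL qA'.le)
      (fun z hz => (kL z (by linarith [hz.2])).2)
    have i2 := cmp_eq (f := K0) (g := fun z => κ * z) (g' := fun _ => κ) (by linarith : A' ≤ B')
      (fun z _ => (dK z).hasDerivWithinAt)
      (fun z _ => by simpa using ((hasDerivAt_id z).const_mul κ).hasDerivWithinAt)
      (fun z hz => kM z hz.1 hz.2)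
    have i3 := cmp (f := K0) o7.le (fun z _ => (dK z).hasDerivWithinAt) (dR pB'.le)
      (fun z hz => (kR z (by linarith [hz.1])).2)
    have i4 : κ * (B' - A') ≤ κ * (B - A) := mul_le_mul_of_nonneg_left (by linarith) hκ0.le
    linarith
  set H := (D * (6 / 10) - (K0 B - K0 A)) / τ with hH
  have hH0 : 0 ≤ H := div_nonneg (by linarith) hτ0.le
  have hHτ : H * τ = D * (6 / 10) - (K0 B - K0 A) := div_mul_cancel₀ _ hτ0.ne'
  set k : ℝ → ℝ := fun s => k0 s + H * tent s1 s2 s with hk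
  set sig : ℝ → ℝ := fun s => K0 s + H * Th s with hsig
  have dS : ∀ x, HasDerivAt sig (k x) x := fun x => (dK x).add ((dT x).const_mul H)
  have dS' : ∀ {I : Set ℝ} (x), x ∈ I → HasDerivWithinAt sig (k x) I x := fun x _ => (dS x).hasDerivWithinAt
  have kk : ∀ s, s ≤ s1 ∨ s2 ≤ s → k s = k0 s := by
    intro s hs
    simp only [hk]
    rcases hs with hs | hs
    · rw [tent_left hs]; ring
    · rw [tent_right hs]; ring
  have s00 : sig 0 = 0 := by simp [hsig, hK0, hTh]
  have lo : ∀ s ≤ A, sig s = sigma s := by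
    have key : ∀ x y, x ≤ y → y ≤ A → sig y - sig x = sigma y - sigma x := fun x y hxy hy =>
      cmp_eq hxy dS' (dL (by linarith)) fun z hz => by
        rw [kk z (Or.inl (by linarith [hz.2])), kA z (by linarith [hz.2])]
    intro s hs
    have h0 := hF.sigma_zero
    rcases le_total s 0 with h | h
    · have := key s 0 h pA.le; linarith
    · have := key 0 s h hs; linarith
  have sB : sig B = sigma B := by
    have h1 := T1 A s1 qA.le le_rfl
    have h2 := T2 s2 B pB.le le_rfl
    have h3 := lo A le_rfl
    have h4 : sig B - sig A = (K0 B - K0 A) + H * τ := by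
      simp only [hsig]
      linear_combination H * h1 + H * h2 + H * hτ
    linarith
  have hi : ∀ s, B ≤ s → sig s = sigma s := by
    intro s hs
    have := cmp_eq (f := sig) (g := sigma) hs dS' (dR pB.le) fun z hz => by
        rw [kk z (Or.inr (by linarith [hz.1])), kB z hz.1]
    linarith
  have kκ : ∀ s, κ ≤ k s := fun s => by
    have := mul_nonneg hH0 (tent_nonneg s1 s2 s)
    simp only [hk]; linarith [kpos s]
  have smono : ∀ x y, x ≤ y → sig x ≤ sig y := by
    intro x y hxy
    have := cmp (f := fun _ => (0:ℝ)) (f' := fun _ => 0) (g := sig) (g' := k) hxy (fun z _ => hasDerivWithinAt_const _ _ _) dS'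
      (fun z _ => hκ0.le.trans (kκ z))
    simp only [sub_self] at this
    linarith
  have sA := lo A le_rfl
  have bk : BHol α k := bk0.add ((BHol.const H).mul btent)
  obtain ⟨Ck, hCk, hk1, hk2⟩ := bk
  refine ⟨κ, Ck, Ck, sig, k, A, B, sigma s2 + D * (1 / 10), sigma s2 + D * (9 / 10), D * (1 / 10), L, U,
    ⟨hα, hα1, hκ0, dS, kκ, fun s => (le_abs_self _).trans (hk1 s), hk2, s00⟩,
    ⟨by positivity, Lc, Uc, qA, pB, by linarith, lo, hi, ?_, ?_, ?_, ?_, ?_, ?_, ?_, ?_⟩⟩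
  · intro s hs
    have := smono A s hs.1
    linarith
  · intro s hs
    have := smono s B hs.2
    linarith
  · intro s hs
    rcases le_total s A2 with h | h
    · have i1 := cmp (f := sig) (g := sigma) hs.1 dS' (dL (by linarith)) fun z hz => by
        rw [kk z (Or.inl (by linarith [hz.2]))]; exact (kL z (by linarith [hz.2])).2
      have i2 : sig s ≤ sigma s := by linarith
      calc L (sig s) ≤ L (sigma s) := Lm i2
        _ = s := SL s ⟨by linarith [hs.1], by linarith⟩
    · have := smono s B hs.2
      calc L (sig s) ≤ L (sigma A2) := Lm (by linarith)
        _ = A2 := SL A2 ⟨by linarith, by linarith⟩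
        _ ≤ s := h
  · intro s hs
    rcases le_total B1 s with h | h
    · have i1 := cmp (f := sig) (g := sigma) hs.2 dS' (dR (by linarith)) fun z hz => by
        rw [kk z (Or.inr (by linarith [hz.1]))]; exact (kR z (by linarith [hz.1])).2
      have i2 : sigma s ≤ sig s := by linarith
      calc s = U (sigma s) := (SU s ⟨by linarith, by linarith [hs.2]⟩).symm
        _ ≤ U (sig s) := Um i2
    · have := smono A s hs.1
      calc s ≤ B1 := h
        _ = U (sigma B1) := (SU B1 ⟨by linarith, by linarith⟩).symm
        _ ≤ U (sig s) := Um (by linarith)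
  · intro w hw; exact LS w (by rw [ea0, ea3]; exact hw)
  · intro w hw; exact US w (by rw [ec0, ec3]; exact hw)
  · intro w; exact lt_of_le_of_lt (Lr w).2 q3
  · intro w; exact lt_of_lt_of_le pc0 (Ur w).1

end FwdSol

namespace FwdSol

/-- A smooth-enough function of two variables together with the derivatives we use. -/
structure Sm (g gx gxx gt gxt : ℝ → ℝ → ℝ) : Prop where
  c0 : Continuous fun z : ℝ × ℝ => g z.1 z.2
  cx : Continuous fun z : ℝ × ℝ => gx z.1 z.2
  cxx : Continuous fun z : ℝ × ℝ => gxx z.1 z.2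
  ct : Continuous fun z : ℝ × ℝ => gt z.1 z.2
  cxt : Continuous fun z : ℝ × ℝ => gxt z.1 z.2
  dx : ∀ x t, HasDerivAt (fun y => g y t) (gx x t) x
  dxx : ∀ x t, HasDerivAt (fun y => gx y t) (gxx x t) x
  dt : ∀ x t, HasDerivAt (fun s => g x s) (gt x t) t
  dxt : ∀ x t, HasDerivAt (fun s => gx x s) (gxt x t) t
  dtx : ∀ x t, HasDerivAt (fun y => gt y t) (gxt x t) x

/-- All functions vanish outside `S`. -/
def Van (S : Set (ℝ × ℝ)) (g gx gxx gt gxt : ℝ → ℝ → ℝ) : Prop :=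
  ∀ x t, (x, t) ∉ S → g x t = 0 ∧ gx x t = 0 ∧ gxx x t = 0 ∧ gt x t = 0 ∧ gxt x t = 0

lemma dir_contDiff {F : ℝ × ℝ → ℝ} (h : ContDiff ℝ (⊤ : ℕ∞) F) (v : ℝ × ℝ) :
    ContDiff ℝ (⊤ : ℕ∞) (fun z => fderiv ℝ F z v) :=
  (h.fderiv_right (m := ((⊤ : ℕ∞) : WithTop ℕ∞)) (by simp)).clm_apply contDiff_const

lemma dir_tsupp {F : ℝ × ℝ → ℝ} (v : ℝ × ℝ) {z : ℝ × ℝ} (hz : z ∉ tsupport F) :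
    z ∉ tsupport (fun z => fderiv ℝ F z v) := by
  intro h
  refine hz (tsupport_fderiv_subset ℝ (closure_mono ?_ h))
  intro y hy
  simp only [Function.mem_support] at hy ⊢
  intro h0; exact hy (by rw [h0]; rfl)

lemma dir_x {F : ℝ × ℝ → ℝ} (h : ContDiff ℝ (⊤ : ℕ∞) F) (x t : ℝ) :
    HasDerivAt (fun y => F (y, t)) (fderiv ℝ F (x, t) (1, 0)) x := by
  have h1 : HasFDerivAt F (fderiv ℝ F (x, t)) (x, t) := (h.differentiable (by simp) _).hasFDerivAt
  have h2 : HasDerivAt (fun y : ℝ => (y, t)) ((1:ℝ), (0:ℝ)) x := (hasDerivAt_id x).prodMk (hasDerivAt_const x t)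
  exact HasFDerivAt.comp_hasDerivAt x h1 h2

lemma dir_t {F : ℝ × ℝ → ℝ} (h : ContDiff ℝ (⊤ : ℕ∞) F) (x t : ℝ) :
    HasDerivAt (fun s => F (x, s)) (fderiv ℝ F (x, t) (0, 1)) t := by
  have h1 : HasFDerivAt F (fderiv ℝ F (x, t)) (x, t) := (h.differentiable (by simp) _).hasFDerivAt
  have h2 : HasDerivAt (fun s : ℝ => (x, s)) ((0:ℝ), (1:ℝ)) t := (hasDerivAt_const t x).prodMk (hasDerivAt_id t)
  exact HasFDerivAt.comp_hasDerivAt t h1 h2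

lemma dir_symm {F : ℝ × ℝ → ℝ} (h : ContDiff ℝ (⊤ : ℕ∞) F) (z v w : ℝ × ℝ) :
    fderiv ℝ (fun z => fderiv ℝ F z v) z w = fderiv ℝ (fun z => fderiv ℝ F z w) z v := by
  have hd : ContDiff ℝ (⊤ : ℕ∞) (fderiv ℝ F) := h.fderiv_right (by simp)
  have hd' : DifferentiableAt ℝ (fderiv ℝ F) z := hd.differentiable (by simp) _
  have key : ∀ v w : ℝ × ℝ, fderiv ℝ (fun z => fderiv ℝ F z v) z w = fderiv ℝ (fderiv ℝ F) z w v := by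
    intro v w
    rw [fderiv_clm_apply hd' (differentiableAt_const v)]
    simp
  rw [key, key]
  exact (h.contDiffAt.isSymmSndFDerivAt (by rw [minSmoothness_of_isRCLikeNormedField]; exact WithTop.coe_le_coe.2 le_top)) w v

lemma sm_of_contDiff {g : ℝ → ℝ → ℝ} (h : ContDiff ℝ (⊤ : ℕ∞) (fun z : ℝ × ℝ => g z.1 z.2)) :
    ∃ gx gxx gt gxt, Sm g gx gxx gt gxt ∧ Van (tsupport (fun z : ℝ × ℝ => g z.1 z.2)) g gx gxx gt gxt := by
  set F : ℝ × ℝ → ℝ := fun z => g z.1 z.2 with hF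
  have hx := dir_contDiff h (1, 0)
  have ht := dir_contDiff h (0, 1)
  have hxx := dir_contDiff hx (1, 0)
  have hxt := dir_contDiff hx (0, 1)
  refine ⟨fun x t => fderiv ℝ F (x, t) (1, 0), fun x t => fderiv ℝ (fun z => fderiv ℝ F z (1, 0)) (x, t) (1, 0),
    fun x t => fderiv ℝ F (x, t) (0, 1), fun x t => fderiv ℝ (fun z => fderiv ℝ F z (1, 0)) (x, t) (0, 1),
    ⟨h.continuous, hx.continuous, hxx.continuous, ht.continuous, hxt.continuous, fun x t => dir_x h x t,
      fun x t => dir_x hx x t, fun x t => dir_t h x t, fun x t => dir_t hx x t, fun x t => ?_⟩, ?_⟩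
  · rw [dir_symm h]
    exact dir_x ht x t
  · intro x t hz
    have z1 := dir_tsupp (1, 0) hz
    have z2 := dir_tsupp (0, 1) hz
    have z3 := dir_tsupp (1, 0) z1
    have z4 := dir_tsupp (0, 1) z1
    have a0 := image_eq_zero_of_notMem_tsupport hz
    have a1 := image_eq_zero_of_notMem_tsupport z1
    have a2 := image_eq_zero_of_notMem_tsupport z2
    have a3 := image_eq_zero_of_notMem_tsupport z3
    have a4 := image_eq_zero_of_notMem_tsupport z4
    exact ⟨a0, a1, a3, a2, a4⟩

lemma ftc {F F' : ℝ → ℝ} {a b : ℝ} (hab : a ≤ b) (h : ∀ x ∈ Icc a b, HasDerivWithinAt F (F' x) (Icc a b) x)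
    (hc : Continuous F') : ∫ x in a..b, F' x = F b - F a := by
  refine intervalIntegral.integral_eq_sub_of_hasDerivAt_of_le hab (fun x hx => (h x hx).continuousWithinAt)
    (fun x hx => (h x (Ioo_subset_Icc_self hx)).hasDerivAt (Icc_mem_nhds hx.1 hx.2)) (hc.intervalIntegrable _ _)

lemma Ioo_int (F : ℝ → ℝ) {a b : ℝ} (hab : a ≤ b) : ∫ x in Ioo a b, F x = ∫ x in a..b, F x := by
  rw [intervalIntegral.integral_of_le hab, integral_Ioc_eq_integral_Ioo]

lemma swap_cont {G : ℝ → ℝ → ℝ} (hG : Continuous fun z : ℝ × ℝ => G z.1 z.2) (a b c d : ℝ) :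
    ∫ t in a..b, ∫ x in c..d, G x t = ∫ x in c..d, ∫ t in a..b, G x t := by
  refine intervalIntegral_intervalIntegral_swap ?_
  have hK : IsCompact (uIcc a b ×ˢ uIcc c d) := isCompact_uIcc.prod isCompact_uIcc
  have hc : Continuous (fun z : ℝ × ℝ => G z.2 z.1) := hG.comp (continuous_snd.prodMk continuous_fst)
  exact (hc.continuousOn.integrableOn_compact hK).mono_set (prod_mono uIoc_subset_uIcc uIoc_subset_uIcc)

set_option maxHeartbeats 1000000 in
/-- The weak formulation for potentials. -/
lemma Pot.weak {T : ℝ} {b c f W u p w Q : ℝ → ℝ → ℝ} (h : Pot T b c f W u p w Q)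
    (hb : Continuous fun z : ℝ × ℝ => b z.1 z.2) (hc : Continuous fun z : ℝ × ℝ => c z.1 z.2)
    (hf : Continuous fun z : ℝ × ℝ => f z.1 z.2)
    {g gx gxx gt gxt : ℝ → ℝ → ℝ} (hg : Sm g gx gxx gt gxt) {s : ℝ} (hs : s ∈ Icc 0 T) :
    ∫ t in (0:ℝ)..s, ∫ x in (0:ℝ)..1, (u x t * gt x t - w x t * gx x t
      + (b x t * p x t + c x t * u x t + f x t) * g x t)
      = ∫ x in (0:ℝ)..1, (u x s * g x s - u x 0 * g x 0) := by
  have h01 : (0:ℝ) ≤ 1 := zero_le_one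
  have cW := h.cW
  have cu := h.cu
  have cp := h.cp
  have cw := h.cw
  have cQ := h.cQ
  have c0 := hg.c0
  have cx := hg.cx
  have ct := hg.ct
  have cxt := hg.cxt
  have hsub : Icc 0 s ⊆ Icc 0 T := Icc_subset_Icc_right hs.2
  have m0 : (0:ℝ) ∈ Icc (0:ℝ) 1 := ⟨le_rfl, h01⟩
  have m1 : (1:ℝ) ∈ Icc (0:ℝ) 1 := ⟨h01, le_rfl⟩
  have fx : ∀ {G : ℝ → ℝ → ℝ}, Continuous (fun z : ℝ × ℝ => G z.1 z.2) → ∀ t, Continuous (fun x => G x t) :=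
    fun {G} hG t => hG.comp (continuous_id.prodMk continuous_const)
  have ft : ∀ {G : ℝ → ℝ → ℝ}, Continuous (fun z : ℝ × ℝ => G z.1 z.2) → ∀ x, Continuous (fun t => G x t) :=
    fun {G} hG x => hG.comp (continuous_const.prodMk continuous_id)
  have fm : ∀ {G H : ℝ → ℝ → ℝ}, Continuous (fun z : ℝ × ℝ => G z.1 z.2) → Continuous (fun z : ℝ × ℝ => H z.1 z.2) →
      ∀ t, IntervalIntegrable (fun x => G x t * H x t) volume 0 1 :=
    fun {G H} hG hH t => ((fx hG t).mul (fx hH t)).intervalIntegrable _ _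
  -- integration by parts in x, at fixed time
  have ibp1 : ∀ τ ∈ Icc 0 T, ∫ x in (0:ℝ)..1, u x τ * g x τ = W 1 τ * g 1 τ - ∫ x in (0:ℝ)..1, W x τ * gx x τ := by
    intro τ hτ
    have e := ftc (F := fun x => W x τ * g x τ) (F' := fun x => u x τ * g x τ + W x τ * gx x τ) h01
      (fun x hx => (h.Wx x hx τ hτ).mul (hg.dx x τ).hasDerivWithinAt)
      (((fx cu τ).mul (fx c0 τ)).add ((fx cW τ).mul (fx cx τ)))
    rw [intervalIntegral.integral_add (fm cu c0 τ)
      (fm cW cx τ), h.W0 τ hτ] at e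
    linarith
  have ibp2 : ∀ τ ∈ Icc 0 T, ∫ x in (0:ℝ)..1, u x τ * gt x τ = W 1 τ * gt 1 τ - ∫ x in (0:ℝ)..1, W x τ * gxt x τ := by
    intro τ hτ
    have e := ftc (F := fun x => W x τ * gt x τ) (F' := fun x => u x τ * gt x τ + W x τ * gxt x τ) h01
      (fun x hx => (h.Wx x hx τ hτ).mul (hg.dtx x τ).hasDerivWithinAt)
      (((fx cu τ).mul (fx ct τ)).add ((fx cW τ).mul (fx cxt τ)))
    rw [intervalIntegral.integral_add (fm cu ct τ)
      (fm cW cxt τ), h.W0 τ hτ] at e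
    linarith
  have cR : Continuous (fun z : ℝ × ℝ => b z.1 z.2 * p z.1 z.2 + c z.1 z.2 * u z.1 z.2 + f z.1 z.2) :=
    ((hb.mul cp).add (hc.mul cu)).add hf
  have ibp3 : ∀ τ ∈ Icc 0 T, ∫ x in (0:ℝ)..1, (b x τ * p x τ + c x τ * u x τ + f x τ) * g x τ
      = Q 1 τ * g 1 τ - ∫ x in (0:ℝ)..1, Q x τ * gx x τ := by
    intro τ hτ
    have cRτ : Continuous (fun x => b x τ * p x τ + c x τ * u x τ + f x τ) :=
      fx (G := fun x τ => b x τ * p x τ + c x τ * u x τ + f x τ) cR τ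
    have e := ftc (F := fun x => Q x τ * g x τ)
      (F' := fun x => (b x τ * p x τ + c x τ * u x τ + f x τ) * g x τ + Q x τ * gx x τ) h01
      (fun x hx => (h.Qx x hx τ hτ).mul (hg.dx x τ).hasDerivWithinAt)
      ((cRτ.mul (fx c0 τ)).add ((fx cQ τ).mul (fx cx τ)))
    rw [intervalIntegral.integral_add (fm (G := fun x τ => b x τ * p x τ + c x τ * u x τ + f x τ) cR c0 τ)
      (fm cQ cx τ), h.Q0 τ hτ] at e
    linarith
  -- time derivative of boundary term and of the bulk term
  have tb : ∫ t in (0:ℝ)..s, (Q 1 t * g 1 t + W 1 t * gt 1 t) = W 1 s * g 1 s - W 1 0 * g 1 0 := by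
    have e := ftc (F := fun t => W 1 t * g 1 t) (F' := fun t => (w 1 t + Q 1 t) * g 1 t + W 1 t * gt 1 t) hs.1
      (fun t ht => ((h.Wt 1 m1 t (hsub ht)).mono hsub).mul (hg.dt 1 t).hasDerivWithinAt)
      ((((ft cw 1).add (ft cQ 1)).mul (ft c0 1)).add ((ft cW 1).mul (ft ct 1)))
    rw [← e]
    refine intervalIntegral.integral_congr fun t ht => ?_
    rw [uIcc_of_le hs.1] at ht
    simp only [h.w1 t (hsub ht), zero_add]
  have ti : ∀ x ∈ Icc (0:ℝ) 1, ∫ t in (0:ℝ)..s, ((w x t + Q x t) * gx x t + W x t * gxt x t)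
      = W x s * gx x s - W x 0 * gx x 0 := by
    intro x hx
    exact ftc (F := fun t => W x t * gx x t) (F' := fun t => (w x t + Q x t) * gx x t + W x t * gxt x t) hs.1
      (fun t ht => ((h.Wt x hx t (hsub ht)).mono hsub).mul (hg.dxt x t).hasDerivWithinAt)
      ((((ft cw x).add (ft cQ x)).mul (ft cx x)).add ((ft cW x).mul (ft cxt x)))
  have cI : Continuous (fun z : ℝ × ℝ => (w z.1 z.2 + Q z.1 z.2) * gx z.1 z.2 + W z.1 z.2 * gxt z.1 z.2) :=
    ((cw.add cQ).mul cx).add (cW.mul cxt)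
  have sw := swap_cont (G := fun x t => (w x t + Q x t) * gx x t + W x t * gxt x t) cI 0 s 0 1
  -- fixed-time identity
  have inner : ∀ τ ∈ Icc 0 T, ∫ x in (0:ℝ)..1, (u x τ * gt x τ - w x τ * gx x τ
      + (b x τ * p x τ + c x τ * u x τ + f x τ) * g x τ)
      = (Q 1 τ * g 1 τ + W 1 τ * gt 1 τ) - ∫ x in (0:ℝ)..1, ((w x τ + Q x τ) * gx x τ + W x τ * gxt x τ) := by
    intro τ hτ
    have cRτ : Continuous (fun x => b x τ * p x τ + c x τ * u x τ + f x τ) :=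
      fx (G := fun x τ => b x τ * p x τ + c x τ * u x τ + f x τ) cR τ
    have i1 : IntervalIntegrable (fun x => u x τ * gt x τ) volume 0 1 := ((fx cu τ).mul (fx ct τ)).intervalIntegrable _ _
    have i2 : IntervalIntegrable (fun x => w x τ * gx x τ) volume 0 1 := ((fx cw τ).mul (fx cx τ)).intervalIntegrable _ _
    have i3 : IntervalIntegrable (fun x => (b x τ * p x τ + c x τ * u x τ + f x τ) * g x τ) volume 0 1 :=
      (cRτ.mul (fx c0 τ)).intervalIntegrable _ _
    have i4 : IntervalIntegrable (fun x => Q x τ * gx x τ) volume 0 1 := ((fx cQ τ).mul (fx cx τ)).intervalIntegrable _ _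
    have i5 : IntervalIntegrable (fun x => W x τ * gxt x τ) volume 0 1 := ((fx cW τ).mul (fx cxt τ)).intervalIntegrable _ _
    have e1 : ∫ x in (0:ℝ)..1, ((w x τ + Q x τ) * gx x τ + W x τ * gxt x τ) =
        (∫ x in (0:ℝ)..1, w x τ * gx x τ) + (∫ x in (0:ℝ)..1, Q x τ * gx x τ) + ∫ x in (0:ℝ)..1, W x τ * gxt x τ := by
      rw [← intervalIntegral.integral_add i2 i4, ← intervalIntegral.integral_add (i2.add i4) i5]
      exact intervalIntegral.integral_congr fun x _ => by ring
    rw [intervalIntegral.integral_add (i1.sub i2) i3, intervalIntegral.integral_sub i1 i2, ibp2 τ hτ, ibp3 τ hτ, e1]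
    ring
  have lhs : ∫ t in (0:ℝ)..s, ∫ x in (0:ℝ)..1, (u x t * gt x t - w x t * gx x t
      + (b x t * p x t + c x t * u x t + f x t) * g x t)
      = ∫ t in (0:ℝ)..s, ((Q 1 t * g 1 t + W 1 t * gt 1 t) - ∫ x in (0:ℝ)..1, ((w x t + Q x t) * gx x t + W x t * gxt x t)) := by
    refine intervalIntegral.integral_congr fun t ht => ?_
    rw [uIcc_of_le hs.1] at ht
    exact inner t (hsub ht)
  have cJ : Continuous (fun t => ∫ x in (0:ℝ)..1, ((w x t + Q x t) * gx x t + W x t * gxt x t)) :=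
    intervalIntegral.continuous_parametric_intervalIntegral_of_continuous'
      (f := fun t x => (w x t + Q x t) * gx x t + W x t * gxt x t)
      (cI.comp (continuous_snd.prodMk continuous_fst)) 0 1
  have cB : Continuous (fun t => Q 1 t * g 1 t + W 1 t * gt 1 t) := ((ft cQ 1).mul (ft c0 1)).add ((ft cW 1).mul (ft ct 1))
  rw [lhs, intervalIntegral.integral_sub (cB.intervalIntegrable _ _) (cJ.intervalIntegrable _ _), tb, sw]
  have e2 : ∫ x in (0:ℝ)..1, ∫ t in (0:ℝ)..s, ((w x t + Q x t) * gx x t + W x t * gxt x t)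
      = ∫ x in (0:ℝ)..1, (W x s * gx x s - W x 0 * gx x 0) := by
    refine intervalIntegral.integral_congr fun x hx => ?_
    rw [uIcc_of_le h01] at hx
    exact ti x hx
  rw [e2, intervalIntegral.integral_sub (fm cW cx s)
    (fm cW cx 0),
    intervalIntegral.integral_sub (fm cu c0 s)
    (fm cu c0 0), ibp1 s hs, ibp1 0 ⟨le_rfl, hs.1.trans hs.2⟩]
  ring

end FwdSol

namespace FwdSol

lemma Sm.add {g gx gxx gt gxt h hx hxx ht hxt : ℝ → ℝ → ℝ} (H1 : Sm g gx gxx gt gxt) (H2 : Sm h hx hxx ht hxt) :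
    Sm (fun x t => g x t + h x t) (fun x t => gx x t + hx x t) (fun x t => gxx x t + hxx x t)
      (fun x t => gt x t + ht x t) (fun x t => gxt x t + hxt x t) :=
  ⟨H1.c0.add H2.c0, H1.cx.add H2.cx, H1.cxx.add H2.cxx, H1.ct.add H2.ct, H1.cxt.add H2.cxt,
    fun x t => (H1.dx x t).add (H2.dx x t), fun x t => (H1.dxx x t).add (H2.dxx x t), fun x t => (H1.dt x t).add (H2.dt x t),
    fun x t => (H1.dxt x t).add (H2.dxt x t), fun x t => (H1.dtx x t).add (H2.dtx x t)⟩

lemma Van.add {S : Set (ℝ × ℝ)} {g gx gxx gt gxt h hx hxx ht hxt : ℝ → ℝ → ℝ} (H1 : Van S g gx gxx gt gxt)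
    (H2 : Van S h hx hxx ht hxt) :
    Van S (fun x t => g x t + h x t) (fun x t => gx x t + hx x t) (fun x t => gxx x t + hxx x t)
      (fun x t => gt x t + ht x t) (fun x t => gxt x t + hxt x t) := by
  intro x t hz
  obtain ⟨a1, a2, a3, a4, a5⟩ := H1 x t hz
  obtain ⟨b1, b2, b3, b4, b5⟩ := H2 x t hz
  simp only [a1, a2, a3, a4, a5, b1, b2, b3, b4, b5, add_zero, and_self]

lemma Sm.zero : Sm (fun _ _ => 0) (fun _ _ => 0) (fun _ _ => 0) (fun _ _ => 0) (fun _ _ => 0) :=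
  ⟨continuous_const, continuous_const, continuous_const, continuous_const, continuous_const,
    fun x _ => hasDerivAt_const x 0, fun x _ => hasDerivAt_const x 0, fun _ t => hasDerivAt_const t 0,
    fun _ t => hasDerivAt_const t 0, fun x _ => hasDerivAt_const x 0⟩

lemma osc_bd {a b C r c s : ℝ} (h : |a| ≤ C) (hb : |b| ≤ C) (hr : 0 < r) (hr1 : r ≤ 1) (hc : |c| ≤ 1) (hs : |s| ≤ 1) :
    |-a * r ^ 2 * c + b * r * s| ≤ 2 * C * r := by
  have hC : 0 ≤ C := (abs_nonneg _).trans h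
  have h1 : |-a * r ^ 2 * c| ≤ C * r := by
    rw [abs_mul, abs_mul, abs_neg, abs_of_nonneg (sq_nonneg r)]
    calc |a| * r ^ 2 * |c| ≤ C * r ^ 2 * 1 := by gcongr
      _ ≤ C * r := by rw [mul_one, sq, ← mul_assoc]; exact mul_le_of_le_one_right (by positivity) hr1
  have h2 : |b * r * s| ≤ C * r := by
    rw [abs_mul, abs_mul, abs_of_pos hr]
    calc |b| * r * |s| ≤ C * r * 1 := by gcongr
      _ = C * r := mul_one _
  exact (abs_add_le _ _).trans (by linarith)

lemma osc {S : Set (ℝ × ℝ)} {m mx mxx mt mxt : ℝ → ℝ → ℝ} (h : Sm m mx mxx mt mxt) (hv : Van S m mx mxx mt mxt)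
    {C r ν : ℝ} (hC : ∀ x t, |m x t| ≤ C ∧ |mx x t| ≤ C ∧ |mxx x t| ≤ C ∧ |mt x t| ≤ C ∧ |mxt x t| ≤ C)
    (hr : 0 < r) (hr1 : r ≤ 1) (hν : r * ν = 1) :
    ∃ g gx gxx gt gxt, Sm g gx gxx gt gxt ∧ Van S g gx gxx gt gxt ∧
      ∀ x t, |g x t| ≤ 2 * C * r ∧ |gx x t| ≤ 2 * C * r ∧ |gt x t| ≤ 2 * C * r ∧ |gxt x t| ≤ 2 * C * r ∧
        |gxx x t - m x t * Real.cos (ν * x)| ≤ 3 * C * r := by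
  have dc : ∀ x, HasDerivAt (fun y => Real.cos (ν * y)) (-Real.sin (ν * x) * ν) x := fun x => by
    have := ((hasDerivAt_id x).const_mul ν).cos
    simpa using this
  have ds : ∀ x, HasDerivAt (fun y => Real.sin (ν * y)) (Real.cos (ν * x) * ν) x := fun x => by
    have := ((hasDerivAt_id x).const_mul ν).sin
    simpa using this
  have cc : Continuous fun z : ℝ × ℝ => Real.cos (ν * z.1) := by fun_prop
  have cs : Continuous fun z : ℝ × ℝ => Real.sin (ν * z.1) := by fun_prop
  have c0 := h.c0
  have cx := h.cx
  have cxx := h.cxx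
  have ct := h.ct
  have cxt := h.cxt
  refine ⟨fun x t => -m x t * r ^ 2 * Real.cos (ν * x), fun x t => -mx x t * r ^ 2 * Real.cos (ν * x) + m x t * r * Real.sin (ν * x),
    fun x t => (-mxx x t * r ^ 2 * Real.cos (ν * x) + mx x t * r * Real.sin (ν * x)) + mx x t * r * Real.sin (ν * x)
      + m x t * Real.cos (ν * x),
    fun x t => -mt x t * r ^ 2 * Real.cos (ν * x), fun x t => -mxt x t * r ^ 2 * Real.cos (ν * x) + mt x t * r * Real.sin (ν * x),
    ⟨by fun_prop, by fun_prop, by fun_prop, by fun_prop, by fun_prop, fun x t => ?_, fun x t => ?_, fun x t => ?_, fun x t => ?_,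
      fun x t => ?_⟩, ?_, fun x t => ?_⟩
  · refine (((h.dx x t).neg.mul_const (r ^ 2)).mul (dc x)).congr_deriv ?_
    simp only [Pi.neg_apply]
    linear_combination (m x t * r * Real.sin (ν * x)) * hν
  · refine ((((h.dxx x t).neg.mul_const (r ^ 2)).mul (dc x)).add (((h.dx x t).mul_const r).mul (ds x))).congr_deriv ?_
    simp only [Pi.neg_apply]
    linear_combination (mx x t * r * Real.sin (ν * x) + m x t * Real.cos (ν * x)) * hν
  · exact (((h.dt x t).neg.mul_const (r ^ 2)).mul_const _)
  · exact (((h.dxt x t).neg.mul_const (r ^ 2)).mul_const _).add (((h.dt x t).mul_const r).mul_const _)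
  · refine (((h.dtx x t).neg.mul_const (r ^ 2)).mul (dc x)).congr_deriv ?_
    simp only [Pi.neg_apply]
    linear_combination (mt x t * r * Real.sin (ν * x)) * hν
  · intro x t hz
    obtain ⟨a1, a2, a3, a4, a5⟩ := hv x t hz
    simp only [a1, a2, a3, a4, a5]
    simp
  · obtain ⟨a1, a2, a3, a4, a5⟩ := hC x t
    have z0 : |(0:ℝ)| ≤ C := by rw [abs_zero]; exact (abs_nonneg _).trans a1
    have k1 := Real.abs_cos_le_one (ν * x)
    have k2 := Real.abs_sin_le_one (ν * x)
    refine ⟨?_, osc_bd a2 a1 hr hr1 k1 k2, ?_, osc_bd a5 a4 hr hr1 k1 k2, ?_⟩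
    · have := osc_bd a1 z0 hr hr1 k1 k2
      simpa using this
    · have := osc_bd a4 z0 hr hr1 k1 k2
      simpa using this
    · have e1 := osc_bd a3 a2 hr hr1 k1 k2
      have e2 : |mx x t * r * Real.sin (ν * x)| ≤ C * r := by
        rw [abs_mul, abs_mul, abs_of_pos hr]
        have hC0 : 0 ≤ C := (abs_nonneg _).trans a1
        calc |mx x t| * r * |Real.sin (ν * x)| ≤ C * r * 1 := by gcongr
          _ = C * r := mul_one _
      rw [add_sub_cancel_right]
      refine (abs_add_le _ _).trans ?_
      linarith

/-- Perturbing a potential by a smooth function vanishing outside `S ⊆ Ω_T`. -/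
lemma Pot.pert {T : ℝ} {b bx c f W u p w Q : ℝ → ℝ → ℝ} {d : ℝ → ℝ} (h : Pot T b c f W u p w Q)
    (hb : Continuous fun z : ℝ × ℝ => b z.1 z.2) (hd : Continuous d)
    (hbx : ∀ x ∈ Icc (0:ℝ) 1, ∀ t ∈ Icc 0 T, HasDerivWithinAt (fun y => b y t) (bx x t) (Icc 0 1) x)
    (hce : ∀ x ∈ Icc (0:ℝ) 1, ∀ t ∈ Icc 0 T, c x t = bx x t + d t)
    {S : Set (ℝ × ℝ)} (hS : S ⊆ Ioo (0:ℝ) 1 ×ˢ Ioo 0 T)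
    {g gx gxx gt gxt : ℝ → ℝ → ℝ} (hg : Sm g gx gxx gt gxt) (hv : Van S g gx gxx gt gxt) :
    Pot T b c f (fun x t => W x t + g x t) (fun x t => u x t + gx x t) (fun x t => p x t + gxx x t)
      (fun x t => w x t + (gt x t - b x t * gx x t - d t * g x t)) (fun x t => Q x t + (b x t * gx x t + d t * g x t)) := by
  have hd2 : Continuous fun z : ℝ × ℝ => d z.2 := hd.comp continuous_snd
  have n0 : ∀ t, ((0:ℝ), t) ∉ S := fun t hz => absurd (hS hz).1.1 (lt_irrefl _)
  have n1 : ∀ t, ((1:ℝ), t) ∉ S := fun t hz => absurd (hS hz).1.2 (lt_irrefl _)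
  refine ⟨h.cW.add hg.c0, h.cu.add hg.cx, h.cp.add hg.cxx, h.cw.add ((hg.ct.sub (hb.mul hg.cx)).sub (hd2.mul hg.c0)),
    h.cQ.add ((hb.mul hg.cx).add (hd2.mul hg.c0)), fun x hx t ht => (h.Wx x hx t ht).add (hg.dx x t).hasDerivWithinAt,
    fun x hx t ht => (h.ux x hx t ht).add (hg.dxx x t).hasDerivWithinAt, fun x hx t ht => ?_, fun x hx t ht => ?_,
    fun t ht => ?_, fun t ht => ?_, fun t ht => ?_, fun t ht => ?_⟩
  · refine ((h.Qx x hx t ht).add (((hbx x hx t ht).mul (hg.dxx x t).hasDerivWithinAt).add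
      ((hg.dx x t).hasDerivWithinAt.const_mul (d t)))).congr_deriv ?_
    rw [hce x hx t ht]; ring
  · refine ((h.Wt x hx t ht).add (hg.dt x t).hasDerivWithinAt).congr_deriv ?_
    ring
  · obtain ⟨a1, a2, a3, a4, a5⟩ := hv 0 t (n0 t)
    simp only [h.W0 t ht, a1, add_zero]
  · obtain ⟨a1, a2, a3, a4, a5⟩ := hv 0 t (n0 t)
    simp only [h.Q0 t ht, a1, a2, mul_zero, add_zero]
  · obtain ⟨a1, a2, a3, a4, a5⟩ := hv 0 t (n0 t)
    simp only [h.w0 t ht, a1, a2, a4, mul_zero, add_zero, sub_zero]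
  · obtain ⟨a1, a2, a3, a4, a5⟩ := hv 1 t (n1 t)
    simp only [h.w1 t ht, a1, a2, a4, mul_zero, add_zero, sub_zero]

/-- Riemann–Lebesgue in the first variable. -/
lemma rl_full {g : ℝ × ℝ → ℝ} (hg : Integrable g) :
    Filter.Tendsto (fun n : ℕ => ∫ z, g z * Real.cos (2 * Real.pi * n * z.1)) Filter.atTop (nhds 0) := by
  have h := tendsto_integral_exp_smul_cocompact (V := ℝ × ℝ) (fun z => (g z : ℂ)) (volume : Measure (ℝ × ℝ))
  have hw : Filter.Tendsto (fun n : ℕ => (n : ℝ) • ContinuousLinearMap.fst ℝ ℝ ℝ) Filter.atTop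
      (Filter.cocompact (StrongDual ℝ (ℝ × ℝ))) := by
    rw [← Metric.cobounded_eq_cocompact, ← tendsto_norm_atTop_iff_cobounded]
    have h0 : 0 < ‖ContinuousLinearMap.fst ℝ ℝ ℝ‖ := by
      rw [norm_pos_iff]; intro h0
      have := congrArg (fun F => F (1, 0)) h0
      simp at this
    simp only [norm_smul, Real.norm_natCast]
    exact tendsto_natCast_atTop_atTop.atTop_mul_const h0
  have h2 := (Complex.continuous_re.tendsto 0).comp (h.comp hw)
  simp only [Complex.zero_re] at h2
  refine h2.congr fun n => ?_
  simp only [Function.comp]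
  have hi : Integrable (fun v : ℝ × ℝ => Real.fourierChar (-((n:ℝ) • ContinuousLinearMap.fst ℝ ℝ ℝ) v) • (g v : ℂ)) := by
    have hgc : Integrable (fun z => (g z : ℂ)) := hg.ofReal
    refine Integrable.mono hgc ?_ (Filter.Eventually.of_forall fun z => ?_)
    · refine AEStronglyMeasurable.smul (Continuous.aestronglyMeasurable ?_) hgc.1
      fun_prop
    · rw [Circle.norm_smul]
  have e : ∀ G : ℝ × ℝ → ℂ, Integrable G → (∫ z, G z).re = ∫ z, (G z).re := fun G hG => (integral_re hG).symm
  rw [e _ hi]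
  refine integral_congr_ae (Filter.Eventually.of_forall fun z => ?_)
  simp only [Circle.smul_def, Real.fourierChar_apply, smul_eq_mul]
  rw [Complex.re_mul_ofReal, Complex.exp_ofReal_mul_I_re, mul_comm]
  congr 1
  simp only [FunLike.coe_smul, Pi.smul_apply, ContinuousLinearMap.coe_fst', smul_eq_mul]
  rw [← Real.cos_neg]; congr 1; ring

lemma rl {g : ℝ × ℝ → ℝ} {S : Set (ℝ × ℝ)} (hS : MeasurableSet S) (hg : IntegrableOn g S) :
    Filter.Tendsto (fun n : ℕ => ∫ z in S, g z * Real.cos (2 * Real.pi * n * z.1)) Filter.atTop (nhds 0) := by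
  refine (rl_full (hg.integrable_indicator hS)).congr fun n => ?_
  rw [← integral_indicator hS]
  refine integral_congr_ae (Filter.Eventually.of_forall fun z => ?_)
  by_cases hz : z ∈ S <;> simp [hz]

end FwdSol

namespace FwdSol

/-- the open space-time rectangle -/
def Om (T : ℝ) : Set (ℝ × ℝ) := Ioo (0:ℝ) 1 ×ˢ Ioo (0:ℝ) T

lemma Om_meas (T : ℝ) : MeasurableSet (Om T) := measurableSet_Ioo.prod measurableSet_Ioo

lemma Om_int {T : ℝ} {F : ℝ × ℝ → ℝ} (hF : Continuous F) : IntegrableOn F (Om T) :=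
  (hF.continuousOn.integrableOn_compact (isCompact_Icc.prod isCompact_Icc)).mono_set
    (prod_mono Ioo_subset_Icc_self Ioo_subset_Icc_self)

lemma Om_vol {T : ℝ} (hT : 0 < T) : volume.real (Om T) = T := by
  rw [Om, Measure.volume_eq_prod, measureReal_prod_prod]
  simp [hT.le]

lemma Om_lt (T : ℝ) : volume (Om T) < ⊤ := by
  rw [Om, Measure.volume_eq_prod, Measure.prod_prod]
  simp only [Real.volume_Ioo]
  exact ENNReal.mul_lt_top ENNReal.ofReal_lt_top ENNReal.ofReal_lt_top

/-- five functions: a function and its derivatives -/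
structure P5 where
  v : ℝ → ℝ → ℝ
  vx : ℝ → ℝ → ℝ
  vxx : ℝ → ℝ → ℝ
  vt : ℝ → ℝ → ℝ
  vxt : ℝ → ℝ → ℝ

def P5.add (P Q : P5) : P5 :=
  ⟨fun x t => P.v x t + Q.v x t, fun x t => P.vx x t + Q.vx x t, fun x t => P.vxx x t + Q.vxx x t,
    fun x t => P.vt x t + Q.vt x t, fun x t => P.vxt x t + Q.vxt x t⟩

/-- flux perturbation -/
def P5.fl (b : ℝ → ℝ → ℝ) (d : ℝ → ℝ) (P : P5) (x t : ℝ) : ℝ := P.vt x t - b x t * P.vx x t - d t * P.v x t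

lemma P5.fl_add (b : ℝ → ℝ → ℝ) (d : ℝ → ℝ) (P Q : P5) (x t : ℝ) :
    (P.add Q).fl b d x t = P.fl b d x t + Q.fl b d x t := by
  simp only [P5.fl, P5.add]; ring

/-- The fixed data of the convex integration scheme. -/
structure Ctx (T : ℝ) (p w b : ℝ → ℝ → ℝ) (d : ℝ → ℝ) (G : Set (ℝ × ℝ)) (R1 R2 eps Kb : ℝ) (L U : ℝ → ℝ) : Prop where
  hT : 0 < T
  cp : Continuous fun z : ℝ × ℝ => p z.1 z.2
  cw : Continuous fun z : ℝ × ℝ => w z.1 z.2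
  cb : Continuous fun z : ℝ × ℝ => b z.1 z.2
  cd : Continuous d
  Gs : G ⊆ Om T
  Go : IsOpen G
  e0 : 0 < eps
  r1 : ∀ x t, (x, t) ∈ G → R1 + eps ≤ w x t
  r2 : ∀ x t, (x, t) ∈ G → w x t ≤ R2 - eps
  Lc : Continuous L
  Uc : Continuous U
  bK : ∀ x t, |b x t| ≤ Kb
  dK : ∀ t, |d t| ≤ Kb

/-- Admissible perturbations. -/
structure Good (p w b : ℝ → ℝ → ℝ) (d : ℝ → ℝ) (G : Set (ℝ × ℝ)) (L U : ℝ → ℝ) (κ : ℝ) (P : P5) : Prop where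
  sm : Sm P.v P.vx P.vxx P.vt P.vxt
  van : Van G P.v P.vx P.vxx P.vt P.vxt
  small : ∀ x t, (x, t) ∈ G → |P.fl b d x t| ≤ κ
  lo : ∀ x t, (x, t) ∈ G → L (w x t + P.fl b d x t) ≤ p x t + P.vxx x t
  hi : ∀ x t, (x, t) ∈ G → p x t + P.vxx x t ≤ U (w x t + P.fl b d x t)

/-- distance to the relation -/
def gap (p w b : ℝ → ℝ → ℝ) (d : ℝ → ℝ) (L U : ℝ → ℝ) (P : P5) (x t : ℝ) : ℝ :=
  min (p x t + P.vxx x t - L (w x t + P.fl b d x t)) (U (w x t + P.fl b d x t) - (p x t + P.vxx x t))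

lemma bdd_of_van {T : ℝ} {G : Set (ℝ × ℝ)} (hG : G ⊆ Om T) {F : ℝ → ℝ → ℝ} (hF : Continuous fun z : ℝ × ℝ => F z.1 z.2)
    (hv : ∀ x t, (x, t) ∉ G → F x t = 0) : ∃ C, 0 ≤ C ∧ ∀ x t, |F x t| ≤ C := by
  obtain ⟨C, hC⟩ := (isCompact_Icc (a := (0:ℝ)) (b := 1)).prod (isCompact_Icc (a := (0:ℝ)) (b := T))
    |>.exists_bound_of_continuousOn hF.continuousOn
  refine ⟨max C 0, le_max_right _ _, fun x t => ?_⟩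
  by_cases hz : (x, t) ∈ G
  · exact (hC (x, t) (prod_mono Ioo_subset_Icc_self Ioo_subset_Icc_self (hG hz))).trans (le_max_left _ _)
  · rw [hv x t hz, abs_zero]; exact le_max_right _ _

lemma Sm.bdd {T : ℝ} {G : Set (ℝ × ℝ)} (hG : G ⊆ Om T) {m mx mxx mt mxt : ℝ → ℝ → ℝ} (h : Sm m mx mxx mt mxt)
    (hv : Van G m mx mxx mt mxt) :
    ∃ C, 0 ≤ C ∧ ∀ x t, |m x t| ≤ C ∧ |mx x t| ≤ C ∧ |mxx x t| ≤ C ∧ |mt x t| ≤ C ∧ |mxt x t| ≤ C := by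
  obtain ⟨C1, p1, h1⟩ := bdd_of_van hG h.c0 (fun x t hz => (hv x t hz).1)
  obtain ⟨C2, p2, h2⟩ := bdd_of_van hG h.cx (fun x t hz => (hv x t hz).2.1)
  obtain ⟨C3, p3, h3⟩ := bdd_of_van hG h.cxx (fun x t hz => (hv x t hz).2.2.1)
  obtain ⟨C4, p4, h4⟩ := bdd_of_van hG h.ct (fun x t hz => (hv x t hz).2.2.2.1)
  obtain ⟨C5, p5, h5⟩ := bdd_of_van hG h.cxt (fun x t hz => (hv x t hz).2.2.2.2)
  exact ⟨C1 + C2 + C3 + C4 + C5, by linarith, fun x t => ⟨(h1 x t).trans (by linarith), (h2 x t).trans (by linarith),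
    (h3 x t).trans (by linarith), (h4 x t).trans (by linarith), (h5 x t).trans (by linarith)⟩⟩

/-- modulus of continuity on a compact interval -/
lemma unif_mod {L : ℝ → ℝ} (hL : Continuous L) (R1 R2 : ℝ) {δ : ℝ} (hδ : 0 < δ) :
    ∃ θ > 0, ∀ a ∈ Icc R1 R2, ∀ b ∈ Icc R1 R2, |a - b| ≤ θ → |L a - L b| ≤ δ := by
  have h := (isCompact_Icc (a := R1) (b := R2)).uniformContinuousOn_of_continuous hL.continuousOn
  obtain ⟨θ, h0, h1⟩ := Metric.uniformContinuousOn_iff.1 h δ hδ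
  refine ⟨θ / 2, by linarith, fun a ha b hb hab => ?_⟩
  have := h1 a ha b hb (by rw [Real.dist_eq]; linarith)
  rw [Real.dist_eq] at this; exact this.le

/-- the amplitude function -/
lemma exists_amp {T : ℝ} {p w b : ℝ → ℝ → ℝ} {d : ℝ → ℝ} {G : Set (ℝ × ℝ)} {R1 R2 eps Kb : ℝ} {L U : ℝ → ℝ}
    (hX : Ctx T p w b d G R1 R2 eps Kb L U) {κ : ℝ} {P : P5} (hP : Good p w b d G L U κ P) {δ : ℝ} (hδ : 0 < δ) (N : ℕ) :
    ∃ m mx mxx mt mxt S, Sm m mx mxx mt mxt ∧ S ⊆ G ∧ Van S m mx mxx mt mxt ∧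
      (∀ x t, (x, t) ∈ S → |m x t| ≤ gap p w b d L U P x t - δ) ∧
      ∀ x t, 2 ≤ N * Metric.infDist (x, t) Gᶜ → gap p w b d L U P x t ≤ |m x t| + 3 * δ := by
  have hT := hX.hT
  have cfl : Continuous (fun z : ℝ × ℝ => P.fl b d z.1 z.2) :=
    (hP.sm.ct.sub (hX.cb.mul hP.sm.cx)).sub ((hX.cd.comp continuous_snd).mul hP.sm.c0)
  have cwk := hX.cw.add cfl
  have cpk := hX.cp.add hP.sm.cxx
  have cM : Continuous (fun z : ℝ × ℝ => gap p w b d L U P z.1 z.2) :=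
    (cpk.sub (hX.Lc.comp cwk)).min ((hX.Uc.comp cwk).sub cpk)
  have cχ0 : Continuous (fun z : ℝ × ℝ => (N:ℝ) * Metric.infDist z Gᶜ) := continuous_const.mul (Metric.continuous_infDist_pt _)
  set χ : ℝ × ℝ → ℝ := fun z => max 0 (min 1 ((N:ℝ) * Metric.infDist z Gᶜ - 1)) with hχ
  have cχ : Continuous χ := continuous_const.max (continuous_const.min (cχ0.sub continuous_const))
  set H : ℝ × ℝ → ℝ := fun z => max (gap p w b d L U P z.1 z.2 - 2 * δ) 0 * χ z with hH
  have cH : Continuous H := ((cM.sub continuous_const).max continuous_const).mul cχ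
  have χ0 : ∀ z, 0 ≤ χ z := fun z => le_max_left _ _
  have χ1 : ∀ z, χ z ≤ 1 := fun z => max_le zero_le_one (min_le_left _ _)
  have H0 : ∀ z, 0 ≤ H z := fun z => mul_nonneg (le_max_right _ _) (χ0 z)
  obtain ⟨m, hm1, hm2, hm3⟩ := cH.exists_contDiff_approx (⊤ : ℕ∞) (continuous_const : Continuous fun _ : ℝ × ℝ => δ) (fun _ => hδ)
  have hsup : tsupport m ⊆ G := by
    have hcl : IsClosed {z : ℝ × ℝ | 1 ≤ (N:ℝ) * Metric.infDist z Gᶜ} := isClosed_le continuous_const cχ0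
    have h1 : Function.support m ⊆ {z : ℝ × ℝ | 1 ≤ (N:ℝ) * Metric.infDist z Gᶜ} := by
      intro z hz
      have := hm3 hz
      simp only [Function.mem_support, hH] at this
      by_contra hn
      have hn' : (N:ℝ) * Metric.infDist z Gᶜ < 1 := not_le.1 hn
      apply this
      have : χ z = 0 := by
        simp only [hχ]
        exact max_eq_left ((min_le_right _ _).trans (by linarith))
      rw [this, mul_zero]
    intro z hz
    have h2 : 1 ≤ (N:ℝ) * Metric.infDist z Gᶜ := closure_minimal h1 hcl hz
    by_contra hn
    rw [Metric.infDist_zero_of_mem (by exact hn), mul_zero] at h2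
    linarith
  obtain ⟨mx, mxx, mt, mxt, hs, hv⟩ := sm_of_contDiff (g := fun x t => m (x, t)) hm1
  have hsup2 : tsupport m ⊆ {z : ℝ × ℝ | 2 * δ ≤ gap p w b d L U P z.1 z.2} := by
    refine closure_minimal (fun z hz => ?_) (isClosed_le continuous_const cM)
    have h1 : H z ≠ 0 := hm3 hz
    simp only [hH] at h1
    have h3 : max (gap p w b d L U P z.1 z.2 - 2 * δ) 0 ≠ 0 := left_ne_zero_of_mul h1
    by_contra hn
    have hn' : gap p w b d L U P z.1 z.2 < 2 * δ := not_le.1 hn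
    exact h3 (max_eq_right (by linarith))
  refine ⟨fun x t => m (x, t), mx, mxx, mt, mxt, tsupport m, hs, hsup, hv, fun x t hz => ?_, fun x t hz => ?_⟩
  · have h4' : 2 * δ ≤ gap p w b d L U P x t := hsup2 hz
    have h4 : 0 ≤ gap p w b d L U P x t - 2 * δ := by linarith
    have h2 := hm2 (x, t)
    rw [Real.dist_eq] at h2
    have h5 : H (x, t) ≤ gap p w b d L U P x t - 2 * δ := by
      simp only [hH]
      rw [max_eq_left h4]
      exact mul_le_of_le_one_right h4 (χ1 _)
    have h6 : |m (x, t)| ≤ |m (x, t) - H (x, t)| + |H (x, t)| := by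
      have := abs_add_le (m (x, t) - H (x, t)) (H (x, t)); rwa [sub_add_cancel] at this
    rw [abs_of_nonneg (H0 _)] at h6
    linarith
  · have h2 := hm2 (x, t)
    rw [Real.dist_eq] at h2
    have h3 : χ (x, t) = 1 := by
      simp only [hχ]
      rw [min_eq_left (by linarith), max_eq_right zero_le_one]
    have h4 : gap p w b d L U P x t - 2 * δ ≤ H (x, t) := by
      simp only [hH]
      rw [h3, mul_one]; exact le_max_left _ _
    have h5 := (abs_lt.1 h2).1
    have h6 := le_abs_self (m (x, t))
    linarith

end FwdSol

namespace FwdSol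

lemma tendsto_r : Filter.Tendsto (fun n : ℕ => (2 * Real.pi * (n:ℝ))⁻¹) Filter.atTop (nhds 0) := by
  refine tendsto_inv_atTop_zero.comp ?_
  exact tendsto_natCast_atTop_atTop.const_mul_atTop (by positivity)

lemma ev_small (C : ℝ) {a : ℝ} (ha : 0 < a) : ∀ᶠ n : ℕ in Filter.atTop, C * (2 * Real.pi * (n:ℝ))⁻¹ ≤ a := by
  have h := tendsto_r.const_mul C
  rw [mul_zero] at h
  exact (h.eventually (gt_mem_nhds ha)).mono fun n hn => le_of_lt hn

/-- energy lower bound, for one oscillation -/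
lemma energy {T : ℝ} (hT : 0 < T) {m k : ℝ × ℝ → ℝ} (hm : Continuous m) (hk : Continuous k) {e ν : ℝ}
    (he : ∀ z, |k z - m z * Real.cos (ν * z.1)| ≤ e) :
    ∫ z in Om T, m z ^ 2 ≤ 4 * (∫ z in Om T, k z ^ 2) + 4 * e ^ 2 * T + |∫ z in Om T, m z ^ 2 * Real.cos (2 * ν * z.1)| := by
  have cc : Continuous fun z : ℝ × ℝ => Real.cos (2 * ν * z.1) := by fun_prop
  have i1 : IntegrableOn (fun z => m z ^ 2) (Om T) := Om_int (hm.pow 2)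
  have i2 : IntegrableOn (fun z => m z ^ 2 * Real.cos (2 * ν * z.1)) (Om T) := Om_int ((hm.pow 2).mul cc)
  have i3 : IntegrableOn (fun z => k z ^ 2) (Om T) := Om_int (hk.pow 2)
  have i4 : IntegrableOn (fun _ : ℝ × ℝ => 4 * e ^ 2) (Om T) := Om_int continuous_const
  have pt : ∀ z, m z ^ 2 + m z ^ 2 * Real.cos (2 * ν * z.1) ≤ 4 * k z ^ 2 + 4 * e ^ 2 := by
    intro z
    have h1 := Real.cos_sq (ν * z.1)
    rw [← mul_assoc] at h1
    have h2 := sq_le_sq' (by linarith [neg_abs_le (k z - m z * Real.cos (ν * z.1)), he z]) ((le_abs_self _).trans (he z))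
    have h3 : m z ^ 2 + m z ^ 2 * Real.cos (2 * ν * z.1) = 2 * (m z * Real.cos (ν * z.1)) ^ 2 := by
      rw [mul_pow, h1]; ring
    rw [h3]
    nlinarith [sq_nonneg (2 * k z - m z * Real.cos (ν * z.1))]
  have h := setIntegral_mono (i1.add i2) ((i3.const_mul 4).add i4) pt
  have e1 : ∫ z in Om T, (m z ^ 2 + m z ^ 2 * Real.cos (2 * ν * z.1)) = _ := integral_add i1 i2
  have e2 : ∫ z in Om T, (4 * k z ^ 2 + 4 * e ^ 2) = _ := integral_add (i3.const_mul 4) i4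
  have h' : ∫ z in Om T, (m z ^ 2 + m z ^ 2 * Real.cos (2 * ν * z.1)) ≤ ∫ z in Om T, (4 * k z ^ 2 + 4 * e ^ 2) := h
  rw [e1, e2, integral_const_mul, setIntegral_const, Om_vol hT, smul_eq_mul] at h'
  linarith [neg_abs_le (∫ z in Om T, m z ^ 2 * Real.cos (2 * ν * z.1))]

lemma corr {T : ℝ} {m k q : ℝ × ℝ → ℝ} (hm : Continuous m) (hk : Continuous k) (hq : Continuous q) {e ν : ℝ}
    (he : ∀ z, |k z - m z * Real.cos (ν * z.1)| ≤ e) :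
    |∫ z in Om T, k z * q z| ≤ e * (∫ z in Om T, |q z|) + |∫ z in Om T, (m z * q z) * Real.cos (ν * z.1)| := by
  have cc : Continuous fun z : ℝ × ℝ => Real.cos (ν * z.1) := by fun_prop
  have i1 : IntegrableOn (fun z => (k z - m z * Real.cos (ν * z.1)) * q z) (Om T) := Om_int ((hk.sub (hm.mul cc)).mul hq)
  have i2 : IntegrableOn (fun z => (m z * q z) * Real.cos (ν * z.1)) (Om T) := Om_int ((hm.mul hq).mul cc)
  have i3 : IntegrableOn (fun z => e * |q z|) (Om T) := Om_int (continuous_const.mul hq.abs)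
  have e1 : ∫ z in Om T, k z * q z = (∫ z in Om T, (k z - m z * Real.cos (ν * z.1)) * q z)
      + ∫ z in Om T, (m z * q z) * Real.cos (ν * z.1) := by
    rw [← integral_add i1 i2]
    congr 1; ext z; ring
  have h2 : |∫ z in Om T, (k z - m z * Real.cos (ν * z.1)) * q z| ≤ ∫ z in Om T, e * |q z| := by
    have := norm_integral_le_of_norm_le (μ := volume.restrict (Om T)) i3
      (Filter.Eventually.of_forall fun z => (by
        rw [Real.norm_eq_abs, abs_mul]
        exact mul_le_mul_of_nonneg_right (he z) (abs_nonneg _) :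
        ‖(k z - m z * Real.cos (ν * z.1)) * q z‖ ≤ e * |q z|))
    exact this
  rw [integral_const_mul] at h2
  rw [e1]
  exact (abs_add_le _ _).trans (by linarith)

set_option maxHeartbeats 1000000 in
/-- One step of the convex integration scheme. -/
lemma step {T : ℝ} {p w b : ℝ → ℝ → ℝ} {d : ℝ → ℝ} {G : Set (ℝ × ℝ)} {R1 R2 eps Kb : ℝ} {L U : ℝ → ℝ}
    (hX : Ctx T p w b d G R1 R2 eps Kb L U) {κ κ' : ℝ} {P : P5} (hP : Good p w b d G L U κ P) (hκ : κ < κ') (hκ' : κ' ≤ eps)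
    {η δ : ℝ} (hη : 0 < η) (hδ : 0 < δ) (N : ℕ) (l : List (ℝ → ℝ → ℝ)) (hl : ∀ q ∈ l, Continuous fun z : ℝ × ℝ => q z.1 z.2) :
    ∃ (m : ℝ → ℝ → ℝ) (h : P5), (Continuous fun z : ℝ × ℝ => m z.1 z.2) ∧ Good p w b d G L U κ' (P.add h) ∧
      Sm h.v h.vx h.vxx h.vt h.vxt ∧ Van G h.v h.vx h.vxx h.vt h.vxt ∧
      (∀ x t, |h.v x t| ≤ η ∧ |h.vx x t| ≤ η ∧ |h.vt x t| ≤ η ∧ |h.vxt x t| ≤ η) ∧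
      (∀ q ∈ l, |∫ z in Om T, h.vxx z.1 z.2 * q z.1 z.2| ≤ η) ∧
      (∫ z in Om T, m z.1 z.2 ^ 2 ≤ 4 * (∫ z in Om T, h.vxx z.1 z.2 ^ 2) + η) ∧
      ∀ x t, 2 ≤ N * Metric.infDist (x, t) Gᶜ → gap p w b d L U P x t ≤ |m x t| + 3 * δ := by
  have hT := hX.hT
  obtain ⟨m, mx, mxx, mt, mxt, S, hs, hSG, hv, hm1, hm2⟩ := exists_amp hX hP hδ N
  have hvG : Van G m mx mxx mt mxt := fun x t hz => hv x t fun h => hz (hSG h)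
  obtain ⟨C, hC0, hC⟩ := hs.bdd hX.Gs hvG
  obtain ⟨θ1, θ10, hθ1⟩ := unif_mod hX.Lc R1 R2 (half_pos hδ)
  obtain ⟨θ2, θ20, hθ2⟩ := unif_mod hX.Uc R1 R2 (half_pos hδ)
  have hKb : 0 ≤ Kb := (abs_nonneg _).trans (hX.dK 0)
  have E1 := ev_small 1 one_pos
  have E2 := ev_small (2 * C) hη
  have E3 := ev_small (3 * C) (half_pos hδ)
  have E4 := ev_small ((1 + 2 * Kb) * (2 * C)) (lt_min (lt_min θ10 θ20) (sub_pos.2 hκ))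
  have E5 : ∀ᶠ n : ℕ in Filter.atTop, ∀ q ∈ {q | q ∈ l}, (3 * C * (2 * Real.pi * (n:ℝ))⁻¹) * (∫ z in Om T, |q z.1 z.2|)
      + |∫ z in Om T, (m z.1 z.2 * q z.1 z.2) * Real.cos (2 * Real.pi * n * z.1)| ≤ η := by
    refine (Filter.eventually_all_finite l.finite_toSet).2 fun q hq => ?_
    have hq' := hl q hq
    have a1 := ((tendsto_r.const_mul (3 * C)).mul_const (∫ z in Om T, |q z.1 z.2|)).add
      (rl (Om_meas T) (Om_int (T := T) (hs.c0.mul hq'))).abs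
    rw [mul_zero, zero_mul, abs_zero, add_zero] at a1
    exact (a1.eventually (gt_mem_nhds hη)).mono fun n hn => le_of_lt hn
  have E6 : ∀ᶠ n : ℕ in Filter.atTop, 4 * (3 * C * (2 * Real.pi * (n:ℝ))⁻¹) ^ 2 * T
      + |∫ z in Om T, m z.1 z.2 ^ 2 * Real.cos (2 * (2 * Real.pi * n) * z.1)| ≤ η := by
    have r2 := (rl (Om_meas T) (Om_int (T := T) (hs.c0.pow 2))).comp
      (Filter.tendsto_id.const_mul_atTop' (two_pos : 0 < 2))
    have a1 := ((((tendsto_r.const_mul (3 * C)).pow 2).const_mul 4).mul_const T).add r2.abs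
    have z0 : 4 * (3 * C * 0) ^ 2 * T + |(0:ℝ)| = 0 := by simp
    rw [z0] at a1
    refine (a1.eventually (gt_mem_nhds hη)).mono fun n hn => ?_
    refine le_trans (le_of_eq ?_) (le_of_lt hn)
    congr 2
    refine integral_congr_ae (Filter.Eventually.of_forall fun z => ?_)
    simp only [id, Nat.cast_mul, Nat.cast_ofNat]
    congr 2; ring
  obtain ⟨n, F1, F2, F3, F4, F5, F6, F7⟩ := (E1.and (E2.and (E3.and (E4.and (E5.and (E6.and (Filter.eventually_ge_atTop 1))))))).exists
  have hn : 0 < 2 * Real.pi * (n:ℝ) := by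
    have : (0:ℝ) < n := by exact_mod_cast F7
    positivity
  set ν := 2 * Real.pi * (n:ℝ) with hν
  rw [one_mul] at F1
  obtain ⟨g, gx, gxx, gt, gxt, hg, hgv, hgb⟩ := osc hs hv hC (inv_pos.2 hn) F1 (inv_mul_cancel₀ hn.ne')
  have hgvG : Van G g gx gxx gt gxt := fun x t hz => hgv x t fun h => hz (hSG h)
  have hfl : ∀ x t, |(P5.mk g gx gxx gt gxt).fl b d x t| ≤ (1 + 2 * Kb) * (2 * C) * ν⁻¹ := by
    intro x t
    obtain ⟨k1, k2, k3, k4, k5⟩ := hgb x t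
    simp only [P5.fl]
    have e1 : |b x t * gx x t| ≤ Kb * (2 * C * ν⁻¹) := by
      rw [abs_mul]; exact mul_le_mul (hX.bK x t) k2 (abs_nonneg _) hKb
    have e2 : |d t * g x t| ≤ Kb * (2 * C * ν⁻¹) := by
      rw [abs_mul]; exact mul_le_mul (hX.dK t) k1 (abs_nonneg _) hKb
    have e3 := abs_sub (gt x t - b x t * gx x t) (d t * g x t)
    have e4 := abs_sub (gt x t) (b x t * gx x t)
    have e5 : (1 + 2 * Kb) * (2 * C) * ν⁻¹ = 2 * C * ν⁻¹ + Kb * (2 * C * ν⁻¹) + Kb * (2 * C * ν⁻¹) := by ring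
    rw [e5]; linarith
  have hsmall : ∀ x t, (x, t) ∈ G → |(P.add ⟨g, gx, gxx, gt, gxt⟩).fl b d x t| ≤ κ' := by
    intro x t hz
    rw [P5.fl_add]
    have e1 := abs_add_le (P.fl b d x t) ((P5.mk g gx gxx gt gxt).fl b d x t)
    have e2 := hP.small x t hz
    have e3 := hfl x t
    have e4 := F4.trans (min_le_right _ _)
    linarith
  have hR : ∀ κ0 ≤ eps, ∀ a x t, (x, t) ∈ G → |a| ≤ κ0 → w x t + a ∈ Icc R1 R2 := by
    intro κ0 h0 a x t hz ha
    have e1 := hX.r1 x t hz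
    have e2 := hX.r2 x t hz
    have e3 := abs_le.1 ha
    exact ⟨by linarith [e3.1], by linarith [e3.2]⟩
  have hboth : ∀ x t, (x, t) ∈ G → L (w x t + (P.add ⟨g, gx, gxx, gt, gxt⟩).fl b d x t) ≤ p x t + (P.vxx x t + gxx x t) ∧
      p x t + (P.vxx x t + gxx x t) ≤ U (w x t + (P.add ⟨g, gx, gxx, gt, gxt⟩).fl b d x t) := by
    intro x t hz
    by_cases hzS : (x, t) ∈ S
    · have mem1 := hR κ (hκ.le.trans hκ') _ x t hz (hP.small x t hz)
      have mem2 := hR κ' hκ' _ x t hz (hsmall x t hz)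
      have hdiff : |(w x t + P.fl b d x t) - (w x t + (P.add ⟨g, gx, gxx, gt, gxt⟩).fl b d x t)| ≤ min θ1 θ2 := by
        rw [P5.fl_add]
        have : (w x t + P.fl b d x t) - (w x t + (P.fl b d x t + (P5.mk g gx gxx gt gxt).fl b d x t))
          = -((P5.mk g gx gxx gt gxt).fl b d x t) := by ring
        rw [this, abs_neg]
        exact (hfl x t).trans (F4.trans (min_le_left _ _))
      have l1 := abs_le.1 (hθ1 _ mem1 _ mem2 (hdiff.trans (min_le_left _ _)))
      have l2 := abs_le.1 (hθ2 _ mem1 _ mem2 (hdiff.trans (min_le_right _ _)))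
      have g1 := hm1 x t hzS
      have g2 : gap p w b d L U P x t ≤ p x t + P.vxx x t - L (w x t + P.fl b d x t) := min_le_left _ _
      have g3 : gap p w b d L U P x t ≤ U (w x t + P.fl b d x t) - (p x t + P.vxx x t) := min_le_right _ _
      have g4 : |gxx x t| ≤ |m x t| + δ / 2 := by
        have a1 := (hgb x t).2.2.2.2.trans F3
        have a2 := abs_add_le (gxx x t - m x t * Real.cos (ν * x)) (m x t * Real.cos (ν * x))
        rw [sub_add_cancel] at a2
        have a3 : |m x t * Real.cos (ν * x)| ≤ |m x t| := by
          rw [abs_mul]; exact mul_le_of_le_one_right (abs_nonneg _) (Real.abs_cos_le_one _)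
        linarith
      have g5 := abs_le.1 g4
      exact ⟨by linarith [l1.1, g5.1], by linarith [l2.2, g5.2]⟩
    · obtain ⟨a1, a2, a3, a4, a5⟩ := hgv x t hzS
      have : (P5.mk g gx gxx gt gxt).fl b d x t = 0 := by simp [P5.fl, a1, a2, a4]
      rw [P5.fl_add, this, a3, add_zero, add_zero]
      exact ⟨hP.lo x t hz, hP.hi x t hz⟩
  refine ⟨m, ⟨g, gx, gxx, gt, gxt⟩, hs.c0, ⟨hP.sm.add hg, hP.van.add hgvG, hsmall, fun x t hz => (hboth x t hz).1,
    fun x t hz => (hboth x t hz).2⟩, hg, hgvG, fun x t => ?_, fun q hq => ?_, ?_, hm2⟩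
  · obtain ⟨k1, k2, k3, k4, k5⟩ := hgb x t
    exact ⟨k1.trans F2, k2.trans F2, k3.trans F2, k4.trans F2⟩
  · exact (corr (m := fun z => m z.1 z.2) (k := fun z => gxx z.1 z.2) (q := fun z => q z.1 z.2) hs.c0 hg.cxx (hl q hq)
      (fun z => (hgb z.1 z.2).2.2.2.2)).trans (F5 q hq)
  · have := energy (T := T) (m := fun z => m z.1 z.2) (k := fun z => gxx z.1 z.2) hT hs.c0 hg.cxx
      (fun z => (hgb z.1 z.2).2.2.2.2)
    linarith

end FwdSol

namespace FwdSol

def P5.zero : P5 := ⟨fun _ _ => 0, fun _ _ => 0, fun _ _ => 0, fun _ _ => 0, fun _ _ => 0⟩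

/-- The properties of the `k`-th step. -/
structure Stp (T : ℝ) (p w b : ℝ → ℝ → ℝ) (d : ℝ → ℝ) (G : Set (ℝ × ℝ)) (L U : ℝ → ℝ) (k : ℕ) (P h : P5)
    (m : ℝ → ℝ → ℝ) : Prop where
  cm : Continuous fun z : ℝ × ℝ => m z.1 z.2
  sm : Sm h.v h.vx h.vxx h.vt h.vxt
  van : Van G h.v h.vx h.vxx h.vt h.vxt
  bd : ∀ x t, |h.v x t| ≤ (1/2)^k ∧ |h.vx x t| ≤ (1/2)^k ∧ |h.vt x t| ≤ (1/2)^k ∧ |h.vxt x t| ≤ (1/2)^k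
  en : ∫ z in Om T, m z.1 z.2 ^ 2 ≤ 4 * (∫ z in Om T, h.vxx z.1 z.2 ^ 2) + (1/2)^k
  gp : ∀ x t, 2 ≤ ((k:ℝ)+1) * Metric.infDist (x, t) Gᶜ → gap p w b d L U P x t ≤ |m x t| + 3 * (1 / ((k:ℝ)+1))

lemma exists_seq {T : ℝ} {p w b : ℝ → ℝ → ℝ} {d : ℝ → ℝ} {G : Set (ℝ × ℝ)} {R1 R2 eps Kb : ℝ} {L U : ℝ → ℝ}
    (hX : Ctx T p w b d G R1 R2 eps Kb L U)
    (h1 : ∀ x t, (x, t) ∈ G → L (w x t) ≤ p x t) (h2 : ∀ x t, (x, t) ∈ G → p x t ≤ U (w x t)) :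
    ∃ (φ h : ℕ → P5) (m : ℕ → ℝ → ℝ → ℝ), φ 0 = P5.zero ∧ (∀ k, φ (k+1) = (φ k).add (h k)) ∧
      (∀ k, Good p w b d G L U eps (φ k)) ∧ (∀ k, Stp T p w b d G L U k (φ k) (h k) (m k)) ∧
      ∀ k, ∀ i ≤ k, |∫ z in Om T, (h k).vxx z.1 z.2 * (p z.1 z.2 + (φ i).vxx z.1 z.2)| ≤ (1/2)^k := by
  have he := hX.e0
  set κ : ℕ → ℝ := fun k => eps * (1 - (1/2)^k) with hκ
  have κlt : ∀ k, κ k < κ (k+1) := fun k => by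
    have : (0:ℝ) < (1/2)^k := by positivity
    simp only [hκ, pow_succ]; nlinarith
  have κle : ∀ k, κ k ≤ eps := fun k => by
    have : (0:ℝ) < (1/2)^k := by positivity
    simp only [hκ]; nlinarith
  have key : ∀ (k : ℕ) (S : {S : P5 × List (ℝ → ℝ → ℝ) // Good p w b d G L U (κ k) S.1 ∧
      ∀ q ∈ S.2, Continuous fun z : ℝ × ℝ => q z.1 z.2}), ∃ R : P5 × (ℝ → ℝ → ℝ),
      Good p w b d G L U (κ (k+1)) (S.1.1.add R.1) ∧ Stp T p w b d G L U k S.1.1 R.1 R.2 ∧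
      ∀ q ∈ ((fun x t => p x t + S.1.1.vxx x t) :: S.1.2), |∫ z in Om T, R.1.vxx z.1 z.2 * q z.1 z.2| ≤ (1/2)^k := by
    rintro k ⟨⟨P, l⟩, hP, hl⟩
    obtain ⟨m, h, a1, a2, a3, a4, a5, a6, a7, a8⟩ := step hX hP (κlt k) (κle (k+1)) (η := (1/2)^k) (by positivity)
      (δ := 1 / ((k:ℝ)+1)) (by positivity) (k+1) ((fun x t => p x t + P.vxx x t) :: l) (by
        intro q hq
        rcases List.mem_cons.1 hq with rfl | hq
        · exact hX.cp.add hP.sm.cxx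
        · exact hl q hq)
    refine ⟨⟨h, m⟩, a2, ⟨a1, a3, a4, a5, a7, fun x t hx => a8 x t ?_⟩, a6⟩
    push_cast; exact hx
  choose R r1 r2 r3 using key
  have h0 : Good p w b d G L U (κ 0) P5.zero := by
    have hk : κ 0 = 0 := by simp [hκ]
    have hf : ∀ x t, P5.zero.fl b d x t = 0 := fun x t => by simp [P5.zero, P5.fl]
    refine ⟨Sm.zero, fun x t _ => ⟨rfl, rfl, rfl, rfl, rfl⟩, fun x t _ => ?_, fun x t hz => ?_, fun x t hz => ?_⟩
    · rw [hf, hk]; simp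
    · rw [hf, add_zero]; simpa [P5.zero] using h1 x t hz
    · rw [hf, add_zero]; simpa [P5.zero] using h2 x t hz
  let F : (k : ℕ) → {S : P5 × List (ℝ → ℝ → ℝ) // Good p w b d G L U (κ k) S.1 ∧
      ∀ q ∈ S.2, Continuous fun z : ℝ × ℝ => q z.1 z.2} := fun k => Nat.rec ⟨(P5.zero, []), h0, by simp⟩
    (fun k S => ⟨(S.1.1.add (R k S).1, (fun x t => p x t + S.1.1.vxx x t) :: S.1.2), r1 k S, by
        intro q hq
        rcases List.mem_cons.1 hq with rfl | hq
        · exact hX.cp.add S.2.1.sm.cxx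
        · exact S.2.2 q hq⟩) k
  have hmem : ∀ k, ∀ i ≤ k, (fun x t => p x t + (F i).1.1.vxx x t) ∈
      ((fun x t => p x t + (F k).1.1.vxx x t) :: (F k).1.2) := by
    intro k
    induction k with
    | zero => intro i hi; rw [Nat.le_zero.1 hi]; exact List.mem_cons_self
    | succ k ih =>
      intro i hi
      rcases Nat.lt_or_ge i (k+1) with hlt | hge
      · exact List.mem_cons_of_mem _ (ih i (Nat.lt_succ_iff.1 hlt))
      · rw [le_antisymm hi hge]; exact List.mem_cons_self
  refine ⟨fun k => (F k).1.1, fun k => (R k (F k)).1, fun k => (R k (F k)).2, rfl, fun k => rfl, fun k => ?_,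
    fun k => r2 k (F k), fun k i hi => r3 k (F k) _ (hmem k i hi)⟩
  have hg := (F k).2.1
  exact ⟨hg.sm, hg.van, fun x t hz => (hg.small x t hz).trans (κle k), hg.lo, hg.hi⟩

end FwdSol

namespace FwdSol

lemma ae_summable {X : Type*} [MeasurableSpace X] {μ : Measure X} {g : ℕ → X → ℝ} (hg : ∀ k, Integrable (g k) μ)
    (h0 : ∀ k z, 0 ≤ g k z) (hs : Summable fun k => ∫ z, g k z ∂μ) : ∀ᵐ z ∂μ, Summable fun k => g k z := by
  have hm : ∀ k, AEMeasurable (fun z => ENNReal.ofReal (g k z)) μ := fun k => (hg k).1.aemeasurable.ennreal_ofReal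
  have h1 : ∫⁻ z, ∑' k, ENNReal.ofReal (g k z) ∂μ ≠ ⊤ := by
    rw [lintegral_tsum hm]
    have : ∀ k, ∫⁻ z, ENNReal.ofReal (g k z) ∂μ = ENNReal.ofReal (∫ z, g k z ∂μ) := fun k =>
      (ofReal_integral_eq_lintegral_ofReal (hg k) (Filter.Eventually.of_forall (h0 k))).symm
    simp_rw [this]
    exact hs.tsum_ofReal_ne_top
  filter_upwards [ae_lt_top' (AEMeasurable.tsum hm) h1] with z hz
  have := ENNReal.summable_toReal hz.ne
  simpa only [ENNReal.toReal_ofReal (h0 _ z)] using this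

lemma pow_half_tail (k n : ℕ) : ∑ i ∈ Finset.range n, (1/2:ℝ)^(k+i) ≤ 2 * (1/2)^k := by
  have h1 : ∑ i ∈ Finset.range n, (1/2:ℝ)^(k+i) = (1/2)^k * ∑ i ∈ Finset.range n, (1/2:ℝ)^i := by
    rw [Finset.mul_sum]; exact Finset.sum_congr rfl fun i _ => pow_add _ _ _
  have h2 : ∑ i ∈ Finset.range n, (1/2:ℝ)^i ≤ 2 := by
    have := summable_geometric_two.sum_le_tsum (Finset.range n) (fun i _ => by positivity)
    rwa [tsum_geometric_two] at this
  rw [h1, mul_comm]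
  exact mul_le_mul_of_nonneg_right h2 (by positivity)

set_option maxHeartbeats 1000000 in
/-- Almost orthogonal bounded martingale-like sequences converge a.e. along a subsequence. -/
lemma conv_ae {X : Type*} [MeasurableSpace X] {μ : Measure X} [IsFiniteMeasure μ] {p h : ℕ → X → ℝ} {C : ℝ} (hC0 : 0 ≤ C)
    (hp : ∀ k, AEStronglyMeasurable (p k) μ) (hC : ∀ k, ∀ᵐ z ∂μ, |p k z| ≤ C)
    (hh : ∀ k z, p (k+1) z = p k z + h k z)
    (ho : ∀ k, ∀ i ≤ k, |∫ z, h k z * p i z ∂μ| ≤ (1/2)^k) :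
    (Summable fun k => ∫ z, h k z ^ 2 ∂μ) ∧ ∃ (q : X → ℝ) (ns : ℕ → ℕ), Measurable q ∧ StrictMono ns ∧
      ∀ᵐ z ∂μ, Filter.Tendsto (fun j => p (ns j) z) Filter.atTop (nhds (q z)) := by
  have ipp : ∀ i j, Integrable (fun z => p i z * p j z) μ := fun i j => by
    refine Integrable.of_bound ((hp i).mul (hp j)) (C * C) ?_
    filter_upwards [hC i, hC j] with z h1 h2
    rw [Real.norm_eq_abs, abs_mul]
    exact mul_le_mul h1 h2 (abs_nonneg _) hC0
  have heq : ∀ k z, h k z = p (k+1) z - p k z := fun k z => by rw [hh]; ring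
  set J : ℕ → ℕ → ℝ := fun i j => ∫ z, p i z * p j z ∂μ with hJ
  have Jc : ∀ i j, J i j = J j i := fun i j => by simp only [hJ, mul_comm]
  have hsq : ∀ i j, ∫ z, (p i z - p j z)^2 ∂μ = J i i + J j j - 2 * J j i := fun i j => by
    have e : ∀ z, (p i z - p j z)^2 = (p i z * p i z + p j z * p j z) - 2 * (p j z * p i z) := fun z => by ring
    simp_rw [e]
    have ia : Integrable (fun z => p i z * p i z + p j z * p j z) μ := (ipp i i).add (ipp j j)
    rw [integral_sub ia ((ipp j i).const_mul 2), integral_add (ipp i i) (ipp j j), integral_const_mul]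
  have isq : ∀ i j, Integrable (fun z => (p i z - p j z)^2) μ := fun i j => by
    have e : (fun z => (p i z - p j z)^2) = fun z => (p i z * p i z + p j z * p j z) - 2 * (p j z * p i z) := by funext z; ring
    rw [e]; exact ((ipp i i).add (ipp j j)).sub ((ipp j i).const_mul 2)
  have hhp : ∀ k i, ∫ z, h k z * p i z ∂μ = J (k+1) i - J k i := fun k i => by
    have e : ∀ z, h k z * p i z = p (k+1) z * p i z - p k z * p i z := fun z => by rw [heq]; ring
    simp_rw [e]
    rw [integral_sub (ipp _ _) (ipp _ _)]
  have ho' : ∀ k, ∀ i ≤ k, |J (k+1) i - J k i| ≤ (1/2)^k := fun k i hi => by rw [← hhp]; exact ho k i hi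
  have tel : ∀ k n, |J (k+n) k - J k k| ≤ 2 * (1/2)^k := fun k n => by
    have : J (k+n) k - J k k = ∑ i ∈ Finset.range n, (J (k+i+1) k - J (k+i) k) :=
      (Finset.sum_range_sub (fun i => J (k+i) k) n).symm
    rw [this]
    exact ((Finset.abs_sum_le_sum_abs _ _).trans (Finset.sum_le_sum fun i _ => ho' (k+i) k (Nat.le_add_right _ _))).trans
      (pow_half_tail k n)
  set e : ℕ → ℝ := fun k => J k k - 4 * (1/2)^k with he
  have hh2 : ∀ k, ∫ z, h k z ^ 2 ∂μ ≤ e (k+1) - e k := fun k => by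
    simp_rw [heq]
    rw [hsq (k+1) k, Jc k (k+1)]
    have := (abs_le.1 (ho' k k le_rfl)).1
    simp only [he, pow_succ]; linarith
  have hh0 : ∀ k, 0 ≤ ∫ z, h k z ^ 2 ∂μ := fun k => integral_nonneg fun z => sq_nonneg _
  have emono : Monotone e := monotone_nat_of_le_succ fun k => by linarith [hh2 k, hh0 k]
  have ebd : ∀ k, e k ≤ C * C * μ.real univ := fun k => by
    have h1 : J k k ≤ ∫ _, C * C ∂μ := integral_mono_ae (ipp k k) (integrable_const _) (by
      filter_upwards [hC k] with z hz
      have := mul_le_mul hz hz (abs_nonneg _) hC0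
      rwa [abs_mul_abs_self] at this)
    rw [integral_const, smul_eq_mul, mul_comm] at h1
    have : (0:ℝ) < (1/2)^k := by positivity
    simp only [he]; linarith
  have econv := tendsto_atTop_ciSup emono ⟨_, by rintro _ ⟨k, rfl⟩; exact ebd k⟩
  have ecau := econv.cauchySeq
  refine ⟨?_, ?_⟩
  · refine summable_of_sum_range_le (c := C * C * μ.real univ - e 0) hh0 fun n => ?_
    refine (Finset.sum_le_sum fun i _ => hh2 i).trans ?_
    rw [Finset.sum_range_sub]; linarith [ebd n]
  · have hd : ∀ j : ℕ, ∃ N, ∀ n ≥ N, ∀ i, ∫ z, (p (n+i) z - p n z)^2 ∂μ ≤ (1/4)^j := by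
      intro j
      obtain ⟨N1, hN1⟩ := Metric.cauchySeq_iff.1 ecau ((1/4)^j/2) (by positivity)
      obtain ⟨N2, hN2⟩ := ((tendsto_pow_atTop_nhds_zero_of_lt_one (by norm_num : (0:ℝ) ≤ 1/2) (by norm_num)).eventually
        (gt_mem_nhds (show (0:ℝ) < (1/4)^j/16 by positivity))).exists_forall_of_atTop
      refine ⟨max N1 N2, fun n hn i => ?_⟩
      have a1 := hN1 (n+i) ((le_max_left _ _).trans (hn.trans (Nat.le_add_right _ _))) n ((le_max_left _ _).trans hn)
      have a2 := hN2 n ((le_max_right _ _).trans hn)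
      rw [Real.dist_eq] at a1
      have a3 := (abs_lt.1 a1).2
      have a4 := (abs_le.1 (tel n i)).1
      have a5 : (1/2:ℝ)^(n+i) ≤ (1/2)^n := pow_le_pow_of_le_one (by norm_num) (by norm_num) (Nat.le_add_right _ _)
      rw [hsq, Jc n (n+i)]
      simp only [he] at a3
      have a6 : (0:ℝ) < (1/4)^j := by positivity
      linarith
    choose N hN using hd
    obtain ⟨ns, hns1, hns2⟩ := Filter.extraction_forall_of_eventually' (P := fun j n => N j ≤ n)
      (fun j => ⟨N j, fun n hn => hn⟩)
    have hdd : ∀ j, ∫ z, (p (ns (j+1)) z - p (ns j) z)^2 ∂μ ≤ (1/4)^j := fun j => by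
      obtain ⟨i, hi⟩ := Nat.exists_eq_add_of_le (hns1 (Nat.lt_succ_self j)).le
      rw [hi]; exact hN j _ (hns2 j) i
    have hae := ae_summable (μ := μ) (g := fun j z => 2^j * (p (ns (j+1)) z - p (ns j) z)^2) (fun j => (isq _ _).const_mul _)
      (fun j z => by positivity) (by
        refine Summable.of_nonneg_of_le (fun j => integral_nonneg fun z => by positivity) (fun j => ?_) summable_geometric_two
        rw [integral_const_mul]
        refine (mul_le_mul_of_nonneg_left (hdd j) (by positivity)).trans (le_of_eq ?_)
        rw [← mul_pow]; norm_num)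
    have hlim : ∀ᵐ z ∂μ, ∃ l, Filter.Tendsto (fun j => p (ns j) z) Filter.atTop (nhds l) := by
      filter_upwards [hae] with z hz
      have hs : Summable fun j => p (ns (j+1)) z - p (ns j) z := by
        refine Summable.of_norm_bounded ((hz.add summable_geometric_two)) fun j => ?_
        rw [Real.norm_eq_abs]
        set y := |p (ns (j+1)) z - p (ns j) z| with hy
        rw [← sq_abs (p (ns (j+1)) z - p (ns j) z), ← hy]
        have h2 : (2:ℝ)^j * (1/2)^j = 1 := by rw [← mul_pow]; norm_num
        have hpos : (0:ℝ) < 2^j := by positivity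
        have hy0 : 0 ≤ y := abs_nonneg _
        have e1 : (1/2:ℝ)^j = 1/2^j := by rw [div_pow, one_pow]
        rw [e1]
        have e2 : 2^j * y^2 + 1/2^j - y = ((2^j * y - 1)^2 + 2^j * y) / 2^j := by field_simp; ring
        have e3 : 0 ≤ ((2^j * y - 1)^2 + 2^j * y) / 2^j := by positivity
        linarith
      refine ⟨∑' j, (p (ns (j+1)) z - p (ns j) z) + p (ns 0) z, ?_⟩
      have := hs.hasSum.tendsto_sum_nat.add_const (p (ns 0) z)
      refine this.congr fun n => ?_
      rw [Finset.sum_range_sub (fun j => p (ns j) z)]; ring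
    obtain ⟨q, hq1, hq2⟩ := measurable_limit_of_tendsto_metrizable_ae (fun j => (hp (ns j)).aemeasurable) hlim
    exact ⟨q, ns, hq1, hns1, hq2⟩

end FwdSol

namespace FwdSol

lemma Om_restrict (T : ℝ) : (volume : Measure (ℝ × ℝ)).restrict (Om T) =
    ((volume : Measure ℝ).restrict (Ioo 0 1)).prod ((volume : Measure ℝ).restrict (Ioo 0 T)) := by
  rw [Measure.prod_restrict, Om, Measure.volume_eq_prod]

lemma Om_ae {T : ℝ} {P : ℝ × ℝ → Prop} (h : ∀ᵐ z ∂(volume.restrict (Om T)), P z) :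
    ∀ᵐ t ∂((volume : Measure ℝ).restrict (Ioo 0 T)), ∀ᵐ x ∂((volume : Measure ℝ).restrict (Ioo 0 1)), P (x, t) := by
  rw [Om_restrict] at h
  have h1 := Measure.measurePreserving_swap (μ := (volume : Measure ℝ).restrict (Ioo 0 T))
    (ν := (volume : Measure ℝ).restrict (Ioo 0 1)) |>.quasiMeasurePreserving.ae h
  exact Measure.ae_ae_of_ae_prod h1

lemma Om_ae' {T : ℝ} {P : ℝ × ℝ → Prop} (hP : MeasurableSet {z | P z})
    (h : ∀ᵐ t ∂((volume : Measure ℝ).restrict (Ioo 0 T)), ∀ᵐ x ∂((volume : Measure ℝ).restrict (Ioo 0 1)), P (x, t)) :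
    ∀ᵐ z ∂(volume.restrict (Om T)), P z := by
  rw [Om_restrict, Measure.ae_prod_iff_ae_ae hP]
  exact (Measure.ae_ae_comm (p := fun x t => P (x, t)) hP).2 h

lemma Om_iter {T : ℝ} {F : ℝ × ℝ → ℝ} (h : IntegrableOn F (Om T)) :
    ∫ t in Ioo 0 T, ∫ x in Ioo (0:ℝ) 1, F (x, t) = ∫ z in Om T, F z := by
  rw [Om_restrict]
  rw [IntegrableOn, Om_restrict] at h
  exact (integral_prod_symm F h).symm

lemma deriv_ae {T C : ℝ} {u : ℝ → ℝ → ℝ} {q : ℝ × ℝ → ℝ} (cu : Continuous fun z : ℝ × ℝ => u z.1 z.2)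
    (hq : Measurable q) {uk pk : ℕ → ℝ → ℝ → ℝ}
    (h1 : ∀ k, ∀ x ∈ Icc (0:ℝ) 1, ∀ t ∈ Icc 0 T, HasDerivWithinAt (fun y => uk k y t) (pk k x t) (Icc 0 1) x)
    (h2 : ∀ k, Continuous fun z : ℝ × ℝ => pk k z.1 z.2)
    (h3 : ∀ k, ∀ x ∈ Ioo (0:ℝ) 1, ∀ t ∈ Ioo 0 T, |pk k x t| ≤ C)
    (h4 : ∀ x ∈ Icc (0:ℝ) 1, ∀ t ∈ Icc 0 T, Filter.Tendsto (fun k => uk k x t) Filter.atTop (nhds (u x t)))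
    (h5 : ∀ᵐ z ∂(volume.restrict (Om T)), Filter.Tendsto (fun k => pk k z.1 z.2) Filter.atTop (nhds (q z))) :
    ∀ᵐ z ∂(volume.restrict (Om T)), HasDerivAt (fun y => u y z.2) (q z) z.1 := by
  have cu' : Continuous (Function.uncurry (fun t x => u x t)) := cu.comp continuous_swap
  have hM : MeasurableSet {z : ℝ × ℝ | HasDerivAt (fun y => u y z.2) (q z) z.1} := by
    have e : {z : ℝ × ℝ | HasDerivAt (fun y => u y z.2) (q z) z.1} =
        {z : ℝ × ℝ | DifferentiableAt ℝ (fun y => u y z.2) z.1} ∩ {z | deriv (fun y => u y z.2) z.1 = q z} := by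
      ext z
      constructor
      · intro h; exact ⟨HasDerivAt.differentiableAt h, HasDerivAt.deriv h⟩
      · rintro ⟨ha, hb⟩
        have := DifferentiableAt.hasDerivAt ha
        have hb' : deriv (fun y => u y z.2) z.1 = q z := hb
        rwa [hb'] at this
    rw [e]
    refine MeasurableSet.inter ?_ (measurableSet_eq_fun ?_ hq)
    · exact measurable_swap (measurableSet_of_differentiableAt_with_param ℝ cu')
    · exact (measurable_deriv_with_param cu').comp measurable_swap
  refine Om_ae' hM ?_
  filter_upwards [Om_ae h5, ae_restrict_mem measurableSet_Ioo] with t h6 ht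
  have ht' : t ∈ Icc 0 T := Ioo_subset_Icc_self ht
  have h6' : ∀ᵐ x, x ∈ Ioo (0:ℝ) 1 → Filter.Tendsto (fun k => pk k x t) Filter.atTop (nhds (q (x, t))) :=
    (ae_restrict_iff' measurableSet_Ioo).1 h6
  have hne1 : ∀ᵐ x : ℝ, x ≠ 1 := by simp [ae_iff, measure_singleton]
  have hqb : ∀ᵐ x, x ∈ Ioo (0:ℝ) 1 → ‖q (x, t)‖ ≤ C := by
    filter_upwards [h6'] with x hx hx1
    exact le_of_tendsto (hx hx1).norm (Filter.Eventually.of_forall fun k => h3 k x hx1 t ht)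
  have hqi : IntervalIntegrable (fun x => q (x, t)) volume 0 1 := by
    rw [intervalIntegrable_iff_integrableOn_Ioo_of_le zero_le_one]
    exact Integrable.of_bound (hq.comp (measurable_id.prodMk measurable_const)).aestronglyMeasurable C
      ((ae_restrict_iff' measurableSet_Ioo).2 hqb)
  have hck : ∀ k, Continuous fun x => pk k x t := fun k => (h2 k).comp (continuous_id.prodMk continuous_const)
  have hint : ∀ y ∈ Icc (0:ℝ) 1, u y t - u 0 t = ∫ x in (0:ℝ)..y, q (x, t) := by
    intro y hy
    have hk : ∀ k, ∫ x in (0:ℝ)..y, pk k x t = uk k y t - uk k 0 t := fun k =>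
      intervalIntegral.integral_eq_sub_of_hasDerivAt_of_le hy.1
        (fun x hx => ((h1 k x ⟨hx.1, hx.2.trans hy.2⟩ t ht').continuousWithinAt).mono (Icc_subset_Icc_right hy.2))
        (fun x hx => (h1 k x ⟨hx.1.le, hx.2.le.trans hy.2⟩ t ht').hasDerivAt (Icc_mem_nhds hx.1 (hx.2.trans_le hy.2)))
        ((hck k).intervalIntegrable _ _)
    have l1 : Filter.Tendsto (fun k => uk k y t - uk k 0 t) Filter.atTop (nhds (u y t - u 0 t)) :=
      (h4 y hy t ht').sub (h4 0 ⟨le_rfl, zero_le_one⟩ t ht')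
    have l2 : Filter.Tendsto (fun k => ∫ x in (0:ℝ)..y, pk k x t) Filter.atTop (nhds (∫ x in (0:ℝ)..y, q (x, t))) := by
      refine intervalIntegral.tendsto_integral_filter_of_dominated_convergence (fun _ => C)
        (Filter.Eventually.of_forall fun k => (hck k).aestronglyMeasurable) (Filter.Eventually.of_forall fun k => ?_)
        intervalIntegrable_const ?_
      · filter_upwards [hne1] with x hx hx1
        rw [uIoc_of_le hy.1] at hx1
        exact h3 k x ⟨hx1.1, lt_of_le_of_ne (hx1.2.trans hy.2) hx⟩ t ht
      · filter_upwards [hne1, h6'] with x hx hx2 hx1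
        rw [uIoc_of_le hy.1] at hx1
        exact hx2 ⟨hx1.1, lt_of_le_of_ne (hx1.2.trans hy.2) hx⟩
    simp_rw [hk] at l2
    exact tendsto_nhds_unique l1 l2
  rw [ae_restrict_iff' measurableSet_Ioo]
  filter_upwards [hqi.ae_hasDerivAt_integral] with x hx hx1
  rw [uIcc_of_le zero_le_one] at hx
  have hd := (hx (Ioo_subset_Icc_self hx1) 0 ⟨le_rfl, zero_le_one⟩).const_add (u 0 t)
  refine hd.congr_of_eventuallyEq ?_
  filter_upwards [Ioo_mem_nhds hx1.1 hx1.2] with y hy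
  rw [← hint y (Ioo_subset_Icc_self hy)]; ring

end FwdSol

namespace FwdSol

lemma unif_lim {F : ℕ → ℝ → ℝ → ℝ} (cF : ∀ k, Continuous fun z : ℝ × ℝ => F k z.1 z.2)
    (hF : ∀ k x t, |F (k+1) x t - F k x t| ≤ (1/2)^k) :
    ∃ G : ℝ → ℝ → ℝ, (Continuous fun z : ℝ × ℝ => G z.1 z.2) ∧ (∀ k x t, |F k x t - G x t| ≤ 2 * (1/2)^k) ∧
      ∀ x t, Filter.Tendsto (fun k => F k x t) Filter.atTop (nhds (G x t)) := by
  have hd : ∀ x t n, dist (F n x t) (F (n+1) x t) ≤ 1 * (1/2)^n := fun x t n => by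
    rw [dist_comm, Real.dist_eq, one_mul]; exact hF n x t
  have hc : ∀ x t, ∃ l, Filter.Tendsto (fun k => F k x t) Filter.atTop (nhds l) := fun x t =>
    cauchySeq_tendsto_of_complete (cauchySeq_of_le_geometric (1/2) 1 (by norm_num) (hd x t))
  choose G hG using hc
  have hb : ∀ k x t, |F k x t - G x t| ≤ 2 * (1/2)^k := fun k x t => by
    have := dist_le_of_le_geometric_of_tendsto (1/2) 1 (by norm_num) (hd x t) (hG x t) k
    rw [Real.dist_eq] at this
    refine this.trans (le_of_eq ?_)
    ring
  refine ⟨G, ?_, hb, hG⟩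
  have hu : TendstoUniformly (fun k (z : ℝ × ℝ) => F k z.1 z.2) (fun z => G z.1 z.2) Filter.atTop := by
    rw [Metric.tendstoUniformly_iff]
    intro ε hε
    have h0 : Filter.Tendsto (fun k : ℕ => 2 * (1/2:ℝ)^k) Filter.atTop (nhds (2 * 0)) :=
      (tendsto_pow_atTop_nhds_zero_of_lt_one (by norm_num) (by norm_num)).const_mul 2
    rw [mul_zero] at h0
    filter_upwards [h0.eventually (gt_mem_nhds hε)] with k hk z
    rw [dist_comm, Real.dist_eq]
    exact (hb k z.1 z.2).trans_lt hk
  exact hu.continuous (Filter.Frequently.of_forall cF)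

lemma lip1 {F F' : ℝ → ℝ} {C : ℝ} (h : ∀ x, HasDerivAt F (F' x) x) (hC : ∀ x, |F' x| ≤ C) (x y : ℝ) :
    |F x - F y| ≤ C * |x - y| := by
  have := convex_univ.norm_image_sub_le_of_norm_hasDerivWithin_le (f := F) (f' := F') (C := C)
    (fun x _ => (h x).hasDerivWithinAt) (fun x _ => hC x) (mem_univ y) (mem_univ x)
  exact this

/-- The output of the iteration. -/
structure Sq (T : ℝ) (p w b : ℝ → ℝ → ℝ) (d : ℝ → ℝ) (G : Set (ℝ × ℝ)) (L U : ℝ → ℝ) (eps : ℝ) (φ h : ℕ → P5)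
    (m : ℕ → ℝ → ℝ → ℝ) : Prop where
  z0 : φ 0 = P5.zero
  su : ∀ k, φ (k+1) = (φ k).add (h k)
  gd : ∀ k, Good p w b d G L U eps (φ k)
  st : ∀ k, Stp T p w b d G L U k (φ k) (h k) (m k)
  or : ∀ k, ∀ i ≤ k, |∫ z in Om T, (h k).vxx z.1 z.2 * (p z.1 z.2 + (φ i).vxx z.1 z.2)| ≤ (1/2)^k

lemma Sq.fl_le {T : ℝ} {p w b : ℝ → ℝ → ℝ} {d : ℝ → ℝ} {G : Set (ℝ × ℝ)} {L U : ℝ → ℝ} {eps : ℝ} {φ h : ℕ → P5}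
    {m : ℕ → ℝ → ℝ → ℝ} (hS : Sq T p w b d G L U eps φ h m) (he : 0 < eps) (k : ℕ) (x t : ℝ) :
    |(φ k).fl b d x t| ≤ eps := by
  by_cases hz : (x, t) ∈ G
  · exact (hS.gd k).small x t hz
  · obtain ⟨h1, h2, h3, h4, h5⟩ := (hS.gd k).van x t hz
    simp only [P5.fl, h1, h2, h4, mul_zero, sub_zero, abs_zero]; exact he.le

lemma Sq.bdd {T : ℝ} {p w b : ℝ → ℝ → ℝ} {d : ℝ → ℝ} {G : Set (ℝ × ℝ)} {R1 R2 eps Kb : ℝ} {L U : ℝ → ℝ}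
    {φ h : ℕ → P5} {m : ℕ → ℝ → ℝ → ℝ}
    (hX : Ctx T p w b d G R1 R2 eps Kb L U) (hS : Sq T p w b d G L U eps φ h m) :
    ∃ C, 0 ≤ C ∧ (∀ k, ∀ x ∈ Icc (0:ℝ) 1, ∀ t ∈ Icc 0 T, |p x t + (φ k).vxx x t| ≤ C) ∧ ∀ k x t, |(φ k).vxx x t| ≤ C := by
  obtain ⟨C1, hC1⟩ := (isCompact_Icc (a := (0:ℝ)) (b := 1)).prod (isCompact_Icc (a := (0:ℝ)) (b := T))
    |>.exists_bound_of_continuousOn hX.cp.continuousOn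
  obtain ⟨C2, hC2⟩ := (isCompact_Icc (a := R1) (b := R2)).exists_bound_of_continuousOn hX.Lc.continuousOn
  obtain ⟨C3, hC3⟩ := (isCompact_Icc (a := R1) (b := R2)).exists_bound_of_continuousOn hX.Uc.continuousOn
  have hC10 : 0 ≤ C1 := (norm_nonneg _).trans (hC1 (0, 0) ⟨⟨le_rfl, zero_le_one⟩, ⟨le_rfl, hX.hT.le⟩⟩)
  have hB : ∀ k x t, (x, t) ∈ G → |p x t + (φ k).vxx x t| ≤ |C2| + |C3| := fun k x t hz => by
    have hf := abs_le.1 ((hS.gd k).small x t hz)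
    have hr : w x t + (φ k).fl b d x t ∈ Icc R1 R2 := ⟨by linarith [hX.r1 x t hz], by linarith [hX.r2 x t hz]⟩
    have a1 := abs_le.1 (hC2 _ hr)
    have a2 := abs_le.1 (hC3 _ hr)
    have a3 := (hS.gd k).lo x t hz
    have a4 := (hS.gd k).hi x t hz
    rw [abs_le]
    constructor <;> linarith [le_abs_self C2, le_abs_self C3, abs_nonneg C2, abs_nonneg C3]
  have h0 : ∀ k x t, (x, t) ∉ G → (φ k).vxx x t = 0 := fun k x t hz => ((hS.gd k).van x t hz).2.2.1
  refine ⟨C1 + (|C2| + |C3|), by positivity, fun k x hx t ht => ?_, fun k x t => ?_⟩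
  · by_cases hz : (x, t) ∈ G
    · linarith [hB k x t hz]
    · rw [h0 k x t hz, add_zero]
      have : |p x t| ≤ C1 := hC1 (x, t) ⟨hx, ht⟩
      linarith [abs_nonneg C2, abs_nonneg C3]
  · by_cases hz : (x, t) ∈ G
    · have a1 := hB k x t hz
      have a2 : |p x t| ≤ C1 := hC1 (x, t) (prod_mono Ioo_subset_Icc_self Ioo_subset_Icc_self (hX.Gs hz))
      have a3 : (φ k).vxx x t = (p x t + (φ k).vxx x t) - p x t := by ring
      rw [a3]
      exact (abs_sub _ _).trans (by linarith)
    · rw [h0 k x t hz, abs_zero]; positivity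

lemma Sq.lip {T : ℝ} {p w b : ℝ → ℝ → ℝ} {d : ℝ → ℝ} {G : Set (ℝ × ℝ)} {L U : ℝ → ℝ} {eps C : ℝ} {φ h : ℕ → P5}
    {m : ℕ → ℝ → ℝ → ℝ} (hS : Sq T p w b d G L U eps φ h m) (hC : ∀ k x t, |(φ k).vxx x t| ≤ C) (k : ℕ) (x y t s : ℝ) :
    |(φ k).vx x t - (φ k).vx y s| ≤ C * |x - y| + 2 * |t - s| := by
  have hxt : ∀ k x t, |(φ k).vxt x t| ≤ 2 - 2 * (1/2)^k := by
    intro k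
    induction k with
    | zero => intro x t; rw [hS.z0]; simp [P5.zero]
    | succ k ih =>
      intro x t
      rw [hS.su]
      have h1 := ((hS.st k).bd x t).2.2.2
      simp only [P5.add]
      refine (abs_add_le _ _).trans ?_
      rw [pow_succ]; linarith [ih x t]
  have a1 := lip1 (fun x => (hS.gd k).sm.dxx x t) (fun x => hC k x t) x y
  have a2 := lip1 (C := 2) (fun t => (hS.gd k).sm.dxt y t) (fun t => (hxt k y t).trans (by
    have : (0:ℝ) < (1/2)^k := by positivity
    linarith)) t s
  have a3 : (φ k).vx x t - (φ k).vx y s = ((φ k).vx x t - (φ k).vx y t) + ((φ k).vx y t - (φ k).vx y s) := by ring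
  rw [a3]
  exact (abs_add_le _ _).trans (add_le_add a1 a2)

lemma Sq.gap_zero {T : ℝ} {p w b : ℝ → ℝ → ℝ} {d : ℝ → ℝ} {G : Set (ℝ × ℝ)} {R1 R2 eps Kb : ℝ} {L U : ℝ → ℝ}
    {φ h : ℕ → P5} {m : ℕ → ℝ → ℝ → ℝ}
    (hX : Ctx T p w b d G R1 R2 eps Kb L U) (hS : Sq T p w b d G L U eps φ h m)
    (hs : Summable fun k => ∫ z in Om T, (h k).vxx z.1 z.2 ^ 2) :
    ∀ᵐ z ∂(volume.restrict (Om T)), z ∈ G →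
      Filter.Tendsto (fun k => gap p w b d L U (φ k) z.1 z.2) Filter.atTop (nhds 0) := by
  have hae := ae_summable (μ := volume.restrict (Om T)) (g := fun k (z : ℝ × ℝ) => m k z.1 z.2 ^ 2)
    (fun k => Om_int ((hS.st k).cm.pow 2)) (fun k z => sq_nonneg _)
    (Summable.of_nonneg_of_le (fun k => integral_nonneg fun z => sq_nonneg _) (fun k => (hS.st k).en)
      ((hs.mul_left 4).add summable_geometric_two))
  filter_upwards [hae] with z hz hzG
  have m0 : Filter.Tendsto (fun k => |m k z.1 z.2|) Filter.atTop (nhds 0) := by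
    have := hz.tendsto_atTop_zero.sqrt
    simpa only [Real.sqrt_sq_eq_abs, Real.sqrt_zero] using this
  have hne : (Gᶜ).Nonempty := ⟨(2, 0), fun hh => by
    have := (hX.Gs hh).1.2
    norm_num at this⟩
  have hpos : 0 < Metric.infDist z Gᶜ :=
    (hX.Go.isClosed_compl.notMem_iff_infDist_pos hne).1 (fun hh => hh hzG)
  have k0 : Filter.Tendsto (fun k : ℕ => 1 / ((k:ℝ)+1)) Filter.atTop (nhds 0) := tendsto_one_div_add_atTop_nhds_zero_nat
  have up : Filter.Tendsto (fun k : ℕ => |m k z.1 z.2| + 3 * (1 / ((k:ℝ)+1))) Filter.atTop (nhds 0) := by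
    have := m0.add (k0.const_mul 3)
    simpa only [mul_zero, add_zero] using this
  refine tendsto_of_tendsto_of_tendsto_of_le_of_le' tendsto_const_nhds up (Filter.Eventually.of_forall fun k => ?_) ?_
  · exact le_min (by linarith [(hS.gd k).lo z.1 z.2 hzG]) (by linarith [(hS.gd k).hi z.1 z.2 hzG])
  · have := k0.eventually (gt_mem_nhds (show 0 < Metric.infDist z Gᶜ / 2 by linarith))
    filter_upwards [this] with k hk
    refine (hS.st k).gp z.1 z.2 ?_
    have hk1 : (0:ℝ) < (k:ℝ) + 1 := by positivity
    rw [div_lt_iff₀ hk1] at hk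
    have hk' : (1:ℝ) < Metric.infDist z Gᶜ / 2 * ((k:ℝ)+1) := hk
    linarith

end FwdSol

namespace FwdSol

set_option maxHeartbeats 2000000 in
lemma weak_limit {T C eps : ℝ} {b c f g gx gt u p w v ω : ℝ → ℝ → ℝ} {q : ℝ × ℝ → ℝ} {vx vxx fl : ℕ → ℝ → ℝ → ℝ}
    (cb : Continuous fun z : ℝ × ℝ => b z.1 z.2) (cc : Continuous fun z : ℝ × ℝ => c z.1 z.2)
    (cf : Continuous fun z : ℝ × ℝ => f z.1 z.2) (cg : Continuous fun z : ℝ × ℝ => g z.1 z.2)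
    (cgx : Continuous fun z : ℝ × ℝ => gx z.1 z.2) (cgt : Continuous fun z : ℝ × ℝ => gt z.1 z.2)
    (cu : Continuous fun z : ℝ × ℝ => u z.1 z.2) (cp : Continuous fun z : ℝ × ℝ => p z.1 z.2)
    (cw : Continuous fun z : ℝ × ℝ => w z.1 z.2) (cv : Continuous fun z : ℝ × ℝ => v z.1 z.2)
    (cω : Continuous fun z : ℝ × ℝ => ω z.1 z.2) (hq : Measurable q)
    (cvx : ∀ k, Continuous fun z : ℝ × ℝ => vx k z.1 z.2) (cvxx : ∀ k, Continuous fun z : ℝ × ℝ => vxx k z.1 z.2)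
    (cfl : ∀ k, Continuous fun z : ℝ × ℝ => fl k z.1 z.2)
    (bvx : ∀ k x t, |vx k x t| ≤ 2) (bvxx : ∀ k x t, |vxx k x t| ≤ C) (bfl : ∀ k x t, |fl k x t| ≤ eps)
    (lv : ∀ x t, Filter.Tendsto (fun k => u x t + vx k x t) Filter.atTop (nhds (v x t)))
    (lω : ∀ x t, Filter.Tendsto (fun k => w x t + fl k x t) Filter.atTop (nhds (ω x t)))
    (lq : ∀ᵐ z ∂(volume.restrict (Om T)), Filter.Tendsto (fun k => p z.1 z.2 + vxx k z.1 z.2) Filter.atTop (nhds (q z)))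
    (hk : ∀ k, ∀ s ∈ Icc 0 T, ∫ t in (0:ℝ)..s, ∫ x in (0:ℝ)..1, ((u x t + vx k x t) * gt x t - (w x t + fl k x t) * gx x t
        + (b x t * (p x t + vxx k x t) + c x t * (u x t + vx k x t) + f x t) * g x t)
      = ∫ x in (0:ℝ)..1, ((u x s + vx k x s) * g x s - (u x 0 + vx k x 0) * g x 0))
    {s : ℝ} (hs : s ∈ Icc 0 T) :
    ∫ t in Ioo 0 s, ∫ x in Ioo (0:ℝ) 1, (v x t * gt x t - ω x t * gx x t + (b x t * q (x, t) + c x t * v x t + f x t) * g x t)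
      = ∫ x in Ioo (0:ℝ) 1, (v x s * g x s - v x 0 * g x 0) := by
  set F : ℕ → ℝ × ℝ → ℝ := fun k z => (u z.1 z.2 + vx k z.1 z.2) * gt z.1 z.2 - (w z.1 z.2 + fl k z.1 z.2) * gx z.1 z.2
        + (b z.1 z.2 * (p z.1 z.2 + vxx k z.1 z.2) + c z.1 z.2 * (u z.1 z.2 + vx k z.1 z.2) + f z.1 z.2) * g z.1 z.2 with hF
  set F0 : ℝ × ℝ → ℝ := fun z => v z.1 z.2 * gt z.1 z.2 - ω z.1 z.2 * gx z.1 z.2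
        + (b z.1 z.2 * q z + c z.1 z.2 * v z.1 z.2 + f z.1 z.2) * g z.1 z.2 with hF0
  set D : ℝ × ℝ → ℝ := fun z => (|u z.1 z.2| + 2) * |gt z.1 z.2| + (|w z.1 z.2| + eps) * |gx z.1 z.2|
        + (|b z.1 z.2| * (|p z.1 z.2| + C) + |c z.1 z.2| * (|u z.1 z.2| + 2) + |f z.1 z.2|) * |g z.1 z.2| with hD
  have cF : ∀ k, Continuous (F k) := fun k =>
    (((cu.add (cvx k)).mul cgt).sub ((cw.add (cfl k)).mul cgx)).add
      ((((cb.mul (cp.add (cvxx k))).add (cc.mul (cu.add (cvx k)))).add cf).mul cg)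
  have cD : Continuous D :=
    (((cu.abs.add continuous_const).mul cgt.abs).add ((cw.abs.add continuous_const).mul cgx.abs)).add
      ((((cb.abs.mul (cp.abs.add continuous_const)).add (cc.abs.mul (cu.abs.add continuous_const))).add cf.abs).mul cg.abs)
  have hFD : ∀ k z, ‖F k z‖ ≤ D z := fun k z => by
    have e1 : |u z.1 z.2 + vx k z.1 z.2| ≤ |u z.1 z.2| + 2 := (abs_add_le _ _).trans (by linarith [bvx k z.1 z.2])
    have e2 : |w z.1 z.2 + fl k z.1 z.2| ≤ |w z.1 z.2| + eps := (abs_add_le _ _).trans (by linarith [bfl k z.1 z.2])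
    have e3 : |p z.1 z.2 + vxx k z.1 z.2| ≤ |p z.1 z.2| + C := (abs_add_le _ _).trans (by linarith [bvxx k z.1 z.2])
    rw [Real.norm_eq_abs]
    simp only [hF, hD]
    refine (abs_add_le _ _).trans (add_le_add ((abs_sub _ _).trans (add_le_add ?_ ?_)) ?_)
    · rw [abs_mul]; exact mul_le_mul_of_nonneg_right e1 (abs_nonneg _)
    · rw [abs_mul]; exact mul_le_mul_of_nonneg_right e2 (abs_nonneg _)
    · rw [abs_mul]
      refine mul_le_mul_of_nonneg_right ((abs_add_le _ _).trans (add_le_add ((abs_add_le _ _).trans (add_le_add ?_ ?_)) le_rfl))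
        (abs_nonneg _)
      · rw [abs_mul]; exact mul_le_mul_of_nonneg_left e3 (abs_nonneg _)
      · rw [abs_mul]; exact mul_le_mul_of_nonneg_left e1 (abs_nonneg _)
  have hsub : Om s ⊆ Om T := prod_mono_right (Ioo_subset_Ioo_right hs.2)
  have lF : ∀ᵐ z ∂(volume.restrict (Om s)), Filter.Tendsto (fun k => F k z) Filter.atTop (nhds (F0 z)) := by
    filter_upwards [ae_restrict_of_ae_restrict_of_subset hsub lq] with z hz
    exact (((lv z.1 z.2).mul_const _).sub ((lω z.1 z.2).mul_const _)).add
      ((((hz.const_mul _).add ((lv z.1 z.2).const_mul _)).add_const _).mul_const _)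
  have mF0 : Measurable F0 :=
    ((cv.mul cgt).sub (cω.mul cgx)).measurable.add
      ((((cb.measurable.mul hq).add (cc.mul cv).measurable).add cf.measurable).mul cg.measurable)
  have iF0 : IntegrableOn F0 (Om s) := by
    refine Integrable.mono' (Om_int cD) mF0.aestronglyMeasurable ?_
    filter_upwards [lF] with z hz
    exact le_of_tendsto hz.norm (Filter.Eventually.of_forall fun k => hFD k z)
  have L1 : Filter.Tendsto (fun k => ∫ z in Om s, F k z) Filter.atTop (nhds (∫ z in Om s, F0 z)) :=
    tendsto_integral_of_dominated_convergence D (fun k => (cF k).aestronglyMeasurable) (Om_int cD)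
      (fun k => Filter.Eventually.of_forall (hFD k)) lF
  have e1 : ∀ k, ∫ z in Om s, F k z = ∫ x in (0:ℝ)..1, ((u x s + vx k x s) * g x s - (u x 0 + vx k x 0) * g x 0) := fun k => by
    rw [← hk k s hs, ← Om_iter (Om_int (cF k)), Ioo_int _ hs.1]
    congr 1
    funext t
    rw [Ioo_int _ zero_le_one]
  have cx : ∀ {G : ℝ → ℝ → ℝ} (t : ℝ), (Continuous fun z : ℝ × ℝ => G z.1 z.2) → Continuous fun x => G x t :=
    fun t h => h.comp (continuous_id.prodMk continuous_const)
  have L2 : Filter.Tendsto (fun k => ∫ x in (0:ℝ)..1, ((u x s + vx k x s) * g x s - (u x 0 + vx k x 0) * g x 0)) Filter.atTop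
      (nhds (∫ x in (0:ℝ)..1, (v x s * g x s - v x 0 * g x 0))) := by
    have cB : Continuous fun x => (|u x s| + 2) * |g x s| + (|u x 0| + 2) * |g x 0| :=
      (((cx s cu).abs.add continuous_const).mul (cx s cg).abs).add (((cx 0 cu).abs.add continuous_const).mul (cx 0 cg).abs)
    refine intervalIntegral.tendsto_integral_filter_of_dominated_convergence
      (fun x => (|u x s| + 2) * |g x s| + (|u x 0| + 2) * |g x 0|)
      (Filter.Eventually.of_forall fun k => Continuous.aestronglyMeasurable
        ((((cx s cu).add (cx s (cvx k))).mul (cx s cg)).sub (((cx 0 cu).add (cx 0 (cvx k))).mul (cx 0 cg))))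
      (Filter.Eventually.of_forall fun k => Filter.Eventually.of_forall fun x _ => ?_)
      (cB.intervalIntegrable _ _)
      (Filter.Eventually.of_forall fun x _ => ((lv x s).mul_const _).sub ((lv x 0).mul_const _))
    rw [Real.norm_eq_abs]
    refine (abs_sub _ _).trans (add_le_add ?_ ?_)
    · rw [abs_mul]
      exact mul_le_mul_of_nonneg_right ((abs_add_le _ _).trans (by linarith [bvx k x s])) (abs_nonneg _)
    · rw [abs_mul]
      exact mul_le_mul_of_nonneg_right ((abs_add_le _ _).trans (by linarith [bvx k x 0])) (abs_nonneg _)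
  simp_rw [e1] at L1
  rw [Om_iter (F := F0) iF0, Ioo_int _ zero_le_one]
  exact tendsto_nhds_unique L1 L2

end FwdSol

namespace FwdSol

set_option maxHeartbeats 2000000 in
lemma exists_limit {T : ℝ} {b bx c f W u p w Q : ℝ → ℝ → ℝ} {d : ℝ → ℝ} {G : Set (ℝ × ℝ)} {R1 R2 eps Kb Ku : ℝ} {L U : ℝ → ℝ}
    (hP : Pot T b c f W u p w Q) (hX : Ctx T p w b d G R1 R2 eps Kb L U)
    (cc : Continuous fun z : ℝ × ℝ => c z.1 z.2) (cf : Continuous fun z : ℝ × ℝ => f z.1 z.2)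
    (hbx : ∀ x ∈ Icc (0:ℝ) 1, ∀ t ∈ Icc 0 T, HasDerivWithinAt (fun y => b y t) (bx x t) (Icc 0 1) x)
    (hce : ∀ x ∈ Icc (0:ℝ) 1, ∀ t ∈ Icc 0 T, c x t = bx x t + d t)
    (h1 : ∀ x t, (x, t) ∈ G → L (w x t) ≤ p x t) (h2 : ∀ x t, (x, t) ∈ G → p x t ≤ U (w x t))
    (hLip : ∀ x y t s, |u x t - u y s| ≤ Ku * |x - y| + Ku * |t - s|) :
    ∃ (v ω : ℝ → ℝ → ℝ) (q : ℝ × ℝ → ℝ) (K : ℝ), (∀ x y t s, |v x t - v y s| ≤ K * |x - y| + K * |t - s|) ∧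
      (∀ x, v x 0 = u x 0) ∧ (∀ᵐ z ∂(volume.restrict (Om T)), HasDerivAt (fun y => v y z.2) (q z) z.1) ∧
      (∀ᵐ z ∂(volume.restrict (Om T)), (z ∈ G → ω z.1 z.2 ∈ Icc R1 R2 ∧ (q z = L (ω z.1 z.2) ∨ q z = U (ω z.1 z.2))) ∧
        (z ∉ G → q z = p z.1 z.2 ∧ ω z.1 z.2 = w z.1 z.2)) ∧
      ∀ g gx gxx gt gxt, Sm g gx gxx gt gxt → ∀ s ∈ Icc 0 T,
        ∫ t in Ioo 0 s, ∫ x in Ioo (0:ℝ) 1,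
          (v x t * gt x t - ω x t * gx x t + (b x t * q (x, t) + c x t * v x t + f x t) * g x t)
        = ∫ x in Ioo (0:ℝ) 1, (v x s * g x s - v x 0 * g x 0) := by
  obtain ⟨φ, h, m, s1, s2, s3, s4, s5⟩ := exists_seq hX h1 h2
  have hS : Sq T p w b d G L U eps φ h m := ⟨s1, s2, s3, s4, s5⟩
  clear s1 s2 s3 s4 s5
  obtain ⟨C, hC0, hC1, hC2⟩ := hS.bdd hX
  haveI : IsFiniteMeasure ((volume : Measure (ℝ × ℝ)).restrict (Om T)) := ⟨by
    rw [Measure.restrict_apply_univ]; exact Om_lt T⟩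
  obtain ⟨hsum, q, ns, hq, hns, hlim⟩ := conv_ae (μ := volume.restrict (Om T)) (p := fun k (z : ℝ × ℝ) => p z.1 z.2 + (φ k).vxx z.1 z.2)
    (h := fun k (z : ℝ × ℝ) => (h k).vxx z.1 z.2) hC0
    (fun k => (hX.cp.add (hS.gd k).sm.cxx).aestronglyMeasurable)
    (fun k => by
      filter_upwards [ae_restrict_mem (Om_meas T)] with z hz
      exact hC1 k z.1 (Ioo_subset_Icc_self hz.1) z.2 (Ioo_subset_Icc_self hz.2))
    (fun k z => by rw [hS.su]; simp only [P5.add]; ring) hS.or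
  have hgap := hS.gap_zero hX hsum
  obtain ⟨V, cV, -, lV⟩ := unif_lim (F := fun k => (φ k).v) (fun k => (hS.gd k).sm.c0) (fun k x t => by
    rw [hS.su]; simp only [P5.add, add_sub_cancel_left]; exact ((hS.st k).bd x t).1)
  obtain ⟨Vx, cVx, -, lVx⟩ := unif_lim (F := fun k => (φ k).vx) (fun k => (hS.gd k).sm.cx) (fun k x t => by
    rw [hS.su]; simp only [P5.add, add_sub_cancel_left]; exact ((hS.st k).bd x t).2.1)
  obtain ⟨Vt, cVt, -, lVt⟩ := unif_lim (F := fun k => (φ k).vt) (fun k => (hS.gd k).sm.ct) (fun k x t => by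
    rw [hS.su]; simp only [P5.add, add_sub_cancel_left]; exact ((hS.st k).bd x t).2.2.1)
  have cd2 : Continuous fun z : ℝ × ℝ => d z.2 := hX.cd.comp continuous_snd
  have bvx : ∀ k x t, |(φ k).vx x t| ≤ 2 := by
    have : ∀ k x t, |(φ k).vx x t| ≤ 2 - 2 * (1/2)^k := by
      intro k
      induction k with
      | zero => intro x t; rw [hS.z0]; simp [P5.zero]
      | succ k ih =>
        intro x t
        rw [hS.su]
        have h1 := ((hS.st k).bd x t).2.1
        simp only [P5.add]
        refine (abs_add_le _ _).trans ?_
        rw [pow_succ]; linarith [ih x t]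
    intro k x t
    have h0 : (0:ℝ) < (1/2)^k := by positivity
    linarith [this k x t]
  have lfl : ∀ x t, Filter.Tendsto (fun k => (φ k).fl b d x t) Filter.atTop (nhds (Vt x t - b x t * Vx x t - d t * V x t)) :=
    fun x t => ((lVt x t).sub ((lVx x t).const_mul _)).sub ((lV x t).const_mul _)
  have hnt := hns.tendsto_atTop
  have van0 : ∀ k x t, (x, t) ∉ G → (φ k).v x t = 0 ∧ (φ k).vx x t = 0 ∧ (φ k).vxx x t = 0 ∧ (φ k).vt x t = 0 ∧ (φ k).vxt x t = 0 :=
    fun k => (hS.gd k).van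
  set ω : ℝ → ℝ → ℝ := fun x t => w x t + (Vt x t - b x t * Vx x t - d t * V x t) with hω
  have lω : ∀ x t, Filter.Tendsto (fun k => w x t + (φ k).fl b d x t) Filter.atTop (nhds (ω x t)) := fun x t => (lfl x t).const_add _
  have cfl : ∀ k, Continuous (fun z : ℝ × ℝ => (φ k).fl b d z.1 z.2) := fun k =>
    ((hS.gd k).sm.ct.sub (hX.cb.mul (hS.gd k).sm.cx)).sub (cd2.mul (hS.gd k).sm.c0)
  have lv : ∀ x t, Filter.Tendsto (fun k => u x t + (φ k).vx x t) Filter.atTop (nhds (u x t + Vx x t)) :=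
    fun x t => (lVx x t).const_add _
  have hpert : ∀ k, Pot T b c f _ _ _ _ _ := fun k => hP.pert hX.cb hX.cd hbx hce hX.Gs (hS.gd k).sm (hS.gd k).van
  refine ⟨fun x t => u x t + Vx x t, ω, q, |Ku| + (C + 2), ?_, ?_, ?_, ?_, ?_⟩
  · intro x y t s
    have a1 := hLip x y t s
    have a2 : |Vx x t - Vx y s| ≤ C * |x - y| + 2 * |t - s| :=
      le_of_tendsto ((lVx x t).sub (lVx y s)).abs (Filter.Eventually.of_forall fun k => hS.lip hC2 k x y t s)
    have e : u x t + Vx x t - (u y s + Vx y s) = (u x t - u y s) + (Vx x t - Vx y s) := by ring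
    simp only [e]
    refine (abs_add_le _ _).trans ?_
    have b1 := mul_le_mul_of_nonneg_right (le_abs_self Ku) (abs_nonneg (x - y))
    have b2 := mul_le_mul_of_nonneg_right (le_abs_self Ku) (abs_nonneg (t - s))
    have b3 := mul_nonneg hC0 (abs_nonneg (t - s))
    linarith [abs_nonneg (x - y)]
  · intro x
    have : Vx x 0 = 0 := tendsto_nhds_unique (lVx x 0) (by
      have hz : (x, (0:ℝ)) ∉ G := fun hh => lt_irrefl _ (hX.Gs hh).2.1
      simp only [(van0 _ x 0 hz).2.1]; exact tendsto_const_nhds)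
    simp only [this, add_zero]
  · exact deriv_ae (C := C) (hP.cu.add cVx) hq (uk := fun j x t => u x t + (φ (ns j)).vx x t)
      (pk := fun j x t => p x t + (φ (ns j)).vxx x t) (fun j => (hpert (ns j)).ux) (fun j => (hpert (ns j)).cp)
      (fun j x hx t ht => hC1 _ x (Ioo_subset_Icc_self hx) t (Ioo_subset_Icc_self ht))
      (fun x _ t _ => (lv x t).comp hnt) hlim
  · filter_upwards [hlim, hgap] with z hz hg
    refine ⟨fun hzG => ⟨?_, ?_⟩, fun hzG => ⟨?_, ?_⟩⟩
    · have a1 := hX.r1 z.1 z.2 hzG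
      have a2 := hX.r2 z.1 z.2 hzG
      have a3 : ∀ k, w z.1 z.2 + (φ k).fl b d z.1 z.2 ∈ Icc R1 R2 := fun k => by
        have := abs_le.1 (hS.fl_le hX.e0 k z.1 z.2)
        exact ⟨by linarith, by linarith⟩
      exact isClosed_Icc.mem_of_tendsto (lω z.1 z.2) (Filter.Eventually.of_forall a3)
    · have g1 := (hg hzG).comp hnt
      have l1 := (lω z.1 z.2).comp hnt
      have g2 : Filter.Tendsto (fun j => gap p w b d L U (φ (ns j)) z.1 z.2) Filter.atTop
          (nhds (min (q z - L (ω z.1 z.2)) (U (ω z.1 z.2) - q z))) :=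
        (hz.sub ((hX.Lc.tendsto _).comp l1)).min (((hX.Uc.tendsto _).comp l1).sub hz)
      have g3 := tendsto_nhds_unique g2 g1
      rcases min_choice (q z - L (ω z.1 z.2)) (U (ω z.1 z.2) - q z) with h | h
      · left; linarith
      · right; linarith
    · refine tendsto_nhds_unique hz ?_
      have hzG' : (z.1, z.2) ∉ G := hzG
      simp only [(van0 _ z.1 z.2 hzG').2.2.1, add_zero]; exact tendsto_const_nhds
    · refine tendsto_nhds_unique (lω z.1 z.2) ?_
      have hzG' : (z.1, z.2) ∉ G := hzG
      simp only [P5.fl, (van0 _ z.1 z.2 hzG').1, (van0 _ z.1 z.2 hzG').2.1, (van0 _ z.1 z.2 hzG').2.2.2.1, mul_zero, sub_zero, add_zero]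
      exact tendsto_const_nhds
  · intro g gx gxx gt gxt hg s hs
    have cω : Continuous fun z : ℝ × ℝ => ω z.1 z.2 :=
      hX.cw.add ((cVt.sub (hX.cb.mul cVx)).sub (cd2.mul cV))
    exact weak_limit (C := C) (eps := eps) (u := u) (p := p) (w := w) (vx := fun j => (φ (ns j)).vx) (vxx := fun j => (φ (ns j)).vxx)
      (fl := fun j => (φ (ns j)).fl b d) hX.cb cc cf hg.c0 hg.cx hg.ct hP.cu hX.cp hX.cw (hP.cu.add cVx) cω hq
      (fun j => (hS.gd _).sm.cx) (fun j => (hS.gd _).sm.cxx) (fun j => cfl _) (fun j => bvx _) (fun j => hC2 _)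
      (fun j => hS.fl_le hX.e0 _) (fun x t => (lv x t).comp hnt) (fun x t => (lω x t).comp hnt) hlim
      (fun j s hs => (hpert (ns j)).weak hX.cb cc cf hg hs) hs

end FwdSol

namespace FwdSol

set_option maxHeartbeats 2000000 in
theorem main
    (α s1 s2 lam Lam T : ℝ) (sigma sigma' : ℝ → ℝ)
    (b bx c f : ℝ → ℝ → ℝ) (d : ℝ → ℝ) (u0 u0' u0'' : ℝ → ℝ)
    (hT : 0 < T)
    (hflux : FluxHyp α s1 s2 lam Lam sigma sigma')
    (hcoeff : CoeffHyp α T b bx c f d)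
    (hinit : InitHyp α u0 u0' u0'') :
    ∃ u ux : ℝ → ℝ → ℝ,
      IsLipschitzSolution T sigma b c f u0 u ux ∧ ForwardRange T s1 s2 ux := by
  have hα := hflux.alpha_pos
  have hα1 := hflux.alpha_lt_one
  obtain ⟨lam', Lam', Ck, sig, k, A, B, R1, R2, eps, L, U, hreg, hrel⟩ := exists_rel hflux
  obtain ⟨Cb, hCb0, hCb⟩ := clf_coef hα hT hcoeff.b_holder
  obtain ⟨Cc, hCc0, hCc⟩ := clf_coef hα hT hcoeff.c_holder
  obtain ⟨Cf, hCf0, hCf⟩ := clf_coef hα hT hcoeff.f_holder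
  have cb : Continuous fun z : ℝ × ℝ => clf T b z.1 z.2 := clf_cont hT hcoeff.b_cont
  have cc : Continuous fun z : ℝ × ℝ => clf T c z.1 z.2 := clf_cont hT hcoeff.c_cont
  have cf : Continuous fun z : ℝ × ℝ => clf T f z.1 z.2 := clf_cont hT hcoeff.f_cont
  obtain ⟨Cd, hCd⟩ := isCompact_Icc.exists_bound_of_continuousOn hcoeff.d_cont
  set K := Cb + Cc + Cf + |Cd| with hK
  have hd0 := abs_nonneg Cd
  obtain ⟨b1, b2, b3⟩ := hCb K (by rw [ge_iff_le, hK]; linarith)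
  obtain ⟨c1, c2, c3⟩ := hCc K (by rw [ge_iff_le, hK]; linarith)
  obtain ⟨f1, f2, f3⟩ := hCf K (by rw [ge_iff_le, hK]; linarith)
  have hCo : Coef K (α / 2) (clf T b) (clf T c) (clf T f) :=
    ⟨by linarith, by linarith, by rw [hK]; linarith, b1, c1, f1, b2, c2, f2⟩
  obtain ⟨Ci, hCi⟩ := hinit.holder
  have hu2 : ∀ x ∈ Icc (0:ℝ) 1, |u0'' x| ≤ |u0'' 0| + |Ci| := fun x hx => by
    have h1 := hCi x hx 0 ⟨le_rfl, zero_le_one⟩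
    have h2 : |x - 0| ^ α ≤ 1 := by
      refine Real.rpow_le_one (abs_nonneg _) ?_ hα.le
      rw [sub_zero, abs_of_nonneg hx.1]; exact hx.2
    have h3 : (0:ℝ) ≤ |x - 0| ^ α := Real.rpow_nonneg (abs_nonneg _) _
    have h4 : Ci * |x - 0| ^ α ≤ |Ci| * 1 :=
      (mul_le_mul_of_nonneg_right (le_abs_self _) h3).trans (mul_le_mul_of_nonneg_left h2 (abs_nonneg _))
    have h5 : u0'' x = u0'' 0 + (u0'' x - u0'' 0) := by ring
    rw [h5]
    exact (abs_add_le _ _).trans (by linarith)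
  have hini := iniD_of (K := |u0'' 0| + |Ci|) (by positivity) hinit.deriv1 hinit.deriv2 hu2 hinit.compat0 hinit.compat1
  have hu0c : ContinuousOn u0 (Icc 0 1) := fun x hx => (hinit.deriv1 x hx).continuousWithinAt
  obtain ⟨W, u, p, Q, hP, ⟨Ku, hKu0, hKu⟩, hu0⟩ := exists_pot (T := T) (C0 := |u0 0| + 3 * (|u0'' 0| + |Ci|)) hreg hCo b3 c3 f3 hT
    (by positivity) hini hu0c
  have cd : Continuous fun t => d (cl T t) := hcoeff.d_cont.comp_continuous (cl_cont T) (cl_mem hT)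
  set G : Set (ℝ × ℝ) := Om T ∩ {z | A < p z.1 z.2 ∧ p z.1 z.2 < B} with hG
  have hGm : ∀ x t, (x, t) ∈ G → p x t ∈ Icc A B := fun x t hz => ⟨hz.2.1.le, hz.2.2.le⟩
  have hX : Ctx T p (fun x t => sig (p x t)) (clf T b) (fun t => d (cl T t)) G R1 R2 eps K L U :=
    { hT := hT, cp := hP.cp, cw := hP.cw, cb := cb, cd := cd
      Gs := inter_subset_left
      Go := (isOpen_Ioo.prod isOpen_Ioo).inter ((isOpen_lt continuous_const hP.cp).inter (isOpen_lt hP.cp continuous_const))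
      e0 := hrel.e0
      r1 := fun x t hz => hrel.r1 _ (hGm x t hz)
      r2 := fun x t hz => hrel.r2 _ (hGm x t hz)
      Lc := hrel.Lc, Uc := hrel.Uc, bK := b1
      dK := fun t => by
        have := hCd _ (cl_mem hT t)
        rw [Real.norm_eq_abs] at this
        refine this.trans ((le_abs_self _).trans ?_)
        rw [hK]; linarith }
  have hbx : ∀ x ∈ Icc (0:ℝ) 1, ∀ t ∈ Icc 0 T, HasDerivWithinAt (fun y => clf T b y t) (bx x t) (Icc 0 1) x :=
    fun x hx t ht => (hcoeff.b_deriv (x, t) ⟨hx, ht⟩).congr (fun y hy => clf_eq b hy ht) (clf_eq b hx ht)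
  have hce : ∀ x ∈ Icc (0:ℝ) 1, ∀ t ∈ Icc 0 T, clf T c x t = bx x t + d (cl T t) := fun x hx t ht => by
    rw [clf_eq c hx ht, cl_eq ht]; exact hcoeff.c_eq (x, t) ⟨hx, ht⟩
  obtain ⟨v, ω, q, Kv, hLip, hv0, hder, hq, hweak⟩ := exists_limit hP hX cc cf hbx hce
    (fun x t hz => hrel.rL _ (hGm x t hz)) (fun x t hz => hrel.rU _ (hGm x t hz)) hKu
  have hOm : OmegaT T = Om T := rfl
  have hfin : ∀ᵐ z ∂(volume.restrict (Om T)), sigma (q z) = ω z.1 z.2 ∧ (q z < s1 ∨ s2 < q z) := by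
    filter_upwards [hq, ae_restrict_mem (Om_meas T)] with z hz hzO
    by_cases hzG : z ∈ G
    · obtain ⟨hr, h | h⟩ := hz.1 hzG
      · rw [h]; exact ⟨hrel.Lp _ hr, Or.inl (hrel.Ls _)⟩
      · rw [h]; exact ⟨hrel.Up _ hr, Or.inr (hrel.Us _)⟩
    · obtain ⟨h1, h2⟩ := hz.2 hzG
      rw [h1, h2]
      have hn : p z.1 z.2 ≤ A ∨ B ≤ p z.1 z.2 := by
        by_contra hcon
        push Not at hcon
        exact hzG ⟨hzO, hcon.1, hcon.2⟩
      rcases hn with h | h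
      · exact ⟨(hrel.lo _ h).symm, Or.inl (h.trans_lt hrel.A1)⟩
      · exact ⟨(hrel.hi _ h).symm, Or.inr (hrel.B2.trans_le h)⟩
  refine ⟨v, fun x t => q (x, t), ⟨⟨Real.toNNReal (2 * |Kv|), ?_⟩, ?_, ?_⟩, ?_⟩
  · refine LipschitzOnWith.of_dist_le_mul fun z _ y _ => ?_
    rw [Real.dist_eq, Real.coe_toNNReal _ (by positivity)]
    refine (hLip z.1 y.1 z.2 y.2).trans ?_
    have a1 : |z.1 - y.1| ≤ dist z y := by rw [← Real.dist_eq, Prod.dist_eq]; exact le_max_left _ _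
    have a2 : |z.2 - y.2| ≤ dist z y := by rw [← Real.dist_eq, Prod.dist_eq]; exact le_max_right _ _
    have a3 : Kv * |z.1 - y.1| ≤ |Kv| * dist z y :=
      (mul_le_mul_of_nonneg_right (le_abs_self _) (abs_nonneg _)).trans (mul_le_mul_of_nonneg_left a1 (abs_nonneg _))
    have a4 : Kv * |z.2 - y.2| ≤ |Kv| * dist z y :=
      (mul_le_mul_of_nonneg_right (le_abs_self _) (abs_nonneg _)).trans (mul_le_mul_of_nonneg_left a2 (abs_nonneg _))
    linarith
  · rw [hOm]; exact hder
  · intro ζ hζ s hs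
    obtain ⟨gx, gxx, gt, gxt, hg, -⟩ := sm_of_contDiff hζ
    have hw := hweak ζ gx gxx gt gxt hg s hs
    have e2 : ∫ x in Ioo (0:ℝ) 1, (v x s * ζ x s - u0 x * ζ x 0) = ∫ x in Ioo (0:ℝ) 1, (v x s * ζ x s - v x 0 * ζ x 0) := by
      refine setIntegral_congr_fun measurableSet_Ioo fun x hx => ?_
      rw [hv0 x, hu0 x (Ioo_subset_Icc_self hx)]
    rw [e2, ← hw]
    have hsub : Om s ⊆ Om T := prod_mono_right (Ioo_subset_Ioo_right hs.2)
    refine integral_congr_ae ?_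
    filter_upwards [Om_ae (ae_restrict_of_ae_restrict_of_subset hsub hfin), ae_restrict_mem measurableSet_Ioo] with t ht htm
    refine integral_congr_ae ?_
    filter_upwards [ht, ae_restrict_mem measurableSet_Ioo] with x hx hxm
    have hx' := Ioo_subset_Icc_self hxm
    have ht' : t ∈ Icc 0 T := ⟨htm.1.le, htm.2.le.trans hs.2⟩
    rw [(hg.dt x t).deriv, (hg.dx x t).deriv, hx.1, clf_eq b hx' ht', clf_eq c hx' ht', clf_eq f hx' ht']
  · rw [ForwardRange, hOm]
    filter_upwards [hfin] with z hz
    exact hz.2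

end FwdSol

/-- For any initial datum `u0 ∈ C^{2+α}` with the compatibility condition,
there exists at least one forward solution to the initial–Neumann problem. -/
theorem exists_forward_solution
    (α s1 s2 lam Lam T : ℝ) (sigma sigma' : ℝ → ℝ)
    (b bx c f : ℝ → ℝ → ℝ) (d : ℝ → ℝ) (u0 u0' u0'' : ℝ → ℝ)
    (hT : 0 < T)
    (hflux : FluxHyp α s1 s2 lam Lam sigma sigma')
    (hcoeff : CoeffHyp α T b bx c f d)
    (hinit : InitHyp α u0 u0' u0'') :
    ∃ u ux : ℝ → ℝ → ℝ,
      IsLipschitzSolution T sigma b c f u0 u ux ∧ ForwardRange T s1 s2 ux := by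
  exact FwdSol.main α s1 s2 lam Lam T sigma sigma' b bx c f d u0 u0' u0'' hT hflux hcoeff hinit
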